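/- Let G be a countable group equipped with an enumerated generating sequence x : ℕ → G (the x_i generate G) and suppose G has a computable left order with respect to x. Then G admits a Frattini embedding into a finitely generated left-orderable simple group H that has a computable left order (with respect to some surjection onto H from the free group on a finite set). -/

import Mathlib

-- The sign (−1, 0, or 1) of a group element relative to the identity,
-- with respect to a linear order `l`.
open Classical in
noncomputable def orderSign {H : Type*} [Group H] (l : LinearOrder H) (h : H) : ℤ :=
  if l.lt h 1 then -1 else if h = 1 then 0 else 1

/-- A group is left-orderable if it carries a left-invariant linear order. -/
def IsLeftOrderable (G : Type*) [Group G] : Prop :=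
  ∃ l : LinearOrder G, ∀ a b c : G, l.le b c → l.le (a * b) (a * c)

/-- A Frattini embedding: an injective homomorphism preserving and reflecting conjugacy. -/
def IsFrattini {G H : Type*} [Group G] [Group H] (φ : G →* H) : Prop :=
  Function.Injective φ ∧ ∀ a b : G, IsConj a b ↔ IsConj (φ a) (φ b)

/-- `X` is a (finite) generating set of the group. -/
def Generates {G : Type*} [Group G] (X : Finset G) : Prop :=
  Subgroup.closure (X : Set G) = ⊤

/-- Word length of `g` with respect to the finite set `X`: the least length of a word
over `X ∪ X⁻¹` representing `g`. -/
noncomputable def wordLength {G : Type*} [Group G] (X : Finset G) (g : G) : ℕ :=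
  sInf {n | ∃ w : List G, w.length = n ∧ (∀ a ∈ w, a ∈ X ∨ a⁻¹ ∈ X) ∧ w.prod = g}

/-- Quasi-isometric embedding with respect to finite generating sets `X` and `Y`. -/
noncomputable def IsQIEmbedding {G H : Type*} [Group G] [Group H]
    (X : Finset G) (Y : Finset H) (φ : G →* H) : Prop :=
  Function.Injective φ ∧ ∃ C k : ℝ, 0 < C ∧ 0 < k ∧ ∀ g : G,
    (1 / C) * (wordLength X g : ℝ) - k ≤ (wordLength Y (φ g) : ℝ) ∧
    (wordLength Y (φ g) : ℝ) ≤ C * (wordLength X g : ℝ) + k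

/-- Evaluation of a formal word (list of pairs (index, sign)) over the
enumerated sequence `x : ℕ → G`. -/
def evalWord {G : Type*} [Group G] (x : ℕ → G) (w : List (ℕ × Bool)) : G :=
  (w.map (fun p => if p.2 then x p.1 else (x p.1)⁻¹)).prod

/-- A computable left order on a countable group with respect to an enumerated
generating sequence `x : ℕ → G`. -/
def ComputableLeftOrderWrt {G : Type*} [Group G] (x : ℕ → G) : Prop :=
  ∃ l : LinearOrder G, (∀ a b c : G, l.le b c → l.le (a * b) (a * c)) ∧
    Computable (fun w : List (ℕ × Bool) => orderSign l (evalWord x w))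

/-- A computable left order on a finitely generated group, presented by
a surjection `π` from a free group of finite rank. -/
def ComputableLeftOrderVia {H : Type*} [Group H] {m : ℕ}
    (π : FreeGroup (Fin m) →* H) : Prop :=
  ∃ l : LinearOrder H, (∀ a b c : H, l.le b c → l.le (a * b) (a * c)) ∧
    Computable (fun w : List (Fin m × Bool) => orderSign l (π (FreeGroup.mk w)))

/-- The embedding `φ` is computable: one can compute, for each `i`, a word over the
generators of `H` representing `φ (x i)`. -/
def ComputableEmbedding {G H : Type*} [Group G] [Group H] (x : ℕ → G) {m : ℕ}
    (π : FreeGroup (Fin m) →* H) (φ : G →* H) : Prop :=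
  ∃ f : ℕ → List (Fin m × Bool), Computable f ∧ ∀ i, π (FreeGroup.mk (f i)) = φ (x i)

/-- Decidable membership problem for the image of `φ` in `H`, presented via `π`. -/
def DecidableMembership {G H : Type*} [Group G] [Group H] {m : ℕ}
    (π : FreeGroup (Fin m) →* H) (φ : G →* H) : Prop :=
  ComputablePred (fun w : List (Fin m × Bool) => π (FreeGroup.mk w) ∈ φ.range)

/-- Decidable word problem for `H`, presented via `π`. -/
def DecidableWordProblemVia {H : Type*} [Group H] {m : ℕ}
    (π : FreeGroup (Fin m) →* H) : Prop :=
  ComputablePred (fun w : List (Fin m × Bool) => π (FreeGroup.mk w) = 1)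

/-- A group is finitely presented: quotient of a finite-rank free group by the
normal closure of finitely many relators. -/
def IsFinitelyPresented (K : Type*) [Group K] : Prop :=
  ∃ (m : ℕ) (π : FreeGroup (Fin m) →* K) (R : Finset (FreeGroup (Fin m))),
    Function.Surjective π ∧ π.ker = Subgroup.normalClosure (R : Set (FreeGroup (Fin m)))


/-! ## Part 1: computability utilities and the pipeline lemma -/
namespace FrattiniProof

open Encodable

theorem computable_list_foldl {α β σ : Type*} [Primcodable α] [Primcodable β] [Primcodable σ]
    {f : α → List β} {g : α → σ} {h : α → σ × β → σ} (hf : Computable f) (hg : Computable g)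
    (hh : Computable₂ h) :
    Computable (fun a => (f a).foldl (fun s b => h a (s, b)) (g a)) := by
  have key : Computable (fun a => Nat.rec (motive := fun _ => σ) (g a)
      (fun n s => Option.casesOn (motive := fun _ => σ) ((f a)[n]?) s (fun b => h a (s, b)))
      (f a).length) := by
    refine Computable.nat_rec (Computable.list_length.comp hf) hg (h := fun a p =>
      Option.casesOn (motive := fun _ => σ) ((f a)[p.1]?) p.2 (fun b => h a (p.2, b))) ?_
    refine Computable.option_casesOn (o := fun q : α × (ℕ × σ) => (f q.1)[q.2.1]?)
      (f := fun q => q.2.2) (g := fun q b => h q.1 (q.2.2, b)) ?_ ?_ ?_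
    · exact Computable.list_getElem?.comp (hf.comp Computable.fst)
        (Computable.fst.comp Computable.snd)
    · exact Computable.snd.comp Computable.snd
    · exact hh.comp (Computable.fst.comp Computable.fst)
        (Computable.pair (Computable.snd.comp (Computable.snd.comp Computable.fst)) Computable.snd)
  refine key.of_eq fun a => ?_
  have : ∀ n, n ≤ (f a).length → Nat.rec (motive := fun _ => σ) (g a)
      (fun n s => Option.casesOn (motive := fun _ => σ) ((f a)[n]?) s (fun b => h a (s, b))) n
      = ((f a).take n).foldl (fun s b => h a (s, b)) (g a) := by
    intro n
    induction n with
    | zero => intro _; simp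
    | succ n ih =>
      intro hn
      have h1 := ih (by omega)
      have h2 : (f a)[n]? = some ((f a)[n]'(by omega)) := List.getElem?_eq_getElem (by omega)
      simp only [h1, h2]
      rw [List.take_add_one, h2, List.foldl_append]
      simp
  have := this _ le_rfl
  simp only [List.take_length] at this
  exact this

theorem computable_list_foldr {α β σ : Type*} [Primcodable α] [Primcodable β] [Primcodable σ]
    {f : α → List β} {g : α → σ} {h : α → σ × β → σ} (hf : Computable f) (hg : Computable g)
    (hh : Computable₂ h) :
    Computable (fun a => (f a).foldr (fun b s => h a (s, b)) (g a)) := by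
  refine (computable_list_foldl (Computable.list_reverse.comp hf) hg hh).of_eq fun a => ?_
  simp [List.foldl_reverse]

theorem computable_ite {α σ : Type*} [Primcodable α] [Primcodable σ] {p : α → Prop}
    [DecidablePred p] {f g : α → σ} (hp : Computable (fun a => decide (p a))) (hf : Computable f)
    (hg : Computable g) : Computable (fun a => if p a then f a else g a) := by
  refine (Computable.cond hp hf hg).of_eq fun a => ?_
  by_cases h : p a <;> simp [h]

/-- evaluation of a word in permutations -/
def wordAct {Ω : Type*} {m : ℕ} (s : Fin m → Equiv.Perm Ω) (w : List (Fin m × Bool)) :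
    Equiv.Perm Ω :=
  (w.map fun a => cond a.2 (s a.1) (s a.1)⁻¹).prod

/-- sign of a comparison -/
def sgnCmp {K : Type*} [LinearOrder K] (a b : K) : ℤ :=
  if a < b then -1 else if a = b then 0 else 1

theorem pipeline {Ω K C : Type} [LinearOrder K] [Primcodable C] (key : Ω → K)
    (key_inj : Function.Injective key) {m : ℕ} (s : Fin m → Equiv.Perm Ω)
    (s_mono : ∀ i p q, key p < key q → key (s i p) < key (s i q))
    (dec : C → Option Ω) (dec_surj : ∀ p, ∃ c, dec c = some p)
    (valid : C → Bool) (valid_comp : Computable valid)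
    (valid_iff : ∀ c, valid c = true ↔ (dec c).isSome = true)
    (e : C → Fin m × Bool → C) (e_comp : Computable₂ e)
    (e_spec : ∀ c a p, dec c = some p → dec (e c a) = some ((cond a.2 (s a.1) (s a.1)⁻¹) p))
    (cmp : C → C → ℤ) (cmp_comp : Computable₂ cmp)
    (cmp_spec : ∀ c d p q, dec c = some p → dec d = some q → cmp c d = sgnCmp (key p) (key q))
    (N : List (Fin m × Bool) → ℕ) (N_comp : Computable N)
    (N_spec : ∀ w, (∀ c p, encode c < N w → dec c = some p → wordAct s w p = p) →
      wordAct s w = 1) :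
    ∃ π : FreeGroup (Fin m) →* Subgroup.closure (Set.range s),
      Function.Surjective π ∧ ComputableLeftOrderVia π := by
  classical
  let H := Subgroup.closure (Set.range s)
  have hmono : ∀ h : H, ∀ p q, key p < key q → key (h.1 p) < key (h.1 q) := by
    rintro ⟨h, hh⟩
    have s_mono' : ∀ i p q, key p < key q → key ((s i)⁻¹ p) < key ((s i)⁻¹ q) := by
      intro i p q hpq
      by_contra hcon
      rcases (not_lt.mp hcon).lt_or_eq with h1 | h1
      · have := s_mono i _ _ h1
        simp at this
        exact absurd this (not_lt.mpr hpq.le)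
      · have := key_inj h1
        have := (s i)⁻¹.injective this
        subst this
        exact lt_irrefl _ hpq
    induction hh using Subgroup.closure_induction with
    | mem x hx => obtain ⟨i, rfl⟩ := hx; exact s_mono i
    | one => simp
    | mul x y _ _ hx hy => intro p q hpq; exact hx _ _ (hy _ _ hpq)
    | inv x _ hx =>
      intro p q hpq
      by_contra hcon
      rcases (not_lt.mp hcon).lt_or_eq with h1 | h1
      · have := hx _ _ h1
        simp at this
        exact absurd this (not_lt.mpr hpq.le)
      · have := key_inj h1
        have := x⁻¹.injective this
        subst this
        exact lt_irrefl _ hpq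
  let pt : ℕ → Option Ω := fun i => (decode (α := C) i).bind dec
  let F : H → Lex (ℕ → WithBot K) := fun h => toLex fun i =>
    match pt i with
    | none => ⊥
    | some p => (key (h.1 p) : WithBot K)
  have Fval : ∀ h i, ofLex (F h) i = match pt i with
    | none => ⊥
    | some p => (key (h.1 p) : WithBot K) := fun _ _ => rfl
  have pt_surj : ∀ p, ∃ i, pt i = some p := by
    intro p
    obtain ⟨c, hc⟩ := dec_surj p
    exact ⟨encode c, by simp [pt, hc]⟩
  have F_inj : Function.Injective F := by
    intro a b hab
    apply Subtype.ext
    ext p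
    obtain ⟨i, hi⟩ := pt_surj p
    have h1 : ofLex (F a) i = ofLex (F b) i := by rw [hab]
    rw [Fval, Fval, hi] at h1
    simp only [WithBot.coe_inj] at h1
    exact key_inj h1
  let l : LinearOrder H := LinearOrder.lift' F F_inj
  have l_lt : ∀ a b : H, l.lt a b ↔ ∃ i, (∀ j < i, ofLex (F a) j = ofLex (F b) j) ∧
      ofLex (F a) i < ofLex (F b) i := by
    intro a b
    exact Iff.rfl
  have l_mul : ∀ a b c : H, l.lt b c → l.lt (a * b) (a * c) := by
    intro a b c hbc
    rw [l_lt] at hbc ⊢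
    obtain ⟨i, h1, h2⟩ := hbc
    refine ⟨i, fun j hj => ?_, ?_⟩
    · have := h1 j hj
      rw [Fval, Fval] at this ⊢
      cases hp : pt j with
      | none => simp
      | some p =>
        rw [hp] at this
        simp only [WithBot.coe_inj] at this
        have := key_inj this
        simp [this]
    · rw [Fval, Fval] at h2 ⊢
      cases hp : pt i with
      | none => simp [hp] at h2
      | some p =>
        rw [hp] at h2
        simp only [WithBot.coe_lt_coe] at h2 ⊢
        exact hmono a _ _ h2
  let s' : Fin m → H := fun i => ⟨s i, Subgroup.subset_closure ⟨i, rfl⟩⟩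
  let π : FreeGroup (Fin m) →* H := FreeGroup.lift s'
  have π_val : ∀ w, (π (FreeGroup.mk w)).1 = wordAct s w := by
    intro w
    simp only [π, FreeGroup.lift_mk, wordAct]
    rw [← Subgroup.coe_subtype, map_list_prod, List.map_map]
    congr 2
    funext a
    rcases a with ⟨i, b⟩
    cases b <;> simp [s']
  refine ⟨π, ?_, l, ?_, ?_⟩
  · rw [← MonoidHom.range_eq_top, eq_top_iff]
    rintro ⟨h, hh⟩ -
    induction hh using Subgroup.closure_induction with
    | mem x hx =>
      obtain ⟨i, rfl⟩ := hx
      exact ⟨FreeGroup.of i, by simp [π, s']⟩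
    | one => exact one_mem _
    | mul x y hx hy h1 h2 => exact mul_mem h1 h2
    | inv x hx h1 => exact inv_mem h1
  · intro a b c hbc
    rcases (@le_iff_lt_or_eq _ l.toPartialOrder b c).1 hbc with h | h
    · exact (l.lt_iff_le_not_ge _ _).1 (l_mul a b c h) |>.1
    · rw [h]
  -- the computability of the sign
  let run : C → List (Fin m × Bool) → C := fun c w => w.foldr (fun a d => e d a) c
  have run_spec : ∀ w c p, dec c = some p → dec (run c w) = some (wordAct s w p) := by
    intro w
    induction w with
    | nil => intro c p h; simpa [run, wordAct] using h
    | cons a w ih =>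
      intro c p h
      have := e_spec _ a _ (ih c p h)
      simpa [run, wordAct] using this
  let st : List (Fin m × Bool) → ℕ → ℤ := fun w i =>
    Option.casesOn (motive := fun _ => ℤ) (decode (α := C) i) 0
      (fun c => cond (valid c) (cmp (run c w) c) 0)
  have st_none : ∀ w i, pt i = none → st w i = 0 := by
    intro w i h
    simp only [st]
    cases hd : decode (α := C) i with
    | none => rfl
    | some c =>
      have h1 : dec c = none := by simpa [pt, hd] using h
      have : valid c = false := by
        have := valid_iff c
        rw [h1] at this
        simpa using this
      simp [this]
  have st_some : ∀ w i p, pt i = some p → st w i = sgnCmp (key (wordAct s w p)) (key p) := by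
    intro w i p h
    simp only [st]
    cases hd : decode (α := C) i with
    | none => simp [pt, hd] at h
    | some c =>
      have h1 : dec c = some p := by simpa [pt, hd] using h
      have : valid c = true := by
        rw [valid_iff, h1]; rfl
      simp only [this, cond_true]
      exact cmp_spec _ _ _ _ (run_spec w c p h1) h1
  let loop : List (Fin m × Bool) → ℕ → ℤ := fun w n =>
    Nat.rec (motive := fun _ => ℤ) 0 (fun i r => if r = 0 then st w i else r) n
  have hst : Computable₂ st := by
    refine Computable.option_casesOn (o := fun q : List (Fin m × Bool) × ℕ => decode (α := C) q.2)
      (f := fun _ => (0 : ℤ)) (g := fun q c => cond (valid c) (cmp (run c q.1) c) 0) ?_ ?_ ?_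
    · exact Computable.decode.comp Computable.snd
    · exact Computable.const _
    · refine Computable.cond (valid_comp.comp Computable.snd) ?_ (Computable.const _)
      refine cmp_comp.comp ?_ Computable.snd
      refine computable_list_foldr (α := (List (Fin m × Bool) × ℕ) × C)
        (f := fun q => q.1.1) (g := fun q => q.2) (h := fun q p => e p.1 p.2) ?_ ?_ ?_
      · exact Computable.fst.comp Computable.fst
      · exact Computable.snd
      · exact e_comp.comp (Computable.fst.comp Computable.snd) (Computable.snd.comp Computable.snd)
  have hloop : Computable (fun w => loop w (N w)) := by
    refine Computable.nat_rec N_comp (Computable.const 0)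
      (h := fun w p => if p.2 = 0 then st w p.1 else p.2) ?_
    refine computable_ite (p := fun q : List (Fin m × Bool) × (ℕ × ℤ) => q.2.2 = 0) ?_ ?_ ?_
    · have : Computable (fun z : ℤ => decide (z = 0)) :=
        (Primrec.eq.decide.comp Primrec.id (Primrec.const 0)).to_comp
      exact this.comp (Computable.snd.comp Computable.snd)
    · exact hst.comp Computable.fst (Computable.fst.comp Computable.snd)
    · exact Computable.snd.comp Computable.snd
  have loop_zero : ∀ w n, (∀ i < n, st w i = 0) → loop w n = 0 := by
    intro w n
    induction n with
    | zero => intro _; rfl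
    | succ n ih =>
      intro h
      have h1 := ih (fun i hi => h i (by omega))
      have : loop w (n + 1) = if loop w n = 0 then st w n else loop w n := rfl
      rw [this, h1]; simp [h n (by omega)]
  have loop_first : ∀ w k n, (∀ i < k, st w i = 0) → st w k ≠ 0 → k < n →
      loop w n = st w k := by
    intro w k n h0 h1 hn
    induction n with
    | zero => omega
    | succ n ih =>
      have h2 : loop w (n + 1) = if loop w n = 0 then st w n else loop w n := rfl
      rcases Nat.lt_succ_iff_lt_or_eq.1 hn with h | h
      · rw [h2, ih h]; simp [h1]
      · subst h
        rw [h2, loop_zero w k h0]; simp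
  refine hloop.of_eq fun w => ?_
  have one_val : ∀ i, ofLex (F 1) i = match pt i with
    | none => ⊥
    | some p => (key p : WithBot K) := fun _ => rfl
  have w_val : ∀ i, ofLex (F (π (FreeGroup.mk w))) i = match pt i with
    | none => ⊥
    | some p => (key (wordAct s w p) : WithBot K) := by
    intro i; rw [Fval, π_val]
  have st_zero_iff : ∀ i, st w i = 0 ↔ ofLex (F (π (FreeGroup.mk w))) i = ofLex (F 1) i := by
    intro i
    rw [one_val, w_val]
    cases hp : pt i with
    | none => simp [st_none w i hp]
    | some p =>
      rw [st_some w i p hp]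
      simp only [sgnCmp, WithBot.coe_inj]
      split_ifs with h1 h2
      · simp [h1.ne]
      · simp [h2]
      · simp [h2]
  by_cases hw : wordAct s w = 1
  · have h1 : π (FreeGroup.mk w) = 1 := Subtype.ext (by rw [π_val, hw]; rfl)
    have : loop w (N w) = 0 := loop_zero w _ fun i _ => by rw [st_zero_iff, h1]
    rw [this, h1]
    simp only [orderSign]
    rw [if_neg (@lt_irrefl _ l.toPreorder 1)]; simp
  · have h1 : π (FreeGroup.mk w) ≠ 1 := fun h => hw (by rw [← π_val, h]; rfl)
    have hex : ∃ i, i < N w ∧ st w i ≠ 0 := by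
      by_contra hcon
      push Not at hcon
      apply hw
      apply N_spec
      intro c p hc hp
      have h2 : pt (encode c) = some p := by simp [pt, hp]
      have := hcon _ hc
      rw [st_zero_iff, one_val, w_val, h2] at this
      simp only [WithBot.coe_inj] at this
      exact key_inj this
    have hfind := Nat.find_spec hex
    have hmin : ∀ i < Nat.find hex, st w i = 0 := by
      intro i hi
      by_contra hne
      exact Nat.find_min hex hi ⟨hi.trans hfind.1, hne⟩
    rw [loop_first w _ _ hmin hfind.2 hfind.1]
    set k := Nat.find hex
    have hk := hfind.2
    cases hp : pt k with
    | none => exact absurd (st_none w k hp) hk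
    | some p =>
      have hs := st_some w k p hp
      have hne : key (wordAct s w p) ≠ key p := by
        intro h
        rw [hs, h] at hk
        simp [sgnCmp] at hk
      rw [hs]
      rcases lt_or_gt_of_ne hne with hlt | hgt
      · have : l.lt (π (FreeGroup.mk w)) 1 := by
          rw [l_lt]
          refine ⟨k, fun j hj => (st_zero_iff j).1 (hmin j hj), ?_⟩
          rw [one_val, w_val, hp]
          simpa using hlt
        simp [orderSign, this, sgnCmp, hlt]
      · have : l.lt 1 (π (FreeGroup.mk w)) := by
          rw [l_lt]
          refine ⟨k, fun j hj => ((st_zero_iff j).1 (hmin j hj)).symm, ?_⟩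
          rw [one_val, w_val, hp]
          simpa using hgt
        have h3 : ¬ l.lt (π (FreeGroup.mk w)) 1 := @lt_asymm _ l.toPreorder _ _ this
        simp [orderSign, h3, sgnCmp, hgt.not_gt, hne, h1]

end FrattiniProof


set_option linter.all false

namespace FrattiniProof

open Encodable

theorem computable₂_of_finite {A C σ : Type*} [Primcodable A] [Primcodable C] [Primcodable σ]
    [Fintype A] {e : C → A → σ} (h : ∀ a, Computable (fun c => e c a)) : Computable₂ e := by
  classical
  rcases isEmpty_or_nonempty A with hA | hA
  · have : IsEmpty (C × A) := ⟨fun p => hA.elim p.2⟩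
    have h0 : Computable (fun p : C × A => (Encodable.decode (α := σ)
      (Encodable.encode p)).isSome) := Primrec.option_isSome.to_comp.comp
        (Computable.decode.comp Computable.encode)
    refine Computable.option_some_iff.1 (Computable.of_eq
      (f := fun p : C × A => (Encodable.decode (α := σ) (Encodable.encode p)))
        (Computable.decode.comp Computable.encode) fun n => (this.elim n))
  let eq := Fintype.equivFin A
  have h1 : Computable (fun c => List.ofFn (fun i => e c (eq.symm i))) :=
    Computable.list_ofFn (f := fun i c => e c (eq.symm i)) fun i => h (eq.symm i)
  have h2 : Computable (fun a : A => (eq a).val) := (Primrec.dom_finite _).to_comp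
  have h3 : Computable (fun p : C × A => (List.ofFn (fun i => e p.1 (eq.symm i)))[(eq p.2).val]?) :=
    Computable.list_getElem?.comp (h1.comp Computable.fst) (h2.comp Computable.snd)
  refine Computable.option_some_iff.1 (h3.of_eq fun p => ?_)
  simp [List.getElem?_ofFn]

/-- pipeline with an explicit list of test codes. -/
theorem pipeline_tests {Ω K C : Type} [LinearOrder K] [Primcodable C] (key : Ω → K)
    (key_inj : Function.Injective key) {m : ℕ} (s : Fin m → Equiv.Perm Ω)
    (s_mono : ∀ i p q, key p < key q → key (s i p) < key (s i q))
    (dec : C → Option Ω) (dec_surj : ∀ p, ∃ c, dec c = some p)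
    (valid : C → Bool) (valid_comp : Computable valid)
    (valid_iff : ∀ c, valid c = true ↔ (dec c).isSome = true)
    (e : C → Fin m × Bool → C) (e_comp : ∀ a, Computable (fun c => e c a))
    (e_spec : ∀ c a p, dec c = some p → dec (e c a) = some ((cond a.2 (s a.1) (s a.1)⁻¹) p))
    (cmp : C → C → ℤ) (cmp_comp : Computable₂ cmp)
    (cmp_spec : ∀ c d p q, dec c = some p → dec d = some q → cmp c d = sgnCmp (key p) (key q))
    (tests : ℕ → List C) (tests_comp : Primrec tests)
    (tests_spec : ∀ w, (∀ c ∈ tests w.length, ∀ p, dec c = some p → wordAct s w p = p) →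
      wordAct s w = 1) :
    ∃ π : FreeGroup (Fin m) →* Subgroup.closure (Set.range s),
      Function.Surjective π ∧ ComputableLeftOrderVia π := by
  refine pipeline key key_inj s s_mono dec dec_surj valid valid_comp valid_iff e
    (computable₂_of_finite e_comp) e_spec cmp cmp_comp cmp_spec
    (fun w => (tests w.length).foldl (fun s c => s + (encode c + 1)) 0) ?_ ?_
  · refine Computable.comp (g := fun w : List (Fin m × Bool) => w.length)
      (f := fun n => (tests n).foldl (fun s c => s + (encode c + 1)) 0) ?_ Computable.list_length
    refine (Primrec.list_foldl (f := tests) (g := fun _ => 0)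
      (h := fun _ p => p.1 + (encode p.2 + 1)) tests_comp (Primrec.const 0) ?_).to_comp
    exact Primrec.nat_add.comp (Primrec.fst.comp Primrec.snd)
      (Primrec.succ.comp (Primrec.encode.comp (Primrec.snd.comp Primrec.snd)))
  · intro w h
    apply tests_spec
    intro c hc p hp
    refine h c p ?_ hp
    have : ∀ (l : List C) (a : ℕ), a ≤ l.foldl (fun s c => s + (encode c + 1)) a ∧
        ∀ c ∈ l, encode c < l.foldl (fun s c => s + (encode c + 1)) a := by
      intro l
      induction l with
      | nil => intro a; simp
      | cons d l ih =>
        intro a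
        obtain ⟨h1, h2⟩ := ih (a + (encode d + 1))
        simp only [List.foldl_cons, List.mem_cons]
        refine ⟨by omega, ?_⟩
        rintro c (rfl | hc)
        · omega
        · exact h2 c hc
    exact (this _ 0).2 c hc

/-- simulation along a word -/
theorem wordAct_sim {Ω : Type*} {m : ℕ} (s : Fin m → Equiv.Perm Ω) (Rel : ℕ → Ω → Ω → Prop)
    (h1 : ∀ i j p p', Rel (j + 1) p p' → Rel j (s i p) (s i p'))
    (h2 : ∀ i j p p', Rel (j + 1) p p' → Rel j ((s i)⁻¹ p) ((s i)⁻¹ p'))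
    (w : List (Fin m × Bool)) (k : ℕ) (p p' : Ω) (h : Rel (k + w.length) p p') :
    Rel k (wordAct s w p) (wordAct s w p') := by
  induction w generalizing k with
  | nil => simpa [wordAct] using h
  | cons a w ih =>
    have := ih (k + 1) (by simpa [add_assoc, add_comm, add_left_comm] using h)
    rcases a with ⟨i, b⟩
    cases b
    · simpa [wordAct] using h2 i k _ _ this
    · simpa [wordAct] using h1 i k _ _ this

/-- combination of signs for lexicographic comparison -/
def lexSgn (a b : ℤ) : ℤ := if a = 0 then b else a

theorem sgnCmp_eq_zero {K : Type*} [LinearOrder K] {a b : K} : sgnCmp a b = 0 ↔ a = b := by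
  unfold sgnCmp
  split_ifs with h1 h2
  · simp [h1.ne]
  · simp [h2]
  · simp [h2]

theorem sgnCmp_eq_neg {K : Type*} [LinearOrder K] {a b : K} : sgnCmp a b = -1 ↔ a < b := by
  unfold sgnCmp
  split_ifs with h1 h2 <;> simp [h1]

theorem sgnCmp_lex {K L : Type*} [LinearOrder K] [LinearOrder L] (a a' : K) (b b' : L) :
    sgnCmp (toLex (a, b)) (toLex (a', b')) = lexSgn (sgnCmp a a') (sgnCmp b b') := by
  rcases lt_trichotomy a a' with h | h | h
  · simp [sgnCmp, lexSgn, Prod.Lex.toLex_lt_toLex, h]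
  · subst h
    simp [sgnCmp, lexSgn, Prod.Lex.toLex_lt_toLex]
  · simp [sgnCmp, lexSgn, Prod.Lex.toLex_lt_toLex, h.not_gt, h.ne']

theorem lexSgn_primrec : Primrec₂ lexSgn :=
  Primrec.ite (Primrec.eq.comp Primrec.fst (Primrec.const 0)) Primrec.snd Primrec.fst

/-- codes of integers -/
def iv (p : ℕ × ℕ) : ℤ := (p.1 : ℤ) - p.2

def icmp (p q : ℕ × ℕ) : ℤ := if p.1 + q.2 < q.1 + p.2 then -1 else
  if p.1 + q.2 = q.1 + p.2 then 0 else 1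

theorem icmp_spec (p q : ℕ × ℕ) : icmp p q = sgnCmp (iv p) (iv q) := by
  unfold icmp sgnCmp iv
  split_ifs <;> omega

theorem icmp_primrec : Primrec₂ icmp := by
  have h1 : Primrec (fun x : (ℕ × ℕ) × (ℕ × ℕ) => x.1.1 + x.2.2) :=
    Primrec.nat_add.comp (Primrec.fst.comp Primrec.fst) (Primrec.snd.comp Primrec.snd)
  have h2 : Primrec (fun x : (ℕ × ℕ) × (ℕ × ℕ) => x.2.1 + x.1.2) :=
    Primrec.nat_add.comp (Primrec.fst.comp Primrec.snd) (Primrec.snd.comp Primrec.fst)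
  exact Primrec.ite (Primrec.nat_lt.comp h1 h2) (Primrec.const _)
    (Primrec.ite (Primrec.eq.comp h1 h2) (Primrec.const _) (Primrec.const _))

theorem iv_surj (n : ℤ) : ∃ p, iv p = n := ⟨(n.toNat, (-n).toNat), by unfold iv; dsimp only; omega⟩

def isucc (p : ℕ × ℕ) : ℕ × ℕ := (p.1 + 1, p.2)
def ipred (p : ℕ × ℕ) : ℕ × ℕ := (p.1, p.2 + 1)
theorem iv_isucc (p : ℕ × ℕ) : iv (isucc p) = iv p + 1 := by unfold iv isucc; push_cast; ring
theorem iv_ipred (p : ℕ × ℕ) : iv (ipred p) = iv p - 1 := by unfold iv ipred; push_cast; ring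
theorem isucc_primrec : Primrec isucc := Primrec.pair (Primrec.succ.comp Primrec.fst) Primrec.snd
theorem ipred_primrec : Primrec ipred := Primrec.pair Primrec.fst (Primrec.succ.comp Primrec.snd)

/-- formal inverse of a word -/
def winv {α : Type*} (w : List (α × Bool)) : List (α × Bool) :=
  (w.map fun p => (p.1, !p.2)).reverse

theorem winv_primrec {α : Type*} [Primcodable α] : Primrec (winv (α := α)) :=
  Primrec.list_reverse.comp (Primrec.list_map Primrec.id
    (Primrec.pair (Primrec.fst.comp Primrec.snd)
      (Primrec.not.comp (Primrec.snd.comp Primrec.snd))))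

theorem evalWord_winv {G : Type*} [Group G] (x : ℕ → G) (w : List (ℕ × Bool)) :
    evalWord x (winv w) = (evalWord x w)⁻¹ := by
  unfold evalWord winv
  rw [List.prod_inv_reverse, List.map_reverse, List.map_map, List.map_map]
  congr 3
  funext p
  rcases p with ⟨i, b⟩
  cases b <;> simp

theorem evalWord_append {G : Type*} [Group G] (x : ℕ → G) (u w : List (ℕ × Bool)) :
    evalWord x (u ++ w) = evalWord x u * evalWord x w := by
  simp [evalWord]

theorem orderSign_cmp {G : Type*} [Group G] (l : LinearOrder G)
    (hl : ∀ a b c : G, l.le b c → l.le (a * b) (a * c)) (a b : G) :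
    orderSign l (b⁻¹ * a) = @sgnCmp _ l a b := by
  have hlt : ∀ a b c : G, l.lt b c → l.lt (a * b) (a * c) := by
    intro a b c h
    refine @lt_of_le_of_ne _ l.toPartialOrder _ _ (hl _ _ _ (@le_of_lt _ l.toPreorder _ _ h)) ?_
    intro h1
    exact @ne_of_lt _ l.toPreorder _ _ h (mul_left_cancel h1)
  have h1 : l.lt (b⁻¹ * a) 1 ↔ l.lt a b := by
    constructor
    · intro h; simpa using hlt b _ _ h
    · intro h; simpa using hlt b⁻¹ _ _ h
  have h2 : b⁻¹ * a = 1 ↔ a = b := by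
    rw [inv_mul_eq_one]; exact eq_comm
  unfold orderSign sgnCmp
  simp only [h1, h2]

end FrattiniProof


/-! ## Part 3: from countable groups to finitely generated groups -/
set_option linter.all false

namespace FrattiniProof

open Encodable

namespace Step1

def IsSq (n : ℤ) : Prop := 1 ≤ n ∧ Nat.sqrt n.toNat * Nat.sqrt n.toNat = n.toNat

instance : DecidablePred IsSq := fun n => by unfold IsSq; infer_instance

def rt (n : ℤ) : ℕ := Nat.sqrt n.toNat

theorem IsSq.eq {n : ℤ} (h : IsSq n) : n = (rt n : ℤ) * rt n := by
  obtain ⟨h1, h2⟩ := h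
  have : ((rt n * rt n : ℕ) : ℤ) = (n.toNat : ℤ) := by unfold rt; rw [h2]
  push_cast at this
  omega

theorem isSq_sq (q : ℕ) (hq : 1 ≤ q) : IsSq ((q : ℤ) * q) ∧ rt ((q : ℤ) * q) = q := by
  have h : ((q : ℤ) * q).toNat = q * q := by
    rw [← Nat.cast_mul]; exact Int.toNat_natCast _
  refine ⟨⟨?_, ?_⟩, ?_⟩
  · have : (1 : ℤ) ≤ q := by exact_mod_cast hq
    nlinarith
  · rw [h, Nat.sqrt_eq]
  · unfold rt; rw [h, Nat.sqrt_eq]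

variable {G : Type} [Group G]

abbrev Om (G : Type) := ℤ × ℤ × G × ℤ

def sP : Equiv.Perm (Om G) where
  toFun p := (p.1 + 1, p.2)
  invFun p := (p.1 - 1, p.2)
  left_inv p := by simp
  right_inv p := by simp

def tP : Equiv.Perm (Om G) where
  toFun p := if p.1 = 0 then (p.1, p.2.1 + 1, p.2.2) else p
  invFun p := if p.1 = 0 then (p.1, p.2.1 - 1, p.2.2) else p
  left_inv p := by by_cases h : p.1 = 0 <;> simp [h]; rw [← h]
  right_inv p := by by_cases h : p.1 = 0 <;> simp [h]; rw [← h]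

/-- condition under which the third generator acts -/
def act (n k : ℤ) : Prop := 0 ≤ k ∧ IsSq n
instance (n k : ℤ) : Decidable (act n k) := by unfold act; infer_instance

def cP (y : ℕ → G) : Equiv.Perm (Om G) where
  toFun p := if act p.1 p.2.1 then (p.1, p.2.1, y (rt p.1) * p.2.2.1, p.2.2.2 + 1) else p
  invFun p := if act p.1 p.2.1 then (p.1, p.2.1, (y (rt p.1))⁻¹ * p.2.2.1, p.2.2.2 - 1) else p
  left_inv p := by by_cases h : act p.1 p.2.1 <;> simp [h]
  right_inv p := by by_cases h : act p.1 p.2.1 <;> simp [h]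

def gen (y : ℕ → G) : Fin 3 → Equiv.Perm (Om G) := ![sP, tP, cP y]

/-- the embedded copy of `G` -/
def del : G →* Equiv.Perm (Om G) where
  toFun g :=
    { toFun := fun p => if p.1 = 0 ∧ p.2.1 = 0 then (p.1, p.2.1, g * p.2.2.1, p.2.2.2) else p
      invFun := fun p => if p.1 = 0 ∧ p.2.1 = 0 then (p.1, p.2.1, g⁻¹ * p.2.2.1, p.2.2.2) else p
      left_inv := by
        rintro ⟨n, k, u⟩
        by_cases h : n = 0 ∧ k = 0 <;> simp [h]
      right_inv := by
        rintro ⟨n, k, u⟩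
        by_cases h : n = 0 ∧ k = 0 <;> simp [h] }
  map_one' := by ext p : 1; simp
  map_mul' a b := by
    ext p : 1
    by_cases h : p.1 = 0 ∧ p.2.1 = 0 <;> simp [h, mul_assoc]

theorem del_apply (g : G) (p : Om G) :
    del g p = if p.1 = 0 ∧ p.2.1 = 0 then (p.1, p.2.1, g * p.2.2.1, p.2.2.2) else p := rfl

abbrev Grp (y : ℕ → G) : Subgroup (Equiv.Perm (Om G)) := Subgroup.closure (Set.range (gen y))

theorem sP_mem (y : ℕ → G) : sP ∈ Grp y := Subgroup.subset_closure ⟨0, rfl⟩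
theorem tP_mem (y : ℕ → G) : tP ∈ Grp y := Subgroup.subset_closure ⟨1, rfl⟩
theorem cP_mem (y : ℕ → G) : cP y ∈ Grp y := Subgroup.subset_closure ⟨2, rfl⟩

theorem sP_zpow (m : ℕ) (p : Om G) : (sP ^ m) p = (p.1 + m, p.2) := by
  induction m with
  | zero => simp
  | succ m ih =>
    rw [pow_succ', Equiv.Perm.mul_apply, ih]
    simp [sP, add_assoc]

theorem sP_zpow_inv (m : ℕ) (p : Om G) : (sP ^ m)⁻¹ p = (p.1 - m, p.2) := by
  rw [Equiv.Perm.inv_eq_iff_eq, sP_zpow]; simp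

/-- the conjugate of `cP` acting at column `0` through `y q` -/
def c1 (y : ℕ → G) (q : ℕ) : Equiv.Perm (Om G) := (sP ^ (q * q))⁻¹ * cP y * sP ^ (q * q)

theorem c1_zero (y : ℕ → G) (q : ℕ) (hq : 1 ≤ q) (k : ℤ) (g : G) (i : ℤ) :
    c1 y q (0, k, g, i) = if 0 ≤ k then (0, k, y q * g, i + 1) else (0, k, g, i) := by
  obtain ⟨h1, h2⟩ := isSq_sq q hq
  simp only [c1, Equiv.Perm.mul_apply, sP_zpow, sP_zpow_inv]
  by_cases hk : 0 ≤ k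
  · simp [cP, act, hk, h1, h2]
  · simp [cP, act, hk]

theorem c1_inv_zero (y : ℕ → G) (q : ℕ) (hq : 1 ≤ q) (k : ℤ) (g : G) (i : ℤ) :
    (c1 y q)⁻¹ (0, k, g, i) = if 0 ≤ k then (0, k, (y q)⁻¹ * g, i - 1) else (0, k, g, i) := by
  rw [Equiv.Perm.inv_eq_iff_eq]
  by_cases hk : 0 ≤ k
  · simp [c1_zero y q hq, hk]
  · simp [c1_zero y q hq, hk]

theorem tP_inv_apply (p : Om G) :
    tP⁻¹ p = if p.1 = 0 then (p.1, p.2.1 - 1, p.2.2) else p := rfl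
theorem tP_apply (p : Om G) :
    tP p = if p.1 = 0 then (p.1, p.2.1 + 1, p.2.2) else p := rfl

theorem c1_fst (y : ℕ → G) (q : ℕ) (p : Om G) : (c1 y q p).1 = p.1 := by
  simp only [c1, Equiv.Perm.mul_apply, sP_zpow, sP_zpow_inv, cP, Equiv.coe_fn_mk]
  split_ifs <;> simp

theorem comm_apply (y : ℕ → G) (q : ℕ) (hq : 1 ≤ q) (n k : ℤ) (g : G) (i : ℤ) :
    (c1 y q * tP * (c1 y q)⁻¹ * tP⁻¹ : Equiv.Perm (Om G)) (n, k, g, i) =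
      if n = 0 ∧ k = 0 then (n, k, y q * g, i + 1) else (n, k, g, i) := by
  by_cases hn : n = 0
  · subst hn
    simp only [Equiv.Perm.mul_apply, tP_inv_apply, if_true]
    rw [c1_inv_zero y q hq]
    by_cases hk : 0 ≤ k - 1
    · rw [if_pos hk, tP_apply]
      simp only [if_true]
      rw [c1_zero y q hq, if_pos (by omega), if_neg (by omega)]
      simp
    · rw [if_neg hk, tP_apply]
      simp only [if_true]
      rw [c1_zero y q hq]
      by_cases hk0 : k = 0
      · simp [hk0]
      · rw [if_neg (by omega), if_neg (by omega)]; simp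
  · have h1 : tP⁻¹ (n, k, g, i) = (n, k, g, i) := by simp [tP_inv_apply, hn]
    have h2 : ((c1 y q)⁻¹ (n, k, g, i)).1 = n := by
      have := c1_fst y q ((c1 y q)⁻¹ (n, k, g, i))
      simp at this
      exact this.symm
    have h3 : tP ((c1 y q)⁻¹ (n, k, g, i)) = (c1 y q)⁻¹ (n, k, g, i) := by
      rw [tP_apply, h2, if_neg hn]
    simp only [Equiv.Perm.mul_apply, h1, h3]
    simp [hn]

theorem del_mem (y : ℕ → G) (hy1 : y 1 = 1) (q : ℕ) (hq : 1 ≤ q) : del (y q) ∈ Grp y := by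
  have hc : ∀ q, c1 y q ∈ Grp y := fun q =>
    mul_mem (mul_mem (inv_mem (pow_mem (sP_mem y) _)) (cP_mem y)) (pow_mem (sP_mem y) _)
  have hE : ∀ q, c1 y q * tP * (c1 y q)⁻¹ * tP⁻¹ ∈ Grp y := fun q =>
    mul_mem (mul_mem (mul_mem (hc q) (tP_mem y)) (inv_mem (hc q))) (inv_mem (tP_mem y))
  have : del (y q) = (c1 y q * tP * (c1 y q)⁻¹ * tP⁻¹) * (c1 y 1 * tP * (c1 y 1)⁻¹ * tP⁻¹)⁻¹ := by
    rw [eq_mul_inv_iff_mul_eq]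
    ext p : 1
    obtain ⟨n, k, g, i⟩ := p
    rw [Equiv.Perm.mul_apply, comm_apply y 1 le_rfl, comm_apply y q hq, del_apply]
    by_cases h : n = 0 ∧ k = 0
    · simp [h, hy1]
    · simp [h]
  rw [this]
  exact mul_mem (hE q) (inv_mem (hE 1))

theorem struct (y : ℕ → G) (h : Equiv.Perm (Om G)) (hh : h ∈ Grp y) :
    ∀ n k, ∃ n' k' a e, ∀ g i, h (n, k, g, i) = (n', k', a * g, i + e) := by
  induction hh using Subgroup.closure_induction with
  | mem x hx =>
    obtain ⟨i, rfl⟩ := hx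
    intro n k
    fin_cases i
    · exact ⟨n + 1, k, 1, 0, by simp [gen, sP]⟩
    · by_cases hn : n = 0
      · exact ⟨n, k + 1, 1, 0, by simp [gen, tP, hn]⟩
      · exact ⟨n, k, 1, 0, by simp [gen, tP, hn]⟩
    · by_cases hn : act n k
      · exact ⟨n, k, y (rt n), 1, by simp [gen, cP, hn]⟩
      · exact ⟨n, k, 1, 0, by simp [gen, cP, hn]⟩
  | one => intro n k; exact ⟨n, k, 1, 0, by simp⟩
  | mul x x' _ _ hx hy =>
    intro n k
    obtain ⟨n1, k1, a1, e1, h1⟩ := hy n k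
    obtain ⟨n2, k2, a2, e2, h2⟩ := hx n1 k1
    exact ⟨n2, k2, a2 * a1, e1 + e2, fun g i => by
      rw [Equiv.Perm.mul_apply, h1, h2, mul_assoc, add_assoc]⟩
  | inv x _ hx =>
    intro n k
    obtain ⟨⟨n0, k0, g0, i0⟩, h0⟩ : ∃ p, x⁻¹ (n, k, 1, 0) = p := ⟨_, rfl⟩
    obtain ⟨n1, k1, a1, e1, h1⟩ := hx n0 k0
    rw [Equiv.Perm.inv_eq_iff_eq, h1] at h0
    simp only [Prod.mk.injEq] at h0
    obtain ⟨h2, h3, h4, h5⟩ := h0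
    refine ⟨n0, k0, a1⁻¹, -e1, fun g i => ?_⟩
    rw [Equiv.Perm.inv_eq_iff_eq, h1, ← h2, ← h3]
    simp

theorem del_mem_all (y : ℕ → G) (hy1 : y 1 = 1)
    (hgen : Subgroup.closure (Set.range fun j => y (j + 2)) = ⊤) (g : G) : del g ∈ Grp y := by
  have : (⊤ : Subgroup G) ≤ (Grp y).comap del := by
    rw [← hgen, Subgroup.closure_le]
    rintro _ ⟨j, rfl⟩
    exact del_mem y hy1 (j + 2) (by omega)
  exact this trivial

def phi (y : ℕ → G) (hy1 : y 1 = 1)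
    (hgen : Subgroup.closure (Set.range fun j => y (j + 2)) = ⊤) : G →* Grp y :=
  del.codRestrict (Grp y) (del_mem_all y hy1 hgen)

theorem phi_frattini (y : ℕ → G) (hy1 : y 1 = 1)
    (hgen : Subgroup.closure (Set.range fun j => y (j + 2)) = ⊤) :
    IsFrattini (phi y hy1 hgen) := by
  have hinj : ∀ g g' : G, del g = del g' → g = g' := by
    intro g g' h
    have := DFunLike.congr_fun h (0, 0, 1, 0)
    simpa [del_apply] using this
  refine ⟨fun a b h => hinj a b (congrArg Subtype.val h), fun a b => ⟨fun h => ?_, fun h => ?_⟩⟩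
  · exact MonoidHom.map_isConj _ h
  · obtain ⟨⟨c, hc⟩, hh⟩ := isConj_iff.1 h
    have hh : c * del a * c⁻¹ = del b := congrArg Subtype.val hh
    rw [mul_inv_eq_iff_eq_mul] at hh
    obtain ⟨n', k', u, e, hu⟩ := struct y c hc 0 0
    have h1 := DFunLike.congr_fun hh (0, 0, 1, 0)
    simp only [Equiv.Perm.mul_apply] at h1
    rw [hu, del_apply, del_apply] at h1
    by_cases hn : n' = 0 ∧ k' = 0
    · simp [hn, hu] at h1
      exact isConj_iff.2 ⟨u, by rw [h1]; simp⟩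
    · simp [hn, hu] at h1
      subst h1
      have : del b = 1 := by
        have := hh
        simp at this
        exact this
      have : (1 : G) = b := hinj _ _ (by rw [this, map_one])
      rw [this]

end Step1
end FrattiniProof

set_option linter.all false

namespace FrattiniProof

open Encodable

namespace Step1

variable {G : Type} [Group G]

def key [LinearOrder G] (p : Om G) : ℤ ×ₗ (ℤ ×ₗ (G ×ₗ ℤ)) :=
  toLex (p.1, toLex (p.2.1, toLex p.2.2))

theorem key_inj [LinearOrder G] : Function.Injective (key (G := G)) := by
  rintro ⟨n, k, g, i⟩ ⟨n', k', g', i'⟩ h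
  simpa [key] using h

theorem sP_mk (n : ℤ) (r : ℤ × G × ℤ) : sP (G := G) (n, r) = (n + 1, r) := rfl
theorem sP_inv_mk (n : ℤ) (r : ℤ × G × ℤ) : (sP (G := G))⁻¹ (n, r) = (n + -1, r) := by
  show sP.symm _ = _
  simp [sP, Equiv.symm, sub_eq_add_neg]
theorem tP_zero (k : ℤ) (r : G × ℤ) : tP (G := G) (0, k, r) = (0, k + 1, r) := rfl
theorem tP_inv_zero (k : ℤ) (r : G × ℤ) : (tP (G := G))⁻¹ (0, k, r) = (0, k + -1, r) := by
  rw [tP_inv_apply]; simp [sub_eq_add_neg]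
theorem tP_ne {n : ℤ} (hn : n ≠ 0) (r : ℤ × G × ℤ) : tP (G := G) (n, r) = (n, r) := by
  rw [tP_apply]; simp [hn]
theorem tP_inv_ne {n : ℤ} (hn : n ≠ 0) (r : ℤ × G × ℤ) : (tP (G := G))⁻¹ (n, r) = (n, r) := by
  rw [tP_inv_apply]; simp [hn]
theorem cP_pos (y : ℕ → G) {n k : ℤ} (h : act n k) (g : G) (i : ℤ) :
    cP y (n, k, g, i) = (n, k, y (rt n) * g, i + 1) := if_pos h
theorem cP_neg (y : ℕ → G) {n k : ℤ} (h : ¬ act n k) (r : G × ℤ) :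
    cP y (n, k, r) = (n, k, r) := if_neg h
theorem cP_inv_pos (y : ℕ → G) {n k : ℤ} (h : act n k) (g : G) (i : ℤ) :
    (cP y)⁻¹ (n, k, g, i) = (n, k, (y (rt n))⁻¹ * g, i + -1) := if_pos h
theorem cP_inv_neg (y : ℕ → G) {n k : ℤ} (h : ¬ act n k) (r : G × ℤ) :
    (cP y)⁻¹ (n, k, r) = (n, k, r) := if_neg h

theorem gen_mono [LinearOrder G] (hl : ∀ a b c : G, b < c → a * b < a * c) (y : ℕ → G) (i : Fin 3)
    (p q : Om G) (h : key p < key q) : key (gen y i p) < key (gen y i q) := by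
  obtain ⟨n, k, g, j⟩ := p
  obtain ⟨n', k', g', j'⟩ := q
  simp only [key, Prod.Lex.toLex_lt_toLex] at h
  fin_cases i
  · show key (sP _) < key (sP _)
    rw [sP_mk, sP_mk]
    simp only [key, Prod.Lex.toLex_lt_toLex]
    simpa using h
  · show key (tP _) < key (tP _)
    rcases h with h | ⟨h1, h⟩
    · try dsimp only at h
      by_cases hn : n = 0 <;> by_cases hn' : n' = 0 <;>
        simp only [tP_apply, hn, hn', if_true, if_false, key, Prod.Lex.toLex_lt_toLex] <;>
        left <;> omega
    · try dsimp only at h1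
      subst h1
      by_cases hn : n = 0
      · subst hn
        rw [tP_zero, tP_zero]
        simp only [key, Prod.Lex.toLex_lt_toLex]
        simpa using h
      · rw [tP_ne hn, tP_ne hn]
        simp only [key, Prod.Lex.toLex_lt_toLex]
        simpa using h
  · show key (cP y _) < key (cP y _)
    have hc : ∀ n k g i, ∃ r, cP y (n, k, g, i) = (n, k, r) := by
      intro n k g i
      by_cases hn : act n k
      · exact ⟨_, cP_pos y hn g i⟩
      · exact ⟨_, cP_neg y hn _⟩
    rcases h with h | ⟨h1, h⟩
    · obtain ⟨r, hr⟩ := hc n k g j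
      obtain ⟨r', hr'⟩ := hc n' k' g' j'
      rw [hr, hr']
      simp only [key, Prod.Lex.toLex_lt_toLex]
      exact Or.inl h
    try dsimp only at h1
    subst h1
    rcases h with h | ⟨h1, h⟩
    · obtain ⟨r, hr⟩ := hc n k g j
      obtain ⟨r', hr'⟩ := hc n k' g' j'
      rw [hr, hr']
      simp only [key, Prod.Lex.toLex_lt_toLex]
      exact Or.inr ⟨trivial, Or.inl h⟩
    try dsimp only at h1
    subst h1
    by_cases hn : act n k
    · rw [cP_pos y hn, cP_pos y hn]
      simp only [key, Prod.Lex.toLex_lt_toLex]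
      rcases h with h | ⟨h1, h⟩
      · exact Or.inr ⟨trivial, Or.inr ⟨trivial, Or.inl (hl _ _ _ h)⟩⟩
      · try dsimp only at h1 h
        subst h1
        exact Or.inr ⟨trivial, Or.inr ⟨trivial, Or.inr ⟨rfl, by omega⟩⟩⟩
    · rw [cP_neg y hn, cP_neg y hn]
      simp only [key, Prod.Lex.toLex_lt_toLex]
      exact Or.inr ⟨trivial, Or.inr ⟨trivial, h⟩⟩

/-- first simulation : clamping `k`, right multiplication. -/
def RA (g0 : G) (i0 d : ℤ) (j : ℕ) (p p' : Om G) : Prop :=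
  p.1 = p'.1 ∧ p.2.2.1 = p'.2.2.1 * g0 ∧ p.2.2.2 = p'.2.2.2 + i0 ∧ p.2.1 = p'.2.1 + d ∧
    (d = 0 ∨ ((j : ℤ) ≤ p.2.1 ∧ (j : ℤ) ≤ p'.2.1) ∨ (p.2.1 < -(j : ℤ) ∧ p'.2.1 < -(j : ℤ)))

/-- second simulation : moving `n` -/
def RB (y : ℕ → G) (q q' : ℕ) (D k0 : ℤ) (j : ℕ) (p p' : Om G) : Prop :=
  p.1 = p'.1 + D ∧ p.2.1 = k0 ∧ p'.2.1 = k0 ∧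
  (∃ e : ℤ, p.2.2 = (y q ^ e, e) ∧ p'.2.2 = (y q' ^ e, e)) ∧
  ∀ t : ℤ, |t| ≤ j → p.1 + t ≠ 0 ∧ p'.1 + t ≠ 0 ∧ (IsSq (p.1 + t) → rt (p.1 + t) = q) ∧
    (IsSq (p'.1 + t) → rt (p'.1 + t) = q') ∧ (IsSq (p.1 + t) ↔ IsSq (p'.1 + t))

theorem RA_step (y : ℕ → G) (g0 : G) (i0 d : ℤ) (i : Fin 3) (j : ℕ) (p p' : Om G)
    (h : RA g0 i0 d (j + 1) p p') : RA g0 i0 d j (gen y i p) (gen y i p') := by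
  obtain ⟨n, k, g, i1⟩ := p
  obtain ⟨n', k', g', i1'⟩ := p'
  obtain ⟨h1, h2, h3, h4, h5⟩ := h
  simp only at h1 h2 h3 h4 h5
  subst h1
  push_cast at h5
  fin_cases i
  · show RA g0 i0 d j (sP _) (sP _)
    rw [sP_mk, sP_mk]
    refine ⟨rfl, h2, h3, h4, ?_⟩
    dsimp only; omega
  · show RA g0 i0 d j (tP _) (tP _)
    by_cases hn : n = 0
    · subst hn
      rw [tP_zero, tP_zero]
      refine ⟨rfl, h2, h3, ?_, ?_⟩ <;> dsimp only <;> omega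
    · rw [tP_ne hn, tP_ne hn]
      refine ⟨rfl, h2, h3, h4, ?_⟩
      dsimp only; omega
  · show RA g0 i0 d j (cP y _) (cP y _)
    have hact : act n k ↔ act n k' := by
      unfold act
      have : 0 ≤ k ↔ 0 ≤ k' := by omega
      rw [this]
    by_cases hn : act n k'
    · rw [cP_pos y (hact.2 hn), cP_pos y hn]
      refine ⟨rfl, ?_, ?_, h4, ?_⟩ <;> dsimp only
      · rw [h2, mul_assoc]
      · omega
      · omega
    · rw [cP_neg y (fun h => hn (hact.1 h)), cP_neg y hn]
      refine ⟨rfl, h2, h3, h4, ?_⟩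
      dsimp only; omega

theorem RB_step (y : ℕ → G) (q q' : ℕ) (D k0 : ℤ) (i : Fin 3) (j : ℕ) (p p' : Om G)
    (h : RB y q q' D k0 (j + 1) p p') : RB y q q' D k0 j (gen y i p) (gen y i p') := by
  obtain ⟨n, k, g, i1⟩ := p
  obtain ⟨n', k', g', i1'⟩ := p'
  obtain ⟨h1, h2, h3, ⟨e, h4, h5⟩, h6⟩ := h
  simp only [Prod.mk.injEq] at h1 h2 h3 h4 h5 h6
  push_cast at h6
  have h6' : ∀ t : ℤ, |t| ≤ j → _ := fun t ht => h6 t (by omega)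
  have h0 := h6 0 (by simp; omega)
  simp only [add_zero] at h0
  obtain ⟨rfl, rfl⟩ := h4
  obtain ⟨rfl, h5⟩ := h5
  subst h5
  fin_cases i
  · show RB y q q' D k0 j (sP _) (sP _)
    rw [sP_mk, sP_mk]
    refine ⟨?_, h2, h3, ⟨_, rfl, rfl⟩, fun t ht => ?_⟩
    · dsimp only; omega
    have := h6 (1 + t) (by
      have := abs_add_le (1) t
      simp at this; omega)
    simpa [add_assoc] using this
  · show RB y q q' D k0 j (tP _) (tP _)
    rw [tP_ne h0.1, tP_ne h0.2.1]
    exact ⟨h1, h2, h3, ⟨_, rfl, rfl⟩, h6'⟩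
  · show RB y q q' D k0 j (cP y _) (cP y _)
    have hact : act n k ↔ act n' k' := by
      unfold act
      rw [h2, h3, h0.2.2.2.2]
    by_cases hn : act n' k'
    · rw [cP_pos y (hact.2 hn), cP_pos y hn, h0.2.2.1 (hact.2 hn).2, h0.2.2.2.1 hn.2]
      refine ⟨h1, h2, h3, ⟨1 + i1', ?_, ?_⟩, h6'⟩
      · rw [zpow_add, add_comm i1']; simp
      · rw [zpow_add, add_comm i1']; simp
    · rw [cP_neg y (fun h => hn (hact.1 h)), cP_neg y hn]
      exact ⟨h1, h2, h3, ⟨_, rfl, rfl⟩, h6'⟩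

theorem RA_step_inv (y : ℕ → G) (g0 : G) (i0 d : ℤ) (i : Fin 3) (j : ℕ) (p p' : Om G)
    (h : RA g0 i0 d (j + 1) p p') : RA g0 i0 d j ((gen y i)⁻¹ p) ((gen y i)⁻¹ p') := by
  obtain ⟨n, k, g, i1⟩ := p
  obtain ⟨n', k', g', i1'⟩ := p'
  obtain ⟨h1, h2, h3, h4, h5⟩ := h
  simp only at h1 h2 h3 h4 h5
  subst h1
  push_cast at h5
  fin_cases i
  · show RA g0 i0 d j (sP⁻¹ _) (sP⁻¹ _)
    rw [sP_inv_mk, sP_inv_mk]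
    refine ⟨rfl, h2, h3, h4, ?_⟩
    dsimp only; omega
  · show RA g0 i0 d j (tP⁻¹ _) (tP⁻¹ _)
    by_cases hn : n = 0
    · subst hn
      rw [tP_inv_zero, tP_inv_zero]
      refine ⟨rfl, h2, h3, ?_, ?_⟩ <;> dsimp only <;> omega
    · rw [tP_inv_ne hn, tP_inv_ne hn]
      refine ⟨rfl, h2, h3, h4, ?_⟩
      dsimp only; omega
  · show RA g0 i0 d j ((cP y)⁻¹ _) ((cP y)⁻¹ _)
    have hact : act n k ↔ act n k' := by
      unfold act
      have : 0 ≤ k ↔ 0 ≤ k' := by omega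
      rw [this]
    by_cases hn : act n k'
    · rw [cP_inv_pos y (hact.2 hn), cP_inv_pos y hn]
      refine ⟨rfl, ?_, ?_, h4, ?_⟩ <;> dsimp only
      · rw [h2, mul_assoc]
      · omega
      · omega
    · rw [cP_inv_neg y (fun h => hn (hact.1 h)), cP_inv_neg y hn]
      refine ⟨rfl, h2, h3, h4, ?_⟩
      dsimp only; omega

theorem RB_step_inv (y : ℕ → G) (q q' : ℕ) (D k0 : ℤ) (i : Fin 3) (j : ℕ) (p p' : Om G)
    (h : RB y q q' D k0 (j + 1) p p') : RB y q q' D k0 j ((gen y i)⁻¹ p) ((gen y i)⁻¹ p') := by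
  obtain ⟨n, k, g, i1⟩ := p
  obtain ⟨n', k', g', i1'⟩ := p'
  obtain ⟨h1, h2, h3, ⟨e, h4, h5⟩, h6⟩ := h
  simp only [Prod.mk.injEq] at h1 h2 h3 h4 h5 h6
  push_cast at h6
  have h6' : ∀ t : ℤ, |t| ≤ j → _ := fun t ht => h6 t (by omega)
  have h0 := h6 0 (by simp; omega)
  simp only [add_zero] at h0
  obtain ⟨rfl, rfl⟩ := h4
  obtain ⟨rfl, h5⟩ := h5
  subst h5
  fin_cases i
  · show RB y q q' D k0 j (sP⁻¹ _) (sP⁻¹ _)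
    rw [sP_inv_mk, sP_inv_mk]
    refine ⟨?_, h2, h3, ⟨_, rfl, rfl⟩, fun t ht => ?_⟩
    · dsimp only; omega
    have := h6 (-1 + t) (by
      have := abs_add_le (-1) t
      simp at this; omega)
    simpa [add_assoc] using this
  · show RB y q q' D k0 j (tP⁻¹ _) (tP⁻¹ _)
    rw [tP_inv_ne h0.1, tP_inv_ne h0.2.1]
    exact ⟨h1, h2, h3, ⟨_, rfl, rfl⟩, h6'⟩
  · show RB y q q' D k0 j ((cP y)⁻¹ _) ((cP y)⁻¹ _)
    have hact : act n k ↔ act n' k' := by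
      unfold act
      rw [h2, h3, h0.2.2.2.2]
    by_cases hn : act n' k'
    · rw [cP_inv_pos y (hact.2 hn), cP_inv_pos y hn, h0.2.2.1 (hact.2 hn).2, h0.2.2.2.1 hn.2]
      refine ⟨h1, h2, h3, ⟨-1 + i1', ?_, ?_⟩, h6'⟩
      · rw [zpow_add, add_comm i1']; simp
      · rw [zpow_add, add_comm i1']; simp
    · rw [cP_inv_neg y (fun h => hn (hact.1 h)), cP_inv_neg y hn]
      exact ⟨h1, h2, h3, ⟨_, rfl, rfl⟩, h6'⟩

theorem sq_window (m : ℕ) (q : ℕ) (hq : m + 1 ≤ q) (t : ℤ) (ht : |t| ≤ 2 * m)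
    (h : IsSq ((q : ℤ) * q + t)) : rt ((q : ℤ) * q + t) = q ∧ t = 0 := by
  have h1 := h.eq
  set r := rt ((q : ℤ) * q + t)
  have ht := abs_le.1 ht
  have hq' : (m : ℤ) + 1 ≤ q := by exact_mod_cast hq
  have : r = q := by
    rcases lt_trichotomy r q with h2 | h2 | h2
    · have h2' : (r : ℤ) + 1 ≤ q := by exact_mod_cast h2
      have hr : (0 : ℤ) ≤ r := by positivity
      nlinarith
    · exact h2
    · have h2' : (q : ℤ) + 1 ≤ r := by exact_mod_cast h2
      nlinarith
  refine ⟨this, ?_⟩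
  rw [this] at h1
  linarith

theorem tests_ok (y : ℕ → G) (w : List (Fin 3 × Bool))
    (h : ∀ n k : ℤ, |n| ≤ (w.length + 1) ^ 2 + w.length → |k| ≤ w.length + 1 →
      wordAct (gen y) w (n, k, 1, 0) = (n, k, 1, 0)) : wordAct (gen y) w = 1 := by
  set m := w.length with hm
  -- clamp `n`
  have hB : ∀ n k : ℤ, |k| ≤ m + 1 → wordAct (gen y) w (n, k, 1, 0) = (n, k, 1, 0) := by
    intro n k hk
    by_cases hn : |n| ≤ (m + 1) ^ 2 + m
    · exact h n k hn hk
    have conc : ∀ (q q' : ℕ) (n' : ℤ), |n'| ≤ (m + 1) ^ 2 + m →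
        RB y q q' (n - n') k m (n, k, 1, 0) (n', k, 1, 0) →
        wordAct (gen y) w (n, k, 1, 0) = (n, k, 1, 0) := by
      intro q q' n' hn' hR
      have := wordAct_sim (gen y) (RB y q q' (n - n') k) (RB_step y q q' _ k)
        (RB_step_inv y q q' _ k) w 0 _ _ (by rw [← hm]; simpa using hR)
      rw [h n' k hn' hk] at this
      obtain ⟨h1, h2, h3, ⟨e, h4, h5⟩, -⟩ := this
      simp only [Prod.mk.injEq] at h1 h3 h5
      have he : e = 0 := h5.2.symm
      subst he
      refine Prod.ext (by rw [h1]; simp) (Prod.ext h2 (by rw [h4]; simp))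
    have hm2 : (m : ℤ) ≤ (m + 1) ^ 2 + m := by nlinarith [sq_nonneg ((m : ℤ) + 1)]
    have hn1 : ∀ t : ℤ, |t| ≤ m → n + t ≠ 0 := by
      intro t ht h0
      apply hn
      have : n = -t := by omega
      rw [this, abs_neg]; omega
    by_cases hs : ∃ t : ℤ, |t| ≤ m ∧ IsSq (n + t)
    · obtain ⟨t0, ht0, hsq⟩ := hs
      set q := rt (n + t0)
      have hq : n + t0 = (q : ℤ) * q := hsq.eq
      have ht0' := abs_le.1 ht0
      have hqm : m + 1 ≤ q := by
        by_contra hcon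
        apply hn
        have : (q : ℤ) ≤ m := by exact_mod_cast (by omega)
        have h0 : (0 : ℤ) ≤ q := by positivity
        have h0m : (0 : ℤ) ≤ m := by positivity
        rw [abs_le]
        constructor <;> nlinarith
      refine conc q (m + 1) ((m + 1) * (m + 1) - t0) ?_ ?_
      · rw [abs_le]
        have h0m : (0 : ℤ) ≤ m := by positivity
        constructor <;> nlinarith
      · refine ⟨by simp, rfl, rfl, ⟨0, by simp, by simp⟩, fun t ht => ?_⟩
        have htt : |t - t0| ≤ 2 * m := by
          have := abs_sub t t0
          omega
        have e1 : n + t = (q : ℤ) * q + (t - t0) := by rw [← hq]; ring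
        have e2 : ((m : ℤ) + 1) * (m + 1) - t0 + t = ((m + 1 : ℕ) : ℤ) * (m + 1 : ℕ) + (t - t0) := by
          push_cast; ring
        dsimp only
        refine ⟨hn1 t ht, ?_, ?_, ?_, ?_⟩
        · have := abs_le.1 htt
          nlinarith
        · rw [e1]; intro h; exact (sq_window m q hqm _ htt h).1
        · rw [e2]; intro h; exact (sq_window m (m + 1) le_rfl _ htt h).1
        · constructor
          · rw [e1, e2]; intro h
            rw [(sq_window m q hqm _ htt h).2, add_zero]
            exact (isSq_sq (m + 1) (by omega)).1
          · rw [e1, e2]; intro h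
            rw [(sq_window m (m + 1) le_rfl _ htt h).2, add_zero]
            exact (isSq_sq q (by omega)).1
    · push Not at hs
      refine conc 0 0 (-m - 1) ?_ ?_
      · rw [abs_le]
        have h0m : (0 : ℤ) ≤ m := by positivity
        constructor <;> nlinarith
      · refine ⟨by simp, rfl, rfl, ⟨0, by simp, by simp⟩, fun t ht => ?_⟩
        dsimp only
        have ht' := abs_le.1 ht
        have hneg : ¬ IsSq (-m - 1 + t) := fun h => by have := h.1; omega
        refine ⟨hn1 t ht, by omega, fun h => absurd h (hs t ht), fun h => absurd h hneg,
          fun h => absurd h (hs t ht), fun h => absurd h hneg⟩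
  ext p : 1
  obtain ⟨n, k, g, i⟩ := p
  have conc : ∀ k' : ℤ, |k'| ≤ m + 1 → RA g i (k - k') m (n, k, g, i) (n, k', 1, 0) →
      wordAct (gen y) w (n, k, g, i) = (n, k, g, i) := by
    intro k' hk' hR
    have := wordAct_sim (gen y) (RA g i (k - k')) (RA_step y g i _)
        (RA_step_inv y g i _) w 0 _ _ (by rw [← hm]; simpa using hR)
    rw [hB n k' hk'] at this
    obtain ⟨h1, h2, h3, h4, -⟩ := this
    refine Prod.ext h1 (Prod.ext (by rw [h4]; simp) (Prod.ext (by rw [h2]; simp) (by rw [h3]; simp)))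
  rw [Equiv.Perm.one_apply]
  rcases le_or_gt |k| m with hk | hk
  · exact conc k (by omega) ⟨rfl, by simp, by simp, by simp, by simp⟩
  · rcases le_or_gt 0 k with h0 | h0
    · rw [abs_of_nonneg h0] at hk
      exact conc m (by simp) ⟨rfl, by simp, by simp, by simp, by simp; omega⟩
    · rw [abs_of_neg h0] at hk
      exact conc (-m - 1) (by rw [abs_le]; omega)
        ⟨rfl, by simp, by simp, by simp, by simp; omega⟩

end Step1
end FrattiniProof


set_option linter.all false

namespace FrattiniProof

open Encodable

namespace Step1

variable {G : Type} [Group G]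

abbrev Code := (ℕ × ℕ) × (ℕ × ℕ) × List (ℕ × Bool) × (ℕ × ℕ)

def yy (x : ℕ → G) (q : ℕ) : G := if q < 2 then 1 else x (q - 2)

def yword (q : ℕ) (b : Bool) : List (ℕ × Bool) := if q < 2 then [] else [(q - 2, b)]

theorem evalWord_yword (x : ℕ → G) (q : ℕ) (b : Bool) :
    evalWord x (yword q b) = cond b (yy x q) (yy x q)⁻¹ := by
  unfold yword yy
  by_cases h : q < 2
  · cases b <;> simp [h, evalWord]
  · cases b <;> simp [h, evalWord]

def dec (x : ℕ → G) (c : Code) : Option (Om G) :=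
  some (iv c.1, iv c.2.1, evalWord x c.2.2.1, iv c.2.2.2)

def cact (c : Code) : Prop :=
  c.2.1.2 ≤ c.2.1.1 ∧ c.1.2 < c.1.1 ∧
    Nat.sqrt (c.1.1 - c.1.2) * Nat.sqrt (c.1.1 - c.1.2) = c.1.1 - c.1.2

instance : DecidablePred cact := fun c => by unfold cact; infer_instance

theorem cact_iff (c : Code) : cact c ↔ act (iv c.1) (iv c.2.1) := by
  have : (iv c.1).toNat = c.1.1 - c.1.2 := by unfold iv; omega
  unfold cact act IsSq
  rw [this]
  unfold iv
  constructor
  · rintro ⟨h1, h2, h3⟩; exact ⟨by omega, by omega, h3⟩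
  · rintro ⟨h1, h2, h3⟩; exact ⟨by omega, by omega, h3⟩

theorem rt_iv (p : ℕ × ℕ) : rt (iv p) = Nat.sqrt (p.1 - p.2) := by
  have : (iv p).toNat = p.1 - p.2 := by unfold iv; omega
  unfold rt; rw [this]

def ibump (b : Bool) (p : ℕ × ℕ) : ℕ × ℕ := cond b (isucc p) (ipred p)

theorem iv_ibump (b : Bool) (p : ℕ × ℕ) : iv (ibump b p) = iv p + cond b 1 (-1) := by
  cases b
  · exact iv_ipred p
  · exact iv_isucc p

theorem ibump_primrec (b : Bool) : Primrec (ibump b) := by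
  cases b
  · exact ipred_primrec
  · exact isucc_primrec

def eact (c : Code) (a : Fin 3 × Bool) : Code :=
  match a.1 with
  | 0 => (ibump a.2 c.1, c.2)
  | 1 => if c.1.1 = c.1.2 then (c.1, ibump a.2 c.2.1, c.2.2) else c
  | 2 => if cact c then (c.1, c.2.1, yword (Nat.sqrt (c.1.1 - c.1.2)) a.2 ++ c.2.2.1,
      ibump a.2 c.2.2.2) else c

theorem p11 : Primrec (fun c : Code => c.1.1) := Primrec.fst.comp Primrec.fst
theorem p12 : Primrec (fun c : Code => c.1.2) := Primrec.snd.comp Primrec.fst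
theorem p21 : Primrec (fun c : Code => c.2.1) := Primrec.fst.comp Primrec.snd
theorem p22 : Primrec (fun c : Code => c.2.2) := Primrec.snd.comp Primrec.snd

theorem yword_primrec (b : Bool) : Primrec (fun q => yword q b) :=
  Primrec.ite (Primrec.nat_lt.comp Primrec.id (Primrec.const 2)) (Primrec.const [])
    (Primrec.list_cons.comp (Primrec.pair (Primrec.nat_sub.comp Primrec.id (Primrec.const 2))
      (Primrec.const b)) (Primrec.const []))

theorem eact_comp (a : Fin 3 × Bool) : Computable (fun c => eact c a) := by
  apply Primrec.to_comp
  obtain ⟨i, b⟩ := a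
  fin_cases i
  · exact Primrec.pair ((ibump_primrec b).comp Primrec.fst) Primrec.snd
  · exact Primrec.ite (Primrec.eq.comp p11 p12) (Primrec.pair Primrec.fst
      (Primrec.pair ((ibump_primrec b).comp p21) p22)) Primrec.id
  · have hd : Primrec (fun c : Code => c.1.1 - c.1.2) := Primrec.nat_sub.comp p11 p12
    have hs : Primrec (fun c : Code => Nat.sqrt (c.1.1 - c.1.2)) := Primrec.nat_sqrt.comp hd
    have hc : PrimrecPred cact :=
      (Primrec.nat_le.comp (Primrec.snd.comp p21) (Primrec.fst.comp p21)).and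
        ((Primrec.nat_lt.comp p12 p11).and (Primrec.eq.comp (Primrec.nat_mul.comp hs hs) hd))
    exact Primrec.ite hc (Primrec.pair Primrec.fst (Primrec.pair p21 (Primrec.pair
      (Primrec.list_append.comp ((yword_primrec b).comp hs) (Primrec.fst.comp p22))
      ((ibump_primrec b).comp (Primrec.snd.comp p22))))) Primrec.id

theorem eact_spec (x : ℕ → G) (c : Code) (a : Fin 3 × Bool) (p : Om G) (h : dec x c = some p) :
    dec x (eact c a) = some ((cond a.2 (gen (yy x) a.1) (gen (yy x) a.1)⁻¹) p) := by
  obtain ⟨i, b⟩ := a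
  simp only [dec, Option.some.injEq] at h
  subst h
  simp only [dec, Option.some.injEq]
  fin_cases i
  · show (iv (ibump b c.1), _) = (cond b sP sP⁻¹) (iv c.1, _)
    rw [iv_ibump]
    cases b
    · exact (sP_inv_mk _ _).symm
    · exact (sP_mk _ _).symm
  · simp only [eact]
    show _ = (cond b tP tP⁻¹) _
    by_cases h : c.1.1 = c.1.2
    · rw [if_pos h]
      have h0 : iv c.1 = 0 := by unfold iv; omega
      simp only [h0, iv_ibump]
      cases b
      · exact (tP_inv_zero _ _).symm
      · exact (tP_zero _ _).symm
    · rw [if_neg h]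
      have h0 : iv c.1 ≠ 0 := by unfold iv; omega
      cases b
      · exact (tP_inv_ne h0 _).symm
      · exact (tP_ne h0 _).symm
  · simp only [eact]
    show _ = (cond b (cP (yy x)) (cP (yy x))⁻¹) _
    by_cases h : cact c
    · rw [if_pos h]
      have h0 := (cact_iff c).1 h
      simp only [iv_ibump, evalWord_append, evalWord_yword, ← rt_iv]
      cases b
      · exact (cP_inv_pos (yy x) h0 _ _).symm
      · exact (cP_pos (yy x) h0 _ _).symm
    · rw [if_neg h]
      have h0 := mt (cact_iff c).2 h
      cases b
      · exact (cP_inv_neg (yy x) h0 _).symm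
      · exact (cP_neg (yy x) h0 _).symm

def tst (n : ℕ) : List Code :=
  (List.range ((n + 1) ^ 2 + n + 1)).flatMap fun a =>
    (List.range ((n + 1) ^ 2 + n + 1)).flatMap fun b =>
      (List.range (n + 2)).flatMap fun c =>
        (List.range (n + 2)).map fun d => ((a, b), (c, d), [], (0, 0))

theorem tst_primrec : Primrec tst := by
  have hr : Primrec (fun n : ℕ => List.range ((n + 1) ^ 2 + n + 1)) := by
    refine Primrec.list_range.comp (Primrec.succ.comp (Primrec.nat_add.comp ?_ Primrec.id))
    refine (Primrec.nat_mul.comp Primrec.succ Primrec.succ).of_eq fun n => ?_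
    simp [sq]
  have hr2 : Primrec (fun n : ℕ => List.range (n + 2)) :=
    Primrec.list_range.comp (Primrec.succ.comp Primrec.succ)
  unfold tst
  refine Primrec.list_flatMap hr ?_
  refine Primrec.list_flatMap (hr.comp Primrec.fst) ?_
  refine Primrec.list_flatMap (hr2.comp (Primrec.fst.comp Primrec.fst)) ?_
  refine Primrec.list_map (hr2.comp (Primrec.fst.comp (Primrec.fst.comp Primrec.fst))) ?_
  refine Primrec.pair ?_ (Primrec.pair ?_ (Primrec.const _))
  · exact Primrec.pair (Primrec.snd.comp (Primrec.fst.comp (Primrec.fst.comp Primrec.fst)))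
      (Primrec.snd.comp (Primrec.fst.comp Primrec.fst))
  · exact Primrec.pair (Primrec.snd.comp Primrec.fst) Primrec.snd

/-- Step 1: countable groups with computable left orders embed, in a Frattini way, into
finitely generated ones. -/
theorem step1 (x : ℕ → G) (hx : Subgroup.closure (Set.range x) = ⊤)
    (hord : ComputableLeftOrderWrt x) :
    ∃ (H : Type) (_ : Group H) (m : ℕ) (π : FreeGroup (Fin m) →* H) (φ : G →* H),
      Function.Surjective π ∧ ComputableLeftOrderVia π ∧ IsFrattini φ := by
  obtain ⟨l, hl, hc⟩ := hord
  letI := l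
  have hlt : ∀ a b c : G, b < c → a * b < a * c := by
    intro a b c h
    refine lt_of_le_of_ne (hl _ _ _ h.le) ?_
    intro h1
    exact h.ne (mul_left_cancel h1)
  have hy1 : yy x 1 = 1 := by simp [yy]
  have hgen : Subgroup.closure (Set.range fun j => yy x (j + 2)) = ⊤ := by
    have : (fun j => yy x (j + 2)) = x := by funext j; simp [yy]
    rw [this, hx]
  obtain ⟨π, h1, h2⟩ := pipeline_tests key key_inj (gen (yy x)) (gen_mono hlt (yy x)) (dec x)
    (by
      rintro ⟨n, k, g, i⟩
      obtain ⟨n, rfl⟩ := iv_surj n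
      obtain ⟨k, rfl⟩ := iv_surj k
      obtain ⟨i, rfl⟩ := iv_surj i
      have : ∀ g, ∃ w, evalWord x w = g := by
        intro g
        have hg : g ∈ Subgroup.closure (Set.range x) := by rw [hx]; trivial
        induction hg using Subgroup.closure_induction with
        | mem g hg => obtain ⟨j, rfl⟩ := hg; exact ⟨[(j, true)], by simp [evalWord]⟩
        | one => exact ⟨[], by simp [evalWord]⟩
        | mul a b _ _ ha hb =>
          obtain ⟨u, rfl⟩ := ha
          obtain ⟨v, rfl⟩ := hb
          exact ⟨u ++ v, evalWord_append _ _ _⟩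
        | inv a _ ha =>
          obtain ⟨u, rfl⟩ := ha
          exact ⟨winv u, evalWord_winv _ _⟩
      obtain ⟨w, rfl⟩ := this g
      exact ⟨(n, k, w, i), rfl⟩)
    (fun _ => true) (Computable.const true) (by intro c; simp [dec])
    eact eact_comp (eact_spec x)
    (fun c d => lexSgn (icmp c.1 d.1) (lexSgn (icmp c.2.1 d.2.1)
      (lexSgn (orderSign l (evalWord x (winv d.2.2.1 ++ c.2.2.1))) (icmp c.2.2.2 d.2.2.2))))
    (by
      have hw : Computable (fun p : Code × Code =>
          orderSign l (evalWord x (winv p.2.2.2.1 ++ p.1.2.2.1))) := by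
        refine hc.comp (Primrec.to_comp ?_)
        exact Primrec.list_append.comp
          (winv_primrec.comp (Primrec.fst.comp (p22.comp Primrec.snd)))
          (Primrec.fst.comp (p22.comp Primrec.fst))
      have hl2 : Computable₂ lexSgn := lexSgn_primrec.to_comp
      refine hl2.comp (Primrec.to_comp (icmp_primrec.comp (Primrec.fst.comp Primrec.fst)
        (Primrec.fst.comp Primrec.snd))) ?_
      refine hl2.comp (Primrec.to_comp (icmp_primrec.comp (p21.comp Primrec.fst)
        (p21.comp Primrec.snd))) ?_
      exact hl2.comp hw (Primrec.to_comp (icmp_primrec.comp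
        (Primrec.snd.comp (p22.comp Primrec.fst)) (Primrec.snd.comp (p22.comp Primrec.snd)))))
    (by
      intro c d p q hp hq
      simp only [dec, Option.some.injEq] at hp hq
      subst hp hq
      simp only [key]
      have := orderSign_cmp l hl (evalWord x c.2.2.1) (evalWord x d.2.2.1)
      rw [sgnCmp_lex, sgnCmp_lex, sgnCmp_lex, icmp_spec, icmp_spec, icmp_spec, evalWord_append,
        evalWord_winv, this])
    tst tst_primrec
    (by
      intro w h
      apply tests_ok
      intro n k hn hk
      refine h ((n.toNat, (-n).toNat), (k.toNat, (-k).toNat), [], (0, 0)) ?_ _ ?_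
      · rw [abs_le] at hn hk
        simp only [tst, List.mem_flatMap, List.mem_map, List.mem_range]
        have hn1 := hn.1
        have hn2 := hn.2
        refine ⟨n.toNat, ?_, (-n).toNat, ?_, k.toNat, by omega, (-k).toNat, by omega, rfl⟩
        · zify
          rw [Int.toNat_eq_max]
          have : (0:ℤ) ≤ (w.length + 1) ^ 2 := by positivity
          omega
        · zify
          rw [Int.toNat_eq_max]
          have : (0:ℤ) ≤ (w.length + 1) ^ 2 := by positivity
          omega
      · simp only [dec, evalWord, List.map_nil, List.prod_nil, Option.some.injEq, Prod.mk.injEq]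
        refine ⟨?_, ?_, trivial, ?_⟩
        · unfold iv; dsimp only; omega
        · unfold iv; dsimp only; omega
        · unfold iv; simp)
  exact ⟨Grp (yy x), inferInstance, 3, π, phi (yy x) hy1 hgen, h1, h2, phi_frattini _ hy1 hgen⟩

end Step1
end FrattiniProof


/-! ## Part 6: the block permutations -/

set_option linter.all false

namespace FrattiniProof

namespace Step2

/-- a left ordered group with a distinguished positive element and a set of labels -/
class Lab (Γ : Type) [Group Γ] [LinearOrder Γ] where
  mul_lt : ∀ a b c : Γ, b < c → a * b < a * c
  lab : Γ → Bool
  β : Γ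
  β_pos : 1 < β
  lab_pos : ∀ a, lab a = true → 1 < a
  lab_β : ∀ a, lab (β * a) = true ↔ a = 1 ∨ lab a = true

/-- nontrivial letters -/
abbrev Ltr (Γ : Type) [One Γ] := {g : Γ // g ≠ 1}

inductive Sym (Γ : Type) [One Γ] : Type
  | bit : Bool → Sym Γ
  | ltr : Ltr Γ → Sym Γ

abbrev D (Γ : Type) [One Γ] := List (Sym Γ)

inductive Cel (Γ : Type) [One Γ] : Type
  | nd : Cel Γ
  | lt : Ltr Γ → D Γ → Cel Γ
  | ce : D Γ → Cel Γ

abbrev Blk (Γ : Type) [One Γ] := Fin 16 × Cel Γ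

abbrev Om (Γ : Type) [One Γ] := ℤ × Blk Γ

open Sym Cel

/-! ### permutations given by translating a family of copies -/

section tr
variable {Γ X E : Type} [Group Γ] (ins : Γ → E → X) (get : X → Option (Γ × E))
  (hget : ∀ x y, get x = some y ↔ ins y.1 y.2 = x)

def trF (a : Γ) (x : X) : X :=
  match get x with
  | some y => ins (a * y.1) y.2
  | none => x

include hget in
theorem get_ins (l : Γ) (d : E) : get (ins l d) = some (l, d) := (hget _ _).2 rfl

include hget in
theorem trF_ins (a l : Γ) (d : E) : trF ins get a (ins l d) = ins (a * l) d := by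
  unfold trF; rw [get_ins ins get hget]

theorem trF_none (a : Γ) (x : X) (h : get x = none) : trF ins get a x = x := by
  unfold trF; rw [h]

include hget in
theorem trF_mul (a b : Γ) (x : X) : trF ins get a (trF ins get b x) = trF ins get (a * b) x := by
  rcases h : get x with _ | ⟨l, d⟩
  · rw [trF_none _ _ _ _ h, trF_none _ _ _ _ h, trF_none _ _ _ _ h]
  · rw [hget] at h
    subst h
    rw [trF_ins _ _ hget, trF_ins _ _ hget, trF_ins _ _ hget, mul_assoc]

include hget in
theorem trF_one (x : X) : trF ins get 1 x = x := by
  rcases h : get x with _ | ⟨l, d⟩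
  · rw [trF_none _ _ _ _ h]
  · rw [hget] at h
    subst h
    rw [trF_ins _ _ hget, one_mul]

def tr : Γ →* Equiv.Perm X where
  toFun a :=
    { toFun := trF ins get a
      invFun := trF ins get a⁻¹
      left_inv := fun x => by rw [trF_mul _ _ hget]; simp [trF_one _ _ hget]
      right_inv := fun x => by rw [trF_mul _ _ hget]; simp [trF_one _ _ hget] }
  map_one' := by ext x : 1; exact trF_one _ _ hget x
  map_mul' a b := by ext x : 1; exact (trF_mul _ _ hget a b x).symm

theorem tr_ins (a l : Γ) (d : E) : tr ins get hget a (ins l d) = ins (a * l) d :=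
  trF_ins _ _ hget a l d

theorem tr_none (a : Γ) (x : X) (h : get x = none) : tr ins get hget a x = x :=
  trF_none _ _ a x h

theorem tr_mono [LinearOrder Γ] (hm : ∀ a b c : Γ, b < c → a * b < a * c)
    {K KE : Type} [LinearOrder K] [LinearOrder KE] (k : X → K) (kE : E → KE)
    (hE : Function.Injective kE)
    (h1 : ∀ l m d e, l < m → k (ins l d) < k (ins m e))
    (h2 : ∀ l d e, kE d < kE e → k (ins l d) < k (ins l e))
    (h3 : ∀ x l m d e, get x = none → k x < k (ins l d) → k x < k (ins m e))
    (h4 : ∀ x l m d e, get x = none → k (ins l d) < k x → k (ins m e) < k x)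
    (a : Γ) (x y : X) (h : k x < k y) :
    k (tr ins get hget a x) < k (tr ins get hget a y) := by
  rcases hx : get x with _ | ⟨l, d⟩ <;> rcases hy : get y with _ | ⟨m, e⟩
  · rw [tr_none _ _ _ _ _ hx, tr_none _ _ _ _ _ hy]; exact h
  · rw [hget] at hy; subst hy
    rw [tr_none _ _ _ _ _ hx, tr_ins]; exact h3 _ _ _ _ _ hx h
  · rw [hget] at hx; subst hx
    rw [tr_none _ _ _ _ _ hy, tr_ins]; exact h4 _ _ _ _ _ hy h
  · rw [hget] at hx hy; subst hx hy
    rw [tr_ins, tr_ins]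
    dsimp only at h ⊢
    rcases lt_trichotomy l m with hlm | hlm | hlm
    · exact h1 _ _ _ _ (hm _ _ _ hlm)
    · subst hlm
      rcases lt_trichotomy (kE d) (kE e) with hde | hde | hde
      · exact h2 _ _ _ hde
      · rw [hE hde] at h; exact absurd h (lt_irrefl _)
      · exact absurd h (h2 _ _ _ hde).not_gt
    · exact absurd h (h1 _ _ _ _ hlm).not_gt

end tr

variable {Γ : Type} [Group Γ] [LinearOrder Γ]

/-! ### the two families of copies -/

def insD (l : Γ) (d : D Γ) : D Γ :=
  if h : l = 1 then bit true :: bit false :: d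
  else if l < 1 then ltr ⟨l, h⟩ :: d else bit true :: ltr ⟨l, h⟩ :: d

def getD (x : D Γ) : Option (Γ × D Γ) :=
  match x with
  | ltr a :: d => if a.1 < 1 then some (a.1, d) else none
  | bit true :: bit false :: d => some (1, d)
  | bit true :: ltr a :: d => if 1 < a.1 then some (a.1, d) else none
  | _ => none

theorem ltr_pos (a : Ltr Γ) (h : ¬ a.1 < 1) : 1 < a.1 := lt_of_le_of_ne (not_lt.1 h) (Ne.symm a.2)

theorem insD_one (d : D Γ) : insD (1 : Γ) d = bit true :: bit false :: d := dif_pos rfl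
theorem insD_lt (a : Ltr Γ) (h : a.1 < 1) (d : D Γ) : insD a.1 d = ltr a :: d := by
  unfold insD; rw [dif_neg a.2, if_pos h]
theorem insD_gt (a : Ltr Γ) (h : 1 < a.1) (d : D Γ) : insD a.1 d = bit true :: ltr a :: d := by
  unfold insD; rw [dif_neg a.2, if_neg h.not_gt]

/-- case analysis on letters -/
theorem three (l : Γ) : l = 1 ∨ (∃ a : Ltr Γ, a.1 = l ∧ a.1 < 1) ∨ (∃ a : Ltr Γ, a.1 = l ∧ 1 < a.1) := by
  rcases lt_trichotomy l 1 with h | h | h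
  · exact Or.inr (Or.inl ⟨⟨l, h.ne⟩, rfl, h⟩)
  · exact Or.inl h
  · exact Or.inr (Or.inr ⟨⟨l, h.ne'⟩, rfl, h⟩)

theorem hgetD (x : D Γ) (y : Γ × D Γ) : getD x = some y ↔ insD y.1 y.2 = x := by
  obtain ⟨l, d⟩ := y
  constructor
  · intro h
    unfold getD at h
    split at h
    · split_ifs at h with h1
      simp only [Option.some.injEq, Prod.mk.injEq] at h
      obtain ⟨rfl, rfl⟩ := h
      exact insD_lt _ h1 _
    · simp only [Option.some.injEq, Prod.mk.injEq] at h
      obtain ⟨rfl, rfl⟩ := h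
      exact insD_one _
    · split_ifs at h with h1
      simp only [Option.some.injEq, Prod.mk.injEq] at h
      obtain ⟨rfl, rfl⟩ := h
      exact insD_gt _ h1 _
    · simp at h
  · rintro rfl
    rcases three l with rfl | ⟨a, rfl, ha⟩ | ⟨a, rfl, ha⟩
    · rw [insD_one]; rfl
    · rw [insD_lt a ha]; exact if_pos ha
    · rw [insD_gt a ha]; exact if_pos ha

def insB (l : Γ) (d : D Γ) : Blk Γ :=
  if h : l = 1 then (4, ce d)
  else if l < 1 then (4, lt ⟨l, h⟩ d) else (5, lt ⟨l, h⟩ d)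

def getB (x : Blk Γ) : Option (Γ × D Γ) :=
  match x.2 with
  | ce d => if x.1 = 4 then some (1, d) else none
  | lt a d => if x.1 = 4 ∧ a.1 < 1 ∨ x.1 = 5 ∧ 1 < a.1 then some (a.1, d) else none
  | nd => none

theorem insB_one (d : D Γ) : insB (1 : Γ) d = (4, ce d) := dif_pos rfl
theorem insB_lt (a : Ltr Γ) (h : a.1 < 1) (d : D Γ) : insB a.1 d = (4, lt a d) := by
  unfold insB; rw [dif_neg a.2, if_pos h]
theorem insB_gt (a : Ltr Γ) (h : 1 < a.1) (d : D Γ) : insB a.1 d = (5, lt a d) := by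
  unfold insB; rw [dif_neg a.2, if_neg h.not_gt]

theorem hgetB (x : Blk Γ) (y : Γ × D Γ) : getB x = some y ↔ insB y.1 y.2 = x := by
  obtain ⟨l, d⟩ := y
  obtain ⟨r, c⟩ := x
  constructor
  · intro h
    unfold getB at h
    cases c with
    | nd => simp at h
    | ce d' =>
      dsimp only at h
      split_ifs at h with h1
      simp only [Option.some.injEq, Prod.mk.injEq] at h
      obtain ⟨rfl, rfl⟩ := h
      rw [h1]; exact insB_one _
    | lt a d' =>
      dsimp only at h
      split_ifs at h with h1
      simp only [Option.some.injEq, Prod.mk.injEq] at h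
      obtain ⟨rfl, rfl⟩ := h
      rcases h1 with ⟨rfl, h1⟩ | ⟨rfl, h1⟩
      · exact insB_lt _ h1 _
      · exact insB_gt _ h1 _
  · intro h
    rw [← h]
    rcases three l with rfl | ⟨a, rfl, ha⟩ | ⟨a, rfl, ha⟩
    · rw [insB_one]; rfl
    · rw [insB_lt a ha]; exact if_pos (Or.inl ⟨rfl, ha⟩)
    · rw [insB_gt a ha]; exact if_pos (Or.inr ⟨rfl, ha⟩)

/-- translation of copies on the block -/
def LB : Γ →* Equiv.Perm (Blk Γ) := tr insB getB hgetB
/-- translation of copies on lists -/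
def MD : Γ →* Equiv.Perm (D Γ) := tr insD getD hgetD

/-! ### the labelled action -/

section cc
variable [Lab Γ]

def cF (f : D Γ → D Γ) : D Γ → D Γ
  | [] => []
  | bit b :: l => bit b :: cF f l
  | ltr a :: l => ltr a :: (if Lab.lab a.1 then f l else l)

theorem cF_comp (f g : D Γ → D Γ) (l : D Γ) : cF f (cF g l) = cF (f ∘ g) l := by
  induction l with
  | nil => rfl
  | cons s l ih =>
    cases s with
    | bit b => simp only [cF, ih]
    | ltr a =>
      simp only [cF]
      by_cases h : Lab.lab a.1 = true
      · simp [h]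
      · simp [h]

theorem cF_id (l : D Γ) : cF id l = l := by
  induction l with
  | nil => rfl
  | cons s l ih =>
    cases s with
    | bit b => simp only [cF, ih]
    | ltr a => simp [cF]

def ccF (f : D Γ → D Γ) (x : Blk Γ) : Blk Γ :=
  if x.1 = 5 then
    match x.2 with
    | nd => x
    | lt a d => (x.1, lt a (if Lab.lab a.1 then f d else d))
    | ce d => (x.1, ce (cF f d))
  else x

theorem ccF_comp (f g : D Γ → D Γ) (x : Blk Γ) : ccF f (ccF g x) = ccF (f ∘ g) x := by
  obtain ⟨r, c⟩ := x
  by_cases hr : r = 5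
  · subst hr
    cases c with
    | nd => rfl
    | lt a d =>
      simp only [ccF, if_true]
      by_cases h : Lab.lab a.1 = true
      · simp [h]
      · simp [h]
    | ce d => simp [ccF, cF_comp]
  · simp [ccF, hr]

theorem ccF_id (x : Blk Γ) : ccF id x = x := by
  obtain ⟨r, c⟩ := x
  by_cases hr : r = 5
  · subst hr
    cases c with
    | nd => rfl
    | lt a d => simp [ccF]
    | ce d => simp [ccF, cF_id]
  · simp [ccF, hr]

def cc : Equiv.Perm (D Γ) →* Equiv.Perm (Blk Γ) where
  toFun f :=
    { toFun := ccF f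
      invFun := ccF f.symm
      left_inv := fun x => by rw [ccF_comp, Equiv.symm_comp_self, ccF_id]
      right_inv := fun x => by rw [ccF_comp, Equiv.self_comp_symm, ccF_id] }
  map_one' := by ext x : 1; exact ccF_id x
  map_mul' a b := by ext x : 1; exact (ccF_comp a b x).symm

def CB : Γ →* Equiv.Perm (Blk Γ) := cc.comp MD
end cc

/-! ### piecewise linear part -/

def X0F (x : Blk Γ) : Blk Γ :=
  if x.1 = 0 then
    match x.2 with
    | nd => (0, nd)
    | lt a d => (0, lt a d)
    | ce [] => (1, nd)
    | ce (bit false :: d) => (0, ce d)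
    | ce (bit true :: d) => (1, ce d)
    | ce (ltr a :: d) => (1, lt a d)
  else if x.1 = 1 then (2, x.2)
  else if x.1 = 2 then
    match x.2 with
    | nd => (3, nd)
    | lt a d => (3, lt a d)
    | ce d => (3, ce (bit false :: d))
  else if x.1 = 3 then
    match x.2 with
    | nd => (3, ce [])
    | lt a d => (3, ce (ltr a :: d))
    | ce d => (3, ce (bit true :: d))
  else x

def X0I (x : Blk Γ) : Blk Γ :=
  if x.1 = 0 then
    match x.2 with
    | nd => (0, nd)
    | lt a d => (0, lt a d)
    | ce d => (0, ce (bit false :: d))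
  else if x.1 = 1 then
    match x.2 with
    | nd => (0, ce [])
    | lt a d => (0, ce (ltr a :: d))
    | ce d => (0, ce (bit true :: d))
  else if x.1 = 2 then (1, x.2)
  else if x.1 = 3 then
    match x.2 with
    | nd => (2, nd)
    | lt a d => (2, lt a d)
    | ce [] => (3, nd)
    | ce (bit false :: d) => (2, ce d)
    | ce (bit true :: d) => (3, ce d)
    | ce (ltr a :: d) => (3, lt a d)
  else x

def X0 : Equiv.Perm (Blk Γ) where
  toFun := X0F
  invFun := X0I
  left_inv := by
    rintro ⟨r, c⟩
    fin_cases r <;> rcases c with _ | _ | (_ | ⟨(_ | _) | _, _⟩) <;> rfl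
  right_inv := by
    rintro ⟨r, c⟩
    fin_cases r <;> rcases c with _ | _ | (_ | ⟨(_ | _) | _, _⟩) <;> rfl

def rot (k : Fin 16) : Equiv.Perm (Blk Γ) where
  toFun x := (x.1 + k, x.2)
  invFun x := (x.1 - k, x.2)
  left_inv x := by simp
  right_inv x := by simp

def XX (k : Fin 16) : Equiv.Perm (Blk Γ) := rot k * X0 * (rot k)⁻¹

theorem XX_apply (k : Fin 16) (x : Blk Γ) :
    XX k x = ((X0F (x.1 - k, x.2)).1 + k, (X0F (x.1 - k, x.2)).2) := rfl
theorem XX_inv_apply (k : Fin 16) (x : Blk Γ) :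
    (XX k)⁻¹ x = ((X0I (x.1 - k, x.2)).1 + k, (X0I (x.1 - k, x.2)).2) := rfl

/-! ### the line of blocks -/

def RR : Equiv.Perm (Om Γ) where
  toFun p := (if p.2.1 = 15 then p.1 + 1 else p.1, p.2.1 + 1, p.2.2)
  invFun p := (if p.2.1 = 0 then p.1 - 1 else p.1, p.2.1 - 1, p.2.2)
  left_inv := by
    rintro ⟨n, r, c⟩
    by_cases h : r = 15
    · subst h; simp; decide
    · have : r + 1 ≠ 0 := by revert h; revert r; decide
      simp [h, this]
  right_inv := by
    rintro ⟨n, r, c⟩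
    by_cases h : r = 0
    · subst h
      have : (0 : Fin 16) - 1 = 15 := by decide
      simp only [if_true, this]
      simp
    · have : r - 1 ≠ 15 := by revert h; revert r; decide
      simp [h, this]

open Classical in
noncomputable def perB (B : Set ℤ) : Equiv.Perm (Blk Γ) →* Equiv.Perm (Om Γ) where
  toFun f :=
    { toFun := fun p => if p.1 ∈ B then (p.1, f p.2) else p
      invFun := fun p => if p.1 ∈ B then (p.1, f.symm p.2) else p
      left_inv := fun p => by by_cases h : p.1 ∈ B <;> simp [h]
      right_inv := fun p => by by_cases h : p.1 ∈ B <;> simp [h] }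
  map_one' := by ext p : 1; simp
  map_mul' f g := by ext p : 1; by_cases h : p.1 ∈ B <;> simp [h]

theorem perB_pos {B : Set ℤ} (f : Equiv.Perm (Blk Γ)) {n : ℤ} (h : n ∈ B) (b : Blk Γ) :
    perB B f (n, b) = (n, f b) := if_pos h
theorem perB_neg {B : Set ℤ} (f : Equiv.Perm (Blk Γ)) {n : ℤ} (h : n ∉ B) (b : Blk Γ) :
    perB B f (n, b) = (n, b) := if_neg h
theorem perB_univ (f : Equiv.Perm (Blk Γ)) (n : ℤ) (b : Blk Γ) :
    perB Set.univ f (n, b) = (n, f b) := if_pos trivial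

end Step2
end FrattiniProof


/-! ## Part 7: monotonicity -/

set_option linter.all false

namespace FrattiniProof

namespace Step2

open Sym Cel

variable {Γ : Type} [Group Γ] [LinearOrder Γ]

abbrev K0 (Γ : Type) := ℤ ×ₗ Γ

def lk (a : Ltr Γ) : K0 Γ := if 1 < a.1 then toLex (-1, a.1) else toLex (1, a.1)

def sk : Sym Γ → K0 Γ
  | bit false => toLex (-2, 1)
  | bit true => toLex (2, 1)
  | ltr a => lk a

def e0 : K0 Γ := toLex (0, 1)

def dk : D Γ → List (K0 Γ)
  | [] => [e0]
  | s :: l => sk s :: dk l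

def ck : Cel Γ → List (K0 Γ)
  | nd => [e0]
  | lt a d => lk a :: dk d
  | ce d => toLex (3, 1) :: dk d

def bk (x : Blk Γ) : Fin 16 ×ₗ List (K0 Γ) := toLex (x.1, ck x.2)
def ok (p : Om Γ) : ℤ ×ₗ (Fin 16 ×ₗ List (K0 Γ)) := toLex (p.1, bk p.2)

theorem lk_pos (a : Ltr Γ) (h : 1 < a.1) : lk a = toLex (-1, a.1) := if_pos h
theorem lk_neg (a : Ltr Γ) (h : a.1 < 1) : lk a = toLex (1, a.1) := if_neg h.not_gt

theorem pn (a : Ltr Γ) : 1 < a.1 ∨ a.1 < 1 := (lt_or_gt_of_ne a.2).symm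

theorem lk_inj (a b : Ltr Γ) (h : lk a = lk b) : a = b := by
  rcases pn a with ha | ha <;> rcases pn b with hb | hb <;>
    simp only [lk_pos, lk_neg, ha, hb, toLex_inj, Prod.mk.injEq] at h
  · exact Subtype.ext h.2
  · omega
  · omega
  · exact Subtype.ext h.2

theorem lk_fst (a : Ltr Γ) : (ofLex (lk a)).1 = -1 ∧ 1 < a.1 ∨ (ofLex (lk a)).1 = 1 ∧ a.1 < 1 := by
  rcases pn a with ha | ha
  · left; rw [lk_pos a ha]; exact ⟨rfl, ha⟩
  · right; rw [lk_neg a ha]; exact ⟨rfl, ha⟩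

theorem sk_inj (a b : Sym Γ) (h : sk a = sk b) : a = b := by
  have h' := congrArg (fun t => (ofLex t).1) h
  rcases a with (_ | _) | a <;> rcases b with (_ | _) | b <;> simp only [sk] at h h' <;>
    try rfl
  all_goals try (have := lk_fst a)
  all_goals try (have := lk_fst b)
  all_goals try (simp only [ofLex_toLex] at h'; omega)
  rw [lk_inj a b h]

theorem sk_ne (a : Sym Γ) : sk a ≠ e0 := by
  intro h
  have h' := congrArg (fun t => (ofLex t).1) h
  rcases a with (_ | _) | a <;> simp only [sk, e0, ofLex_toLex] at h'
  · omega
  · omega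
  · have := lk_fst a; omega

theorem dk_inj : Function.Injective (dk (Γ := Γ)) := by
  intro l
  induction l with
  | nil =>
    intro l' h
    cases l' with
    | nil => rfl
    | cons s l' =>
      simp only [dk, List.cons.injEq] at h
      exact absurd h.1.symm (sk_ne s)
  | cons s l ih =>
    intro l' h
    cases l' with
    | nil =>
      simp only [dk, List.cons.injEq] at h
      exact absurd h.1 (sk_ne s)
    | cons s' l' =>
      simp only [dk, List.cons.injEq] at h
      rw [sk_inj _ _ h.1, ih h.2]

theorem ck_inj : Function.Injective (ck (Γ := Γ)) := by
  intro x y h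
  rcases x with _ | ⟨a, d⟩ | d <;> rcases y with _ | ⟨b, e⟩ | e <;>
    simp only [ck, List.cons.injEq] at h
  · rfl
  · exact absurd h.1.symm (sk_ne (ltr b))
  · have := congrArg (fun t => (ofLex t).1) h.1; simp [e0] at this
  · exact absurd h.1 (sk_ne (ltr a))
  · rw [lk_inj _ _ h.1, dk_inj h.2]
  · have := congrArg (fun t => (ofLex t).1) h.1
    have := lk_fst a
    simp at *; omega
  · have := congrArg (fun t => (ofLex t).1) h.1; simp [e0] at this
  · have := congrArg (fun t => (ofLex t).1) h.1
    have := lk_fst b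
    simp at *; omega
  · rw [dk_inj h.2]

theorem ok_inj : Function.Injective (ok (Γ := Γ)) := by
  rintro ⟨n, r, c⟩ ⟨n', r', c'⟩ h
  simp only [ok, bk, toLex_inj, Prod.mk.injEq] at h
  obtain ⟨rfl, rfl, h⟩ := h
  rw [ck_inj h]

theorem cons_lt {α : Type} [LinearOrder α] (a b : α) (l m : List α) :
    a :: l < b :: m ↔ a < b ∨ a = b ∧ l < m := List.cons_lt_cons_iff

theorem bk_lt (x y : Blk Γ) : bk x < bk y ↔ x.1 < y.1 ∨ x.1 = y.1 ∧ ck x.2 < ck y.2 :=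
  Prod.Lex.toLex_lt_toLex
theorem ok_lt (x y : Om Γ) : ok x < ok y ↔ x.1 < y.1 ∨ x.1 = y.1 ∧ bk x.2 < bk y.2 :=
  Prod.Lex.toLex_lt_toLex

/-- comparison of letters keys -/
theorem k0_lt (i j : ℤ) (a b : Γ) : (toLex (i, a) : K0 Γ) < toLex (j, b) ↔ i < j ∨ i = j ∧ a < b :=
  Prod.Lex.toLex_lt_toLex

variable [Lab Γ]

theorem MD_mono (a : Γ) (x y : D Γ) (h : dk x < dk y) : dk (MD a x) < dk (MD a y) := by
  refine tr_mono insD getD hgetD Lab.mul_lt dk dk dk_inj ?_ ?_ ?_ ?_ a x y h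
  · intro l m d e hlm
    rcases three l with rfl | ⟨a, rfl, ha⟩ | ⟨a, rfl, ha⟩ <;>
      rcases three m with rfl | ⟨b, rfl, hb⟩ | ⟨b, rfl, hb⟩ <;>
      simp only [insD_one, insD_lt, insD_gt, *, dk, sk, cons_lt, lk_pos, lk_neg, k0_lt] <;>
      first
      | (simp; done)
      | (simp [hlm]; done)
      | (exact absurd hlm (lt_irrefl _))
      | (exact absurd (hlm.trans hb) (lt_irrefl _))
      | (exact absurd (ha.trans hlm) (lt_irrefl _))
      | (exact absurd (ha.trans (hlm.trans hb)) (lt_irrefl _))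
  · intro l d e hde
    rcases three l with rfl | ⟨a, rfl, ha⟩ | ⟨a, rfl, ha⟩ <;>
      simp [insD_one, insD_lt, insD_gt, *, dk, sk, cons_lt, lk_pos, lk_neg, k0_lt]
  · intro x l m d e hx
    have key : x = [] ∨ (∃ t, x = bit false :: t) ∨ (∃ a t, 1 < a.1 ∧ x = ltr a :: t) ∨
        x = [bit true] ∨ (∃ t, x = bit true :: bit true :: t) ∨
        (∃ a t, a.1 < 1 ∧ x = bit true :: ltr a :: t) := by
      rcases x with _ | ⟨(_ | _) | a, (_ | ⟨(_ | _) | b, t⟩)⟩ <;> simp [getD] at hx ⊢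
      · exact lt_of_le_of_ne hx b.2
      · exact lt_of_le_of_ne hx (Ne.symm a.2)
      · exact lt_of_le_of_ne hx (Ne.symm a.2)
      · exact lt_of_le_of_ne hx (Ne.symm a.2)
      · exact lt_of_le_of_ne hx (Ne.symm a.2)
    clear hx
    rcases key with rfl | ⟨t, rfl⟩ | ⟨c, t, hc, rfl⟩ | rfl | ⟨t, rfl⟩ | ⟨c, t, hc, rfl⟩ <;>
    rcases three l with rfl | ⟨a, rfl, ha⟩ | ⟨a, rfl, ha⟩ <;>
      rcases three m with rfl | ⟨b, rfl, hb⟩ | ⟨b, rfl, hb⟩ <;>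
      simp [insD_one, insD_lt, insD_gt, *, dk, sk, cons_lt, lk_pos, lk_neg, k0_lt, e0]
  · intro x l m d e hx
    have key : x = [] ∨ (∃ t, x = bit false :: t) ∨ (∃ a t, 1 < a.1 ∧ x = ltr a :: t) ∨
        x = [bit true] ∨ (∃ t, x = bit true :: bit true :: t) ∨
        (∃ a t, a.1 < 1 ∧ x = bit true :: ltr a :: t) := by
      rcases x with _ | ⟨(_ | _) | a, (_ | ⟨(_ | _) | b, t⟩)⟩ <;> simp [getD] at hx ⊢
      · exact lt_of_le_of_ne hx b.2
      · exact lt_of_le_of_ne hx (Ne.symm a.2)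
      · exact lt_of_le_of_ne hx (Ne.symm a.2)
      · exact lt_of_le_of_ne hx (Ne.symm a.2)
      · exact lt_of_le_of_ne hx (Ne.symm a.2)
    clear hx
    rcases key with rfl | ⟨t, rfl⟩ | ⟨c, t, hc, rfl⟩ | rfl | ⟨t, rfl⟩ | ⟨c, t, hc, rfl⟩ <;>
    rcases three l with rfl | ⟨a, rfl, ha⟩ | ⟨a, rfl, ha⟩ <;>
      rcases three m with rfl | ⟨b, rfl, hb⟩ | ⟨b, rfl, hb⟩ <;>
      simp [insD_one, insD_lt, insD_gt, *, dk, sk, cons_lt, lk_pos, lk_neg, k0_lt, e0]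

theorem LB_mono (a : Γ) (x y : Blk Γ) (h : bk x < bk y) : bk (LB a x) < bk (LB a y) := by
  have key : ∀ x : Blk Γ, getB x = none → x.1 < 4 ∨ (x.1 = 4 ∧ x.2 = nd) ∨
      (∃ a t, x.1 = 4 ∧ x.2 = lt a t ∧ 1 < a.1) ∨ (x.1 = 5 ∧ x.2 = nd) ∨
      (∃ t, x.1 = 5 ∧ x.2 = ce t) ∨ (∃ a t, x.1 = 5 ∧ x.2 = lt a t ∧ a.1 < 1) ∨ 5 < x.1 := by
    rintro ⟨r, c⟩ hx
    dsimp only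
    by_cases h4 : r = 4
    · subst h4
      rcases c with _ | ⟨a, t⟩ | t <;> simp [getB] at hx ⊢
      · exact lt_of_le_of_ne hx (Ne.symm a.2)
    by_cases h5 : r = 5
    · subst h5
      rcases c with _ | ⟨a, t⟩ | t <;> simp [getB] at hx ⊢
      · exact lt_of_le_of_ne hx a.2
    have : r < 4 ∨ 5 < r := by clear hx; revert h4 h5; revert r; decide
    rcases this with h | h <;> simp [h]
  refine tr_mono insB getB hgetB Lab.mul_lt bk dk dk_inj ?_ ?_ ?_ ?_ a x y h
  · intro l m d e hlm
    rcases three l with rfl | ⟨a, rfl, ha⟩ | ⟨a, rfl, ha⟩ <;>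
      rcases three m with rfl | ⟨b, rfl, hb⟩ | ⟨b, rfl, hb⟩ <;>
      simp only [insB_one, insB_lt, insB_gt, *, bk_lt, ck, cons_lt, lk_pos, lk_neg, k0_lt] <;>
      first
      | (simp; done)
      | (simp [hlm]; done)
      | (exact absurd hlm (lt_irrefl _))
      | (exact absurd (hlm.trans hb) (lt_irrefl _))
      | (exact absurd (ha.trans hlm) (lt_irrefl _))
      | (exact absurd (ha.trans (hlm.trans hb)) (lt_irrefl _))
  · intro l d e hde
    rcases three l with rfl | ⟨a, rfl, ha⟩ | ⟨a, rfl, ha⟩ <;>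
      simp [insB_one, insB_lt, insB_gt, *, bk_lt, ck, cons_lt, lk_pos, lk_neg, k0_lt]
  · rintro ⟨r, c⟩ l m d e hx
    have h45 : (4 : Fin 16) < 5 := by decide
    rcases key _ hx with h | ⟨h, h'⟩ | ⟨c, t, h, h', hc⟩ | ⟨h, h'⟩ | ⟨t, h, h'⟩ | ⟨c, t, h, h', hc⟩ | h <;>
    (try dsimp only at h) <;> (try dsimp only at h') <;> (try subst h) <;> (try subst h')
    all_goals
      rcases three l with rfl | ⟨a, rfl, ha⟩ | ⟨a, rfl, ha⟩ <;>
      rcases three m with rfl | ⟨b, rfl, hb⟩ | ⟨b, rfl, hb⟩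
    all_goals first
      | (simp [insB_one, insB_lt, insB_gt, *, bk_lt, ck, cons_lt, lk_pos, lk_neg, k0_lt, e0]; done)
      | (have h5 := h.trans h45
         simp [insB_one, insB_lt, insB_gt, *, bk_lt, h.ne, h.ne', h.not_gt, h5, h5.ne, h5.ne', h5.not_gt]; done)
      | (have h4 := h45.trans h
         simp [insB_one, insB_lt, insB_gt, *, bk_lt, h.ne, h.ne', h.not_gt, h4, h4.ne, h4.ne', h4.not_gt]; done)
  · rintro ⟨r, c⟩ l m d e hx
    have h45 : (4 : Fin 16) < 5 := by decide
    rcases key _ hx with h | ⟨h, h'⟩ | ⟨c, t, h, h', hc⟩ | ⟨h, h'⟩ | ⟨t, h, h'⟩ | ⟨c, t, h, h', hc⟩ | h <;>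
    (try dsimp only at h) <;> (try dsimp only at h') <;> (try subst h) <;> (try subst h')
    all_goals
      rcases three l with rfl | ⟨a, rfl, ha⟩ | ⟨a, rfl, ha⟩ <;>
      rcases three m with rfl | ⟨b, rfl, hb⟩ | ⟨b, rfl, hb⟩
    all_goals first
      | (simp [insB_one, insB_lt, insB_gt, *, bk_lt, ck, cons_lt, lk_pos, lk_neg, k0_lt, e0]; done)
      | (have h5 := h.trans h45
         simp [insB_one, insB_lt, insB_gt, *, bk_lt, h.ne, h.ne', h.not_gt, h5, h5.ne, h5.ne', h5.not_gt]; done)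
      | (have h4 := h45.trans h
         simp [insB_one, insB_lt, insB_gt, *, bk_lt, h.ne, h.ne', h.not_gt, h4, h4.ne, h4.ne', h4.not_gt]; done)

def Mon (f : Equiv.Perm (Blk Γ)) : Prop := ∀ x y, bk x < bk y → bk (f x) < bk (f y)

omit [Lab Γ] in
theorem dk_lt_or (x y : D Γ) (h : dk x = dk y) : x = y := dk_inj h

theorem cF_mono (f : D Γ → D Γ) (hf : ∀ x y, dk x < dk y → dk (f x) < dk (f y)) :
    ∀ x y : D Γ, dk x < dk y → dk (cF f x) < dk (cF f y) := by
  intro x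
  induction x with
  | nil =>
    intro y h
    rcases y with _ | ⟨b | a, t⟩
    · exact h
    · simp only [dk, cons_lt, cF] at h ⊢
      rcases h with h | ⟨h, _⟩
      · exact Or.inl h
      · exact absurd h.symm (sk_ne _)
    · simp only [dk, cons_lt, cF] at h ⊢
      rcases h with h | ⟨h, _⟩
      · exact Or.inl h
      · exact absurd h.symm (sk_ne _)
  | cons s x ih =>
    intro y h
    rcases y with _ | ⟨s', t⟩
    · cases s <;>
      · simp only [dk, cons_lt, cF] at h ⊢
        rcases h with h | ⟨h, _⟩
        · exact Or.inl h
        · exact absurd h (sk_ne _)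
    · simp only [dk, cons_lt] at h
      rcases h with h | ⟨h, h1⟩
      · cases s <;> cases s' <;> · simp only [dk, cons_lt, cF]; exact Or.inl h
      · obtain rfl := sk_inj _ _ h
        cases s with
        | bit b =>
          show sk (bit b) :: dk (cF f x) < sk (bit b) :: dk (cF f t)
          rw [cons_lt]; exact Or.inr ⟨rfl, ih _ h1⟩
        | ltr a =>
          show sk (ltr a) :: dk (if Lab.lab a.1 then f x else x) < sk (ltr a) :: dk (if Lab.lab a.1 then f t else t)
          rw [cons_lt]
          refine Or.inr ⟨rfl, ?_⟩
          by_cases hl : Lab.lab a.1 = true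
          · simp only [hl, if_true]; exact hf _ _ h1
          · simp only [hl]; exact h1

theorem CB_mono (a : Γ) : Mon (CB a) := by
  have hf := MD_mono a
  rintro ⟨r, c⟩ ⟨r', c'⟩ h
  show bk (ccF (MD a) (r, c)) < bk (ccF (MD a) (r', c'))
  have h1 : ∀ (r : Fin 16) (c : Cel Γ), (ccF (MD a) (r, c)).1 = r := by
    intro r c
    unfold ccF
    split_ifs
    · cases c <;> rfl
    · rfl
  rw [bk_lt] at h ⊢
  rw [h1, h1]
  rcases h with h | ⟨h, h2⟩
  · exact Or.inl h
  refine Or.inr ⟨h, ?_⟩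
  dsimp only at h h2
  subst h
  unfold ccF
  split_ifs with h5
  · rcases c with _ | ⟨b, d⟩ | d <;> rcases c' with _ | ⟨b', d'⟩ | d' <;>
      dsimp only [ck] at h2 ⊢ <;> rw [cons_lt] at h2 ⊢ <;> rcases h2 with h2 | ⟨h2, h3⟩ <;>
      first
      | exact Or.inl h2
      | exact absurd h2 (sk_ne (ltr b))
      | exact absurd h2.symm (sk_ne (ltr b'))
      | exact Or.inr ⟨rfl, cF_mono _ hf _ _ h3⟩
      | (obtain rfl := lk_inj _ _ h2
         refine Or.inr ⟨rfl, ?_⟩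
         by_cases hl : Lab.lab b.1 = true
         · simp only [hl, if_true]; exact hf _ _ h3
         · simp only [hl]; exact h3)
      | exact absurd h3 (lt_irrefl _)
      | (exfalso; have := congrArg (fun t => (ofLex t).1) h2; have := lk_fst b; simp at *; omega)
      | (exfalso; have := congrArg (fun t => (ofLex t).1) h2; have := lk_fst b'; simp at *; omega)
      | exact absurd (congrArg (fun t => (ofLex t).1) h2) (by simp [e0])
  · exact h2

theorem lk_bd (a : Ltr Γ) : (toLex (-2, 1) : K0 Γ) < lk a ∧ lk a < toLex (2, 1) ∧ lk a < toLex (3, 1) ∧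
    ¬ lk a < toLex (-2, 1) ∧ ¬ (toLex (2, 1) : K0 Γ) < lk a ∧ ¬ (toLex (3, 1) : K0 Γ) < lk a ∧
    lk a ≠ e0 ∧ e0 ≠ lk a ∧ lk a ≠ toLex (-2, 1) ∧ lk a ≠ toLex (2, 1) ∧ lk a ≠ toLex (3, 1) ∧
    (toLex (-2, 1) : K0 Γ) ≠ lk a ∧ (toLex (2, 1) : K0 Γ) ≠ lk a ∧ (toLex (3, 1) : K0 Γ) ≠ lk a := by
  rcases pn a with ha | ha
  · rw [lk_pos a ha]; simp [k0_lt, e0]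
  · rw [lk_neg a ha]; simp [k0_lt, e0]

theorem X4_mono : Mon (XX 4 : Equiv.Perm (Blk Γ)) := by
  have hlo : ∀ (r : Fin 16) (c : Cel Γ), r < 4 ∨ 7 < r → XX 4 (r, c) = (r, c) := by
    intro r c h
    have : r - 4 ≠ 0 ∧ r - 4 ≠ 1 ∧ r - 4 ≠ 2 ∧ r - 4 ≠ 3 := by revert h; revert r; decide
    rw [XX_apply]
    simp [X0F, this]
  have hmi : ∀ (r : Fin 16) (c : Cel Γ), 4 ≤ r → r ≤ 7 → 4 ≤ (XX 4 (r, c)).1 ∧ (XX 4 (r, c)).1 ≤ 7 := by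
    intro r c h h'
    have : r = 4 ∨ r = 5 ∨ r = 6 ∨ r = 7 := by revert h h'; revert r; decide
    have h4 : (XX 4 (r, c)).1 = 4 ∨ (XX 4 (r, c)).1 = 5 ∨ (XX 4 (r, c)).1 = 6 ∨ (XX 4 (r, c)).1 = 7 := by
      rcases this with rfl | rfl | rfl | rfl <;> rcases c with _ | _ | (_ | ⟨(_ | _) | _, _⟩) <;>
        first
        | exact Or.inl rfl
        | exact Or.inr (Or.inl rfl)
        | exact Or.inr (Or.inr (Or.inl rfl))
        | exact Or.inr (Or.inr (Or.inr rfl))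
    have h5 : ∀ q : Fin 16, q = 4 ∨ q = 5 ∨ q = 6 ∨ q = 7 → 4 ≤ q ∧ q ≤ 7 := by decide
    exact h5 _ h4
  rintro ⟨r, c⟩ ⟨r', c'⟩ h
  have tri : ∀ r : Fin 16, r < 4 ∨ 7 < r ∨ (4 ≤ r ∧ r ≤ 7) := by decide
  rcases tri r with h1 | h1 | h1 <;> rcases tri r' with h2 | h2 | h2
  · rw [hlo _ _ (Or.inl h1), hlo _ _ (Or.inl h2)]; exact h
  · rw [hlo _ _ (Or.inl h1), hlo _ _ (Or.inr h2)]; exact h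
  · rw [hlo _ _ (Or.inl h1), bk_lt]; exact Or.inl (lt_of_lt_of_le h1 (hmi _ _ h2.1 h2.2).1)
  · rw [hlo _ _ (Or.inr h1), hlo _ _ (Or.inl h2)]; exact h
  · rw [hlo _ _ (Or.inr h1), hlo _ _ (Or.inr h2)]; exact h
  · exfalso
    rw [bk_lt] at h
    dsimp only at h
    have := lt_of_le_of_lt h2.2 h1
    rcases h with h | ⟨h, _⟩
    · exact absurd h this.not_gt
    · exact absurd h this.ne'
  · exfalso
    rw [bk_lt] at h
    dsimp only at h
    have := lt_of_lt_of_le h2 h1.1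
    rcases h with h | ⟨h, _⟩
    · exact absurd h this.not_gt
    · exact absurd h this.ne'
  · rw [hlo _ _ (Or.inr h2), bk_lt]; exact Or.inl (lt_of_le_of_lt (hmi _ _ h1.1 h1.2).2 h2)
  · have hh : ∀ r : Fin 16, 4 ≤ r → r ≤ 7 → r = 4 ∨ r = 5 ∨ r = 6 ∨ r = 7 := by decide
    have e1 : ∀ c : Cel Γ, XX 4 (5, c) = (6, c) := fun c => rfl
    have e21 : XX 4 ((6, nd) : Blk Γ) = (7, nd) := rfl
    have e22 : ∀ a d, XX 4 ((6, lt a d) : Blk Γ) = (7, lt a d) := fun a d => rfl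
    have e23 : ∀ d, XX 4 ((6, ce d) : Blk Γ) = (7, ce (bit false :: d)) := fun d => rfl
    have e31 : XX 4 ((7, nd) : Blk Γ) = (7, ce []) := rfl
    have e32 : ∀ a d, XX 4 ((7, lt a d) : Blk Γ) = (7, ce (ltr a :: d)) := fun a d => rfl
    have e33 : ∀ d, XX 4 ((7, ce d) : Blk Γ) = (7, ce (bit true :: d)) := fun d => rfl
    have e01 : XX 4 ((4, nd) : Blk Γ) = (4, nd) := rfl
    have e02 : ∀ a d, XX 4 ((4, lt a d) : Blk Γ) = (4, lt a d) := fun a d => rfl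
    have e03 : XX 4 ((4, ce []) : Blk Γ) = (5, nd) := rfl
    have e04 : ∀ d, XX 4 ((4, ce (bit false :: d)) : Blk Γ) = (4, ce d) := fun d => rfl
    have e05 : ∀ d, XX 4 ((4, ce (bit true :: d)) : Blk Γ) = (5, ce d) := fun d => rfl
    have e06 : ∀ a d, XX 4 ((4, ce (ltr a :: d)) : Blk Γ) = (5, lt a d) := fun a d => rfl
    have l67 : (6 : Fin 16) < 7 := by decide
    have l45 : (4 : Fin 16) < 5 := by decide
    have l46 : (4 : Fin 16) < 6 := by decide
    have l47 : (4 : Fin 16) < 7 := by decide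
    have l56 : (5 : Fin 16) < 6 := by decide
    have l57 : (5 : Fin 16) < 7 := by decide
    rw [bk_lt] at h ⊢
    rcases hh r h1.1 h1.2 with rfl | rfl | rfl | rfl <;> rcases hh r' h2.1 h2.2 with rfl | rfl | rfl | rfl <;>
      first
      | (exfalso; revert h; simp [l45.not_gt, l46.not_gt, l47.not_gt, l56.not_gt, l57.not_gt, l67.not_gt, l45.ne', l46.ne', l47.ne', l56.ne', l57.ne', l67.ne']; done)
      | (rw [e1, e1]; simpa using h)
      | (rw [e1]; rcases c with _ | ⟨b, d⟩ | (_ | ⟨(_ | _) | _, _⟩) <;> simp [e01, e02, e03, e04, e05, e06, l46, l56]; done)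
      | (rw [e1]; rcases c' with _ | ⟨b', d'⟩ | d' <;> simp [e21, e22, e23, e31, e32, e33, l67]; done)
      | (rcases c with _ | ⟨b, d⟩ | (_ | ⟨(_ | _) | _, _⟩) <;> rcases c' with _ | ⟨b', d'⟩ | d' <;>
          simp [e01, e02, e03, e04, e05, e06, e21, e22, e23, e31, e32, e33, l47, l57]; done)
      | (rcases c with _ | ⟨b, d⟩ | d <;> rcases c' with _ | ⟨b', d'⟩ | d' <;>
          simp [e21, e22, e23, e31, e32, e33, ck, dk, sk, cons_lt, lk_bd, k0_lt, e0, -Prod.mk.injEq] at h ⊢ <;> first | done | exact h)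
      | (rcases c with _ | ⟨b, d⟩ | (_ | ⟨(_ | _) | b, d⟩) <;> rcases c' with _ | ⟨b', d'⟩ | (_ | ⟨(_ | _) | b', d'⟩) <;>
          simp [e01, e02, e03, e04, e05, e06, ck, dk, sk, cons_lt, lk_bd, k0_lt, e0, l45, -Prod.mk.injEq] at h ⊢ <;> first | done | exact h | exact absurd (congrArg Prod.fst h.1) (by norm_num))

def MonO (f : Equiv.Perm (Om Γ)) : Prop := ∀ x y, ok x < ok y → ok (f x) < ok (f y)

theorem perB_mono (B : Set ℤ) (f : Equiv.Perm (Blk Γ)) (hf : Mon f) : MonO (perB B f) := by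
  have h1 : ∀ p : Om Γ, (perB B f p).1 = p.1 := by
    rintro ⟨n, b⟩
    by_cases h : n ∈ B
    · rw [perB_pos f h]
    · rw [perB_neg f h]
  rintro ⟨n, b⟩ ⟨n', b'⟩ h
  rw [ok_lt] at h ⊢
  rw [h1, h1]
  rcases h with h | ⟨h, h2⟩
  · exact Or.inl h
  refine Or.inr ⟨h, ?_⟩
  dsimp only at h h2
  subst h
  by_cases hn : n ∈ B
  · rw [perB_pos f hn, perB_pos f hn]; exact hf _ _ h2
  · rw [perB_neg f hn, perB_neg f hn]; exact h2

theorem RR_mono : MonO (RR : Equiv.Perm (Om Γ)) := by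
  rintro ⟨n, r, c⟩ ⟨n', r', c'⟩ h
  simp only [ok_lt, bk_lt] at h
  show ok (if r = 15 then n + 1 else n, r + 1, c) < ok (if r' = 15 then n' + 1 else n', r' + 1, c')
  simp only [ok_lt, bk_lt]
  by_cases h1 : r = 15
  · subst h1
    by_cases h2 : r' = 15
    · subst h2; simpa using h
    · have : ¬ 15 ≤ r' := by clear h; revert h2; revert r'; decide
      have h3 : (15 : Fin 16) + 1 < r' + 1 := by clear h; revert h2; revert r'; decide
      simp only [if_true, if_neg h2]
      rcases h with h | ⟨rfl, h | ⟨h, _⟩⟩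
      · rcases eq_or_lt_of_le (Int.add_one_le_iff.2 h) with h' | h'
        · exact Or.inr ⟨h', Or.inl h3⟩
        · exact Or.inl h'
      · exact absurd h.le this
      · exact absurd h.symm h2
  · by_cases h2 : r' = 15
    · subst h2
      simp only [if_true, if_neg h1]
      left
      rcases h with h | ⟨rfl, h | ⟨h, _⟩⟩ <;> omega
    · have h3 : r < r' → r + 1 < r' + 1 := by clear h; revert h1 h2; revert r r'; decide
      simp only [if_neg h1, if_neg h2]
      rcases h with h | ⟨rfl, h | ⟨h, h4⟩⟩
      · exact Or.inl h
      · exact Or.inr ⟨rfl, Or.inl (h3 h)⟩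
      · exact Or.inr ⟨rfl, Or.inr ⟨by rw [h], h4⟩⟩

theorem MonO_mul {f g : Equiv.Perm (Om Γ)} (hf : MonO f) (hg : MonO g) : MonO (f * g) :=
  fun x y h => hf _ _ (hg _ _ h)
theorem MonO_inv {f : Equiv.Perm (Om Γ)} (hf : MonO f) : MonO f⁻¹ := by
  intro x y h
  rcases lt_trichotomy (ok (f⁻¹ x)) (ok (f⁻¹ y)) with h1 | h1 | h1
  · exact h1
  · rw [f⁻¹.injective (ok_inj h1)] at h; exact absurd h (lt_irrefl _)
  · have := hf _ _ h1
    rw [show f (f⁻¹ x) = x from f.apply_symm_apply x, show f (f⁻¹ y) = y from f.apply_symm_apply y] at this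
    exact absurd h this.not_gt

end Step2
end FrattiniProof



/-! ## Part 8: the set of blocks and perfectness identities -/

set_option linter.all false

namespace FrattiniProof

namespace Step2

open Sym Cel
open scoped commutatorElement

/-! ### the set of integers with even two-adic valuation -/

def AA : Set ℤ := {n | Even (padicValInt 2 n)}

theorem AA_zero : (0 : ℤ) ∈ AA := by simp [AA]

theorem AA_odd (j : ℕ) (m : ℤ) (hm : Odd m) : (2 ^ j * m ∈ AA) ↔ Even j := by
  have h0 : m ≠ 0 := by rintro rfl; simp at hm
  have h1 : padicValInt 2 (2 ^ j * m) = j := by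
    rw [padicValInt.mul (by positivity) h0]
    have : padicValInt 2 m = 0 := by
      apply padicValInt.eq_zero_of_not_dvd
      rw [← Int.not_even_iff_odd, even_iff_two_dvd] at hm
      exact_mod_cast hm
    rw [this]
    simp [padicValInt, Int.natAbs_pow]
  show Even (padicValInt 2 (2 ^ j * m)) ↔ _
  rw [h1]

theorem exists_odd (n : ℤ) (hn : n ≠ 0) : ∃ (j : ℕ) (m : ℤ), Odd m ∧ n = 2 ^ j * m := by
  obtain ⟨j, m, hm, h⟩ := Nat.exists_eq_two_pow_mul_odd (n := n.natAbs) (by simpa using hn)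
  rcases Int.natAbs_eq n with h' | h'
  · exact ⟨j, m, by exact_mod_cast hm, by rw [h', h]; push_cast; rfl⟩
  · exact ⟨j, -m, by rw [Int.odd_iff] ; have := Nat.odd_iff.1 hm; omega, by rw [h', h]; push_cast; ring⟩

/-- Toeplitz property -/
theorem AA_shift (J : ℕ) (n k : ℤ) (hn : n ≠ 0) (h : |n| < 2 ^ J) : n + 2 ^ J * k ∈ AA ↔ n ∈ AA := by
  obtain ⟨j, m, hm, rfl⟩ := exists_odd n hn
  have hj : j < J := by
    by_contra hc
    push Not at hc
    have h1 : (2 : ℤ) ^ J ≤ 2 ^ j := pow_le_pow_right₀ (by norm_num) hc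
    have h2 : 1 ≤ |m| := Int.one_le_abs (by rintro rfl; simp at hm)
    rw [abs_mul, abs_of_pos (by positivity)] at h
    nlinarith [pow_pos (show (0:ℤ) < 2 by norm_num) j]
  obtain ⟨i, rfl⟩ := Nat.exists_eq_add_of_lt hj
  rw [show (2 : ℤ) ^ j * m + 2 ^ (j + i + 1) * k = 2 ^ j * (m + 2 * (2 ^ i * k)) by ring]
  rw [AA_odd _ _ hm, AA_odd]
  exact hm.add_even (even_two_mul _)

theorem AA_shift' (e : ℕ) (he : Even e) (n : ℤ) (h : |n| < 2 ^ e) : n + 2 ^ e ∈ AA ↔ n ∈ AA := by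
  by_cases hn : n = 0
  · subst hn
    have := AA_odd e 1 (by decide)
    simp only [mul_one] at this
    simp [this, he, AA_zero]
  · have := AA_shift e n 1 hn h
    simpa using this

def PP (j : ℕ) : Set ℤ := {n | (2 : ℤ) ^ j ∣ n}

theorem PP_zero : PP 0 = Set.univ := by ext n; simp [PP]

theorem PP_succ (j : ℕ) (n : ℤ) : n ∈ PP (j + 1) ↔
    (n ∈ PP j ∧ (n ∈ AA ↔ Even (j + 1))) ∨ (n - 2 ^ (j + 1) ∈ PP j ∧ (n - 2 ^ (j + 1) ∈ AA ↔ Even (j + 1))) := by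
  have key : ∀ n : ℤ, n ∈ PP j → (n ∈ AA ↔ Even (j + 1)) → n ∈ PP (j + 1) := by
    rintro _ ⟨m, rfl⟩ h
    rcases Int.even_or_odd m with h1 | h1
    · obtain ⟨t, rfl⟩ := h1
      exact ⟨t, by ring⟩
    · rw [AA_odd _ _ h1, Nat.even_add_one] at h
      tauto
  constructor
  · rintro ⟨m, rfl⟩
    rcases Int.even_or_odd m with h1 | h1
    · right
      rw [show (2 : ℤ) ^ (j + 1) * m - 2 ^ (j + 1) = 2 ^ (j + 1) * (m - 1) by ring]
      exact ⟨⟨2 * (m - 1), by ring⟩, AA_odd _ _ (by rw [Int.even_iff] at h1; rw [Int.odd_iff]; omega)⟩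
    · left
      exact ⟨⟨2 * m, by ring⟩, AA_odd _ _ h1⟩
  · rintro (⟨h1, h2⟩ | ⟨h1, h2⟩)
    · exact key n h1 h2
    · have h3 : (2 : ℤ) ^ (j + 1) ∣ n - 2 ^ (j + 1) := key _ h1 h2
      show (2 : ℤ) ^ (j + 1) ∣ n
      simpa using dvd_add h3 (dvd_refl _)

theorem PP_split (j : ℕ) (n : ℤ) : n ∈ PP j ↔ n ∈ PP (j + 1) ∨ n - 2 ^ j ∈ PP (j + 1) := by
  constructor
  · rintro ⟨m, rfl⟩
    rcases Int.even_or_odd m with ⟨t, rfl⟩ | ⟨t, rfl⟩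
    · exact Or.inl ⟨t, by ring⟩
    · exact Or.inr ⟨t, by ring⟩
  · rintro (⟨t, rfl⟩ | ⟨t, h⟩)
    · exact ⟨2 * t, by ring⟩
    · exact ⟨2 * t + 1, by linear_combination h⟩

theorem PP_disj (j : ℕ) (n : ℤ) : n ∈ PP (j + 1) → ¬ n - 2 ^ j ∈ PP (j + 1) := by
  rintro ⟨m, rfl⟩ ⟨t, h⟩
  have h2 : (2 : ℤ) ^ j ≠ 0 := by positivity
  have : (2 : ℤ) ^ j * (2 * m - 1) = 2 ^ j * (2 * t) := by linear_combination h
  have := mul_left_cancel₀ h2 this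
  omega

/-! ### identities -/

variable {Γ : Type} [Group Γ] [LinearOrder Γ]

theorem fin16 : ∀ r : Fin 16, r = 0 ∨ r = 1 ∨ r = 2 ∨ r = 3 ∨ r = 4 ∨ r = 5 ∨ r = 6 ∨ r = 7 ∨ r = 8 ∨ r = 9 ∨
    r = 10 ∨ r = 11 ∨ r = 12 ∨ r = 13 ∨ r = 14 ∨ r = 15 := by decide

theorem XX_out (k r : Fin 16) (c : Cel Γ) (h : 3 < r - k) : XX k (r, c) = (r, c) := by
  have h1 : ∀ q : Fin 16, 3 < q → q ≠ 0 ∧ q ≠ 1 ∧ q ≠ 2 ∧ q ≠ 3 := by decide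
  rw [XX_apply]; simp [X0F, h1 _ h]
theorem XX_out' (k r : Fin 16) (c : Cel Γ) (h : 3 < r - k) : (XX k)⁻¹ (r, c) = (r, c) := by
  have h1 : ∀ q : Fin 16, 3 < q → q ≠ 0 ∧ q ≠ 1 ∧ q ≠ 2 ∧ q ≠ 3 := by decide
  rw [XX_inv_apply]; simp [X0I, h1 _ h]
section ev
variable (k r : Fin 16) (a : Ltr Γ) (d : D Γ) (c : Cel Γ)
theorem XX_0nd (h : r = k) : XX k (r, (nd : Cel Γ)) = (k, nd) := by rw [XX_apply]; simp [h, X0F]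
theorem XX_0lt (h : r = k) : XX k (r, lt a d) = (k, lt a d) := by rw [XX_apply]; simp [h, X0F]
theorem XX_0e (h : r = k) : XX k (r, (ce [] : Cel Γ)) = (k + 1, nd) := by
  rw [XX_apply]; simp [h, X0F, add_comm]
theorem XX_0f (h : r = k) : XX k (r, ce (bit false :: d)) = (k, ce d) := by
  rw [XX_apply]; simp [h, X0F, add_comm]
theorem XX_0t (h : r = k) : XX k (r, ce (bit true :: d)) = (k + 1, ce d) := by
  rw [XX_apply]; simp [h, X0F, add_comm]
theorem XX_0l (h : r = k) : XX k (r, ce (ltr a :: d)) = (k + 1, lt a d) := by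
  rw [XX_apply]; simp [h, X0F, add_comm]
theorem XX_1 (h : r = k + 1) : XX k (r, c) = (k + 2, c) := by
  rw [XX_apply]; simp [h, X0F, add_comm]
theorem XX_2nd (h : r = k + 2) : XX k (r, (nd : Cel Γ)) = (k + 3, nd) := by
  rw [XX_apply]; simp [h, X0F, add_comm]
theorem XX_2lt (h : r = k + 2) : XX k (r, lt a d) = (k + 3, lt a d) := by
  rw [XX_apply]; simp [h, X0F, add_comm]
theorem XX_2ce (h : r = k + 2) : XX k (r, ce d) = (k + 3, ce (bit false :: d)) := by
  rw [XX_apply]; simp [h, X0F, add_comm]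
theorem XX_3nd (h : r = k + 3) : XX k (r, (nd : Cel Γ)) = (k + 3, ce []) := by
  rw [XX_apply]; simp [h, X0F, add_comm]
theorem XX_3lt (h : r = k + 3) : XX k (r, lt a d) = (k + 3, ce (ltr a :: d)) := by
  rw [XX_apply]; simp [h, X0F, add_comm]
theorem XX_3ce (h : r = k + 3) : XX k (r, ce d) = (k + 3, ce (bit true :: d)) := by
  rw [XX_apply]; simp [h, X0F, add_comm]

theorem XI_0nd (h : r = k) : (XX k)⁻¹ (r, (nd : Cel Γ)) = (k, nd) := by
  rw [XX_inv_apply]; simp [h, X0I]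
theorem XI_0lt (h : r = k) : (XX k)⁻¹ (r, lt a d) = (k, lt a d) := by
  rw [XX_inv_apply]; simp [h, X0I]
theorem XI_0ce (h : r = k) : (XX k)⁻¹ (r, ce d) = (k, ce (bit false :: d)) := by
  rw [XX_inv_apply]; simp [h, X0I, add_comm]
theorem XI_1nd (h : r = k + 1) : (XX k)⁻¹ (r, (nd : Cel Γ)) = (k, ce []) := by
  rw [XX_inv_apply]; simp [h, X0I, add_comm]
theorem XI_1lt (h : r = k + 1) : (XX k)⁻¹ (r, lt a d) = (k, ce (ltr a :: d)) := by
  rw [XX_inv_apply]; simp [h, X0I, add_comm]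
theorem XI_1ce (h : r = k + 1) : (XX k)⁻¹ (r, ce d) = (k, ce (bit true :: d)) := by
  rw [XX_inv_apply]; simp [h, X0I, add_comm]
theorem XI_2 (h : r = k + 2) : (XX k)⁻¹ (r, c) = (k + 1, c) := by
  rw [XX_inv_apply]; simp [h, X0I, add_comm]
theorem XI_3nd (h : r = k + 3) : (XX k)⁻¹ (r, (nd : Cel Γ)) = (k + 2, nd) := by
  rw [XX_inv_apply]; simp [h, X0I, add_comm]
theorem XI_3lt (h : r = k + 3) : (XX k)⁻¹ (r, lt a d) = (k + 2, lt a d) := by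
  rw [XX_inv_apply]; simp [h, X0I, add_comm]
theorem XI_3e (h : r = k + 3) : (XX k)⁻¹ (r, (ce [] : Cel Γ)) = (k + 3, nd) := by
  rw [XX_inv_apply]; simp [h, X0I, add_comm]
theorem XI_3f (h : r = k + 3) : (XX k)⁻¹ (r, ce (bit false :: d)) = (k + 2, ce d) := by
  rw [XX_inv_apply]; simp [h, X0I, add_comm]
theorem XI_3t (h : r = k + 3) : (XX k)⁻¹ (r, ce (bit true :: d)) = (k + 3, ce d) := by
  rw [XX_inv_apply]; simp [h, X0I, add_comm]
theorem XI_3l (h : r = k + 3) : (XX k)⁻¹ (r, ce (ltr a :: d)) = (k + 3, lt a d) := by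
  rw [XX_inv_apply]; simp [h, X0I, add_comm]
end ev

set_option maxHeartbeats 2000000 in
theorem id_X : ((XX 4 * XX 2) * XX 4 * (XX 4 * XX 2)⁻¹) * ((XX 6)⁻¹ * XX 4 * XX 6) =
    (XX 4 : Equiv.Perm (Blk Γ)) := by
  ext x : 1
  obtain ⟨r, c⟩ := x
  simp only [mul_inv_rev, Equiv.Perm.mul_apply]
  rcases fin16 r with rfl | rfl | rfl | rfl | rfl | rfl | rfl | rfl | rfl | rfl | rfl | rfl | rfl | rfl | rfl | rfl <;>
   rcases c with _ | _ | (_ | ⟨(_ | _) | _, (_ | ⟨(_ | _) | _, _⟩)⟩) <;> simp (disch := decide) only [XX_out, XX_out', XX_0nd, XX_0lt, XX_0e, XX_0f, XX_0t, XX_0l, XX_1, XX_2nd, XX_2lt, XX_2ce, XX_3nd, XX_3lt, XX_3ce, XI_0nd, XI_0lt, XI_0ce, XI_1nd, XI_1lt, XI_1ce, XI_2, XI_3nd, XI_3lt, XI_3e, XI_3f, XI_3t, XI_3l, Fin.reduceAdd]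

def VV : Equiv.Perm (Blk Γ) := (XX 3)⁻¹ * (XX 2 * XX 2)

theorem VV_4ce (d : D Γ) : VV (4, ce d) = (4, ce (bit true :: bit false :: d)) := rfl
theorem VV_4lt (a : Ltr Γ) (d : D Γ) : VV (4, lt a d) = (4, ce (ltr a :: d)) := rfl
theorem VV_5lt (a : Ltr Γ) (d : D Γ) : VV (5, lt a d) = (4, ce (bit true :: ltr a :: d)) := rfl

theorem perB_fst (B : Set ℤ) (f : Equiv.Perm (Blk Γ)) (p : Om Γ) : (perB B f p).1 = p.1 := by
  obtain ⟨n, b⟩ := p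
  by_cases h : n ∈ B
  · rw [perB_pos f h]
  · rw [perB_neg f h]

theorem perB_univ' (f : Equiv.Perm (Blk Γ)) (p : Om Γ) : perB Set.univ f p = (p.1, f p.2) :=
  perB_univ _ _ _

def GG (k : Fin 16) : Equiv.Perm (Blk Γ) := (XX (k + 2))⁻¹ * XX k * XX (k + 2)

theorem RR_lt (n : ℤ) (r : Fin 16) (c : Cel Γ) (h : r ≠ 15) : RR (n, r, c) = (n, r + 1, c) := by
  show (if r = 15 then n + 1 else n, r + 1, c) = _
  rw [if_neg h]
theorem RR_15 (n : ℤ) (c : Cel Γ) : RR (n, 15, c) = (n + 1, 0, c) := rfl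
theorem RI_gt (n : ℤ) (r : Fin 16) (c : Cel Γ) (h : r ≠ 0) : RR⁻¹ (n, r, c) = (n, r - 1, c) := by
  show (if r = 0 then n - 1 else n, r - 1, c) = _
  rw [if_neg h]
theorem RI_0 (n : ℤ) (c : Cel Γ) : RR⁻¹ (n, 0, c) = (n - 1, 15, c) := rfl

set_option maxHeartbeats 4000000 in
theorem RR_id : (perB Set.univ (XX 0 * XX 4 * XX 8 * XX 12)) * (perB Set.univ (GG 2 * GG 6 * GG 10)) *
    (RR ^ 4 * perB Set.univ (GG 10) * (RR ^ 4)⁻¹) = (RR : Equiv.Perm (Om Γ)) := by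
  ext p : 1
  obtain ⟨n, r, c⟩ := p
  simp only [Equiv.Perm.mul_apply, pow_succ, pow_zero, one_mul, mul_inv_rev, GG, Fin.reduceAdd]
  rcases fin16 r with rfl | rfl | rfl | rfl | rfl | rfl | rfl | rfl | rfl | rfl | rfl | rfl | rfl | rfl | rfl | rfl <;>
   rcases c with _ | _ | (_ | ⟨(_ | _) | _, (_ | ⟨(_ | _) | _, _⟩)⟩) <;> simp (disch := decide) only [Equiv.Perm.mul_apply, XX_out, XX_out', XX_0nd, XX_0lt, XX_0e, XX_0f, XX_0t, XX_0l, XX_1, XX_2nd, XX_2lt, XX_2ce, XX_3nd, XX_3lt, XX_3ce, XI_0nd, XI_0lt, XI_0ce, XI_1nd, XI_1lt, XI_1ce, XI_2, XI_3nd, XI_3lt, XI_3e, XI_3f, XI_3t, XI_3l, Fin.reduceAdd, Fin.reduceSub, perB_univ, RR_15, RI_0, RR_lt, RI_gt, sub_add_cancel]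

section lab
variable [Lab Γ]

theorem LB_ins (a l : Γ) (d : D Γ) : LB a (insB l d) = insB (a * l) d := tr_ins insB getB hgetB a l d
theorem LB_none (a : Γ) (x : Blk Γ) (h : getB x = none) : LB a x = x := tr_none insB getB hgetB a x h
theorem MD_ins (a l : Γ) (d : D Γ) : MD a (insD l d) = insD (a * l) d := tr_ins insD getD hgetD a l d
theorem MD_none (a : Γ) (x : D Γ) (h : getD x = none) : MD a x = x := tr_none insD getD hgetD a x h

theorem VV_ins (l : Γ) (d : D Γ) : VV (insB l d) = (4, ce (insD l d)) := by
  rcases three l with rfl | ⟨a, rfl, ha⟩ | ⟨a, rfl, ha⟩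
  · rw [insB_one, insD_one]; rfl
  · rw [insB_lt a ha, insD_lt a ha]; rfl
  · rw [insB_gt a ha, insD_gt a ha]; rfl

theorem CB_out (a : Γ) (r : Fin 16) (c : Cel Γ) (h : r ≠ 5) : CB a (r, c) = (r, c) := if_neg h
theorem CB_nd (a : Γ) : CB a ((5, nd) : Blk Γ) = (5, nd) := rfl
theorem CB_lt (a : Γ) (b : Ltr Γ) (d : D Γ) :
  CB a ((5, lt b d) : Blk Γ) = (5, lt b (if Lab.lab b.1 then MD a d else d)) := rfl
theorem CB_ce (a : Γ) (d : D Γ) : CB a ((5, ce d) : Blk Γ) = (5, ce (cF (MD a) d)) := rfl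

theorem CB_ins (a l : Γ) (d : D Γ) : CB a (insB l d) = insB l (if Lab.lab l then MD a d else d) := by
  have h0 : ∀ l : Γ, ¬ 1 < l → Lab.lab l = false := by
    intro l hl
    by_contra h
    exact hl (Lab.lab_pos l (by simpa using h))
  rcases three l with rfl | ⟨b, rfl, hb⟩ | ⟨b, rfl, hb⟩
  · rw [h0 _ (lt_irrefl _)]; rw [insB_one, insB_one]; rfl
  · rw [h0 _ hb.not_gt]; rw [insB_lt b hb, insB_lt b hb]; rfl
  · rw [insB_gt b hb, insB_gt b hb]; rfl

theorem CB_get_none (a : Γ) (x : Blk Γ) (h : getB x = none) : getB (CB a x) = none := by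
  rcases h' : getB (CB a x) with _ | ⟨l, d⟩
  · rfl
  · rw [hgetB] at h'
    have := congrArg (CB a⁻¹) h'
    rw [CB_ins, ← Equiv.Perm.mul_apply, ← map_mul, inv_mul_cancel, map_one, Equiv.Perm.one_apply] at this
    rw [← this, get_ins _ _ hgetB] at h
    simp at h

theorem id_L (a : Γ) : VV⁻¹ * ⁅LB (Lab.β : Γ)⁻¹, CB a⁆ * VV = LB a := by
  have key : ∀ x, ⁅LB (Lab.β : Γ)⁻¹, CB a⁆ (VV x) = VV (LB a x) := by
    intro x
    have hb : Lab.lab (Lab.β : Γ) = true := by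
      have := (Lab.lab_β (1 : Γ)).2 (Or.inl rfl); rwa [mul_one] at this
    have h1 : Lab.lab (1 : Γ) = false := by
      by_contra h
      exact lt_irrefl _ (Lab.lab_pos (1 : Γ) (by simpa using h))
    have hc : ∀ y, ⁅LB (Lab.β : Γ)⁻¹, CB a⁆ y = LB (Lab.β : Γ)⁻¹ (CB a (LB Lab.β ((CB a⁻¹) y))) := by
      intro y
      rw [commutatorElement_def, map_inv, map_inv, inv_inv]; rfl
    have e4 : ∀ d, ⁅LB (Lab.β : Γ)⁻¹, CB a⁆ (4, ce d) = (4, ce (MD a d)) := by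
      intro d
      rw [hc, ← insB_one d, CB_ins, LB_ins, CB_ins, LB_ins, inv_mul_cancel_left, insB_one, mul_one, hb, h1]
      rfl
    have eo : ∀ y, (∀ d, y ≠ (4, ce d)) → ⁅LB (Lab.β : Γ)⁻¹, CB a⁆ y = y := by
      intro y hy
      have hinv : ∀ z : Blk Γ, CB a (CB a⁻¹ z) = z := by
        intro z; rw [← Equiv.Perm.mul_apply, ← map_mul, mul_inv_cancel, map_one, Equiv.Perm.one_apply]
      rcases h : getB y with _ | ⟨l, d⟩
      · rw [hc, LB_none _ _ (CB_get_none _ _ h), hinv, LB_none _ _ h]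
      · rw [hgetB] at h
        dsimp only at h
        subst h
        have hl : l ≠ 1 := by rintro rfl; exact hy d (insB_one d)
        rw [hc, CB_ins, LB_ins, CB_ins, LB_ins, inv_mul_cancel_left]
        have : Lab.lab (Lab.β * l) = Lab.lab l := by
          have h2 := Lab.lab_β l
          rw [Bool.eq_iff_iff, h2]; simp [hl]
        rw [this]
        by_cases hh : Lab.lab l = true
        · simp only [hh, if_true]; rw [← Equiv.Perm.mul_apply, ← map_mul, mul_inv_cancel, map_one, Equiv.Perm.one_apply]
        · simp [hh]
    rcases h : getB x with _ | ⟨l, d⟩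
    · rw [LB_none _ _ h]
      by_cases hy : ∃ d, VV x = (4, ce d)
      · obtain ⟨d, hd⟩ := hy
        rw [hd, e4]
        rw [MD_none]
        rcases h' : getD d with _ | ⟨l, t⟩
        · rfl
        · rw [hgetD] at h'
          dsimp only at h'
          subst h'
          rw [← VV_ins] at hd
          rw [VV.injective hd, get_ins _ _ hgetB] at h
          simp at h
      · exact eo _ (fun d hd => hy ⟨d, hd⟩)
    · rw [hgetB] at h
      dsimp only at h
      subst h
      rw [VV_ins, e4, MD_ins, LB_ins, VV_ins]
  ext x : 1
  rw [Equiv.Perm.mul_apply, Equiv.Perm.mul_apply, key, Equiv.Perm.inv_eq_iff_eq]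

theorem id_C (a : Γ) : ((XX 5)⁻¹ * CB a * XX 5) * (XX 2 * CB a * (XX 2)⁻¹) = CB a := by
  ext x : 1
  obtain ⟨r, c⟩ := x
  simp only [mul_inv_rev, Equiv.Perm.mul_apply]
  rcases fin16 r with rfl | rfl | rfl | rfl | rfl | rfl | rfl | rfl | rfl | rfl | rfl | rfl | rfl | rfl | rfl | rfl <;>
   rcases c with _ | _ | (_ | ⟨(_ | _) | _, _⟩) <;> simp (disch := decide) only [CB_out, CB_nd, CB_lt, CB_ce, cF, XX_out, XX_out', XX_0nd, XX_0lt, XX_0e, XX_0f, XX_0t, XX_0l, XX_1, XX_2nd, XX_2lt, XX_2ce, XX_3nd, XX_3lt, XX_3ce, XI_0nd, XI_0lt, XI_0ce, XI_1nd, XI_1lt, XI_1ce, XI_2, XI_3nd, XI_3lt, XI_3e, XI_3f, XI_3t, XI_3l, Fin.reduceAdd]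

def TT : Set (Equiv.Perm (Blk Γ)) := {f | f = XX 4 ∨ (∃ a, f = LB a) ∨ ∃ a, f = CB a}

def WW : Subgroup (Equiv.Perm (Blk Γ)) :=
  Subgroup.closure {f | f ∈ TT ∨ f = XX 2 ∨ f = XX 3 ∨ f = XX 5 ∨ f = XX 6}

theorem WW_T {f : Equiv.Perm (Blk Γ)} (h : f ∈ TT) : f ∈ WW := Subgroup.subset_closure (Or.inl h)
theorem WW_4 : (XX 4 : Equiv.Perm (Blk Γ)) ∈ WW := WW_T (Or.inl rfl)
theorem WW_L (a : Γ) : LB a ∈ WW (Γ := Γ) := WW_T (Or.inr (Or.inl ⟨a, rfl⟩))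
theorem WW_C (a : Γ) : CB a ∈ WW (Γ := Γ) := WW_T (Or.inr (Or.inr ⟨a, rfl⟩))
theorem WW_2 : (XX 2 : Equiv.Perm (Blk Γ)) ∈ WW := Subgroup.subset_closure (by simp)
theorem WW_3 : (XX 3 : Equiv.Perm (Blk Γ)) ∈ WW := Subgroup.subset_closure (by simp)
theorem WW_5 : (XX 5 : Equiv.Perm (Blk Γ)) ∈ WW := Subgroup.subset_closure (by simp)
theorem WW_6 : (XX 6 : Equiv.Perm (Blk Γ)) ∈ WW := Subgroup.subset_closure (by simp)

theorem comm_of_id {P : Type} [Group P] (W : Subgroup P) (x u v : P) (hx : x ∈ W) (hu : u ∈ W) (hv : v ∈ W)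
    (h : (u * x * u⁻¹) * (v * x * v⁻¹) = x) : x ∈ ⁅W, W⁆ := by
  have h1 : x = ⁅u, x⁆⁻¹ * ⁅v, x⁆⁻¹ := by
    rw [commutatorElement_def, commutatorElement_def]
    have h2 : v * x * v⁻¹ = (u * x * u⁻¹)⁻¹ * x := eq_inv_mul_of_mul_eq h
    rw [h2]; group
  rw [h1]
  exact mul_mem (inv_mem (Subgroup.commutator_mem_commutator hu hx)) (inv_mem (Subgroup.commutator_mem_commutator hv hx))

theorem TT_comm (f : Equiv.Perm (Blk Γ)) (hf : f ∈ TT) : f ∈ ⁅WW (Γ := Γ), WW (Γ := Γ)⁆ := by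
  rcases hf with rfl | ⟨a, rfl⟩ | ⟨a, rfl⟩
  · refine comm_of_id _ _ (XX 4 * XX 2) (XX 6)⁻¹ WW_4 (mul_mem WW_4 WW_2) (inv_mem WW_6) ?_
    rw [inv_inv]; exact id_X
  · rw [← id_L]
    have hV : VV ∈ WW (Γ := Γ) := mul_mem (inv_mem WW_3) (mul_mem WW_2 WW_2)
    rw [show VV⁻¹ * ⁅LB (Lab.β : Γ)⁻¹, CB a⁆ * VV = ⁅VV⁻¹ * LB (Lab.β : Γ)⁻¹ * VV, VV⁻¹ * CB a * VV⁆ by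
      simp only [commutatorElement_def]; group]
    exact Subgroup.commutator_mem_commutator (mul_mem (mul_mem (inv_mem hV) (WW_L _)) hV)
      (mul_mem (mul_mem (inv_mem hV) (WW_C _)) hV)
  · refine comm_of_id _ _ (XX 5)⁻¹ (XX 2) (WW_C a) (inv_mem WW_5) WW_2 ?_
    rw [inv_inv]; exact id_C a
end lab

end Step2
end FrattiniProof


/-! ## Part 9: the simple group -/

set_option linter.all false

namespace FrattiniProof

namespace Step2

open Sym Cel
open scoped commutatorElement

variable {Γ : Type} [Group Γ] [LinearOrder Γ] [Lab Γ]

abbrev Idx (r : ℕ) := Unit ⊕ (Bool ⊕ ((Bool × Fin r) ⊕ (Bool × Fin r)))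

def bs : Bool → Set ℤ
  | true => Set.univ
  | false => AA

noncomputable def gen {r : ℕ} (ℓ : Fin r → Γ) : Idx r → Equiv.Perm (Om Γ)
  | Sum.inl _ => RR
  | Sum.inr (Sum.inl b) => perB (bs b) (XX 4)
  | Sum.inr (Sum.inr (Sum.inl x)) => perB (bs x.1) (LB (ℓ x.2))
  | Sum.inr (Sum.inr (Sum.inr x)) => perB (bs x.1) (CB (ℓ x.2))

def HH {r : ℕ} (ℓ : Fin r → Γ) : Subgroup (Equiv.Perm (Om Γ)) := Subgroup.closure (Set.range (gen ℓ))

def Good (K : Subgroup (Equiv.Perm (Om Γ))) (B : Set ℤ) : Prop := ∀ f ∈ TT (Γ := Γ), perB B f ∈ K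

section mem
variable {r : ℕ} (ℓ : Fin r → Γ)

theorem HH_gen (i : Idx r) : gen ℓ i ∈ HH ℓ := Subgroup.subset_closure ⟨i, rfl⟩

theorem HH_RR : (RR : Equiv.Perm (Om Γ)) ∈ HH ℓ := HH_gen ℓ (Sum.inl ())

theorem HH_good (hℓ : Subgroup.closure (Set.range ℓ) = ⊤) (b : Bool) : Good (HH ℓ) (bs b) := by
  rintro f (rfl | ⟨a, rfl⟩ | ⟨a, rfl⟩)
  · exact HH_gen ℓ (Sum.inr (Sum.inl b))
  · have : (⊤ : Subgroup Γ) ≤ (HH ℓ).comap ((perB (bs b)).comp LB) := by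
      rw [← hℓ, Subgroup.closure_le]
      rintro _ ⟨i, rfl⟩
      exact HH_gen ℓ (Sum.inr (Sum.inr (Sum.inl (b, i))))
    exact this (Subgroup.mem_top a)
  · have : (⊤ : Subgroup Γ) ≤ (HH ℓ).comap ((perB (bs b)).comp CB) := by
      rw [← hℓ, Subgroup.closure_le]
      rintro _ ⟨i, rfl⟩
      exact HH_gen ℓ (Sum.inr (Sum.inr (Sum.inr (b, i))))
    exact this (Subgroup.mem_top a)
end mem

theorem RR_conj (B : Set ℤ) (f : Equiv.Perm (Blk Γ)) (hf : ∀ c, f (15, c) = (15, c)) :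
    RR * perB B f * RR⁻¹ = perB B (rot 1 * f * (rot 1)⁻¹) := by
  have hf' : ∀ r c, r ≠ 15 → (f (r, c)).1 ≠ 15 := by
    intro r c h h1
    have h2 : f (r, c) = f (15, (f (r, c)).2) := by rw [hf]; exact Prod.ext h1 rfl
    exact h (congrArg Prod.fst (f.injective h2))
  have hr : ∀ r (c : Cel Γ), (rot 1)⁻¹ ((r, c) : Blk Γ) = (r - 1, c) := fun r c => rfl
  have hr' : ∀ (x : Blk Γ), rot 1 x = (x.1 + 1, x.2) := fun x => rfl
  ext p : 1
  obtain ⟨n, r, c⟩ := p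
  simp only [Equiv.Perm.mul_apply]
  by_cases h0 : r = 0
  · subst h0
    have e15 : (0 : Fin 16) - 1 = 15 := by decide
    rw [RI_0]
    by_cases hB : n ∈ B
    · rw [perB_pos _ hB]
      simp only [Equiv.Perm.mul_apply, hr, e15, hf]
      by_cases hB' : n - 1 ∈ B
      · rw [perB_pos _ hB', hf, RR_15, sub_add_cancel]; rfl
      · rw [perB_neg _ hB', RR_15, sub_add_cancel]; rfl
    · rw [perB_neg _ hB]
      by_cases hB' : n - 1 ∈ B
      · rw [perB_pos _ hB', hf, RR_15, sub_add_cancel]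
      · rw [perB_neg _ hB', RR_15, sub_add_cancel]
  · have h1 : r - 1 ≠ 15 := by revert h0; revert r; decide
    rw [RI_gt _ _ _ h0]
    by_cases hB : n ∈ B
    · rw [perB_pos _ hB, perB_pos _ hB]
      simp only [Equiv.Perm.mul_apply, hr]
      rcases h2 : f (r - 1, c) with ⟨r', c'⟩
      have := hf' _ c h1
      rw [h2] at this
      rw [RR_lt _ _ _ this]; rfl
    · rw [perB_neg _ hB, perB_neg _ hB, RR_lt _ _ _ h1, sub_add_cancel]

theorem XX_succ (k : Fin 16) : (XX (k + 1) : Equiv.Perm (Blk Γ)) = rot 1 * XX k * (rot 1)⁻¹ := by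
  have : (rot (k + 1) : Equiv.Perm (Blk Γ)) = rot 1 * rot k := by
    ext x : 1
    show (x.1 + (k + 1), x.2) = (x.1 + k + 1, x.2)
    rw [add_assoc]
  unfold XX
  rw [this]; group

section K
variable (K : Subgroup (Equiv.Perm (Om Γ))) (h1 : ∀ x ∈ K, RR * x * RR⁻¹ ∈ K)
  (h2 : ∀ x ∈ K, RR⁻¹ * x * RR ∈ K)
include h1 h2

theorem XX_all (B : Set ℤ) (h : perB B (XX 4) ∈ K) (k : Fin 16) (hk : k ≤ 12) : perB B (XX k) ∈ K := by
  have step : ∀ k : Fin 16, 3 < 15 - k → RR * perB B (XX k) * RR⁻¹ = perB B (XX (k + 1) : Equiv.Perm (Blk Γ)) := by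
    intro k hk
    rw [XX_succ, RR_conj]
    intro c
    exact XX_out _ _ _ hk
  have up : ∀ k : Fin 16, 3 < 15 - k → perB B (XX k) ∈ K → perB B (XX (k + 1)) ∈ K := by
    intro k hk h
    rw [← step k hk]; exact h1 _ h
  have dn : ∀ k : Fin 16, 3 < 15 - k → perB B (XX (k + 1)) ∈ K → perB B (XX k) ∈ K := by
    intro k hk h
    rw [← step k hk] at h
    have := h2 _ h
    rwa [show RR⁻¹ * (RR * perB B (XX k) * RR⁻¹) * RR = perB B (XX k) by group] at this
  have p3 := dn 3 (by decide) h
  have p2 := dn 2 (by decide) p3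
  have p1 := dn 1 (by decide) p2
  have p0 := dn 0 (by decide) p1
  have p5 := up 4 (by decide) h
  have p6 := up 5 (by decide) p5
  have p7 := up 6 (by decide) p6
  have p8 := up 7 (by decide) p7
  have p9 := up 8 (by decide) p8
  have p10 := up 9 (by decide) p9
  have p11 := up 10 (by decide) p10
  have p12 := up 11 (by decide) p11
  rcases fin16 k with rfl | rfl | rfl | rfl | rfl | rfl | rfl | rfl | rfl | rfl | rfl | rfl | rfl | rfl | rfl | rfl <;>
    first | assumption | exact absurd hk (by decide)

theorem WW_of_good (B : Set ℤ) (h : Good K B) : ∀ f ∈ WW (Γ := Γ), perB B f ∈ K := by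
  have h4 : perB B (XX 4) ∈ K := h _ (Or.inl rfl)
  have : WW ≤ K.comap (perB B) := by
    unfold WW
    rw [Subgroup.closure_le]
    rintro f (hf | rfl | rfl | rfl | rfl)
    · exact h f hf
    · exact XX_all K h1 h2 B h4 2 (by decide)
    · exact XX_all K h1 h2 B h4 3 (by decide)
    · exact XX_all K h1 h2 B h4 5 (by decide)
    · exact XX_all K h1 h2 B h4 6 (by decide)
  exact fun f hf => this hf

theorem RR_mem_of_good (h : Good K Set.univ) : (RR : Equiv.Perm (Om Γ)) ∈ K := by
  have h4 := XX_all K h1 h2 Set.univ (h _ (Or.inl rfl))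
  have hG : ∀ k : Fin 16, k + 2 ≤ 12 → k ≤ 12 → perB Set.univ (GG k) ∈ K := by
    intro k hk hk'
    unfold GG
    rw [map_mul, map_mul, map_inv]
    exact mul_mem (mul_mem (inv_mem (h4 _ hk)) (h4 _ hk')) (h4 _ hk)
  have hc : ∀ x ∈ K, RR ^ 4 * x * (RR ^ 4)⁻¹ ∈ K := by
    intro x hx
    have := h1 _ (h1 _ (h1 _ (h1 _ hx)))
    rwa [show RR * (RR * (RR * (RR * x * RR⁻¹) * RR⁻¹) * RR⁻¹) * RR⁻¹ = RR ^ 4 * x * (RR ^ 4)⁻¹ by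
      simp only [pow_succ, pow_zero, one_mul, mul_inv_rev, mul_assoc]] at this
  rw [← RR_id]
  refine mul_mem (mul_mem ?_ ?_) (hc _ (hG 10 (by decide) (by decide)))
  · simp only [map_mul]
    exact mul_mem (mul_mem (mul_mem (h4 0 (by decide)) (h4 4 (by decide))) (h4 8 (by decide))) (h4 12 (by decide))
  · simp only [map_mul]
    exact mul_mem (mul_mem (hG 2 (by decide) (by decide)) (hG 6 (by decide) (by decide))) (hG 10 (by decide) (by decide))
end K

/-! ### shifts -/

def Zs (d : ℤ) : Equiv.Perm (Om Γ) where
  toFun p := (p.1 + d, p.2)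
  invFun p := (p.1 - d, p.2)
  left_inv p := by simp
  right_inv p := by simp

theorem Zs_apply (d : ℤ) (p : Om Γ) : Zs d p = (p.1 + d, p.2) := rfl
theorem Zs_inv_apply (d : ℤ) (p : Om Γ) : (Zs d)⁻¹ p = (p.1 - d, p.2) := rfl
theorem Zs_add (a b : ℤ) : (Zs (a + b) : Equiv.Perm (Om Γ)) = Zs a * Zs b := by
  ext p : 1
  simp only [Equiv.Perm.mul_apply, Zs_apply]
  congr 1; ring
theorem Zs_one : (Zs 1 : Equiv.Perm (Om Γ)) = RR ^ 16 := by
  ext p : 1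
  obtain ⟨n, r, c⟩ := p
  simp only [Equiv.Perm.mul_apply, pow_succ, pow_zero, one_mul, Zs_apply]
  rcases fin16 r with rfl | rfl | rfl | rfl | rfl | rfl | rfl | rfl | rfl | rfl | rfl | rfl | rfl | rfl | rfl | rfl <;>
    simp (disch := decide) only [RR_lt, RR_15, Fin.reduceAdd]
theorem Zs_zero : (Zs 0 : Equiv.Perm (Om Γ)) = 1 := by
  ext p : 1
  simp [Zs_apply]

theorem Zs_mem (K : Subgroup (Equiv.Perm (Om Γ))) (h : RR ∈ K) (d : ℤ) : Zs d ∈ K := by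
  have h1 : (Zs 1 : Equiv.Perm (Om Γ)) ∈ K := by rw [Zs_one]; exact pow_mem h 16
  have h2 : (Zs (-1) : Equiv.Perm (Om Γ)) ∈ K := by
    have : (Zs (-1) : Equiv.Perm (Om Γ)) = (Zs 1)⁻¹ := by
      rw [eq_inv_iff_mul_eq_one, ← Zs_add]; exact Zs_zero
    rw [this]; exact inv_mem h1
  induction d using Int.induction_on with
  | zero => rw [Zs_zero]; exact one_mem K
  | succ i ih => rw [Zs_add]; exact mul_mem ih h1
  | pred i ih => rw [sub_eq_add_neg, Zs_add]; exact mul_mem ih h2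

theorem Zs_conj (d : ℤ) (B : Set ℤ) (f : Equiv.Perm (Blk Γ)) :
    Zs d * perB B f * (Zs d)⁻¹ = perB {n | n - d ∈ B} f := by
  ext p : 1
  obtain ⟨n, b⟩ := p
  simp only [Equiv.Perm.mul_apply, Zs_inv_apply]
  by_cases h : n - d ∈ B
  · rw [perB_pos f h, perB_pos (B := {n | n - d ∈ B}) f h, Zs_apply, sub_add_cancel]
  · rw [perB_neg f h, perB_neg (B := {n | n - d ∈ B}) f h, Zs_apply, sub_add_cancel]

theorem perB_compl (B : Set ℤ) (f : Equiv.Perm (Blk Γ)) : perB Bᶜ f = perB Set.univ f * (perB B f)⁻¹ := by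
  rw [eq_mul_inv_iff_mul_eq]
  ext p : 1
  obtain ⟨n, b⟩ := p
  rw [Equiv.Perm.mul_apply, perB_univ]
  by_cases h : n ∈ B
  · rw [perB_pos f h, perB_neg f (by simpa using h)]
  · rw [perB_neg f h, perB_pos f (by simpa using h)]

theorem perB_union (B B' : Set ℤ) (hd : ∀ n ∈ B, n ∉ B') (f : Equiv.Perm (Blk Γ)) :
    perB (B ∪ B') f = perB B f * perB B' f := by
  ext p : 1
  obtain ⟨n, b⟩ := p
  rw [Equiv.Perm.mul_apply]
  by_cases h : n ∈ B
  · rw [perB_neg _ (hd n h), perB_pos _ h, perB_pos _ (Or.inl h)]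
  · by_cases h' : n ∈ B'
    · rw [perB_pos _ h', perB_neg _ h, perB_pos _ (Or.inr h')]
    · rw [perB_neg _ h', perB_neg _ h, perB_neg _ (by simp [h, h'])]

theorem perB_inter (B B' : Set ℤ) (f g : Equiv.Perm (Blk Γ)) :
    perB (B ∩ B') ⁅f, g⁆ = ⁅perB B f, perB B' g⁆ := by
  ext p : 1
  obtain ⟨n, b⟩ := p
  simp only [commutatorElement_def, ← map_inv]
  simp only [Equiv.Perm.mul_apply]
  by_cases h : n ∈ B <;> by_cases h' : n ∈ B'
  · rw [perB_pos (B := B ∩ B') _ ⟨h, h'⟩, perB_pos _ h', perB_pos _ h, perB_pos _ h', perB_pos _ h]; rfl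
  · rw [perB_neg _ (by simp [h'])]
    rw [perB_neg _ h', perB_pos _ h, perB_neg _ h', perB_pos _ h]; simp
  · rw [perB_neg _ (by simp [h])]
    rw [perB_pos _ h', perB_neg _ h, perB_pos _ h', perB_neg _ h]; simp
  · rw [perB_neg _ (by simp [h])]
    rw [perB_neg _ h', perB_neg _ h, perB_neg _ h', perB_neg _ h]

end Step2
end FrattiniProof


/-! ## Part 10: simplicity -/

set_option linter.all false

namespace FrattiniProof

namespace Step2

open Sym Cel
open scoped commutatorElement

variable {Γ : Type} [Group Γ] [LinearOrder Γ] [Lab Γ]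

/-! ### the sets of blocks on which the group acts independently -/

section good
variable (K : Subgroup (Equiv.Perm (Om Γ))) (hR : RR ∈ K)
include hR

theorem good_shift (B : Set ℤ) (h : Good K B) (d : ℤ) : Good K {n | n - d ∈ B} := by
  intro f hf
  rw [← Zs_conj]
  exact mul_mem (mul_mem (Zs_mem K hR d) (h f hf)) (inv_mem (Zs_mem K hR d))

theorem good_compl (hu : Good K Set.univ) (B : Set ℤ) (h : Good K B) : Good K Bᶜ := by
  intro f hf
  rw [perB_compl]
  exact mul_mem (hu f hf) (inv_mem (h f hf))

theorem good_inter (B B' : Set ℤ) (h : Good K B) (h' : Good K B') : Good K (B ∩ B') := by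
  have c1 : ∀ x ∈ K, RR * x * RR⁻¹ ∈ K := fun x hx => mul_mem (mul_mem hR hx) (inv_mem hR)
  have c2 : ∀ x ∈ K, RR⁻¹ * x * RR ∈ K := fun x hx => mul_mem (mul_mem (inv_mem hR) hx) hR
  have : ⁅WW (Γ := Γ), WW (Γ := Γ)⁆ ≤ K.comap (perB (B ∩ B')) := by
    rw [Subgroup.commutator_le]
    intro a ha b hb
    show perB (B ∩ B') ⁅a, b⁆ ∈ K
    rw [perB_inter, commutatorElement_def]
    have e1 := WW_of_good K c1 c2 B h a ha
    have e2 := WW_of_good K c1 c2 B' h' b hb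
    exact mul_mem (mul_mem (mul_mem e1 e2) (inv_mem e1)) (inv_mem e2)
  exact fun f hf => this (TT_comm f hf)

theorem good_union (hu : Good K Set.univ) (B B' : Set ℤ) (h : Good K B) (h' : Good K B') :
    Good K (B ∪ B') := by
  have := good_compl K hR hu _ (good_inter K hR _ _ (good_compl K hR hu _ h) (good_compl K hR hu _ h'))
  rwa [show (Bᶜ ∩ B'ᶜ)ᶜ = B ∪ B' by ext n; simp; tauto] at this

theorem good_PP (hu : Good K Set.univ) (hA : Good K AA) (j : ℕ) : Good K (PP j) := by
  induction j with
  | zero => rw [PP_zero]; exact hu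
  | succ j ih =>
    have h1 : Good K {n | n ∈ PP j ∧ (n ∈ AA ↔ Even (j + 1))} := by
      by_cases he : Even (j + 1)
      · have := good_inter K hR _ _ ih hA
        rwa [show PP j ∩ AA = {n | n ∈ PP j ∧ (n ∈ AA ↔ Even (j + 1))} by ext n; simp [he]] at this
      · have := good_inter K hR _ _ ih (good_compl K hR hu _ hA)
        rwa [show PP j ∩ AAᶜ = {n | n ∈ PP j ∧ (n ∈ AA ↔ Even (j + 1))} by ext n; simp [he]] at this
    have h2 := good_union K hR hu _ _ h1 (good_shift K hR _ h1 (2 ^ (j + 1)))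
    convert h2 using 1
    ext n
    exact PP_succ j n
end good

/-! ### moving points -/

def CC : Subgroup (Equiv.Perm (Om Γ)) :=
  Subgroup.closure {h | h = RR ∨ ∃ f ∈ TT (Γ := Γ), h = perB Set.univ f}

theorem CC_RR : (RR : Equiv.Perm (Om Γ)) ∈ CC := Subgroup.subset_closure (Or.inl rfl)
theorem CC_good : Good (CC (Γ := Γ)) Set.univ := fun f hf => Subgroup.subset_closure (Or.inr ⟨f, hf, rfl⟩)
theorem CC_le (K : Subgroup (Equiv.Perm (Om Γ))) (hR : RR ∈ K) (hu : Good K Set.univ) : CC ≤ K := by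
  unfold CC
  rw [Subgroup.closure_le]
  rintro h (rfl | ⟨f, hf, rfl⟩)
  · exact hR
  · exact hu f hf
theorem CC_XX (k : Fin 16) (hk : k ≤ 12) : perB Set.univ (XX k) ∈ CC (Γ := Γ) :=
  XX_all CC (fun x hx => mul_mem (mul_mem CC_RR hx) (inv_mem CC_RR))
    (fun x hx => mul_mem (mul_mem (inv_mem CC_RR) hx) CC_RR) _ (CC_good _ (Or.inl rfl)) k hk
theorem CC_LB (a : Γ) : perB Set.univ (LB a) ∈ CC (Γ := Γ) := CC_good _ (Or.inr (Or.inl ⟨a, rfl⟩))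

theorem CC_Zs (h : Equiv.Perm (Om Γ)) (hh : h ∈ CC) : ∀ (d : ℤ), h * Zs d = Zs d * h := by
  intro d
  have : CC ≤ Subgroup.centralizer {(Zs d : Equiv.Perm (Om Γ))} := by
    unfold CC
    rw [Subgroup.closure_le]
    rintro h (rfl | ⟨f, hf, rfl⟩)
    · rw [SetLike.mem_coe, Subgroup.mem_centralizer_singleton_iff]
      ext p : 1
      obtain ⟨n, r, c⟩ := p
      simp only [Equiv.Perm.mul_apply, Zs_apply]
      by_cases h : r = 15
      · subst h; rw [RR_15, RR_15]; dsimp only; congr 1; ring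
      · rw [RR_lt _ _ _ h, RR_lt _ _ _ h]
    · rw [SetLike.mem_coe, Subgroup.mem_centralizer_singleton_iff]
      ext p : 1
      obtain ⟨n, b⟩ := p
      simp only [Equiv.Perm.mul_apply, Zs_apply, perB_univ]
  exact (Subgroup.mem_centralizer_singleton_iff.1 (this hh))

def Reach (p q : Om Γ) : Prop := ∃ h ∈ CC (Γ := Γ), h p = q

theorem Reach.trans {p q s : Om Γ} (h1 : Reach p q) (h2 : Reach q s) : Reach p s := by
  obtain ⟨h, hh, rfl⟩ := h1
  obtain ⟨h', hh', rfl⟩ := h2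
  exact ⟨h' * h, mul_mem hh' hh, rfl⟩
theorem Reach.refl (p : Om Γ) : Reach p p := ⟨1, one_mem _, rfl⟩
theorem Reach.symm {p q : Om Γ} (h1 : Reach p q) : Reach q p := by
  obtain ⟨h, hh, rfl⟩ := h1
  exact ⟨h⁻¹, inv_mem hh, by simp⟩

theorem reach_rot (n n' : ℤ) (r r' : Fin 16) (c : Cel Γ) : Reach (n, r, c) (n', r', c) := by
  have h1 : ∀ (n : ℤ) (r : Fin 16), Reach (n, r, c) (0, r, c) := by
    intro n r
    refine ⟨Zs (-n), Zs_mem _ CC_RR _, ?_⟩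
    simp [Zs_apply]
  have h2 : ∀ (r : Fin 16), Reach (0, r, c) (0, 0, c) := by
    have : ∀ k : ℕ, ∀ h : k < 16, Reach ((0, ⟨k, h⟩, c) : Om Γ) (0, 0, c) := by
      intro k
      induction k with
      | zero => intro h; exact Reach.refl _
      | succ k ih =>
        intro h
        refine Reach.trans ?_ (ih (by omega))
        refine Reach.symm ⟨RR, CC_RR, ?_⟩
        rw [RR_lt]
        · congr 1
          congr 1
          apply Fin.ext
          simp [Fin.val_add]; omega
        · intro h'
          have := congrArg Fin.val h'
          simp at this; omega
    rintro ⟨k, h⟩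
    exact this k h
  exact ((h1 n r).trans (h2 r)).trans ((h1 n' r').trans (h2 r')).symm

theorem reach_lt (n : ℤ) (r : Fin 16) (a : Ltr Γ) (d : D Γ) : Reach (n, r, lt a d) (0, 0, ce d) := by
  have key : Reach (0, insB a.1 d) ((0, 4, ce d) : Om Γ) := by
    refine ⟨_, CC_LB a.1⁻¹, ?_⟩
    rw [perB_univ, LB_ins, inv_mul_cancel, insB_one]
  rcases pn a with ha | ha
  · rw [insB_gt a ha] at key
    exact ((reach_rot _ _ _ _ _).trans key).trans (reach_rot _ _ _ _ _)
  · rw [insB_lt a ha] at key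
    exact ((reach_rot _ _ _ _ _).trans key).trans (reach_rot _ _ _ _ _)

theorem reach_ce (d : D Γ) : Reach (0, 0, ce d) ((0, 0, nd) : Om Γ) := by
  have hx : ∀ b : Blk Γ, Reach (0, b) (0, XX 0 b) := fun b => ⟨_, CC_XX 0 (by decide), perB_univ _ _ _⟩
  induction d with
  | nil => exact (hx _).trans (reach_rot _ _ _ _ _)
  | cons s d ih =>
    rcases s with (_ | _) | a
    · exact (hx _).trans ih
    · exact ((hx _).trans (reach_rot _ 0 _ 0 _)).trans ih
    · exact ((hx _).trans (reach_lt _ _ _ _)).trans ih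

theorem reach_o (p : Om Γ) : Reach p ((0, 0, nd) : Om Γ) := by
  obtain ⟨n, r, c⟩ := p
  rcases c with _ | ⟨a, d⟩ | d
  · exact reach_rot _ _ _ _ _
  · exact (reach_lt _ _ _ _).trans (reach_ce _)
  · exact (reach_rot _ 0 _ 0 _).trans (reach_ce _)

/-- raising points while fixing the base point -/
def Up (b : Blk Γ) (r : Fin 16) : Prop :=
  ∃ h ∈ CC (Γ := Γ), h (0, 0, nd) = (0, 0, nd) ∧ ∃ c : Blk Γ, h (0, b) = (0, c) ∧ r ≤ c.1

theorem Up_step (h : Equiv.Perm (Om Γ)) (hh : h ∈ CC) (h0 : h (0, 0, nd) = (0, 0, nd)) (b b' : Blk Γ)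
    (hb : h (0, b) = (0, b')) (r : Fin 16) (hu : Up b' r) : Up b r := by
  obtain ⟨h', hh', h0', c, hc, hr⟩ := hu
  refine ⟨h' * h, mul_mem hh' hh, ?_, c, ?_, hr⟩
  · rw [Equiv.Perm.mul_apply, h0, h0']
  · rw [Equiv.Perm.mul_apply, hb, hc]

theorem XX_raise (k : Fin 16) (hk : k = 0 ∨ k = 2 ∨ k = 4 ∨ k = 6 ∨ k = 8) (r : Fin 16) (c : Cel Γ) (h : k + 1 ≤ r) :
    k + 3 ≤ (XX k (XX k (r, c))).1 := by
  by_cases h1 : r = k + 1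
  · rw [XX_1 k r c h1]
    rcases c with _ | _ | _ <;> simp [XX_2nd, XX_2lt, XX_2ce]
  by_cases h2 : r = k + 2
  · rcases c with _ | _ | _
    · rw [XX_2nd _ _ h2, XX_3nd _ _ rfl]
    · rw [XX_2lt _ _ _ _ h2, XX_3lt _ _ _ _ rfl]
    · rw [XX_2ce _ _ _ h2, XX_3ce _ _ _ rfl]
  by_cases h3 : r = k + 3
  · rcases c with _ | _ | _
    · rw [XX_3nd _ _ h3, XX_3ce _ _ _ rfl]
    · rw [XX_3lt _ _ _ _ h3, XX_3ce _ _ _ rfl]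
    · rw [XX_3ce _ _ _ h3, XX_3ce _ _ _ rfl]
  have h4 : 3 < r - k ∧ k + 3 ≤ r := by
    clear c
    rcases hk with rfl | rfl | rfl | rfl | rfl <;> (revert h h1 h2 h3; revert r; decide)
  rw [XX_out _ _ _ h4.1, XX_out _ _ _ h4.1]
  exact h4.2

theorem Up_raise (k : Fin 16) (hk : k = 0 ∨ k = 2 ∨ k = 4 ∨ k = 6 ∨ k = 8) (r0 : Fin 16)
    (h : ∀ b : Blk Γ, k + 3 ≤ b.1 → Up b r0) : ∀ b : Blk Γ, k + 1 ≤ b.1 → Up b r0 := by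
  rintro ⟨r, c⟩ hb
  have hk' : k ≤ 12 := by rcases hk with rfl | rfl | rfl | rfl | rfl <;> decide
  have h0 : perB Set.univ (XX k) ((0, 0, nd) : Om Γ) = (0, 0, nd) := by
    rw [perB_univ]
    by_cases h : k = 0
    · subst h; rfl
    · rw [XX_out]
      rcases hk with rfl | rfl | rfl | rfl | rfl <;> first | decide | exact absurd rfl h
  refine Up_step _ (CC_XX k hk') h0 _ _ (perB_univ _ _ _) _ ?_
  refine Up_step _ (CC_XX k hk') h0 _ _ (perB_univ _ _ _) _ ?_
  exact h _ (XX_raise k hk r c hb)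

theorem Up_pos (b : Blk Γ) (h : 1 ≤ b.1) : Up b 11 := by
  have h11 : ∀ b : Blk Γ, 8 + 3 ≤ b.1 → Up b 11 := fun b hb => ⟨1, one_mem _, rfl, b, rfl, hb⟩
  exact Up_raise 0 (by decide) _ (Up_raise 2 (by decide) _ (Up_raise 4 (by decide) _ (Up_raise 6 (by decide) _
    (Up_raise 8 (by decide) _ h11)))) b h

theorem Up_ce (d : D Γ) : Up ((0, ce d) : Blk Γ) 11 := by
  have h0 : perB Set.univ (XX 0) ((0, 0, nd) : Om Γ) = (0, 0, nd) := by rw [perB_univ]; rfl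
  induction d with
  | nil => exact Up_step _ (CC_XX 0 (by decide)) h0 _ _ (perB_univ _ _ _) _ (Up_pos (1, nd) le_rfl)
  | cons s d ih =>
    rcases s with (_ | _) | a
    · exact Up_step _ (CC_XX 0 (by decide)) h0 _ _ (perB_univ _ _ _) _ ih
    · exact Up_step _ (CC_XX 0 (by decide)) h0 _ _ (perB_univ _ _ _) _ (Up_pos (1, ce d) le_rfl)
    · exact Up_step _ (CC_XX 0 (by decide)) h0 _ _ (perB_univ _ _ _) _ (Up_pos (1, lt a d) le_rfl)

theorem Up_all (b : Blk Γ) (h : bk ((0, nd) : Blk Γ) < bk b) : Up b 11 := by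
  obtain ⟨r, c⟩ := b
  by_cases hr : 1 ≤ r
  · exact Up_pos _ hr
  have hr0 : r = 0 := by revert hr; clear h; revert r; decide
  subst hr0
  rcases c with _ | ⟨a, d⟩ | d
  · exact absurd h (lt_irrefl _)
  · have ha : a.1 < 1 := by
      rcases pn a with ha | ha
      · exfalso
        rw [bk_lt] at h
        simp [ck, cons_lt, lk_pos a ha, e0, k0_lt] at h
      · exact ha
    have hc : (RR ^ 4)⁻¹ * perB Set.univ (LB a.1⁻¹) * RR ^ 4 ∈ CC (Γ := Γ) :=
      mul_mem (mul_mem (inv_mem (pow_mem CC_RR 4)) (CC_LB _)) (pow_mem CC_RR 4)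
    have e : ∀ c : Cel Γ, (RR ^ 4) ((0, 0, c) : Om Γ) = (0, 4, c) := fun c => rfl
    refine Up_step _ hc ?_ _ (0, ce d) ?_ _ (Up_ce d)
    · rw [Equiv.Perm.mul_apply, Equiv.Perm.mul_apply, Equiv.Perm.inv_eq_iff_eq, e, perB_univ]
      rw [LB_none _ _ rfl]
    · rw [Equiv.Perm.mul_apply, Equiv.Perm.mul_apply, Equiv.Perm.inv_eq_iff_eq, e, perB_univ, e]
      rw [← insB_lt a ha, LB_ins, inv_mul_cancel, insB_one]
  · exact Up_ce d

end Step2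
end FrattiniProof


/-! ## Part 11: simplicity, conclusion -/

set_option linter.all false

namespace FrattiniProof

namespace Step2

open Sym Cel
open scoped commutatorElement

variable {Γ : Type} [Group Γ] [LinearOrder Γ] [Lab Γ]

theorem inv_ap {X : Type} (f : Equiv.Perm X) (x : X) : f⁻¹ (f x) = x := f.symm_apply_apply x
theorem ap_inv {X : Type} (f : Equiv.Perm X) (x : X) : f (f⁻¹ x) = x := f.apply_symm_apply x

/-! ### supports -/

theorem TT_fix (f : Equiv.Perm (Blk Γ)) (hf : f ∈ TT (Γ := Γ)) (r : Fin 16) (c : Cel Γ)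
    (h : ¬ (2 ≤ r ∧ r ≤ 9)) : f (r, c) = (r, c) := by
  rcases hf with rfl | ⟨a, rfl⟩ | ⟨a, rfl⟩
  · apply XX_out; revert h; revert r; decide
  · apply LB_none
    have h1 : r ≠ 4 ∧ r ≠ 5 := by revert h; revert r; decide
    cases c <;> simp [getB, h1]
  · apply CB_out; revert h; revert r; decide

theorem WW_fix (f : Equiv.Perm (Blk Γ)) (hf : f ∈ WW (Γ := Γ)) : ∀ (r : Fin 16) (c : Cel Γ),
    ¬ (2 ≤ r ∧ r ≤ 9) → f (r, c) = (r, c) := by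
  unfold WW at hf
  induction hf using Subgroup.closure_induction with
  | mem f hf =>
    intro r c h
    rcases hf with hf | rfl | rfl | rfl | rfl
    · exact TT_fix f hf r c h
    all_goals (apply XX_out; revert h; revert r; decide)
  | one => intro r c h; rfl
  | mul f g _ _ hf hg => intro r c h; rw [Equiv.Perm.mul_apply, hg r c h, hf r c h]
  | inv f _ hf => intro r c h; rw [Equiv.Perm.inv_eq_iff_eq, hf r c h]

def MonSub : Subgroup (Equiv.Perm (Om Γ)) where
  carrier := {f | MonO f}
  one_mem' := fun _ _ h => h
  mul_mem' := fun hf hg => MonO_mul hf hg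
  inv_mem' := fun hf => MonO_inv hf

theorem TT_mono (f : Equiv.Perm (Blk Γ)) (hf : f ∈ TT (Γ := Γ)) : Mon f := by
  rcases hf with rfl | ⟨a, rfl⟩ | ⟨a, rfl⟩
  · exact X4_mono
  · exact LB_mono a
  · exact CB_mono a

theorem CC_mono : CC ≤ MonSub (Γ := Γ) :=
  CC_le _ RR_mono fun f hf => perB_mono _ f (TT_mono f hf)

theorem gen_mono {r : ℕ} (ℓ : Fin r → Γ) (i : Idx r) : MonO (gen ℓ i) := by
  rcases i with _ | b | x | x
  · exact RR_mono
  · exact perB_mono _ _ X4_mono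
  · exact perB_mono _ _ (LB_mono _)
  · exact perB_mono _ _ (CB_mono _)

theorem HH_mono {r : ℕ} (ℓ : Fin r → Γ) : HH ℓ ≤ MonSub := by
  unfold HH
  rw [Subgroup.closure_le]
  rintro _ ⟨i, rfl⟩
  exact gen_mono ℓ i

theorem between (p q : Om Γ) (h : ok p < ok q) : ∃ κ ∈ CC (Γ := Γ), ∀ (s : Fin 16) (c : Cel Γ),
    2 ≤ s ∧ s ≤ 9 → ok p < ok (κ (0, s, c)) ∧ ok (κ (0, s, c)) < ok q := by
  obtain ⟨g, hg, hp⟩ := reach_o p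
  have hq : ok ((0, 0, nd) : Om Γ) < ok (g q) := by rw [← hp]; exact CC_mono hg _ _ h
  have hs0 : ∀ s : Fin 16, 2 ≤ s ∧ s ≤ 9 → 0 < s := by decide
  have hs1 : ∀ s r : Fin 16, 2 ≤ s ∧ s ≤ 9 → 11 ≤ r → s < r := by decide
  have aux : ∀ g' ∈ CC (Γ := Γ), g' p = (0, 0, nd) → (∀ (s : Fin 16) (c : Cel Γ),
      2 ≤ s ∧ s ≤ 9 → ok ((0, s, c) : Om Γ) < ok (g' q)) → ∃ κ ∈ CC (Γ := Γ), ∀ (s : Fin 16) (c : Cel Γ),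
    2 ≤ s ∧ s ≤ 9 → ok p < ok (κ (0, s, c)) ∧ ok (κ (0, s, c)) < ok q := by
    intro g' hg' hp' hh
    refine ⟨g'⁻¹, inv_mem hg', fun s c hs => ?_⟩
    have m := CC_mono (inv_mem hg')
    have h1 : ok ((0, 0, nd) : Om Γ) < ok ((0, s, c) : Om Γ) := by
      rw [ok_lt]; right; refine ⟨rfl, ?_⟩; rw [bk_lt]; left; exact hs0 s hs
    have h2 := m _ _ h1
    have h3 := m _ _ (hh s c hs)
    rw [← hp', inv_ap g'] at h2
    rw [inv_ap g'] at h3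
    exact ⟨h2, h3⟩
  rcases hgq : g q with ⟨n, b⟩
  rw [hgq, ok_lt] at hq
  rcases hq with hq | ⟨hq, hb⟩
  · refine aux g hg hp fun s c hs => ?_
    rw [hgq, ok_lt]; exact Or.inl hq
  · dsimp only at hq hb
    subst hq
    obtain ⟨g', hg', ho, c', hc', h11⟩ := Up_all b hb
    refine aux (g' * g) (mul_mem hg' hg) ?_ fun s c hs => ?_
    · rw [Equiv.Perm.mul_apply, hp, ho]
    · rw [Equiv.Perm.mul_apply, hgq, hc', ok_lt]; right; refine ⟨rfl, ?_⟩; rw [bk_lt]; left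
      exact hs1 s _ hs h11

/-! ### locality -/

def Loc (h : Equiv.Perm (Om Γ)) (m : ℤ) : Prop :=
  (∀ n d : ℤ, (∀ i, |i - n| ≤ m → (i ∈ AA ↔ i + d ∈ AA)) → ∀ b, h (n + d, b) = Zs d (h (n, b))) ∧
    ∀ x, |(h x).1 - x.1| ≤ m

theorem Loc_perB (b : Bool) (f : Equiv.Perm (Blk Γ)) : Loc (perB (bs b) f) 0 := by
  constructor
  · intro n d hi c
    have h := hi n (by simp)
    have h' : n ∈ bs b ↔ n + d ∈ bs b := by
      cases b
      · exact h
      · exact ⟨fun _ => trivial, fun _ => trivial⟩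
    by_cases hn : n ∈ bs b
    · rw [perB_pos f hn, perB_pos f (h'.1 hn), Zs_apply]
    · rw [perB_neg f hn, perB_neg f (fun h => hn (h'.2 h)), Zs_apply]
  · intro x; rw [perB_fst]; simp

theorem Loc_RR : Loc (RR : Equiv.Perm (Om Γ)) 1 := by
  constructor
  · intro n d _ b
    exact congrArg (fun h : Equiv.Perm (Om Γ) => h (n, b)) (CC_Zs RR CC_RR d)
  · rintro ⟨n, r, c⟩
    by_cases h : r = 15
    · subst h; rw [RR_15]; simp
    · rw [RR_lt _ _ _ h]; simp

theorem Loc_gen {r : ℕ} (ℓ : Fin r → Γ) (i : Idx r) : ∃ m : ℤ, 0 ≤ m ∧ m ≤ 1 ∧ Loc (gen ℓ i) m := by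
  rcases i with _ | b | x | x
  · exact ⟨1, by norm_num, by norm_num, Loc_RR⟩
  all_goals exact ⟨0, by norm_num, by norm_num, Loc_perB _ _⟩

theorem Loc_mul {f g : Equiv.Perm (Om Γ)} {m k : ℤ} (hk : 0 ≤ k) (hm : 0 ≤ m) (hf : Loc f m) (hg : Loc g k) :
    Loc (f * g) (m + k) := by
  constructor
  · intro n d hi b
    rw [Equiv.Perm.mul_apply, hg.1 n d (fun i h => hi i (by linarith)), Zs_apply, Equiv.Perm.mul_apply]
    have h1 := hg.2 (n, b)
    rcases hh : g (n, b) with ⟨n', b'⟩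
    rw [hh] at h1
    dsimp only at h1 ⊢
    refine hf.1 n' d (fun i h => hi i ?_) b'
    rw [abs_le] at *; constructor <;> linarith [h.1, h.2, h1.1, h1.2]
  · intro x
    have h1 := hf.2 (g x)
    have h2 := hg.2 x
    rw [Equiv.Perm.mul_apply]
    rw [abs_le] at *; constructor <;> linarith [h1.1, h1.2, h2.1, h2.2]

theorem Loc_inv {f : Equiv.Perm (Om Γ)} {m : ℤ} (hm : 0 ≤ m) (hf : Loc f m) : Loc f⁻¹ (m + m) := by
  have h0 : ∀ x, |(f⁻¹ x).1 - x.1| ≤ m := by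
    intro x
    have h1 := hf.2 (f⁻¹ x)
    rw [ap_inv f] at h1
    rwa [abs_sub_comm]
  constructor
  · intro n d hi b
    rw [Equiv.Perm.inv_eq_iff_eq]
    have h1 := h0 (n, b)
    rcases hh : f⁻¹ (n, b) with ⟨n', b'⟩
    rw [hh] at h1
    dsimp only at h1
    rw [Zs_apply]
    dsimp only
    rw [hf.1 n' d _ b']
    · rw [← hh, ap_inv f, Zs_apply]
    · intro i h
      apply hi
      rw [abs_le] at *; constructor <;> linarith [h.1, h.2, h1.1, h1.2]
  · intro x
    linarith [h0 x]

theorem HH_loc {r : ℕ} (ℓ : Fin r → Γ) (h : Equiv.Perm (Om Γ)) (hh : h ∈ HH ℓ) : ∃ m : ℤ, 0 ≤ m ∧ Loc h m := by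
  unfold HH at hh
  induction hh using Subgroup.closure_induction with
  | mem f hf => obtain ⟨i, rfl⟩ := hf; obtain ⟨m, h1, _, h2⟩ := Loc_gen ℓ i; exact ⟨m, h1, h2⟩
  | one => exact ⟨0, le_rfl, fun n d _ b => rfl, fun x => by simp⟩
  | mul f g _ _ hf hg =>
    obtain ⟨m, h1, h2⟩ := hf
    obtain ⟨k, h3, h4⟩ := hg
    exact ⟨m + k, by linarith, Loc_mul h3 h1 h2 h4⟩
  | inv f _ hf =>
    obtain ⟨m, h1, h2⟩ := hf
    exact ⟨m + m, by linarith, Loc_inv h1 h2⟩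

theorem Zs_mono (d : ℤ) : MonO (Zs d : Equiv.Perm (Om Γ)) := by
  intro x y h
  rw [ok_lt] at *
  rw [Zs_apply, Zs_apply]
  dsimp only
  rcases h with h | ⟨h, h'⟩
  · left; linarith
  · right; exact ⟨by rw [h], h'⟩

theorem ok_lt_fst {x y : Om Γ} (h : ok x < ok y) : x.1 ≤ y.1 := by
  rw [ok_lt] at h
  rcases h with h | h
  · exact h.le
  · exact h.1.le

/-! ### a displaced set -/

theorem displaced (ν : Equiv.Perm (Om Γ)) (m : ℤ) (hm : 0 ≤ m) (hl : Loc ν m) (hmono : MonO ν) (p : Om Γ)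
    (hp : ok p < ok (ν p)) :
    ∃ (κ : Equiv.Perm (Om Γ)) (J : ℕ), κ ∈ CC ∧ ∀ (k k' : ℤ) (s s' : Fin 16) (c c' : Cel Γ), k ∈ PP J → k' ∈ PP J →
      2 ≤ s ∧ s ≤ 9 → 2 ≤ s' ∧ s' ≤ 9 → ν (κ (k, s, c)) ≠ κ (k', s', c') := by
  obtain ⟨n, b⟩ := p
  obtain ⟨e, he, h2⟩ : ∃ e : ℕ, Even e ∧ |n| + m < 2 ^ e := by
    refine ⟨2 * (|n| + m).toNat, even_two_mul _, ?_⟩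
    have h1 : |n| + m = ((|n| + m).toNat : ℤ) := (Int.toNat_of_nonneg (by positivity)).symm
    have h3 := Nat.lt_two_pow_self (n := 2 * (|n| + m).toNat)
    have h4 : ((2 * (|n| + m).toNat : ℕ) : ℤ) < 2 ^ (2 * (|n| + m).toNat) := by exact_mod_cast h3
    push_cast at h4
    linarith [(|n| + m).toNat.cast_nonneg (α := ℤ)]
  have hn := abs_le.1 (le_refl |n|)
  set n1 := n + 2 ^ e with hn1
  have e1 : ν (n1, b) = Zs (2 ^ e) (ν (n, b)) := by
    refine hl.1 n _ (fun i hi => (AA_shift' e he i ?_).symm) b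
    rw [abs_le] at hi
    rw [abs_lt]; constructor <;> linarith [hi.1, hi.2, hn.1, hn.2]
  have e2 : ok ((n1, b) : Om Γ) < ok (ν (n1, b)) := by
    rw [e1]; exact Zs_mono (2 ^ e) _ _ hp
  have e3 : ∀ k ∈ PP (e + 1), ν (Zs k (n1, b)) = Zs k (ν (n1, b)) := by
    rintro _ ⟨t, rfl⟩
    refine hl.1 n1 _ (fun i hi => (AA_shift (e + 1) i t ?_ ?_).symm) b
    · rintro rfl
      rw [abs_le] at hi; linarith [hi.1, hi.2, hn.1, hn.2]
    · rw [abs_le] at hi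
      rw [pow_succ]
      rw [abs_lt]; constructor <;> linarith [hi.1, hi.2, hn.1, hn.2]
  obtain ⟨κ, hκ, hb⟩ := between _ _ e2
  refine ⟨κ, e + 1, hκ, ?_⟩
  have hz : ∀ (k : ℤ) (s : Fin 16) (c : Cel Γ), κ (k, s, c) = Zs k (κ (0, s, c)) := by
    intro k s c
    have := congrArg (fun h : Equiv.Perm (Om Γ) => h (0, s, c)) (CC_Zs κ hκ k)
    simpa [Equiv.Perm.mul_apply, Zs_apply] using this
  have hlow : ∀ (k : ℤ) (s : Fin 16) (c : Cel Γ), 2 ≤ s ∧ s ≤ 9 → ok (Zs k (n1, b)) < ok (κ (k, s, c)) ∧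
      ok (κ (k, s, c)) < ok (Zs k (ν (n1, b))) := by
    intro k s c hs
    rw [hz]
    exact ⟨Zs_mono k _ _ (hb s c hs).1, Zs_mono k _ _ (hb s c hs).2⟩
  have hd := hl.2 (n1, b)
  intro k k' s s' c c' hk hk' hs hs' heq
  have a1 := hlow k s c hs
  have a2 := hlow k' s' c' hs'
  have a3 : ok (Zs k (ν (n1, b))) < ok (ν (κ (k, s, c))) := by
    rw [← e3 k hk]; exact hmono _ _ a1.1
  by_cases hkk : k = k'
  · subst hkk
    rw [heq] at a3
    exact lt_asymm a3 a2.2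
  · have b1 := ok_lt_fst a1.1
    have b2 := ok_lt_fst a1.2
    have b3 := ok_lt_fst a2.1
    have b4 := ok_lt_fst a2.2
    have b5 := ok_lt_fst a3
    have b6 := hl.2 (κ (k, s, c))
    rw [heq] at b5 b6
    simp only [Zs_apply] at b1 b2 b3 b4 b5
    rw [abs_le] at hd b6
    have c0 := ok_lt_fst e2
    dsimp only at c0 hd
    obtain ⟨t, rfl⟩ := hk
    obtain ⟨t', rfl⟩ := hk'
    have htt : t ≠ t' := fun h => hkk (by rw [h])
    have hpos : (0 : ℤ) < 2 ^ e := by positivity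
    rw [pow_succ] at *
    rcases lt_or_gt_of_ne htt with h | h
    · have : 2 ^ e * 2 * t + 2 ^ e * 2 ≤ 2 ^ e * 2 * t' := by nlinarith
      linarith [abs_nonneg n, hd.1, hd.2, b6.1, b6.2]
    · have : 2 ^ e * 2 * t' + 2 ^ e * 2 ≤ 2 ^ e * 2 * t := by nlinarith
      linarith [abs_nonneg n, hd.1, hd.2, b6.1, b6.2]

/-! ### normal subgroups -/

section normal
variable (K N : Subgroup (Equiv.Perm (Om Γ))) (hR : RR ∈ K) (hu : Good K Set.univ) (hA : Good K AA)
  (hNK : N ≤ K) (hN : ∀ k ∈ K, ∀ x ∈ N, k * x * k⁻¹ ∈ N)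
include hR hu hA hNK hN

theorem normal_PP (ν : Equiv.Perm (Om Γ)) (hν : ν ∈ N) (m : ℤ) (hm : 0 ≤ m) (hl : Loc ν m) (hmono : MonO ν) (p : Om Γ)
    (hp : ok p < ok (ν p)) : ∃ J, Good N (PP J) := by
  obtain ⟨κ, J, hκ, hd⟩ := displaced ν m hm hl hmono p hp
  refine ⟨J, ?_⟩
  have c1 : ∀ x ∈ K, RR * x * RR⁻¹ ∈ K := fun x hx => mul_mem (mul_mem hR hx) (inv_mem hR)
  have c2 : ∀ x ∈ K, RR⁻¹ * x * RR ∈ K := fun x hx => mul_mem (mul_mem (inv_mem hR) hx) hR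
  have hκK : κ ∈ K := CC_le K hR hu hκ
  have hW := WW_of_good K c1 c2 (PP J) (good_PP K hR hu hA J)
  have : ⁅WW (Γ := Γ), WW (Γ := Γ)⁆ ≤ N.comap (perB (PP J)) := by
    rw [Subgroup.commutator_le]
    intro a ha b hb
    show perB (PP J) ⁅a, b⁆ ∈ N
    have hU : ∀ f ∈ WW (Γ := Γ), ∀ x : Om Γ, (κ * perB (PP J) f * κ⁻¹) x ≠ x →
        ∃ k ∈ PP J, ∃ (s : Fin 16) (c : Cel Γ), (2 ≤ s ∧ s ≤ 9) ∧ x = κ (k, s, c) := by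
      intro f hf x hx
      rcases hy : κ⁻¹ x with ⟨k, s, c⟩
      have hxy : x = κ (k, s, c) := by rw [← hy, ap_inv κ]
      rw [Equiv.Perm.mul_apply, Equiv.Perm.mul_apply, hy] at hx
      by_cases hk : k ∈ PP J
      · by_cases hs : 2 ≤ s ∧ s ≤ 9
        · exact ⟨k, hk, s, c, hs, hxy⟩
        · rw [perB_pos _ hk, WW_fix f hf s c hs, ← hxy] at hx; exact absurd rfl hx
      · rw [perB_neg _ hk, ← hxy] at hx; exact absurd rfl hx
    set a' := κ * perB (PP J) a * κ⁻¹ with ha'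
    set b' := κ * perB (PP J) b * κ⁻¹ with hb'
    have hcomm : Commute (ν * a'⁻¹ * ν⁻¹) b' := by
      apply Equiv.Perm.Disjoint.commute
      intro x
      by_contra hx
      push Not at hx
      obtain ⟨k, hk, s, c, hs, rfl⟩ := hU b hb x hx.2
      have h1 : a' (ν⁻¹ (κ (k, s, c))) ≠ ν⁻¹ (κ (k, s, c)) := by
        intro h
        apply hx.1
        rw [Equiv.Perm.mul_apply, Equiv.Perm.mul_apply, Equiv.Perm.inv_eq_iff_eq.2 h.symm, ap_inv ν]
      obtain ⟨k', hk', s', c', hs', h2⟩ := hU a ha _ h1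
      apply hd k' k s' s c' c hk' hk hs' hs
      rw [← h2, ap_inv ν]
    have hcN : a' * (ν * a'⁻¹ * ν⁻¹) ∈ N := by
      have ha'K : a' ∈ K := mul_mem (mul_mem hκK (hW a ha)) (inv_mem hκK)
      have := mul_mem (hN a' ha'K ν hν) (inv_mem hν)
      rwa [show a' * ν * a'⁻¹ * ν⁻¹ = a' * (ν * a'⁻¹ * ν⁻¹) by group] at this
    have hb'K : b' ∈ K := mul_mem (mul_mem hκK (hW b hb)) (inv_mem hκK)
    have h3 := mul_mem hcN (hN b' hb'K _ (inv_mem hcN))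
    have h4 : a' * (ν * a'⁻¹ * ν⁻¹) * (b' * (a' * (ν * a'⁻¹ * ν⁻¹))⁻¹ * b'⁻¹) = a' * b' * a'⁻¹ * b'⁻¹ := by
      set c' := ν * a'⁻¹ * ν⁻¹ with hc'
      calc _ = a' * (c' * b') * c'⁻¹ * a'⁻¹ * b'⁻¹ := by group
        _ = _ := by rw [hcomm.eq]; group
    rw [h4] at h3
    have h5 := hN κ⁻¹ (inv_mem hκK) _ h3
    have h6 : κ⁻¹ * (a' * b' * a'⁻¹ * b'⁻¹) * κ⁻¹⁻¹ = perB (PP J ∩ PP J) ⁅a, b⁆ := by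
      rw [perB_inter, ha', hb', commutatorElement_def]; group
    rw [h6, Set.inter_self] at h5
    exact h5
  exact fun f hf => this (TT_comm f hf)

theorem normal_univ (J : ℕ) (h : Good N (PP J)) : Good N Set.univ := by
  induction J with
  | zero => rwa [PP_zero] at h
  | succ j ih =>
    apply ih
    intro f hf
    have e : PP j = PP (j + 1) ∪ {n | n - 2 ^ j ∈ PP (j + 1)} := by
      ext n; exact PP_split j n
    rw [e, perB_union _ {n | n - 2 ^ j ∈ PP (j + 1)} (fun n hn => PP_disj j n hn), ← Zs_conj]
    exact mul_mem (h f hf) (hN _ (Zs_mem K hR _) _ (h f hf))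

theorem normal_AA (h : Good N Set.univ) : RR ∈ N ∧ Good N AA := by
  have c1 : ∀ x ∈ K, RR * x * RR⁻¹ ∈ K := fun x hx => mul_mem (mul_mem hR hx) (inv_mem hR)
  have c2 : ∀ x ∈ K, RR⁻¹ * x * RR ∈ K := fun x hx => mul_mem (mul_mem (inv_mem hR) hx) hR
  have d1 : ∀ x ∈ N, RR * x * RR⁻¹ ∈ N := fun x hx => hN RR hR x hx
  have d2 : ∀ x ∈ N, RR⁻¹ * x * RR ∈ N := fun x hx => by simpa using hN RR⁻¹ (inv_mem hR) x hx
  refine ⟨RR_mem_of_good N d1 d2 h, ?_⟩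
  have hWu := WW_of_good N d1 d2 Set.univ h
  have hWA := WW_of_good K c1 c2 AA hA
  have : ⁅WW (Γ := Γ), WW (Γ := Γ)⁆ ≤ N.comap (perB AA) := by
    rw [Subgroup.commutator_le]
    intro a ha b hb
    show perB AA ⁅a, b⁆ ∈ N
    have e : AA = AA ∩ Set.univ := (Set.inter_univ _).symm
    rw [e, perB_inter, commutatorElement_def]
    exact mul_mem (hN _ (hWA a ha) _ (hWu b hb)) (inv_mem (hWu b hb))
  exact fun f hf => this (TT_comm f hf)
end normal

theorem HH_le {r : ℕ} (ℓ : Fin r → Γ) (N : Subgroup (Equiv.Perm (Om Γ))) (hR : RR ∈ N) (hu : Good N Set.univ)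
    (hA : Good N AA) : HH ℓ ≤ N := by
  have hb : ∀ b, Good N (bs b) := by
    rintro (_ | _)
    · exact hA
    · exact hu
  unfold HH
  rw [Subgroup.closure_le]
  rintro _ ⟨_ | b | x | x, rfl⟩
  · exact hR
  · exact hb _ _ (Or.inl rfl)
  · exact hb _ _ (Or.inr (Or.inl ⟨_, rfl⟩))
  · exact hb _ _ (Or.inr (Or.inr ⟨_, rfl⟩))

theorem HH_simple {r : ℕ} (ℓ : Fin r → Γ) (hℓ : Subgroup.closure (Set.range ℓ) = ⊤) : IsSimpleGroup (HH ℓ) := by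
  have hR := HH_RR ℓ
  have hu : Good (HH ℓ) Set.univ := HH_good ℓ hℓ true
  have hA : Good (HH ℓ) AA := HH_good ℓ hℓ false
  refine { exists_pair_ne := ⟨⟨RR, hR⟩, 1, ?_⟩, eq_bot_or_eq_top_of_normal := ?_ }
  · intro h
    have h1 := congrArg (fun g : HH ℓ => (g.1 ((0, 0, nd) : Om Γ)).2.1) h
    exact absurd h1 (by show ((0 : Fin 16) + 1) ≠ 0; decide)
  · intro N₀ hnorm
    by_cases hbot : N₀ = ⊥
    · exact Or.inl hbot
    right
    obtain ⟨⟨⟨ν, hνK⟩, hν⟩, hν0⟩ := Subgroup.ne_bot_iff_exists_ne_one.1 hbot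
    have hν1 : (⟨ν, hνK⟩ : HH ℓ) ≠ 1 := fun h => hν0 (Subtype.ext h)
    set N := N₀.map (HH ℓ).subtype with hNdef
    have hNK : N ≤ HH ℓ := by rintro _ ⟨x, _, rfl⟩; exact x.2
    have hN : ∀ k ∈ HH ℓ, ∀ x ∈ N, k * x * k⁻¹ ∈ N := by
      rintro k hk _ ⟨x, hx, rfl⟩
      exact ⟨⟨k, hk⟩ * x * ⟨k, hk⟩⁻¹, hnorm.conj_mem x hx _, rfl⟩
    have hνN : ν ∈ N := ⟨⟨ν, hνK⟩, hν, rfl⟩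
    have hν2 : ν ≠ 1 := fun h => hν1 (Subtype.ext h)
    obtain ⟨p, hp⟩ : ∃ p, ν p ≠ p := by
      by_contra hc
      push Not at hc
      exact hν2 (Equiv.ext hc)
    have key : ∃ J, Good N (PP J) := by
      rcases lt_or_gt_of_ne (fun h => hp (ok_inj h) : ok (ν p) ≠ ok p) with h | h
      · have hi := inv_mem hνN
        obtain ⟨m, hm, hl⟩ := HH_loc ℓ _ (hNK hi)
        have hmo := HH_mono ℓ (hNK hi)
        refine normal_PP (HH ℓ) N hR hu hA hNK hN ν⁻¹ hi m hm hl hmo p ?_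
        have := hmo _ _ h
        rwa [inv_ap ν] at this
      · obtain ⟨m, hm, hl⟩ := HH_loc ℓ _ hνK
        exact normal_PP (HH ℓ) N hR hu hA hNK hN ν hνN m hm hl (HH_mono ℓ hνK) p h
    obtain ⟨J, hJ⟩ := key
    have h1 := normal_univ (HH ℓ) N hR hu hA hNK hN J hJ
    have h2 := normal_AA (HH ℓ) N hR hu hA hNK hN h1
    have h3 := HH_le ℓ N h2.1 h1 h2.2
    rw [eq_top_iff]
    rintro ⟨x, hx⟩ _
    obtain ⟨y, hy, hyx⟩ := h3 hx
    have : y = ⟨x, hx⟩ := Subtype.ext hyx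
    rwa [← this]

end Step2
end FrattiniProof


/-! ## Part 12: simulations -/

set_option linter.all false

namespace FrattiniProof

namespace Step2

open Sym Cel

variable {Γ : Type} [Group Γ] [LinearOrder Γ] [Lab Γ]

omit [LinearOrder Γ] [Lab Γ] in
theorem cel_cases {P : Cel Γ → Prop} (c : Cel Γ) (h1 : P nd) (h2 : ∀ a d, P (lt a d)) (h3 : ∀ d, P (ce d)) : P c := by
  cases c
  · exact h1
  · exact h2 _ _
  · exact h3 _

def flat : Cel Γ → D Γ
  | nd => []
  | lt a d => ltr a :: d
  | ce d => bit true :: d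

theorem flat_inj {c c' : Cel Γ} (h : flat c = flat c') : c = c' := by
  cases c <;> cases c' <;> simp_all [flat]

theorem flat_surj (l : D Γ) (h : ∀ t, l ≠ bit false :: t) : ∃ c, flat c = l := by
  rcases l with _ | ⟨(_ | _) | a, t⟩
  · exact ⟨nd, rfl⟩
  · exact absurd rfl (h t)
  · exact ⟨ce t, rfl⟩
  · exact ⟨lt a t, rfl⟩

/-- a simulation relation on lists, with a relation on exposed letters -/
structure Sim (A : Set Γ) (R : ℕ → D Γ → D Γ → Prop) (E : ℕ → Γ → Γ → Prop) : Prop where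
  E_ne : ∀ {m a a'}, E m a a' → a ≠ 1 ∧ a' ≠ 1
  E_lt : ∀ {m a a'}, E m a a' → (a < 1 ↔ a' < 1)
  E_lab : ∀ {m a a'}, E m a a' → Lab.lab a = Lab.lab a'
  E_mono : ∀ {m a a'}, E (m + 1) a a' → E m a a'
  E_step : ∀ {m a a' g}, g ∈ A → E (m + 1) a a' → E m (g * a) (g * a')
  cons : ∀ {m l l'} s, R m l l' → R m (s :: l) (s :: l')
  mono : ∀ {m l l'}, R (m + 1) l l' → R m l l'
  ltr : ∀ {m} {a a' : Ltr Γ} t, E m a.1 a'.1 → R m (ltr a :: t) (ltr a' :: t)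
  uncons : ∀ {m l l'}, R (m + 1) l l' → (∃ s t t', l = s :: t ∧ l' = s :: t' ∧ R m t t') ∨
    (∃ (a a' : Ltr Γ) (t : D Γ), l = Sym.ltr a :: t ∧ l' = Sym.ltr a' :: t ∧ E (m + 1) a.1 a'.1)
  c : ∀ {m l l'} (f : D Γ → D Γ), (∀ t t', R (m + 2) t t' → R m (f t) (f t')) →
    R (m + 3) l l' → R m (cF f l) (cF f l')

section sim
variable {A : Set Γ} {R : ℕ → D Γ → D Γ → Prop} {E : ℕ → Γ → Γ → Prop} (S : Sim A R E)
include S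

theorem Sim.mono2 {m l l'} (h : R (m + 2) l l') : R m l l' := S.mono (S.mono h)

theorem Sim.duncons {m l l'} (h : R (m + 1) l l') : (∃ b t t', l = bit b :: t ∧ l' = bit b :: t' ∧ R m t t') ∨
    (∃ a t t', l = Sym.ltr a :: t ∧ l' = Sym.ltr a :: t' ∧ R m t t') ∨
    (∃ (a a' : Ltr Γ) (t : D Γ), l = Sym.ltr a :: t ∧ l' = Sym.ltr a' :: t ∧ E (m + 1) a.1 a'.1) := by
  rcases S.uncons h with ⟨s, t, t', h1, h2, h3⟩ | h
  · cases s with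
    | bit b => exact Or.inl ⟨b, t, t', h1, h2, h3⟩
    | ltr a => exact Or.inr (Or.inl ⟨a, t, t', h1, h2, h3⟩)
  · exact Or.inr (Or.inr h)

theorem Sim.cuncons {m} {c c' : Cel Γ} (h : R (m + 1) (flat c) (flat c')) :
    (∃ t t', c = ce t ∧ c' = ce t' ∧ R m t t') ∨
    (∃ a t t', c = lt a t ∧ c' = lt a t' ∧ R m t t') ∨
    (∃ (a a' : Ltr Γ) (t : D Γ), c = lt a t ∧ c' = lt a' t ∧ E (m + 1) a.1 a'.1) := by
  rcases S.duncons h with ⟨b, t, t', h1, h2, h3⟩ | ⟨a, t, t', h1, h2, h3⟩ | ⟨a, a', t, h1, h2, h3⟩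
  · left
    refine ⟨t, t', ?_, ?_, h3⟩ <;> apply flat_inj <;> cases c <;> cases c' <;> simp_all [flat]
  · right; left
    exact ⟨a, t, t', flat_inj h1, flat_inj h2, h3⟩
  · right; right
    exact ⟨a, a', t, flat_inj h1, flat_inj h2, h3⟩

theorem Sim.cell_exists {m} {c : Cel Γ} {l' : D Γ} (h : R (m + 1) (flat c) l') : ∃ c', flat c' = l' := by
  apply flat_surj
  rintro t rfl
  rcases S.duncons h with ⟨b, t, t', h1, h2, h3⟩ | ⟨a, t, t', h1, h2, h3⟩ | ⟨a, a', t, h1, h2, h3⟩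
  · cases c <;> simp_all [flat]
  · simp at h2
  · simp at h2

def RB (R : ℕ → D Γ → D Γ → Prop) (m : ℕ) (x x' : Blk Γ) : Prop := x.1 = x'.1 ∧ R m (flat x.2) (flat x'.2)

theorem Sim.X0F {m} {x x' : Blk Γ} (h : RB R (m + 2) x x') : RB R m (X0F x) (X0F x') := by
  obtain ⟨r, c⟩ := x
  obtain ⟨r', c'⟩ := x'
  obtain ⟨hr, h⟩ := h
  dsimp only at hr h
  subst hr
  have hm := S.mono2 h
  by_cases h0 : r = 0
  · subst h0
    rcases S.cuncons h with ⟨t, t', rfl, rfl, h3⟩ | ⟨a, t, t', rfl, rfl, h3⟩ | ⟨a, a', t, rfl, rfl, h3⟩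
    · rcases S.duncons h3 with ⟨b, u, u', rfl, rfl, h4⟩ | ⟨a, u, u', rfl, rfl, h4⟩ | ⟨a, a', u, rfl, rfl, h4⟩
      · cases b
        · exact ⟨rfl, S.cons _ h4⟩
        · exact ⟨rfl, S.cons _ h4⟩
      · exact ⟨rfl, S.cons _ h4⟩
      · exact ⟨rfl, S.ltr _ (S.E_mono h4)⟩
    · exact ⟨rfl, hm⟩
    · exact ⟨rfl, hm⟩
  by_cases h1 : r = 1
  · subst h1; exact ⟨rfl, hm⟩
  by_cases h2 : r = 2
  · subst h2
    rcases S.cuncons h with ⟨t, t', rfl, rfl, h3⟩ | ⟨a, t, t', rfl, rfl, h3⟩ | ⟨a, a', t, rfl, rfl, h3⟩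
    · exact ⟨rfl, S.cons _ (S.cons _ (S.mono h3))⟩
    · exact ⟨rfl, hm⟩
    · exact ⟨rfl, hm⟩
  by_cases h3 : r = 3
  · subst h3
    rcases S.cuncons h with ⟨t, t', rfl, rfl, h3⟩ | ⟨a, t, t', rfl, rfl, h3⟩ | ⟨a, a', t, rfl, rfl, h3⟩
    · exact ⟨rfl, S.cons _ hm⟩
    · exact ⟨rfl, S.cons _ hm⟩
    · exact ⟨rfl, S.cons _ hm⟩
  · have e : ∀ c : Cel Γ, Step2.X0F (r, c) = (r, c) := by intro c; simp [Step2.X0F, h0, h1, h2, h3]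
    rw [e, e]; exact ⟨rfl, hm⟩

theorem Sim.X0I {m} {x x' : Blk Γ} (h : RB R (m + 2) x x') : RB R m (X0I x) (X0I x') := by
  obtain ⟨r, c⟩ := x
  obtain ⟨r', c'⟩ := x'
  obtain ⟨hr, h⟩ := h
  dsimp only at hr h
  subst hr
  have hm := S.mono2 h
  by_cases h0 : r = 3
  · subst h0
    rcases S.cuncons h with ⟨t, t', rfl, rfl, h3⟩ | ⟨a, t, t', rfl, rfl, h3⟩ | ⟨a, a', t, rfl, rfl, h3⟩
    · rcases S.duncons h3 with ⟨b, u, u', rfl, rfl, h4⟩ | ⟨a, u, u', rfl, rfl, h4⟩ | ⟨a, a', u, rfl, rfl, h4⟩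
      · cases b
        · exact ⟨rfl, S.cons _ h4⟩
        · exact ⟨rfl, S.cons _ h4⟩
      · exact ⟨rfl, S.cons _ h4⟩
      · exact ⟨rfl, S.ltr _ (S.E_mono h4)⟩
    · exact ⟨rfl, hm⟩
    · exact ⟨rfl, hm⟩
  by_cases h1 : r = 2
  · subst h1; exact ⟨rfl, hm⟩
  by_cases h2 : r = 0
  · subst h2
    rcases S.cuncons h with ⟨t, t', rfl, rfl, h3⟩ | ⟨a, t, t', rfl, rfl, h3⟩ | ⟨a, a', t, rfl, rfl, h3⟩
    · exact ⟨rfl, S.cons _ (S.cons _ (S.mono h3))⟩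
    · exact ⟨rfl, hm⟩
    · exact ⟨rfl, hm⟩
  by_cases h3 : r = 1
  · subst h3
    rcases S.cuncons h with ⟨t, t', rfl, rfl, h3⟩ | ⟨a, t, t', rfl, rfl, h3⟩ | ⟨a, a', t, rfl, rfl, h3⟩
    · exact ⟨rfl, S.cons _ hm⟩
    · exact ⟨rfl, S.cons _ hm⟩
    · exact ⟨rfl, S.cons _ hm⟩
  · have e : ∀ c : Cel Γ, Step2.X0I (r, c) = (r, c) := by intro c; simp [Step2.X0I, h0, h1, h2, h3]
    rw [e, e]; exact ⟨rfl, hm⟩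

theorem Sim.XX (k : Fin 16) {m} {x x' : Blk Γ} (h : RB R (m + 2) x x') : RB R m (XX k x) (XX k x') := by
  have h1 : RB R (m + 2) (x.1 - k, x.2) (x'.1 - k, x'.2) := ⟨congrArg (· - k) h.1, h.2⟩
  have h2 := S.X0F h1
  exact ⟨congrArg (· + k) h2.1, h2.2⟩

theorem Sim.XXi (k : Fin 16) {m} {x x' : Blk Γ} (h : RB R (m + 2) x x') :
    RB R m ((Step2.XX k)⁻¹ x) ((Step2.XX k)⁻¹ x') := by
  have h1 : RB R (m + 2) (x.1 - k, x.2) (x'.1 - k, x'.2) := ⟨congrArg (· - k) h.1, h.2⟩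
  have h2 := S.X0I h1
  exact ⟨congrArg (· + k) h2.1, h2.2⟩

theorem Sim.E_gt {m a a'} (h : E m a a') : 1 < a ↔ 1 < a' := by
  have h1 := S.E_lt h
  have h2 := S.E_ne h
  constructor
  · intro h3; exact lt_of_le_of_ne (not_lt.1 fun h => lt_asymm h3 (h1.2 h)) (Ne.symm h2.2)
  · intro h3; exact lt_of_le_of_ne (not_lt.1 fun h => lt_asymm h3 (h1.1 h)) (Ne.symm h2.1)

theorem Sim.insB_E {m a a'} (h : E m a a') (t : D Γ) : RB R m (insB a t) (insB a' t) := by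
  have h2 := S.E_ne h
  rcases three a with rfl | ⟨b, rfl, hb⟩ | ⟨b, rfl, hb⟩
  · exact absurd rfl h2.1
  · have hb' := (S.E_lt h).1 hb
    rw [insB_lt b hb, show a' = (⟨a', h2.2⟩ : Ltr Γ).1 from rfl, insB_lt _ hb']
    exact ⟨rfl, S.ltr t h⟩
  · have hb' := (S.E_gt h).1 hb
    rw [insB_gt b hb, show a' = (⟨a', h2.2⟩ : Ltr Γ).1 from rfl, insB_gt _ hb']
    exact ⟨rfl, S.ltr t h⟩

theorem Sim.insB_R {m t t'} (h : R m t t') (a : Γ) : RB R m (insB a t) (insB a t') := by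
  rcases three a with rfl | ⟨b, rfl, hb⟩ | ⟨b, rfl, hb⟩
  · rw [insB_one, insB_one]; exact ⟨rfl, S.cons _ h⟩
  · rw [insB_lt b hb, insB_lt b hb]; exact ⟨rfl, S.cons _ h⟩
  · rw [insB_gt b hb, insB_gt b hb]; exact ⟨rfl, S.cons _ h⟩

theorem Sim.insD_E {m a a'} (h : E m a a') (t : D Γ) : R m (insD a t) (insD a' t) := by
  have h2 := S.E_ne h
  rcases three a with rfl | ⟨b, rfl, hb⟩ | ⟨b, rfl, hb⟩
  · exact absurd rfl h2.1
  · have hb' := (S.E_lt h).1 hb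
    rw [insD_lt b hb, show a' = (⟨a', h2.2⟩ : Ltr Γ).1 from rfl, insD_lt _ hb']
    exact S.ltr t h
  · have hb' := (S.E_gt h).1 hb
    rw [insD_gt b hb, show a' = (⟨a', h2.2⟩ : Ltr Γ).1 from rfl, insD_gt _ hb']
    exact S.cons _ (S.ltr t h)

theorem Sim.insD_R {m t t'} (h : R m t t') (a : Γ) : R m (insD a t) (insD a t') := by
  rcases three a with rfl | ⟨b, rfl, hb⟩ | ⟨b, rfl, hb⟩
  · rw [insD_one, insD_one]; exact S.cons _ (S.cons _ h)
  · rw [insD_lt b hb, insD_lt b hb]; exact S.cons _ h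
  · rw [insD_gt b hb, insD_gt b hb]; exact S.cons _ (S.cons _ h)

theorem Sim.getB {m} {x x' : Blk Γ} (h : RB R (m + 1) x x') : (getB x = none ∧ getB x' = none) ∨
    (∃ l d d', getB x = some (l, d) ∧ getB x' = some (l, d') ∧ R m d d') ∨
    (∃ l l' d, getB x = some (l, d) ∧ getB x' = some (l', d) ∧ E (m + 1) l l') := by
  obtain ⟨r, c⟩ := x
  obtain ⟨r', c'⟩ := x'
  obtain ⟨hr, h⟩ := h
  dsimp only at hr h
  subst hr
  rcases S.cuncons h with ⟨t, t', rfl, rfl, h3⟩ | ⟨a, t, t', rfl, rfl, h3⟩ | ⟨a, a', t, rfl, rfl, h3⟩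
  · simp only [Step2.getB]
    split_ifs
    · exact Or.inr (Or.inl ⟨_, _, _, rfl, rfl, h3⟩)
    · exact Or.inl ⟨rfl, rfl⟩
  · simp only [Step2.getB]
    split_ifs
    · exact Or.inr (Or.inl ⟨_, _, _, rfl, rfl, h3⟩)
    · exact Or.inl ⟨rfl, rfl⟩
  · simp only [Step2.getB, S.E_lt h3, S.E_gt h3]
    split_ifs
    · exact Or.inr (Or.inr ⟨_, _, _, rfl, rfl, h3⟩)
    · exact Or.inl ⟨rfl, rfl⟩

theorem Sim.getD {m} {x x' : D Γ} (h : R (m + 2) x x') : (getD x = none ∧ getD x' = none) ∨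
    (∃ l d d', getD x = some (l, d) ∧ getD x' = some (l, d') ∧ R m d d') ∨
    (∃ l l' d, getD x = some (l, d) ∧ getD x' = some (l', d) ∧ E (m + 1) l l') := by
  rcases S.duncons h with ⟨b, t, t', rfl, rfl, h3⟩ | ⟨a, t, t', rfl, rfl, h3⟩ | ⟨a, a', t, rfl, rfl, h3⟩
  · cases b
    · exact Or.inl ⟨rfl, rfl⟩
    · rcases S.duncons h3 with ⟨b, u, u', rfl, rfl, h4⟩ | ⟨a, u, u', rfl, rfl, h4⟩ | ⟨a, a', u, rfl, rfl, h4⟩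
      · cases b
        · exact Or.inr (Or.inl ⟨_, _, _, rfl, rfl, h4⟩)
        · exact Or.inl ⟨rfl, rfl⟩
      · simp only [Step2.getD]
        split_ifs
        · exact Or.inr (Or.inl ⟨_, _, _, rfl, rfl, h4⟩)
        · exact Or.inl ⟨rfl, rfl⟩
      · simp only [Step2.getD, S.E_gt h4]
        split_ifs
        · exact Or.inr (Or.inr ⟨_, _, _, rfl, rfl, h4⟩)
        · exact Or.inl ⟨rfl, rfl⟩
  · simp only [Step2.getD]
    split_ifs
    · exact Or.inr (Or.inl ⟨_, _, _, rfl, rfl, S.mono h3⟩)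
    · exact Or.inl ⟨rfl, rfl⟩
  · simp only [Step2.getD, S.E_lt h3]
    split_ifs
    · exact Or.inr (Or.inr ⟨_, _, _, rfl, rfl, S.E_mono h3⟩)
    · exact Or.inl ⟨rfl, rfl⟩

theorem Sim.LB {g : Γ} (hg : g ∈ A) {m} {x x' : Blk Γ} (h : RB R (m + 1) x x') : RB R m (LB g x) (LB g x') := by
  rcases S.getB h with ⟨h1, h2⟩ | ⟨l, d, d', h1, h2, h3⟩ | ⟨l, l', d, h1, h2, h3⟩
  · rw [LB_none _ _ h1, LB_none _ _ h2]; exact ⟨h.1, S.mono h.2⟩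
  · rw [hgetB] at h1 h2
    rw [← h1, ← h2, LB_ins, LB_ins]
    exact S.insB_R h3 _
  · rw [hgetB] at h1 h2
    rw [← h1, ← h2, LB_ins, LB_ins]
    exact S.insB_E (S.E_step hg h3) _

theorem Sim.MD {g : Γ} (hg : g ∈ A) {m} {x x' : D Γ} (h : R (m + 2) x x') : R m (MD g x) (MD g x') := by
  rcases S.getD h with ⟨h1, h2⟩ | ⟨l, d, d', h1, h2, h3⟩ | ⟨l, l', d, h1, h2, h3⟩
  · rw [MD_none _ _ h1, MD_none _ _ h2]; exact S.mono2 h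
  · rw [hgetD] at h1 h2
    rw [← h1, ← h2, MD_ins, MD_ins]
    exact S.insD_R h3 _
  · rw [hgetD] at h1 h2
    rw [← h1, ← h2, MD_ins, MD_ins]
    exact S.insD_E (S.E_step hg h3) _

omit S in
theorem CB_flat (g : Γ) (c : Cel Γ) : ∃ c', CB g (5, c) = (5, c') ∧ flat c' = cF (MD g) (flat c) := by
  cases c with
  | nd => exact ⟨nd, rfl, rfl⟩
  | lt a d => exact ⟨_, rfl, rfl⟩
  | ce d => exact ⟨_, rfl, rfl⟩

theorem Sim.CB {g : Γ} (hg : g ∈ A) {m} {x x' : Blk Γ} (h : RB R (m + 3) x x') : RB R m (CB g x) (CB g x') := by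
  obtain ⟨r, c⟩ := x
  obtain ⟨r', c'⟩ := x'
  obtain ⟨hr, h⟩ := h
  dsimp only at hr h
  subst hr
  by_cases h5 : r = 5
  · subst h5
    obtain ⟨c1, e1, f1⟩ := CB_flat g c
    obtain ⟨c2, e2, f2⟩ := CB_flat g c'
    rw [e1, e2]
    refine ⟨rfl, ?_⟩
    dsimp only
    rw [f1, f2]
    exact S.c _ (fun t t' ht => S.MD hg ht) h
  · rw [CB_out _ _ _ h5, CB_out _ _ _ h5]
    exact ⟨rfl, S.mono (S.mono2 h)⟩

def RO (R : ℕ → D Γ → D Γ → Prop) (m : ℕ) (p p' : Om Γ) : Prop := p.1 = p'.1 ∧ RB R m p.2 p'.2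

theorem Sim.perB (B : Set ℤ) (f : Equiv.Perm (Blk Γ)) {m k} {p p' : Om Γ} (h0 : RO R m p p') (h : RO R k p p')
    (hf : ∀ x x', RB R m x x' → RB R k (f x) (f x')) : RO R k (perB B f p) (perB B f p') := by
  obtain ⟨n, b⟩ := p
  obtain ⟨n', b'⟩ := p'
  obtain ⟨hn, h'⟩ := h0
  dsimp only at hn h'
  subst hn
  by_cases hB : n ∈ B
  · rw [perB_pos f hB, perB_pos f hB]; exact ⟨rfl, hf _ _ h'⟩
  · rw [perB_neg f hB, perB_neg f hB]; exact h

theorem Sim.RO_mono {m k} {p p' : Om Γ} (h : RO R (m + k) p p') : RO R m p p' := by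
  induction k with
  | zero => exact h
  | succ k ih => exact ih ⟨h.1, h.2.1, S.mono h.2.2⟩

theorem Sim.gen {r : ℕ} (ℓ : Fin r → Γ) (hA : ∀ i, ℓ i ∈ A) (i : Idx r) {m} {p p' : Om Γ} (h : RO R (m + 3) p p') :
    RO R m (gen ℓ i p) (gen ℓ i p') := by
  have hm := S.RO_mono h
  have h2 : RO R (m + 2) p p' := S.RO_mono (k := 1) h
  have h1 : RO R (m + 1) p p' := S.RO_mono (k := 2) h
  rcases i with _ | b | x | x
  · obtain ⟨n, r, c⟩ := p
    obtain ⟨n', r', c'⟩ := p'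
    obtain ⟨hn, hr, h9⟩ := hm
    dsimp only at hn hr h9
    subst hn hr
    exact ⟨rfl, rfl, h9⟩
  · exact S.perB _ _ h2 hm fun _ _ => S.XX 4
  · exact S.perB _ _ h1 hm fun _ _ => S.LB (hA _)
  · exact S.perB _ _ h hm fun _ _ => S.CB (hA _)

theorem Sim.geni {r : ℕ} (ℓ : Fin r → Γ) (hA : ∀ i, (ℓ i)⁻¹ ∈ A) (i : Idx r) {m} {p p' : Om Γ}
    (h : RO R (m + 3) p p') : RO R m ((Step2.gen ℓ i)⁻¹ p) ((Step2.gen ℓ i)⁻¹ p') := by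
  have hm := S.RO_mono h
  have h2 : RO R (m + 2) p p' := S.RO_mono (k := 1) h
  have h1 : RO R (m + 1) p p' := S.RO_mono (k := 2) h
  rcases i with _ | b | x | x
  · obtain ⟨n, r, c⟩ := p
    obtain ⟨n', r', c'⟩ := p'
    obtain ⟨hn, hr, h9⟩ := hm
    dsimp only at hn hr h9
    subst hn hr
    exact ⟨rfl, rfl, h9⟩
  · simp only [Step2.gen, ← map_inv]
    exact S.perB _ _ h2 hm fun _ _ => S.XXi 4
  · simp only [Step2.gen, ← map_inv]
    exact S.perB _ _ h1 hm fun _ _ => S.LB (hA _)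
  · simp only [Step2.gen, ← map_inv]
    exact S.perB _ _ h hm fun _ _ => S.CB (hA _)

/-- simulation of words -/
theorem Sim.word {r : ℕ} (ℓ : Fin r → Γ) (hA : ∀ i, ℓ i ∈ A) (hA' : ∀ i, (ℓ i)⁻¹ ∈ A) {M : ℕ}
    (s : Fin M → Idx r) (w : List (Fin M × Bool)) (p p' : Om Γ) (h : RO R (3 * w.length) p p') :
    RO R 0 (wordAct (fun i => Step2.gen ℓ (s i)) w p) (wordAct (fun i => Step2.gen ℓ (s i)) w p') := by
  have := wordAct_sim (fun i => Step2.gen ℓ (s i)) (fun j => RO R (3 * j))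
    (fun i j p p' h => S.gen ℓ hA _ h) (fun i j p p' h => S.geni ℓ hA' _ h) w 0 p p'
    (by rw [zero_add]; exact h)
  exact this
end sim

end Step2
end FrattiniProof


/-! ## Part 13: instances of simulations -/

set_option linter.all false

namespace FrattiniProof

namespace Step2

open Sym Cel

variable {Γ : Type} [Group Γ] [LinearOrder Γ] [Lab Γ]

/-- number of letters -/
def nl : D Γ → ℕ
  | [] => 0
  | bit _ :: l => nl l
  | ltr _ :: l => nl l + 1

theorem nl_append (u v : D Γ) : nl (u ++ v) = nl u + nl v := by
  induction u with
  | nil => simp [nl]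
  | cons s u ih => cases s <;> simp [nl, ih] <;> omega

/-- the list is empty or starts with a letter -/
def LF (T : D Γ) : Prop := ∀ b t, T ≠ bit b :: t

/-! ### tails -/

def RT (T T' : D Γ) (m : ℕ) (l l' : D Γ) : Prop := ∃ u, l = u ++ T ∧ l' = u ++ T' ∧ m ≤ nl u

theorem RT_sim (A : Set Γ) (T T' : D Γ) : Sim A (RT T T') (fun _ _ _ => False) where
  E_ne := False.elim
  E_lt := False.elim
  E_lab := False.elim
  E_mono := False.elim
  E_step := fun _ => False.elim
  cons := by
    rintro m _ _ s ⟨u, rfl, rfl, h⟩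
    refine ⟨s :: u, rfl, rfl, ?_⟩
    cases s <;> simp [nl] <;> omega
  mono := by
    rintro m _ _ ⟨u, rfl, rfl, h⟩
    exact ⟨u, rfl, rfl, by omega⟩
  ltr := fun _ => False.elim
  uncons := by
    rintro m _ _ ⟨u, rfl, rfl, h⟩
    rcases u with _ | ⟨s, u⟩
    · simp [nl] at h
    · refine Or.inl ⟨s, _, _, rfl, rfl, u, rfl, rfl, ?_⟩
      cases s <;> simp [nl] at h <;> omega
  c := by
    rintro m _ _ f hf ⟨u, rfl, rfl, h⟩
    induction u with
    | nil => simp [nl] at h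
    | cons s u ih =>
      cases s with
      | bit b =>
        obtain ⟨u', h1, h2, h3⟩ := ih h
        exact ⟨bit b :: u', by simp [cF, h1], by simp [cF, h2], h3⟩
      | ltr a =>
        simp only [nl] at h
        have h2 : RT T T' (m + 2) (u ++ T) (u ++ T') := ⟨u, rfl, rfl, by omega⟩
        simp only [List.cons_append, cF]
        split_ifs
        · obtain ⟨u', h3, h4, h5⟩ := hf _ _ h2
          rw [h3, h4]
          exact ⟨Sym.ltr a :: u', rfl, rfl, by simp [nl]; omega⟩
        · exact ⟨Sym.ltr a :: u, rfl, rfl, by simp [nl]; omega⟩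

/-! ### runs of bits -/

def bits (B : List Bool) : D Γ := B.map bit

theorem bits_append (B B' : List Bool) : (bits (B ++ B') : D Γ) = bits B ++ bits B' := List.map_append ..

theorem cF_bits (f : D Γ → D Γ) (B : List Bool) (T : D Γ) : cF f (bits B ++ T) = bits B ++ cF f T := by
  induction B with
  | nil => rfl
  | cons b B ih => simp only [bits, List.map_cons, List.cons_append, cF] at ih ⊢; rw [ih]

theorem cF_LF (f : D Γ → D Γ) (T : D Γ) (h : LF T) : LF (cF f T) := by
  rcases T with _ | ⟨b | a, t⟩
  · exact h
  · exact absurd rfl (h b t)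
  · intro b t'; simp [cF]

def RV (v v' : List Bool) (m : ℕ) (l l' : D Γ) : Prop := ∃ u B T, l = u ++ bits B ++ bits v ++ T ∧
  l' = u ++ bits B ++ bits v' ++ T ∧ m ≤ B.length ∧ LF T

theorem RV_sim (A : Set Γ) (v v' : List Bool) : Sim A (RV v v') (fun _ _ _ => False) where
  E_ne := False.elim
  E_lt := False.elim
  E_lab := False.elim
  E_mono := False.elim
  E_step := fun _ => False.elim
  cons := by
    rintro m _ _ s ⟨u, B, T, rfl, rfl, h, hT⟩
    exact ⟨s :: u, B, T, rfl, rfl, h, hT⟩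
  mono := by
    rintro m _ _ ⟨u, B, T, rfl, rfl, h, hT⟩
    exact ⟨u, B, T, rfl, rfl, by omega, hT⟩
  ltr := fun _ => False.elim
  uncons := by
    rintro m _ _ ⟨u, B, T, rfl, rfl, h, hT⟩
    left
    rcases u with _ | ⟨s, u⟩
    · rcases B with _ | ⟨b, B⟩
      · simp at h
      · exact ⟨bit b, _, _, rfl, rfl, [], B, T, rfl, rfl, by simpa using h, hT⟩
    · exact ⟨s, _, _, rfl, rfl, u, B, T, rfl, rfl, by omega, hT⟩
  c := by
    rintro m _ _ f hf ⟨u, B, T, rfl, rfl, h, hT⟩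
    induction u with
    | nil =>
      simp only [List.nil_append, List.append_assoc, cF_bits]
      exact ⟨[], B, cF f T, by simp, by simp, by omega, cF_LF f T hT⟩
    | cons s u ih =>
      cases s with
      | bit b =>
        obtain ⟨u', B', T', h1, h2, h3⟩ := ih
        exact ⟨bit b :: u', B', T', by simp [cF] at h1 ⊢; exact h1, by simp [cF] at h2 ⊢; exact h2, h3⟩
      | ltr a =>
        have h2 : RV v v' (m + 2) (u ++ bits B ++ bits v ++ T) (u ++ bits B ++ bits v' ++ T) :=
          ⟨u, B, T, rfl, rfl, by omega, hT⟩
        simp only [List.cons_append, cF]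
        split_ifs
        · obtain ⟨u', B', T', h3, h4, h5⟩ := hf _ _ h2
          rw [h3, h4]
          exact ⟨Sym.ltr a :: u', B', T', rfl, rfl, h5⟩
        · exact ⟨Sym.ltr a :: u, B, T, rfl, rfl, by omega, hT⟩

/-! ### letters -/

def gset {r : ℕ} (ℓ : Fin r → Γ) : Set Γ := {g | ∃ a : Fin r × Bool, g = cond a.2 (ℓ a.1) (ℓ a.1)⁻¹}

def wp {r : ℕ} (ℓ : Fin r → Γ) (w : List (Fin r × Bool)) : Γ :=
  (w.map fun a => cond a.2 (ℓ a.1) (ℓ a.1)⁻¹).prod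

def EE {r : ℕ} (ℓ : Fin r → Γ) (δ : Γ) (m : ℕ) (a a' : Γ) : Prop := a' = a * δ ∧
  ∀ w : List (Fin r × Bool), w.length ≤ m → wp ℓ w * a ≠ 1 ∧ wp ℓ w * a' ≠ 1 ∧
    (wp ℓ w * a < 1 ↔ wp ℓ w * a' < 1) ∧ Lab.lab (wp ℓ w * a) = Lab.lab (wp ℓ w * a')

def RL {r : ℕ} (ℓ : Fin r → Γ) (δ : Γ) (m : ℕ) (l l' : D Γ) : Prop := ∃ u a a' t, l = u ++ ltr a :: t ∧
  l' = u ++ ltr a' :: t ∧ EE ℓ δ m a.1 a'.1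

theorem RL_sim {r : ℕ} (ℓ : Fin r → Γ) (δ : Γ) : Sim (gset ℓ) (RL ℓ δ) (EE ℓ δ) where
  E_ne := by
    rintro m a a' ⟨_, h⟩
    have := h [] (Nat.zero_le _)
    simp [wp] at this
    exact ⟨this.1, this.2.1⟩
  E_lt := by
    rintro m a a' ⟨_, h⟩
    have := h [] (Nat.zero_le _)
    simp [wp] at this
    exact this.2.2.1
  E_lab := by
    rintro m a a' ⟨_, h⟩
    have := h [] (Nat.zero_le _)
    simp [wp] at this
    exact this.2.2.2
  E_mono := by
    rintro m a a' ⟨h1, h⟩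
    exact ⟨h1, fun w hw => h w (by omega)⟩
  E_step := by
    rintro m a a' _ ⟨x, rfl⟩ ⟨h1, h⟩
    refine ⟨by rw [h1, mul_assoc], fun w hw => ?_⟩
    have := h (w ++ [x]) (by simpa using hw)
    simpa [wp, mul_assoc] using this
  cons := by
    rintro m _ _ s ⟨u, a, a', t, rfl, rfl, h⟩
    exact ⟨s :: u, a, a', t, rfl, rfl, h⟩
  mono := by
    rintro m _ _ ⟨u, a, a', t, rfl, rfl, h1, h⟩
    exact ⟨u, a, a', t, rfl, rfl, h1, fun w hw => h w (by omega)⟩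
  ltr := fun {m a a'} t h => ⟨[], a, a', t, rfl, rfl, h⟩
  uncons := by
    rintro m _ _ ⟨u, a, a', t, rfl, rfl, h1, h⟩
    rcases u with _ | ⟨s, u⟩
    · exact Or.inr ⟨a, a', t, rfl, rfl, h1, h⟩
    · exact Or.inl ⟨s, _, _, rfl, rfl, u, a, a', t, rfl, rfl, h1, fun w hw => h w (by omega)⟩
  c := by
    rintro m _ _ f hf ⟨u, a, a', t, rfl, rfl, h1, h⟩
    induction u with
    | nil =>
      have := h [] (Nat.zero_le _)
      simp [wp] at this
      simp only [List.nil_append, cF, this.2.2.2]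
      exact ⟨[], a, a', _, rfl, rfl, h1, fun w hw => h w (by omega)⟩
    | cons s u ih =>
      cases s with
      | bit b =>
        obtain ⟨u', b', b'', t', h1, h2, h3⟩ := ih
        exact ⟨bit b :: u', b', b'', t', by simp [cF, h1], by simp [cF, h2], h3⟩
      | ltr x =>
        have h2 : RL ℓ δ (m + 2) (u ++ Sym.ltr a :: t) (u ++ Sym.ltr a' :: t) :=
          ⟨u, a, a', t, rfl, rfl, h1, fun w hw => h w (by omega)⟩
        simp only [List.cons_append, cF]
        split_ifs
        · obtain ⟨u', b', b'', t', h3, h4, h5⟩ := hf _ _ h2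
          rw [h3, h4]
          exact ⟨Sym.ltr x :: u', b', b'', t', rfl, rfl, h5⟩
        · exact ⟨Sym.ltr x :: u, a, a', t, rfl, rfl, h1, fun w hw => h w (by omega)⟩

/-! ### reductions -/

/-- `g` respects all simulations up to depth `m` -/
def SimOK {r : ℕ} (ℓ : Fin r → Γ) (g : Equiv.Perm (Om Γ)) (m : ℕ) : Prop :=
  ∀ R E, Sim (gset ℓ) R E → ∀ p p', RO R m p p' → RO R 0 (g p) (g p')

theorem SimOK_word {r : ℕ} (ℓ : Fin r → Γ) {M : ℕ} (s : Fin M → Idx r) (w : List (Fin M × Bool)) :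
    SimOK ℓ (wordAct (fun i => gen ℓ (s i)) w) (3 * w.length + 1) := by
  intro R E S p p' h
  exact S.word ℓ (fun i => ⟨(i, true), rfl⟩) (fun i => ⟨(i, false), rfl⟩) s w p p' (S.RO_mono h)

section red
variable {r : ℕ} (ℓ : Fin r → Γ) (g : Equiv.Perm (Om Γ)) (m : ℕ) (hg : SimOK ℓ g (m + 1)) (n : ℤ) (q : Fin 16)

def Fx (l : D Γ) : Prop := ∀ c, flat c = l → g (n, q, c) = (n, q, c)

include hg in
theorem red_aux (R : ℕ → D Γ → D Γ → Prop) (E) (S : Sim (gset ℓ) R E) (l l' : D Γ) (h : R (m + 1) l l')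
    (h1 : Fx g n q l') (c : Cel Γ) (hc : flat c = l) :
    ∃ x, g (n, q, c) = (n, q, x) ∧ R 0 (flat x) l' := by
  subst hc
  obtain ⟨c', rfl⟩ := S.cell_exists h
  have h2 := hg R E S (n, q, c) (n, q, c') ⟨rfl, rfl, h⟩
  rw [h1 c' rfl] at h2
  obtain ⟨e1, e2, e3⟩ := h2
  exact ⟨(g (n, q, c)).2.2, Prod.ext e1 (Prod.ext e2 rfl), e3⟩

include hg in
theorem red_tail (u T : D Γ) (hu : m + 1 ≤ nl u) (h : Fx g n q u) : Fx g n q (u ++ T) := by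
  intro c hc
  obtain ⟨x, h1, u', h2, h3, _⟩ := red_aux ℓ g m hg n q _ _ (RT_sim (gset ℓ) T []) (u ++ T) u ⟨u, rfl, by simp, hu⟩ h c hc
  rw [List.append_nil] at h3
  rw [h1, flat_inj (h2.trans (by rw [← h3, hc]))]

/-- number of bits followed by exactly `j` letters -/
def ph (j : ℕ) : D Γ → ℕ
  | [] => 0
  | bit _ :: l => ph j l + (if nl l = j then 1 else 0)
  | ltr _ :: l => ph j l

theorem ph_ins (j : ℕ) (u : D Γ) (b : Bool) (T : D Γ) :
    ph j (u ++ bit b :: T) = ph j (u ++ T) + (if nl T = j then 1 else 0) := by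
  induction u with
  | nil => rfl
  | cons s u ih =>
    have : nl (u ++ bit b :: T) = nl (u ++ T) := by rw [nl_append, nl_append]; rfl
    cases s <;> simp only [List.cons_append, ph, ih, this]
    omega

theorem LF_unique (u u' T T' : D Γ) (h : u ++ T = u' ++ T') (hT : LF T) (hT' : LF T') (hn : nl T = nl T') : T = T' := by
  have aux : ∀ (T T' : D Γ), LF T → nl T = nl T' → T' <:+ T → T = T' := by
    rintro T T' hT hn ⟨x, rfl⟩
    rcases x with _ | ⟨b | a, x⟩
    · rfl
    · exact absurd rfl (hT b _)
    · rw [nl_append] at hn; simp only [nl] at hn; omega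
  rcases le_total T.length T'.length with hl | hl
  · exact (aux T' T hT' hn.symm (List.suffix_of_suffix_length_le (l₃ := u ++ T) ⟨u, rfl⟩ (h ▸ ⟨u', rfl⟩) hl)).symm
  · exact aux T T' hT hn (List.suffix_of_suffix_length_le (l₃ := u ++ T) (h ▸ ⟨u', rfl⟩) ⟨u, rfl⟩ hl)

include hg in
theorem red_bits (u : D Γ) (B : List Bool) (b1 b2 : Bool) (T : D Γ) (hT : LF T) (hB : m + 1 ≤ B.length)
    (h1 : Fx g n q (u ++ bits B ++ bit b1 :: T)) (h2 : Fx g n q (u ++ bits B ++ T)) :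
    Fx g n q (u ++ bits B ++ bit b1 :: bit b2 :: T) := by
  intro c hc
  obtain ⟨x, e1, u', B', T', e2, e3, _, hT'⟩ := red_aux ℓ g m hg n q _ _ (RV_sim (gset ℓ) [b2] []) _ _
    ⟨u, B ++ [b1], T, by simp [bits], by simp [bits], by simp; omega, hT⟩ h1 c hc
  obtain ⟨x', e1', u'', B'', T'', e2', e3', _, hT''⟩ := red_aux ℓ g m hg n q _ _ (RV_sim (gset ℓ) [b1, b2] []) _ _
    ⟨u, B, T, by simp [bits], by simp [bits], hB, hT⟩ h2 c hc
  have hxx : x' = x := by rw [e1] at e1'; simpa using e1'.symm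
  subst hxx
  simp only [bits, List.map_cons, List.map_nil, List.append_nil, List.append_assoc, List.cons_append, List.nil_append] at e2 e3 e2' e3' ⊢
  have a1 := congrArg (ph (nl T)) e2
  have a2 := congrArg (ph (nl T)) e3
  have a3 := congrArg (ph (nl T)) e2'
  have a4 := congrArg (ph (nl T)) e3'
  simp only [← List.append_assoc, ph_ins, if_true] at a1 a2 a3 a4
  simp only [nl] at a3
  have hn : nl T = nl T'' := by
    by_contra hne
    have b1 := a1.trans (congrArg (fun y => y + (if nl T' = nl T then 1 else 0)) a2.symm)
    have b3 := a3.trans (congrArg (fun y => y + (if nl T'' = nl T then 1 else 0) + (if nl T'' = nl T then 1 else 0)) a4.symm)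
    have b4 := b1.symm.trans b3
    split_ifs at b4 <;> omega
  have hTT : T = T'' := LF_unique _ _ _ _ ((List.append_assoc ..).trans (e3'.trans (List.append_assoc ..).symm)) hT hT'' hn
  subst hTT
  have huu : u ++ List.map bit B = u'' ++ List.map bit B'' :=
    List.append_cancel_right ((List.append_assoc ..).trans (e3'.trans (List.append_assoc ..).symm))
  rw [e1]
  have : flat x' = flat c := by
    rw [e2', hc, ← List.append_assoc, ← huu]
    simp [bits]
  rw [flat_inj this]

theorem rep_irr (u t l : D Γ) (a a' : Ltr Γ) (h : l = u ++ ltr a :: t) (h' : l = u ++ ltr a' :: t) : a = a' := by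
  rw [h] at h'
  simpa using h'

theorem rep_unique (u0 t0 : D Γ) (c1 c2 : Ltr Γ) (hc : c1 ≠ c2) (δ1 δ2 : Γ) (hd1 : δ1 ≠ 1) (hd2 : δ2 ≠ 1)
    (l : D Γ) (u u' : D Γ) (a a1 b b2 : Ltr Γ) (t t' : D Γ)
    (h1 : l = u ++ ltr a :: t) (h2 : u0 ++ ltr c1 :: t0 = u ++ ltr a1 :: t) (h3 : a1.1 = a.1 * δ1)
    (h4 : l = u' ++ ltr b :: t') (h5 : u0 ++ ltr c2 :: t0 = u' ++ ltr b2 :: t') (h6 : b2.1 = b.1 * δ2) :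
    ∃ e : Ltr Γ, l = u0 ++ ltr e :: t0 ∧ c1.1 = e.1 * δ1 := by
  have hne1 : a ≠ a1 := by rintro rfl; exact hd1 (by simpa using h3)
  have hne2 : b ≠ b2 := by rintro rfl; exact hd2 (by simpa using h6)
  induction u0 generalizing l u u' with
  | nil =>
    rcases u with _ | ⟨s, u⟩
    · simp only [List.nil_append, List.cons.injEq, Sym.ltr.injEq] at h1 h2
      obtain ⟨rfl, rfl⟩ := h2
      exact ⟨a, h1, h3⟩
    · simp only [List.nil_append, List.cons_append, List.cons.injEq, Sym.ltr.injEq] at h1 h2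
      obtain ⟨rfl, rfl⟩ := h2
      subst h1
      rcases u' with _ | ⟨s', u'⟩
      · simp only [List.nil_append, List.cons.injEq, Sym.ltr.injEq] at h4 h5
        obtain ⟨rfl, h7⟩ := h4
        obtain ⟨rfl, h8⟩ := h5
        exact absurd (rep_irr u t _ a a1 rfl (h7.trans h8.symm)) hne1
      · simp only [List.nil_append, List.cons_append, List.cons.injEq, Sym.ltr.injEq] at h4 h5
        obtain ⟨rfl, h7⟩ := h4
        exact absurd (by simpa using h5.1.symm) hc
  | cons s0 u0 ih =>
    rcases u with _ | ⟨s, u⟩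
    · simp only [List.nil_append, List.cons_append, List.cons.injEq] at h1 h2
      obtain ⟨rfl, rfl⟩ := h2
      subst h1
      rcases u' with _ | ⟨s', u'⟩
      · simp only [List.nil_append, List.cons_append, List.cons.injEq] at h4 h5
        have := h4.2.trans h5.2.symm
        simp at this
        exact absurd this hc
      · simp only [List.nil_append, List.cons_append, List.cons.injEq] at h4 h5
        obtain ⟨rfl, _⟩ := h5
        exact absurd (by simpa using h4.1) hne1
    · simp only [List.cons_append, List.cons.injEq] at h1 h2
      obtain ⟨rfl, h2⟩ := h2
      subst h1
      rcases u' with _ | ⟨s', u'⟩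
      · simp only [List.nil_append, List.cons_append, List.cons.injEq] at h4 h5
        obtain ⟨rfl, _⟩ := h5
        exact absurd (by simpa using h4.1.symm) hne2
      · simp only [List.cons_append, List.cons.injEq] at h4 h5
        obtain ⟨e, h7, h8⟩ := ih _ u u' rfl h2 h4.2 h5.2
        exact ⟨e, by rw [h7]; rfl, h8⟩

include hg in
theorem red_letter (u t : D Γ) (a c1 c2 : Ltr Γ) (hc : c1 ≠ c2) (h1 : a ≠ c1) (h2 : a ≠ c2)
    (e1 : EE ℓ (a.1⁻¹ * c1.1) (m + 1) a.1 c1.1) (e2 : EE ℓ (a.1⁻¹ * c2.1) (m + 1) a.1 c2.1)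
    (f1 : Fx g n q (u ++ ltr c1 :: t)) (f2 : Fx g n q (u ++ ltr c2 :: t)) : Fx g n q (u ++ ltr a :: t) := by
  intro c hcl
  obtain ⟨x, g1, u', a', b', t', g2, g3, g4, _⟩ := red_aux ℓ g m hg n q _ _ (RL_sim ℓ (a.1⁻¹ * c1.1)) _ _
    ⟨u, a, c1, t, rfl, rfl, e1⟩ f1 c hcl
  obtain ⟨x', g1', u'', a'', b'', t'', g2', g3', g4', _⟩ := red_aux ℓ g m hg n q _ _ (RL_sim ℓ (a.1⁻¹ * c2.1)) _ _
    ⟨u, a, c2, t, rfl, rfl, e2⟩ f2 c hcl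
  have hxx : x' = x := by rw [g1] at g1'; simpa using g1'.symm
  subst hxx
  obtain ⟨e, h7, h8⟩ := rep_unique u t c1 c2 hc _ _ (fun h => h1 (Subtype.ext (inv_mul_eq_one.1 h)))
    (fun h => h2 (Subtype.ext (inv_mul_eq_one.1 h))) _ _ _ _ _ _ _ _ _ g2 g3 g4 g2' g3' g4'
  have : e = a := by
    apply Subtype.ext
    rw [← mul_assoc] at h8
    exact mul_inv_eq_one.1 (mul_eq_right.1 h8.symm)
  rw [g1]
  have h9 : flat x' = flat c := by rw [h7, hcl, this]
  rw [flat_inj h9]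
end red

end Step2
end FrattiniProof


/-! ## Part 14: reduction to finitely many test points -/

set_option linter.all false

namespace FrattiniProof

namespace Step2

open Sym Cel

variable {Γ : Type} [Group Γ] [LinearOrder Γ] [Lab Γ]

theorem nl_dropLast (l : D Γ) : nl l ≤ nl l.dropLast + 1 := by
  rcases List.eq_nil_or_concat' l with rfl | ⟨u, s, rfl⟩
  · simp [nl]
  · simp only [List.dropLast_concat, nl_append]
    cases s <;> simp [nl]

theorem pigeon (m : ℕ) (l : D Γ) : (∃ u B b1 b2 T, l = u ++ bits B ++ bit b1 :: bit b2 :: T ∧ m + 1 ≤ B.length ∧ LF T) ∨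
    ∃ B T, l = bits B ++ T ∧ B.length ≤ m + 2 ∧ LF T ∧ T.length ≤ nl l * (m + 3) := by
  induction l with
  | nil => exact Or.inr ⟨[], [], rfl, by simp, fun b t => by simp, by simp⟩
  | cons s l ih =>
    rcases ih with ⟨u, B, b1, b2, T, rfl, h1, h2⟩ | ⟨B, T, rfl, h1, h2, h3⟩
    · exact Or.inl ⟨s :: u, B, b1, b2, T, rfl, h1, h2⟩
    · cases s with
      | bit b =>
        by_cases hB : B.length ≤ m + 1
        · exact Or.inr ⟨b :: B, T, rfl, by simpa using hB, h2, h3⟩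
        · left
          obtain ⟨B1, b2, rfl⟩ : ∃ B1 b2, B = B1 ++ [b2] := by
            rcases List.eq_nil_or_concat' B with rfl | ⟨u, s, rfl⟩
            · simp at hB
            · exact ⟨u, s, rfl⟩
          obtain ⟨B2, b1, rfl⟩ : ∃ B2 b1, B1 = B2 ++ [b1] := by
            rcases List.eq_nil_or_concat' B1 with rfl | ⟨u, s, rfl⟩
            · simp at hB
            · exact ⟨u, s, rfl⟩
          refine ⟨[], b :: B2, b1, b2, T, by simp [bits], ?_, h2⟩
          simp at hB ⊢; omega
      | ltr a =>
        refine Or.inr ⟨[], ltr a :: (bits B ++ T), rfl, by simp, fun b t => by simp, ?_⟩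
        simp only [nl, List.length_cons, List.length_append]
        have : (bits B : D Γ).length = B.length := by simp [bits]
        nlinarith

section red
variable {r : ℕ} (ℓ : Fin r → Γ) (g : Equiv.Perm (Om Γ)) (m : ℕ) (hg : SimOK ℓ g (m + 1)) (n : ℤ) (q : Fin 16)

include hg in
theorem red_small (Sm : Ltr Γ → Prop)
    (hN : ∀ l : D Γ, l.length ≤ (m + 2) + (m + 1) * (m + 3) → (∀ a, ltr a ∈ l → Sm a) → Fx g n q l) :
    ∀ (N : ℕ) (l : D Γ), l.length ≤ N → (∀ a, ltr a ∈ l → Sm a) → Fx g n q l := by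
  intro N
  induction N with
  | zero => exact fun l hl hs => hN l (by omega) hs
  | succ N ih =>
    intro l hl hs
    by_cases h1 : m + 2 ≤ nl l
    · rcases List.eq_nil_or_concat' l with rfl | ⟨u, s, rfl⟩
      · simp [nl] at h1
      · have h2 := nl_dropLast (u ++ [s])
        rw [List.dropLast_concat] at h2
        refine red_tail ℓ g m hg n q u [s] (by omega) (ih u ?_ fun a ha => hs a ?_)
        · simp at hl; exact hl
        · simp [ha]
    · rcases pigeon m l with ⟨u, B, b1, b2, T, rfl, h2, h3⟩ | ⟨B, T, h4, h2, h5, h3⟩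
      · refine red_bits ℓ g m hg n q u B b1 b2 T h3 h2 (ih _ ?_ fun a ha => hs a ?_) (ih _ ?_ fun a ha => hs a ?_)
        · simp only [List.length_append, List.length_cons] at hl ⊢; omega
        · simp only [List.mem_append, List.mem_cons] at ha ⊢; tauto
        · simp only [List.length_append, List.length_cons] at hl ⊢; omega
        · simp only [List.mem_append, List.mem_cons] at ha ⊢; tauto
      · refine hN l ?_ hs
        have : l.length = B.length + T.length := by rw [h4]; simp [bits]
        have h6 : nl l * (m + 3) ≤ (m + 1) * (m + 3) := Nat.mul_le_mul_right _ (by omega)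
        omega

include hg in
theorem red_all (Sm : Ltr Γ → Prop)
    (hrep : ∀ a, ¬ Sm a → ∃ c1 c2, Sm c1 ∧ Sm c2 ∧ c1 ≠ c2 ∧ EE ℓ (a.1⁻¹ * c1.1) (m + 1) a.1 c1.1 ∧
      EE ℓ (a.1⁻¹ * c2.1) (m + 1) a.1 c2.1)
    (hN : ∀ l : D Γ, l.length ≤ (m + 2) + (m + 1) * (m + 3) → (∀ a, ltr a ∈ l → Sm a) → Fx g n q l) :
    ∀ (l2 l1 : D Γ), (∀ a, ltr a ∈ l1 → Sm a) → Fx g n q (l1 ++ l2) := by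
  intro l2
  induction l2 with
  | nil => intro l1 h; rw [List.append_nil]; exact red_small ℓ g m hg n q Sm hN _ l1 le_rfl h
  | cons s l2 ih =>
    intro l1 h
    have key : (∀ a, s = ltr a → Sm a) → Fx g n q (l1 ++ s :: l2) := by
      intro hs
      have := ih (l1 ++ [s]) (by
        intro a ha
        rcases List.mem_append.1 ha with ha | ha
        · exact h a ha
        · exact hs a (List.mem_singleton.1 ha).symm)
      simpa using this
    cases s with
    | bit b => exact key (fun a ha => by simp at ha)
    | ltr a =>
      by_cases ha : Sm a
      · exact key (fun a' h' => by cases h'; exact ha)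
      · obtain ⟨c1, c2, s1, s2, hne, e1, e2⟩ := hrep a ha
        have aux : ∀ c, Sm c → Fx g n q (l1 ++ ltr c :: l2) := by
          intro c hc
          have := ih (l1 ++ [ltr c]) (by
            intro a ha
            rcases List.mem_append.1 ha with ha | ha
            · exact h a ha
            · have : a = c := by simpa using ha
              exact this ▸ hc)
          simpa using this
        exact red_letter ℓ g m hg n q l1 l2 a c1 c2 hne (fun h => ha (h ▸ s1)) (fun h => ha (h ▸ s2)) e1 e2 (aux c1 s1) (aux c2 s2)
end red

/-! ### positions -/

theorem AA_per (e : ℕ) (i k : ℤ) (hi : ¬ (2 : ℤ) ^ e ∣ i) : i + 2 ^ e * k ∈ AA ↔ i ∈ AA := by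
  have hp : (0 : ℤ) < 2 ^ e := by positivity
  have h0 : i % 2 ^ e ≠ 0 := fun h => hi (Int.dvd_of_emod_eq_zero h)
  have h1 : |i % 2 ^ e| < 2 ^ e := by
    rw [abs_of_nonneg (Int.emod_nonneg _ hp.ne')]; exact Int.emod_lt_of_pos _ hp
  have h2 := AA_shift e (i % 2 ^ e) (i / 2 ^ e) h0 h1
  have h3 := AA_shift e (i % 2 ^ e) (i / 2 ^ e + k) h0 h1
  rw [Int.emod_add_mul_ediv] at h2
  rw [mul_add, ← add_assoc, Int.emod_add_mul_ediv] at h3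
  rw [h2, h3]

theorem AA_window (e : ℕ) (he : Even e) (m n : ℤ) (hm : 0 ≤ m) (hme : 2 * m < 2 ^ e) :
    ∃ d, |n + d| ≤ 2 ^ (e + 1) + m ∧ ∀ i, |i - n| ≤ m → (i ∈ AA ↔ i + d ∈ AA) := by
  have hp : (0 : ℤ) < 2 ^ e := by positivity
  have h2p : (2 : ℤ) ^ (e + 1) = 2 ^ e * 2 := pow_succ _ _
  by_cases h : ∃ t : ℤ, |2 ^ e * t - n| ≤ m
  · obtain ⟨t, ht⟩ := h
    have hz : (2:ℤ) ^ (e + 1) ∉ AA := by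
      have := AA_odd (e + 1) 1 odd_one
      rw [mul_one] at this
      rw [this]
      exact fun h => (Nat.even_add_one.1 h) he
    obtain ⟨d, k, hd, hdd, hk⟩ : ∃ d k : ℤ, d = 2 ^ e * k ∧ (d = - (2 ^ e * t) ∨ d = - (2 ^ e * t) + 2 ^ (e + 1)) ∧
        (2 ^ e * t ∈ AA ↔ 2 ^ e * t + d ∈ AA) := by
      by_cases hq : 2 ^ e * t ∈ AA
      · refine ⟨_, -t, rfl, Or.inl (by ring), ?_⟩
        have : (2:ℤ) ^ e * t + 2 ^ e * (-t) = 0 := by ring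
        rw [this]
        exact ⟨fun _ => AA_zero, fun _ => hq⟩
      · refine ⟨_, -t + 2, rfl, Or.inr (by rw [h2p]; ring), ?_⟩
        have : (2:ℤ) ^ e * t + 2 ^ e * (-t + 2) = 2 ^ (e + 1) := by rw [h2p]; ring
        rw [this]
        exact ⟨fun h => absurd h hq, fun h => absurd h hz⟩
    refine ⟨d, ?_, ?_⟩
    · rw [abs_le] at ht ⊢
      rcases hdd with hd' | hd' <;> constructor <;> omega
    · intro i hi
      by_cases hdv : (2:ℤ) ^ e ∣ i
      · obtain ⟨s, rfl⟩ := hdv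
        have : s = t := by
          by_contra hne
          have h1 : 1 ≤ |s - t| := Int.one_le_abs (sub_ne_zero.2 hne)
          have h3 : |(2:ℤ) ^ e * s - 2 ^ e * t| = 2 ^ e * |s - t| := by
            rw [← mul_sub, abs_mul, abs_of_pos hp]
          have h4 : |(2:ℤ) ^ e * s - 2 ^ e * t| ≤ 2 * m := by
            rw [abs_le] at hi ht ⊢; constructor <;> omega
          nlinarith
        rw [this]; exact hk
      · rw [hd]; exact (AA_per e i k hdv).symm
  · refine ⟨2 ^ e * (-(n / 2 ^ e)), ?_, ?_⟩
    · have h1 := Int.emod_add_mul_ediv n (2 ^ e)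
      have h2 := Int.emod_nonneg n hp.ne'
      have h3 := Int.emod_lt_of_pos n hp
      have h4 : n + 2 ^ e * (-(n / 2 ^ e)) = n % 2 ^ e := by rw [mul_neg]; omega
      rw [h4, abs_of_nonneg h2]; omega
    · intro i hi
      refine (AA_per e i _ ?_).symm
      rintro ⟨s, rfl⟩
      exact h ⟨s, hi⟩

theorem Loc_word {r : ℕ} (ℓ : Fin r → Γ) {M : ℕ} (s : Fin M → Idx r) (w : List (Fin M × Bool)) :
    Loc (wordAct (fun i => gen ℓ (s i)) w) (2 * w.length) := by
  have mono : ∀ (h : Equiv.Perm (Om Γ)) (m m' : ℤ), m ≤ m' → Loc h m → Loc h m' := by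
    rintro h m m' hm ⟨h1, h2⟩
    exact ⟨fun n d hd => h1 n d fun i hi => hd i (hi.trans hm), fun x => (h2 x).trans hm⟩
  induction w with
  | nil =>
    simp only [wordAct, List.map_nil, List.prod_nil]
    exact ⟨fun n d _ b => (Zs_apply d (n, b)).symm, fun x => by simp⟩
  | cons a w ih =>
    have h1 : Loc (cond a.2 (gen ℓ (s a.1)) (gen ℓ (s a.1))⁻¹) 2 := by
      obtain ⟨m, h0, h1, h2⟩ := Loc_gen ℓ (s a.1)
      cases a.2
      · exact mono _ _ _ (by omega) (Loc_inv h0 h2)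
      · exact mono _ _ _ (by omega) h2
    have := Loc_mul (by norm_num) (by positivity) h1 ih
    have h3 : wordAct (fun i => gen ℓ (s i)) (a :: w) = (cond a.2 (gen ℓ (s a.1)) (gen ℓ (s a.1))⁻¹) * wordAct (fun i => gen ℓ (s i)) w := by
      simp [wordAct]
    rw [h3]
    refine mono _ _ _ ?_ this
    push_cast [List.length_cons]; omega

theorem Loc_fix (g : Equiv.Perm (Om Γ)) (m : ℤ) (hm : 0 ≤ m) (hg : Loc g m) (e : ℕ) (he : Even e) (hme : 2 * m < 2 ^ e)
    (h : ∀ n : ℤ, |n| ≤ 2 ^ (e + 1) + m → ∀ b, g (n, b) = (n, b)) : g = 1 := by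
  ext1 ⟨n, b⟩
  obtain ⟨d, h1, h2⟩ := AA_window e he m n hm hme
  have h3 := hg.1 n d h2 b
  rw [h _ h1 b, Zs_apply] at h3
  simp only [Prod.mk.injEq] at h3
  refine Prod.ext ?_ h3.2.symm
  have := h3.1
  simp only [Equiv.Perm.coe_one, id]
  omega

/-- A word acting trivially on the bounded test points acts trivially. -/
theorem word_trivial {r : ℕ} (ℓ : Fin r → Γ) {M : ℕ} (s : Fin M → Idx r) (w : List (Fin M × Bool)) (Sm : Ltr Γ → Prop) (m e : ℕ)
    (hm : m = 3 * w.length) (he : Even e) (hme : 4 * w.length < 2 ^ e)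
    (hrep : ∀ a, ¬ Sm a → ∃ c1 c2, Sm c1 ∧ Sm c2 ∧ c1 ≠ c2 ∧ EE ℓ (a.1⁻¹ * c1.1) (m + 1) a.1 c1.1 ∧
      EE ℓ (a.1⁻¹ * c2.1) (m + 1) a.1 c2.1)
    (h : ∀ (n : ℤ) (q : Fin 16) (c : Cel Γ), |n| ≤ 2 ^ (e + 1) + 2 * w.length →
      (flat c).length ≤ (m + 2) + (m + 1) * (m + 3) → (∀ a, ltr a ∈ flat c → Sm a) →
      wordAct (fun i => gen ℓ (s i)) w (n, q, c) = (n, q, c)) :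
    wordAct (fun i => gen ℓ (s i)) w = 1 := by
  refine Loc_fix _ (2 * w.length) (by positivity) (Loc_word ℓ s w) e he ?_ ?_
  · have : ((4 * w.length : ℕ) : ℤ) < ((2 ^ e : ℕ) : ℤ) := by exact_mod_cast hme
    push_cast at this; omega
  · rintro n hn ⟨q, c⟩
    subst hm
    refine red_all ℓ _ _ (SimOK_word ℓ s w) n q Sm hrep ?_ (flat c) [] (by simp) c (by simp)
    rintro l h1 h2 c' rfl
    exact h n q c' hn h1 h2

end Step2
end FrattiniProof


/-! ## Part 15: codes for points and the action on codes -/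

set_option linter.all false

namespace FrattiniProof

namespace Step2

open Sym Cel

variable {Γ : Type} [Group Γ] [LinearOrder Γ] [Lab Γ]

/-- words -/
abbrev Wd (r : ℕ) := List (Fin r × Bool)
/-- symbol codes -/
abbrev CS (r : ℕ) := Bool ⊕ Wd r
/-- list codes -/
abbrev CL (r : ℕ) := List (CS r)

section codes
variable {r : ℕ} (ℓ : Fin r → Γ) (sg : Wd r → ℤ) (hsg : ∀ w, sg w = sgnCmp (wp ℓ w) 1)
  (lw : Wd r → Bool) (hlw : ∀ w, lw w = Lab.lab (wp ℓ w))

def DS : CS r → Sym Γ → Prop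
  | Sum.inl b, bit b' => b = b'
  | Sum.inr w, ltr a => wp ℓ w = a.1
  | _, _ => False

def DL (l : CL r) (d : D Γ) : Prop := List.Forall₂ (DS ℓ) l d

theorem DL_nil (l : CL r) : DL ℓ l [] ↔ l = [] := List.forall₂_nil_right_iff

theorem DL_bit (l : CL r) (b : Bool) (d : D Γ) : DL ℓ l (bit b :: d) ↔ ∃ l', l = Sum.inl b :: l' ∧ DL ℓ l' d := by
  constructor
  · intro h
    rcases h with _ | ⟨h1, h2⟩
    rename_i c l'
    rcases c with b' | w
    · obtain rfl : b' = b := h1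
      exact ⟨l', rfl, h2⟩
    · exact absurd h1 id
  · rintro ⟨l', rfl, h⟩
    exact List.Forall₂.cons rfl h

theorem DL_ltr (l : CL r) (a : Ltr Γ) (d : D Γ) : DL ℓ l (ltr a :: d) ↔ ∃ w l', l = Sum.inr w :: l' ∧ wp ℓ w = a.1 ∧ DL ℓ l' d := by
  constructor
  · intro h
    rcases h with _ | ⟨h1, h2⟩
    rename_i c l'
    rcases c with b' | w
    · exact absurd h1 id
    · exact ⟨w, l', rfl, h1, h2⟩
  · rintro ⟨w, l', rfl, h, h'⟩
    exact List.Forall₂.cons h h'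

def kd (l : CL r) : ℕ :=
  match l.head? with
  | none => 0
  | some (Sum.inl b) => cond b 2 1
  | some (Sum.inr w) => if sg w = -1 then 3 else 4

def hw (l : CL r) : Wd r :=
  match l.head? with
  | some (Sum.inr w) => w
  | _ => []

theorem kd_nil : kd sg [] = 0 := rfl
theorem kd_ff (l : CL r) : kd sg (Sum.inl false :: l) = 1 := rfl
theorem kd_tt (l : CL r) : kd sg (Sum.inl true :: l) = 2 := rfl

include hsg in
theorem kd_lt (w : Wd r) (l : CL r) (h : wp ℓ w < 1) : kd sg (Sum.inr w :: l) = 3 := by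
  show (if sg w = -1 then 3 else 4) = 3
  rw [if_pos]
  rw [hsg]; exact sgnCmp_eq_neg.2 h

include hsg in
theorem kd_gt (w : Wd r) (l : CL r) (h : 1 < wp ℓ w) : kd sg (Sum.inr w :: l) = 4 := by
  show (if sg w = -1 then 3 else 4) = 4
  rw [if_neg]
  rw [hsg, sgnCmp_eq_neg]; exact h.not_gt

/-! ### lists -/

def cinsD (w : Wd r) (d : CL r) : CL r :=
  if sg w = 0 then Sum.inl true :: Sum.inl false :: d else if sg w = -1 then Sum.inr w :: d else Sum.inl true :: Sum.inr w :: d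

def cgetD (l : CL r) : Option (Wd r × CL r) :=
  if kd sg l = 3 then some (hw l, l.tail)
  else if kd sg l = 2 then
    if kd sg l.tail = 1 then some ([], l.tail.tail)
    else if kd sg l.tail = 4 then some (hw l.tail, l.tail.tail) else none
  else none

include hsg in
theorem cinsD_spec (w : Wd r) (l : CL r) (d : D Γ) (h : DL ℓ l d) : DL ℓ (cinsD sg w l) (insD (wp ℓ w) d) := by
  unfold cinsD
  rw [hsg]
  rcases three (wp ℓ w) with h1 | ⟨a, ha, h1⟩ | ⟨a, ha, h1⟩
  · rw [if_pos (sgnCmp_eq_zero.2 h1), h1, insD_one]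
    exact (DL_bit ..).2 ⟨_, rfl, (DL_bit ..).2 ⟨_, rfl, h⟩⟩
  · rw [← ha, if_neg (mt sgnCmp_eq_zero.1 h1.ne), if_pos (sgnCmp_eq_neg.2 h1), insD_lt a h1]
    exact (DL_ltr ..).2 ⟨_, _, rfl, ha.symm, h⟩
  · rw [← ha, if_neg (mt sgnCmp_eq_zero.1 h1.ne'), if_neg (mt sgnCmp_eq_neg.1 h1.not_gt), insD_gt a h1]
    exact (DL_bit ..).2 ⟨_, rfl, (DL_ltr ..).2 ⟨_, _, rfl, ha.symm, h⟩⟩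

include hsg in
theorem cgetD_spec (l : CL r) (d : D Γ) (h : DL ℓ l d) : (cgetD sg l = none ∧ getD d = none) ∨
    ∃ w l' d', cgetD sg l = some (w, l') ∧ getD d = some (wp ℓ w, d') ∧ DL ℓ l' d' := by
  rcases d with _ | ⟨b | a, d⟩
  · obtain rfl := (DL_nil ..).1 h
    exact Or.inl ⟨rfl, rfl⟩
  · obtain ⟨l1, rfl, h1⟩ := (DL_bit ..).1 h
    cases b
    · exact Or.inl ⟨rfl, rfl⟩
    · rcases d with _ | ⟨b | a, d⟩
      · obtain rfl := (DL_nil ..).1 h1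
        exact Or.inl ⟨rfl, rfl⟩
      · obtain ⟨l2, rfl, h2⟩ := (DL_bit ..).1 h1
        cases b
        · exact Or.inr ⟨[], l2, d, rfl, rfl, h2⟩
        · exact Or.inl ⟨rfl, rfl⟩
      · obtain ⟨w, l2, rfl, ha, h2⟩ := (DL_ltr ..).1 h1
        rcases pn a with h3 | h3
        · have h4 : getD (bit true :: ltr a :: d) = some (a.1, d) := if_pos h3
          rw [h4, ← ha]
          refine Or.inr ⟨w, l2, d, ?_, rfl, h2⟩
          unfold cgetD
          simp only [kd_tt, List.tail_cons, kd_gt ℓ sg hsg w l2 (ha ▸ h3)]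
          rfl
        · have h4 : getD (bit true :: ltr a :: d) = none := if_neg h3.not_gt
          rw [h4]
          refine Or.inl ⟨?_, rfl⟩
          unfold cgetD
          simp only [kd_tt, List.tail_cons, kd_lt ℓ sg hsg w l2 (ha ▸ h3)]
          rfl
  · obtain ⟨w, l2, rfl, ha, h2⟩ := (DL_ltr ..).1 h
    rcases pn a with h3 | h3
    · have h4 : getD (ltr a :: d) = none := if_neg h3.not_gt
      rw [h4]
      refine Or.inl ⟨?_, rfl⟩
      unfold cgetD
      simp only [kd_gt ℓ sg hsg w l2 (ha ▸ h3)]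
      rfl
    · have h4 : getD (ltr a :: d) = some (a.1, d) := if_pos h3
      rw [h4, ← ha]
      refine Or.inr ⟨w, l2, d, ?_, rfl, h2⟩
      unfold cgetD
      simp only [kd_lt ℓ sg hsg w l2 (ha ▸ h3)]
      rfl

/-- value of one signed generator -/
def lv (x : Fin r × Bool) : Γ := cond x.2 (ℓ x.1) (ℓ x.1)⁻¹

theorem wp_cons (x : Fin r × Bool) (w : Wd r) : wp ℓ (x :: w) = lv ℓ x * wp ℓ w := by simp [wp, lv]

def cMD (x : Fin r × Bool) (l : CL r) : CL r :=
  (cgetD sg l).elim l fun y => cinsD sg (x :: y.1) y.2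

include hsg in
theorem cMD_spec (x : Fin r × Bool) (l : CL r) (d : D Γ) (h : DL ℓ l d) : DL ℓ (cMD sg x l) (MD (lv ℓ x) d) := by
  unfold cMD
  rcases cgetD_spec ℓ sg hsg l d h with ⟨h1, h2⟩ | ⟨w, l', d', h1, h2, h3⟩
  · rw [h1, MD_none _ _ h2]; exact h
  · rw [h1]
    rw [hgetD] at h2
    rw [← h2, MD_ins, ← wp_cons]
    exact cinsD_spec ℓ sg hsg _ _ _ h3

def isb (s : CS r) : Bool := s.isLeft
def lws (s : CS r) : Bool := lw (hw [s])

def ccstep (x : Fin r × Bool) (p : CL r × CL r) (s : CS r) : CL r × CL r :=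
  (s :: p.1, s :: (if isb s = true then p.2 else if lws lw s = true then cMD sg x p.1 else p.1))

def ccFF (x : Fin r × Bool) (l : CL r) : CL r := (l.foldr (fun s p => ccstep sg lw x p s) ([], [])).2

include hsg hlw in
theorem ccFF_spec (x : Fin r × Bool) (l : CL r) (d : D Γ) (h : DL ℓ l d) : DL ℓ (ccFF sg lw x l) (cF (MD (lv ℓ x)) d) := by
  have h1 : ∀ l : CL r, (l.foldr (fun s p => ccstep sg lw x p s) ([], [])).1 = l := by
    intro l
    induction l with
    | nil => rfl
    | cons s l ih => exact congrArg (s :: ·) ih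
  induction d generalizing l with
  | nil => obtain rfl := (DL_nil ..).1 h; exact List.Forall₂.nil
  | cons s d ih =>
    rcases s with b | a
    · obtain ⟨l2, rfl, h2⟩ := (DL_bit ..).1 h
      exact (DL_bit ..).2 ⟨_, rfl, ih l2 h2⟩
    · obtain ⟨w, l2, rfl, ha, h2⟩ := (DL_ltr ..).1 h
      refine (DL_ltr ..).2 ⟨w, if lw w = true then cMD sg x l2 else l2, ?_, ha, ?_⟩
      · have e : ccFF sg lw x (Sum.inr w :: l2) = Sum.inr w :: (if lw w = true then
            cMD sg x (l2.foldr (fun s p => ccstep sg lw x p s) ([], [])).1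
            else (l2.foldr (fun s p => ccstep sg lw x p s) ([], [])).1) := rfl
        rw [e, h1]
      · rw [hlw, ha]
        split_ifs
        · exact cMD_spec ℓ sg hsg x l2 d h2
        · exact h2

/-! ### blocks -/

abbrev CBk (r : ℕ) := Fin 16 × CL r

def BL (x : CBk r) (y : Blk Γ) : Prop := x.1 = y.1 ∧ DL ℓ x.2 (flat y.2)

def cinsB (w : Wd r) (d : CL r) : CBk r :=
  if sg w = 0 then (4, Sum.inl true :: d) else if sg w = -1 then (4, Sum.inr w :: d) else (5, Sum.inr w :: d)

def cgetB (x : CBk r) : Option (Wd r × CL r) :=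
  if x.1 = 4 then
    if kd sg x.2 = 2 then some ([], x.2.tail) else if kd sg x.2 = 3 then some (hw x.2, x.2.tail) else none
  else if x.1 = 5 then
    if kd sg x.2 = 4 then some (hw x.2, x.2.tail) else none
  else none

include hsg in
theorem cinsB_spec (w : Wd r) (l : CL r) (d : D Γ) (h : DL ℓ l d) : BL ℓ (cinsB sg w l) (insB (wp ℓ w) d) := by
  unfold cinsB
  rw [hsg]
  rcases three (wp ℓ w) with h1 | ⟨a, ha, h1⟩ | ⟨a, ha, h1⟩
  · rw [if_pos (sgnCmp_eq_zero.2 h1), h1, insB_one]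
    exact ⟨rfl, (DL_bit ..).2 ⟨_, rfl, h⟩⟩
  · rw [← ha, if_neg (mt sgnCmp_eq_zero.1 h1.ne), if_pos (sgnCmp_eq_neg.2 h1), insB_lt a h1]
    exact ⟨rfl, (DL_ltr ..).2 ⟨_, _, rfl, ha.symm, h⟩⟩
  · rw [← ha, if_neg (mt sgnCmp_eq_zero.1 h1.ne'), if_neg (mt sgnCmp_eq_neg.1 h1.not_gt), insB_gt a h1]
    exact ⟨rfl, (DL_ltr ..).2 ⟨_, _, rfl, ha.symm, h⟩⟩

include hsg in
theorem cgetB_spec (x : CBk r) (y : Blk Γ) (h : BL ℓ x y) : (cgetB sg x = none ∧ getB y = none) ∨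
    ∃ w l' d', cgetB sg x = some (w, l') ∧ getB y = some (wp ℓ w, d') ∧ DL ℓ l' d' := by
  obtain ⟨q, l⟩ := x
  obtain ⟨q', c⟩ := y
  obtain ⟨hq, h⟩ := h
  dsimp only at hq h
  subst hq
  rcases c with _ | ⟨a, d⟩ | d
  · obtain rfl := (DL_nil ..).1 h
    refine Or.inl ⟨?_, rfl⟩
    unfold cgetB; split_ifs <;> first | rfl | simp_all [kd_nil]
  · obtain ⟨w, l2, rfl, ha, h2⟩ := (DL_ltr ..).1 h
    have h45 : ¬ ((5 : Fin 16) = 4) := by decide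
    have e : getB ((q, lt a d) : Blk Γ) = if q = 4 ∧ a.1 < 1 ∨ q = 5 ∧ 1 < a.1 then some (a.1, d) else none := rfl
    rcases pn a with h1 | h1
    · have hk := kd_gt ℓ sg hsg w l2 (ha ▸ h1)
      by_cases h5 : q = 5
      · subst h5
        rw [e, if_pos (Or.inr ⟨rfl, h1⟩), ← ha]
        refine Or.inr ⟨w, l2, d, ?_, rfl, h2⟩
        unfold cgetB
        simp only [h45, if_false, if_true, hk]; rfl
      · refine Or.inl ⟨?_, ?_⟩
        · unfold cgetB; simp [hk, h5]
        · rw [e, if_neg]; simp [h5, h1.not_gt]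
    · have hk := kd_lt ℓ sg hsg w l2 (ha ▸ h1)
      by_cases h4 : q = 4
      · subst h4
        rw [e, if_pos (Or.inl ⟨rfl, h1⟩), ← ha]
        refine Or.inr ⟨w, l2, d, ?_, rfl, h2⟩
        unfold cgetB
        simp only [if_true, hk]; rfl
      · refine Or.inl ⟨?_, ?_⟩
        · unfold cgetB; simp [hk, h4]
        · rw [e, if_neg]; simp [h4, h1.not_gt]
  · obtain ⟨l2, rfl, h2⟩ := (DL_bit ..).1 h
    have e : getB ((q, ce d) : Blk Γ) = if q = 4 then some (1, d) else none := rfl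
    by_cases h4 : q = 4
    · subst h4
      exact Or.inr ⟨[], l2, d, rfl, rfl, h2⟩
    · rw [e, if_neg h4]
      refine Or.inl ⟨?_, rfl⟩
      unfold cgetB; simp [kd_tt, h4]

def cLB (x : Fin r × Bool) (y : CBk r) : CBk r :=
  (cgetB sg y).elim y fun z => cinsB sg (x :: z.1) z.2

include hsg in
theorem cLB_spec (x : Fin r × Bool) (y : CBk r) (z : Blk Γ) (h : BL ℓ y z) : BL ℓ (cLB sg x y) (LB (lv ℓ x) z) := by
  unfold cLB
  rcases cgetB_spec ℓ sg hsg y z h with ⟨h1, h2⟩ | ⟨w, l', d', h1, h2, h3⟩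
  · rw [h1, LB_none _ _ h2]; exact h
  · rw [h1]
    rw [hgetB] at h2
    rw [← h2, LB_ins, ← wp_cons]
    exact cinsB_spec ℓ sg hsg _ _ _ h3

def cCB (x : Fin r × Bool) (y : CBk r) : CBk r := if y.1 = 5 then (y.1, ccFF sg lw x y.2) else y

include hsg hlw in
theorem cCB_spec (x : Fin r × Bool) (y : CBk r) (z : Blk Γ) (h : BL ℓ y z) : BL ℓ (cCB sg lw x y) (CB (lv ℓ x) z) := by
  obtain ⟨q, l⟩ := y
  obtain ⟨q', c⟩ := z
  obtain ⟨hq, h⟩ := h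
  dsimp only at hq h
  subst hq
  unfold cCB
  by_cases h5 : q = 5
  · subst h5
    obtain ⟨c', h1, h2⟩ := CB_flat (lv ℓ x) c
    rw [h1]
    refine ⟨rfl, ?_⟩
    dsimp only
    rw [h2]
    exact ccFF_spec ℓ sg hsg lw hlw x l _ h
  · rw [if_neg h5, CB_out _ _ _ h5]
    exact ⟨rfl, h⟩

/-- the elementary box transformation -/
def cX (y : CBk r) : CBk r :=
  if y.1 = 0 then
    if kd sg y.2 = 2 then
      if kd sg y.2.tail = 1 then (0, Sum.inl true :: y.2.tail.tail) else (1, y.2.tail)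
    else y
  else if y.1 = 1 then (2, y.2)
  else if y.1 = 2 then
    if kd sg y.2 = 2 then (3, Sum.inl true :: Sum.inl false :: y.2.tail) else (3, y.2)
  else if y.1 = 3 then (3, Sum.inl true :: y.2)
  else y

def cXI (y : CBk r) : CBk r :=
  if y.1 = 3 then
    if kd sg y.2 = 2 then
      if kd sg y.2.tail = 1 then (2, Sum.inl true :: y.2.tail.tail) else (3, y.2.tail)
    else (2, y.2)
  else if y.1 = 2 then (1, y.2)
  else if y.1 = 0 then
    if kd sg y.2 = 2 then (0, Sum.inl true :: Sum.inl false :: y.2.tail) else (0, y.2)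
  else if y.1 = 1 then (0, Sum.inl true :: y.2)
  else y

include hsg in
theorem kd_ltr (w : Wd r) (l : CL r) (hw : wp ℓ w ≠ 1) : kd sg (Sum.inr w :: l) ≠ 1 ∧ kd sg (Sum.inr w :: l) ≠ 2 := by
  rcases lt_or_gt_of_ne hw with h1 | h1
  · rw [kd_lt ℓ sg hsg w l h1]; decide
  · rw [kd_gt ℓ sg hsg w l h1]; decide

theorem box4 (q : Fin 16) : (q = 0 ∨ q = 1 ∨ q = 2 ∨ q = 3) ∨ (q ≠ 0 ∧ q ≠ 1 ∧ q ≠ 2 ∧ q ≠ 3) := by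
  revert q; decide

include hsg in
theorem cX_spec (y : CBk r) (z : Blk Γ) (h : BL ℓ y z) : BL ℓ (cX sg y) (X0F z) := by
  obtain ⟨q, l⟩ := y
  obtain ⟨q', c⟩ := z
  obtain ⟨hq, h⟩ := h
  dsimp only at hq h
  subst hq
  rcases box4 q with hq | ⟨h0, h1, h2, h3⟩
  · rcases c with _ | ⟨a, d⟩ | (_ | ⟨(_ | _) | a, d⟩)
    · obtain rfl := (DL_nil ..).1 h
      rcases hq with rfl | rfl | rfl | rfl <;>
        first | exact ⟨rfl, h⟩ | exact ⟨rfl, (DL_bit ..).2 ⟨_, rfl, h⟩⟩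
    · obtain ⟨w, l2, rfl, ha, h''⟩ := (DL_ltr ..).1 h
      have hk1 := (kd_ltr ℓ sg hsg w l2 (ha ▸ a.2)).2
      rcases hq with rfl | rfl | rfl | rfl
      · have e : cX sg (0, Sum.inr w :: l2) = (0, Sum.inr w :: l2) := if_neg hk1
        rw [e]; exact ⟨rfl, h⟩
      · exact ⟨rfl, h⟩
      · have e : cX sg (2, Sum.inr w :: l2) = (3, Sum.inr w :: l2) := if_neg hk1
        rw [e]; exact ⟨rfl, h⟩
      · exact ⟨rfl, (DL_bit ..).2 ⟨_, rfl, h⟩⟩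
    · obtain ⟨l2, rfl, h'⟩ := (DL_bit ..).1 h
      obtain rfl := (DL_nil ..).1 h'
      rcases hq with rfl | rfl | rfl | rfl <;>
        first | exact ⟨rfl, h⟩ | exact ⟨rfl, h'⟩ | exact ⟨rfl, (DL_bit ..).2 ⟨_, rfl, h⟩⟩ |
          exact ⟨rfl, (DL_bit ..).2 ⟨_, rfl, (DL_bit ..).2 ⟨_, rfl, h'⟩⟩⟩
    · obtain ⟨l2, rfl, h'⟩ := (DL_bit ..).1 h
      obtain ⟨l3, rfl, h''⟩ := (DL_bit ..).1 h'
      rcases hq with rfl | rfl | rfl | rfl <;>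
        first | exact ⟨rfl, h⟩ | exact ⟨rfl, (DL_bit ..).2 ⟨_, rfl, h''⟩⟩ | exact ⟨rfl, (DL_bit ..).2 ⟨_, rfl, h⟩⟩ |
          exact ⟨rfl, (DL_bit ..).2 ⟨_, rfl, (DL_bit ..).2 ⟨_, rfl, h'⟩⟩⟩
    · obtain ⟨l2, rfl, h'⟩ := (DL_bit ..).1 h
      obtain ⟨l3, rfl, h''⟩ := (DL_bit ..).1 h'
      rcases hq with rfl | rfl | rfl | rfl <;>
        first | exact ⟨rfl, h⟩ | exact ⟨rfl, h'⟩ | exact ⟨rfl, (DL_bit ..).2 ⟨_, rfl, h⟩⟩ |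
          exact ⟨rfl, (DL_bit ..).2 ⟨_, rfl, (DL_bit ..).2 ⟨_, rfl, h'⟩⟩⟩
    · obtain ⟨l2, rfl, h'⟩ := (DL_bit ..).1 h
      obtain ⟨w, l3, rfl, ha, h''⟩ := (DL_ltr ..).1 h'
      have hk1 := (kd_ltr ℓ sg hsg w l3 (ha ▸ a.2)).1
      rcases hq with rfl | rfl | rfl | rfl
      · have e : cX sg (0, Sum.inl true :: Sum.inr w :: l3) = (1, Sum.inr w :: l3) := if_neg hk1
        rw [e]; exact ⟨rfl, h'⟩
      · exact ⟨rfl, h⟩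
      · exact ⟨rfl, (DL_bit ..).2 ⟨_, rfl, (DL_bit ..).2 ⟨_, rfl, h'⟩⟩⟩
      · exact ⟨rfl, (DL_bit ..).2 ⟨_, rfl, h⟩⟩
  · simp only [cX, X0F, h0, h1, h2, h3, if_false]; exact ⟨rfl, h⟩

include hsg in
theorem cXI_spec (y : CBk r) (z : Blk Γ) (h : BL ℓ y z) : BL ℓ (cXI sg y) (X0I z) := by
  obtain ⟨q, l⟩ := y
  obtain ⟨q', c⟩ := z
  obtain ⟨hq, h⟩ := h
  dsimp only at hq h
  subst hq
  rcases box4 q with hq | ⟨h0, h1, h2, h3⟩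
  · rcases c with _ | ⟨a, d⟩ | (_ | ⟨(_ | _) | a, d⟩)
    · obtain rfl := (DL_nil ..).1 h
      rcases hq with rfl | rfl | rfl | rfl <;>
        first | exact ⟨rfl, h⟩ | exact ⟨rfl, (DL_bit ..).2 ⟨_, rfl, h⟩⟩
    · obtain ⟨w, l2, rfl, ha, h''⟩ := (DL_ltr ..).1 h
      have hk1 := (kd_ltr ℓ sg hsg w l2 (ha ▸ a.2)).2
      rcases hq with rfl | rfl | rfl | rfl
      · have e : cXI sg (0, Sum.inr w :: l2) = (0, Sum.inr w :: l2) := if_neg hk1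
        rw [e]; exact ⟨rfl, h⟩
      · exact ⟨rfl, (DL_bit ..).2 ⟨_, rfl, h⟩⟩
      · exact ⟨rfl, h⟩
      · have e : cXI sg (3, Sum.inr w :: l2) = (2, Sum.inr w :: l2) := if_neg hk1
        rw [e]; exact ⟨rfl, h⟩
    · obtain ⟨l2, rfl, h'⟩ := (DL_bit ..).1 h
      obtain rfl := (DL_nil ..).1 h'
      rcases hq with rfl | rfl | rfl | rfl <;>
        first | exact ⟨rfl, h⟩ | exact ⟨rfl, h'⟩ | exact ⟨rfl, (DL_bit ..).2 ⟨_, rfl, h⟩⟩ |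
          exact ⟨rfl, (DL_bit ..).2 ⟨_, rfl, (DL_bit ..).2 ⟨_, rfl, h'⟩⟩⟩
    · obtain ⟨l2, rfl, h'⟩ := (DL_bit ..).1 h
      obtain ⟨l3, rfl, h''⟩ := (DL_bit ..).1 h'
      rcases hq with rfl | rfl | rfl | rfl <;>
        first | exact ⟨rfl, h⟩ | exact ⟨rfl, (DL_bit ..).2 ⟨_, rfl, h''⟩⟩ | exact ⟨rfl, (DL_bit ..).2 ⟨_, rfl, h⟩⟩ |
          exact ⟨rfl, (DL_bit ..).2 ⟨_, rfl, (DL_bit ..).2 ⟨_, rfl, h'⟩⟩⟩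
    · obtain ⟨l2, rfl, h'⟩ := (DL_bit ..).1 h
      obtain ⟨l3, rfl, h''⟩ := (DL_bit ..).1 h'
      rcases hq with rfl | rfl | rfl | rfl <;>
        first | exact ⟨rfl, h⟩ | exact ⟨rfl, h'⟩ | exact ⟨rfl, (DL_bit ..).2 ⟨_, rfl, h⟩⟩ |
          exact ⟨rfl, (DL_bit ..).2 ⟨_, rfl, (DL_bit ..).2 ⟨_, rfl, h'⟩⟩⟩
    · obtain ⟨l2, rfl, h'⟩ := (DL_bit ..).1 h
      obtain ⟨w, l3, rfl, ha, h''⟩ := (DL_ltr ..).1 h'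
      have hk1 := (kd_ltr ℓ sg hsg w l3 (ha ▸ a.2)).1
      rcases hq with rfl | rfl | rfl | rfl
      · exact ⟨rfl, (DL_bit ..).2 ⟨_, rfl, (DL_bit ..).2 ⟨_, rfl, h'⟩⟩⟩
      · exact ⟨rfl, (DL_bit ..).2 ⟨_, rfl, h⟩⟩
      · exact ⟨rfl, h⟩
      · have e : cXI sg (3, Sum.inl true :: Sum.inr w :: l3) = (3, Sum.inr w :: l3) := if_neg hk1
        rw [e]; exact ⟨rfl, h'⟩
  · simp only [cXI, X0I, h0, h1, h2, h3, if_false]; exact ⟨rfl, h⟩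

def cXX (b : Bool) (y : CBk r) : CBk r :=
  ((cond b (cX sg (y.1 - 4, y.2)) (cXI sg (y.1 - 4, y.2))).1 + 4,
    (cond b (cX sg (y.1 - 4, y.2)) (cXI sg (y.1 - 4, y.2))).2)

include hsg in
theorem cXX_spec (b : Bool) (y : CBk r) (z : Blk Γ) (h : BL ℓ y z) : BL ℓ (cXX sg b y) ((cond b (XX 4) (XX 4)⁻¹ : Equiv.Perm (Blk Γ)) z) := by
  have h1 : BL ℓ (y.1 - 4, y.2) (z.1 - 4, z.2) := ⟨congrArg (· - 4) h.1, h.2⟩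
  cases b
  · have h2 := cXI_spec ℓ sg hsg _ _ h1
    exact ⟨congrArg (· + 4) h2.1, h2.2⟩
  · have h2 := cX_spec ℓ sg hsg _ _ h1
    exact ⟨congrArg (· + 4) h2.1, h2.2⟩

end codes

end Step2
end FrattiniProof


/-! ## Part 16: codes of points: generators, comparison, decoding -/

set_option linter.all false

namespace FrattiniProof

namespace Step2

open Sym Cel

variable {Γ : Type} [Group Γ] [LinearOrder Γ] [Lab Γ]

/-! ### the Toeplitz set -/

def inN (n : ℕ) : Prop := n = 0 ∨ ∃ j < n, j % 2 = 0 ∧ n % 2 ^ (j + 1) = 2 ^ j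
def inA (p : ℕ × ℕ) : Prop := inN ((p.1 - p.2) + (p.2 - p.1))

theorem inN_nat (n : ℕ) : inN n ↔ (n : ℤ) ∈ AA := by
  unfold inN
  by_cases h0 : n = 0
  · subst h0; simp [AA_zero]
  · obtain ⟨j, m, hm, h⟩ := Nat.exists_eq_two_pow_mul_odd h0
    have hA : ((n : ℤ) ∈ AA) ↔ Even j := by
      rw [h]; push_cast; exact AA_odd j m (by exact_mod_cast hm)
    rw [hA]
    constructor
    · rintro (h1 | ⟨i, hi, h2, h3⟩)
      · exact absurd h1 h0
      · have h4 : (n : ℤ) ∈ AA := by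
          have := Nat.div_add_mod n (2 ^ (i + 1))
          rw [h3] at this
          have h5 : (n : ℤ) = 2 ^ i * (2 * (n / 2 ^ (i + 1) : ℕ) + 1) := by
            have h6 : n = 2 ^ i * (2 * (n / 2 ^ (i + 1)) + 1) := by
              conv_lhs => rw [← this]
              ring
            exact_mod_cast h6
          rw [h5]
          exact (AA_odd i _ (odd_two_mul_add_one _)).2 (Nat.even_iff.2 h2)
        exact hA.1 h4
    · intro h1
      refine Or.inr ⟨j, ?_, Nat.even_iff.1 h1, ?_⟩
      · have h2 : 2 ^ j ≤ n := Nat.le_of_dvd (Nat.pos_of_ne_zero h0) ⟨m, h⟩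
        exact lt_of_lt_of_le Nat.lt_two_pow_self h2
      · obtain ⟨k, rfl⟩ := hm
        rw [h, show 2 ^ j * (2 * k + 1) = 2 ^ j + 2 ^ (j + 1) * k by ring, Nat.add_mul_mod_self_left]
        exact Nat.mod_eq_of_lt (Nat.pow_lt_pow_right (by norm_num) (by omega))

theorem AA_neg (n : ℤ) : -n ∈ AA ↔ n ∈ AA := by
  simp [AA, padicValInt]

theorem inA_spec (p : ℕ × ℕ) : inA p ↔ iv p ∈ AA := by
  unfold inA
  rw [inN_nat]
  rcases le_total p.1 p.2 with h | h
  · have : (((p.1 - p.2) + (p.2 - p.1) : ℕ) : ℤ) = - iv p := by unfold iv; omega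
    rw [this, AA_neg]
  · have : (((p.1 - p.2) + (p.2 - p.1) : ℕ) : ℤ) = iv p := by unfold iv; omega
    rw [this]

open Classical in
noncomputable def bst (b : Bool) (p : ℕ × ℕ) : Bool := cond b true (decide (inA p))

theorem bst_spec (b : Bool) (p : ℕ × ℕ) : bst b p = true ↔ iv p ∈ bs b := by
  cases b
  · simp [bst, bs, inA_spec]
  · simp [bst, bs]

abbrev CO (r : ℕ) := (ℕ × ℕ) × CBk r

section codes
variable {r : ℕ} (ℓ : Fin r → Γ) (sg : Wd r → ℤ) (hsg : ∀ w, sg w = sgnCmp (wp ℓ w) 1)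
  (lw : Wd r → Bool) (hlw : ∀ w, lw w = Lab.lab (wp ℓ w))

def DO (c : CO r) (p : Om Γ) : Prop := iv c.1 = p.1 ∧ BL ℓ c.2 p.2

def cRR (b : Bool) (c : CO r) : CO r :=
  cond b (if c.2.1 = 15 then isucc c.1 else c.1, c.2.1 + 1, c.2.2)
    (if c.2.1 = 0 then ipred c.1 else c.1, c.2.1 - 1, c.2.2)

noncomputable def cper (b : Bool) (f : CBk r → CBk r) (c : CO r) : CO r := cond (bst b c.1) (c.1, f c.2) c

noncomputable def cgen (i : Idx r) (b : Bool) (c : CO r) : CO r :=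
  match i with
  | Sum.inl _ => cRR b c
  | Sum.inr (Sum.inl x) => cper x (cXX sg b) c
  | Sum.inr (Sum.inr (Sum.inl x)) => cper x.1 (cLB sg (x.2, b)) c
  | Sum.inr (Sum.inr (Sum.inr x)) => cper x.1 (cCB sg lw (x.2, b)) c

theorem cper_spec (b : Bool) (f : CBk r → CBk r) (F : Equiv.Perm (Blk Γ)) (h : ∀ y z, BL ℓ y z → BL ℓ (f y) (F z))
    (c : CO r) (p : Om Γ) (hp : DO ℓ c p) : DO ℓ (cper b f c) (perB (bs b) F p) := by
  obtain ⟨n, z⟩ := p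
  obtain ⟨h1, h2⟩ := hp
  dsimp only at h1 h2
  unfold cper
  by_cases hb : n ∈ bs b
  · rw [perB_pos F hb, (bst_spec b c.1).2 (h1 ▸ hb)]
    exact ⟨h1, h _ _ h2⟩
  · have : bst b c.1 = false := by
      rw [← Bool.not_eq_true, bst_spec, h1]; exact hb
    rw [perB_neg F hb, this]
    exact ⟨h1, h2⟩

include hsg hlw in
theorem cgen_spec (i : Idx r) (b : Bool) (c : CO r) (p : Om Γ) (hp : DO ℓ c p) :
    DO ℓ (cgen sg lw i b c) ((cond b (gen ℓ i) (gen ℓ i)⁻¹ : Equiv.Perm (Om Γ)) p) := by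
  rcases i with _ | x | x | x
  · obtain ⟨n, q, z⟩ := p
    obtain ⟨k, q', l⟩ := c
    obtain ⟨h1, h2, h3⟩ := hp
    dsimp only at h1 h2 h3
    subst h2
    cases b
    · by_cases hq : q' = 0
      · subst hq
        exact ⟨(iv_ipred k).trans (congrArg (· - 1) h1), rfl, h3⟩
      · show DO ℓ (cRR false (k, q', l)) (RR⁻¹ (n, q', z))
        rw [RI_gt _ _ _ hq]
        refine ⟨?_, rfl, h3⟩
        show iv (if q' = 0 then ipred k else k) = n
        rw [if_neg hq, h1]
    · by_cases hq : q' = 15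
      · subst hq
        exact ⟨(iv_isucc k).trans (congrArg (· + 1) h1), rfl, h3⟩
      · show DO ℓ (cRR true (k, q', l)) (RR (n, q', z))
        rw [RR_lt _ _ _ hq]
        refine ⟨?_, rfl, h3⟩
        show iv (if q' = 15 then isucc k else k) = n
        rw [if_neg hq, h1]
  · have e : (cond b (gen ℓ (Sum.inr (Sum.inl x))) (gen ℓ (Sum.inr (Sum.inl x)))⁻¹ : Equiv.Perm (Om Γ)) =
        perB (bs x) (cond b (XX 4) (XX 4)⁻¹) := by
      cases b
      · exact (map_inv _ _).symm
      · rfl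
    rw [e]
    exact cper_spec ℓ _ _ _ (fun y z h => cXX_spec ℓ sg hsg b y z h) _ _ hp
  · have e : (cond b (gen ℓ (Sum.inr (Sum.inr (Sum.inl x)))) (gen ℓ (Sum.inr (Sum.inr (Sum.inl x))))⁻¹ : Equiv.Perm (Om Γ)) =
        perB (bs x.1) (LB (lv ℓ (x.2, b))) := by
      cases b
      · show (perB (bs x.1) (LB (ℓ x.2)))⁻¹ = perB (bs x.1) (LB (ℓ x.2)⁻¹)
        rw [map_inv, map_inv]
      · rfl
    rw [e]
    exact cper_spec ℓ _ _ _ (fun y z h => cLB_spec ℓ sg hsg (x.2, b) y z h) _ _ hp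
  · have e : (cond b (gen ℓ (Sum.inr (Sum.inr (Sum.inr x)))) (gen ℓ (Sum.inr (Sum.inr (Sum.inr x))))⁻¹ : Equiv.Perm (Om Γ)) =
        perB (bs x.1) (CB (lv ℓ (x.2, b))) := by
      cases b
      · show (perB (bs x.1) (CB (ℓ x.2)))⁻¹ = perB (bs x.1) (CB (ℓ x.2)⁻¹)
        rw [map_inv, map_inv]
      · rfl
    rw [e]
    exact cper_spec ℓ _ _ _ (fun y z h => cCB_spec ℓ sg hsg lw hlw (x.2, b) y z h) _ _ hp

/-! ### comparison -/

theorem wp_nil : wp ℓ [] = 1 := rfl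
theorem wp_append (u v : Wd r) : wp ℓ (u ++ v) = wp ℓ u * wp ℓ v := by simp [wp]
theorem wp_winv (u : Wd r) : wp ℓ (winv u) = (wp ℓ u)⁻¹ := by
  unfold winv wp
  rw [List.prod_inv_reverse, ← List.map_reverse, List.map_map, List.map_map, ← List.map_reverse]
  congr 1
  apply List.map_congr_left
  rintro ⟨a, b⟩ _
  cases b <;> simp

def oc (o : Option (CS r)) : ℤ :=
  match o with
  | none => 0
  | some (Sum.inl b) => cond b 2 (-2)
  | some (Sum.inr w) => if sg w = -1 then 1 else -1

def ow (o : Option (CS r)) : Wd r :=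
  match o with
  | some (Sum.inr w) => w
  | _ => []

def scmp (o o' : Option (CS r)) : ℤ := lexSgn (sgnCmp (oc sg o) (oc sg o')) (sg (winv (ow o') ++ ow o))

def lcmp (l l' : CL r) : ℤ := (List.range (l.length + 1)).foldr (fun i acc => lexSgn (scmp sg l[i]? l'[i]?) acc) 0

include hsg in
theorem sg_cmp (u v : Wd r) : sg (winv v ++ u) = sgnCmp (wp ℓ u) (wp ℓ v) := by
  rw [hsg, wp_append, wp_winv]
  have h1 : ∀ a b : Γ, b⁻¹ * a < 1 ↔ a < b := by
    intro a b
    constructor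
    · intro h; have := Lab.mul_lt b _ _ h; simpa using this
    · intro h; have := Lab.mul_lt b⁻¹ _ _ h; simpa using this
  have h2 : ∀ a b : Γ, b⁻¹ * a = 1 ↔ a = b := by
    intro a b; rw [inv_mul_eq_one]; exact eq_comm
  simp only [sgnCmp, h1, h2]

include hsg in
theorem scmp_spec (o o' : Option (CS r)) : scmp sg o o' =
    sgnCmp (toLex (oc sg o, wp ℓ (ow o)) : K0 Γ) (toLex (oc sg o', wp ℓ (ow o'))) := by
  rw [sgnCmp_lex, ← sg_cmp ℓ sg hsg]; rfl

include hsg in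
theorem key_spec (s : CS r) (x : Sym Γ) (h : DS ℓ s x) : sk x = toLex (oc sg (some s), wp ℓ (ow (some s))) := by
  rcases s with b | w <;> rcases x with b' | a
  · obtain rfl : b = b' := h
    cases b <;> rfl
  · exact absurd h id
  · exact absurd h id
  · have ha : wp ℓ w = a.1 := h
    show lk a = toLex ((if sg w = -1 then 1 else -1), wp ℓ w)
    rw [hsg, ha]
    rcases pn a with h1 | h1
    · rw [lk_pos a h1, if_neg (mt sgnCmp_eq_neg.1 h1.not_gt)]
    · rw [lk_neg a h1, if_pos (sgnCmp_eq_neg.2 h1)]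

theorem sgnCmp_cons {α : Type} [LinearOrder α] (a b : α) (l m : List α) :
    sgnCmp (a :: l) (b :: m) = lexSgn (sgnCmp a b) (sgnCmp l m) := by
  unfold sgnCmp lexSgn
  rcases lt_trichotomy a b with h | h | h
  · simp [cons_lt, h]
  · subst h; simp only [cons_lt, lt_irrefl, true_and, false_or, List.cons.injEq, if_false, if_true]; split_ifs <;> rfl
  · simp [cons_lt, h.not_gt, h.ne']

theorem lcmp_nil_nil : lcmp sg ([] : CL r) [] = lexSgn (scmp sg none none) 0 := rfl
theorem lcmp_nil_cons (s : CS r) (l : CL r) : lcmp sg [] (s :: l) = lexSgn (scmp sg none (some s)) 0 := rfl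
theorem lcmp_cons_nil (s : CS r) (l : CL r) : ∃ z, lcmp sg (s :: l) [] = lexSgn (scmp sg (some s) none) z := by
  unfold lcmp
  rw [List.range_succ_eq_map]
  exact ⟨_, rfl⟩
theorem lcmp_cons_cons (s s' : CS r) (l l' : CL r) :
    lcmp sg (s :: l) (s' :: l') = lexSgn (scmp sg (some s) (some s')) (lcmp sg l l') := by
  unfold lcmp
  rw [List.length_cons, List.range_succ_eq_map (n := l.length + 1), List.foldr_cons, List.foldr_map]
  rfl

include hsg in
theorem oc_ne (s : CS r) : oc sg (some s) ≠ 0 := by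
  rcases s with b | w
  · cases b <;> simp [oc]
  · simp only [oc]; split_ifs <;> decide

include hsg in
theorem lcmp_spec (l l' : CL r) (d d' : D Γ) (h : DL ℓ l d) (h' : DL ℓ l' d') :
    lcmp sg l l' = sgnCmp (dk d) (dk d') := by
  have e : (e0 : K0 Γ) = toLex (oc sg none, wp ℓ (ow none)) := rfl
  have hne : ∀ a b : ℤ, a ≠ 0 → lexSgn a b = a := fun a b h => if_neg h
  induction h generalizing l' d' with
  | nil =>
    cases h' with
    | nil =>
      rw [lcmp_nil_nil]
      have : scmp sg (none : Option (CS r)) none = 0 := by rw [scmp_spec ℓ sg hsg]; exact sgnCmp_eq_zero.2 rfl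
      rw [this, sgnCmp_eq_zero.2 rfl]; rfl
    | cons h1 h2 =>
      rename_i s' x' l' d'
      rw [lcmp_nil_cons, dk, dk, sgnCmp_cons, key_spec ℓ sg hsg _ _ h1, e, ← scmp_spec ℓ sg hsg]
      have : scmp sg none (some s') ≠ 0 := by
        rw [scmp_spec ℓ sg hsg]
        intro h3
        have h4 := congrArg (fun z : K0 Γ => (ofLex z).1) (sgnCmp_eq_zero.1 h3)
        exact oc_ne ℓ sg hsg s' h4.symm
      rw [hne _ _ this, hne _ _ this]
  | cons h1 h2 ih =>
    rename_i s x l d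
    cases h' with
    | nil =>
      obtain ⟨z, hz⟩ := lcmp_cons_nil sg s l
      rw [hz, dk, dk, sgnCmp_cons, key_spec ℓ sg hsg _ _ h1, e, ← scmp_spec ℓ sg hsg]
      have : scmp sg (some s) none ≠ 0 := by
        rw [scmp_spec ℓ sg hsg]
        intro h3
        have h4 := congrArg (fun z : K0 Γ => (ofLex z).1) (sgnCmp_eq_zero.1 h3)
        exact oc_ne ℓ sg hsg s h4
      rw [hne _ _ this, hne _ _ this]
    | cons h3 h4 =>
      rw [lcmp_cons_cons, dk, dk, sgnCmp_cons, key_spec ℓ sg hsg _ _ h1, key_spec ℓ sg hsg _ _ h3,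
        ← scmp_spec ℓ sg hsg, ih _ _ h4]

theorem k0_cmp (a b c d : ℤ) (x y : Γ) (h : sgnCmp a b = sgnCmp c d) :
    sgnCmp (toLex (a, x) : K0 Γ) (toLex (b, y)) = sgnCmp (toLex (c, x) : K0 Γ) (toLex (d, y)) := by
  rw [sgnCmp_lex, sgnCmp_lex, h]

theorem ck_flat (c c' : Cel Γ) : sgnCmp (ck c) (ck c') = sgnCmp (dk (flat c)) (dk (flat c')) := by
  have hl : ∀ a : Ltr Γ, ∃ k : ℤ, (k = 1 ∨ k = -1) ∧ lk a = toLex (k, a.1) := by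
    intro a
    rcases pn a with h | h
    · exact ⟨-1, by simp, lk_pos a h⟩
    · exact ⟨1, by simp, lk_neg a h⟩
  have h1 : ∀ (k : ℤ) (a : Γ), k = 0 ∨ k = 1 ∨ k = -1 → sgnCmp (toLex (3, 1) : K0 Γ) (toLex (k, a)) = sgnCmp (toLex (2, 1) : K0 Γ) (toLex (k, a)) := by
    intro k a hk
    apply k0_cmp
    rcases hk with rfl | rfl | rfl <;> decide
  have h2 : ∀ (k : ℤ) (a : Γ), k = 0 ∨ k = 1 ∨ k = -1 → sgnCmp (toLex (k, a) : K0 Γ) (toLex (3, 1)) = sgnCmp (toLex (k, a) : K0 Γ) (toLex (2, 1)) := by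
    intro k a hk
    apply k0_cmp
    rcases hk with rfl | rfl | rfl <;> decide
  rcases c with _ | ⟨a, d⟩ | d <;> rcases c' with _ | ⟨a', d'⟩ | d' <;>
    simp only [ck, flat, dk, sk, sgnCmp_cons]
  · rw [e0, h2 _ _ (Or.inl rfl)]
  · obtain ⟨k, hk, ha⟩ := hl a
    rw [ha, h2 _ _ (Or.inr hk)]
  · rw [e0, h1 _ _ (Or.inl rfl)]
  · obtain ⟨k, hk, ha⟩ := hl a'
    rw [ha, h1 _ _ (Or.inr hk)]
  · have : ∀ z : K0 Γ, sgnCmp z z = 0 := fun z => sgnCmp_eq_zero.2 rfl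
    rw [this, this]

def ocmp (c c' : CO r) : ℤ := lexSgn (icmp c.1 c'.1) (lexSgn (sgnCmp c.2.1 c'.2.1) (lcmp sg c.2.2 c'.2.2))

include hsg in
theorem ocmp_spec (c c' : CO r) (p p' : Om Γ) (h : DO ℓ c p) (h' : DO ℓ c' p') : ocmp sg c c' = sgnCmp (ok p) (ok p') := by
  unfold ocmp ok bk
  rw [sgnCmp_lex, sgnCmp_lex, icmp_spec, ck_flat, h.1, h'.1, h.2.1, h'.2.1, lcmp_spec ℓ sg hsg _ _ _ _ h.2.2 h'.2.2]

/-! ### decoding -/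

theorem DL_unique (l : CL r) (d d' : D Γ) (h : DL ℓ l d) (h' : DL ℓ l d') : d = d' := by
  induction h generalizing d' with
  | nil => cases h'; rfl
  | cons h1 h2 ih =>
    rename_i s x l d
    cases h' with
    | cons h3 h4 =>
      rename_i x' d'
      rw [ih _ h4]
      congr 1
      rcases s with b | w <;> rcases x with b' | a <;> rcases x' with b'' | a'
      · exact congrArg bit (Eq.trans (Eq.symm h1) h3)
      · exact absurd h3 id
      · exact absurd h1 id
      · exact absurd h1 id
      · exact absurd h1 id
      · exact absurd h1 id
      · exact absurd h3 id
      · exact congrArg ltr (Subtype.ext (Eq.trans (Eq.symm h1) h3))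

theorem DO_unique (c : CO r) (p p' : Om Γ) (h : DO ℓ c p) (h' : DO ℓ c p') : p = p' := by
  refine Prod.ext (h.1.symm.trans h'.1) (Prod.ext (h.2.1.symm.trans h'.2.1) ?_)
  exact flat_inj (DL_unique ℓ _ _ _ h.2.2 h'.2.2)

open Classical in
noncomputable def dec (c : CO r) : Option (Om Γ) := if h : ∃ p, DO ℓ c p then some h.choose else none

theorem dec_iff (c : CO r) (p : Om Γ) : dec ℓ c = some p ↔ DO ℓ c p := by
  unfold dec
  constructor
  · intro h
    split_ifs at h with h1
    rw [← Option.some.inj h]; exact h1.choose_spec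
  · intro h
    rw [dif_pos ⟨p, h⟩]
    exact congrArg some (DO_unique ℓ c _ _ (Exists.choose_spec (⟨p, h⟩ : ∃ p, DO ℓ c p)) h)

theorem dec_isSome (c : CO r) : (dec ℓ c).isSome = true ↔ ∃ p, DO ℓ c p := by
  rw [Option.isSome_iff_exists]
  simp only [dec_iff]

def okS (s : CS r) : Bool := isb s || ! decide (sg (hw [s]) = 0)

def valid (c : CO r) : Bool := c.2.2.foldr (fun s acc => okS sg s && acc) true && ! decide (kd sg c.2.2 = 1)

include hsg in
theorem valid_list (l : CL r) : l.foldr (fun s acc => okS sg s && acc) true = true ↔ ∃ d, DL ℓ l d := by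
  induction l with
  | nil => exact ⟨fun _ => ⟨[], List.Forall₂.nil⟩, fun _ => rfl⟩
  | cons s l ih =>
    rw [List.foldr_cons, Bool.and_eq_true, ih]
    constructor
    · rintro ⟨h1, d, h2⟩
      rcases s with b | w
      · exact ⟨bit b :: d, List.Forall₂.cons rfl h2⟩
      · have h3 : wp ℓ w ≠ 1 := by
          intro h3
          have h4 : sg w = 0 := by rw [hsg]; exact sgnCmp_eq_zero.2 h3
          simp [okS, isb, hw, h4] at h1
        exact ⟨ltr ⟨wp ℓ w, h3⟩ :: d, List.Forall₂.cons rfl h2⟩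
    · rintro ⟨d, h⟩
      cases h with
      | cons h1 h2 =>
        rename_i x d
        refine ⟨?_, d, h2⟩
        rcases s with b | w
        · rfl
        · rcases x with b' | a
          · exact absurd h1 id
          · have h3 : wp ℓ w = a.1 := h1
            have h4 : sg w ≠ 0 := by
              rw [hsg, h3]; exact mt sgnCmp_eq_zero.1 a.2
            simp [okS, isb, hw, h4]

include hsg in
theorem valid_iff (c : CO r) : valid sg c = true ↔ (dec ℓ c).isSome = true := by
  rw [dec_isSome]
  unfold valid
  rw [Bool.and_eq_true, valid_list ℓ sg hsg, Bool.not_eq_true', decide_eq_false_iff_not]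
  constructor
  · rintro ⟨⟨d, h1⟩, h2⟩
    obtain ⟨z, hz⟩ := flat_surj d (by
      rintro t rfl
      obtain ⟨l', h3, _⟩ := (DL_bit ..).1 h1
      rw [h3] at h2
      exact h2 rfl)
    subst hz
    exact ⟨(iv c.1, c.2.1, z), rfl, rfl, h1⟩
  · rintro ⟨⟨n, q, z⟩, h1, h2, h3⟩
    refine ⟨⟨_, h3⟩, ?_⟩
    dsimp only at h3
    rcases z with _ | ⟨a, d⟩ | d
    · rw [(DL_nil ..).1 h3]; exact Nat.zero_ne_one
    · obtain ⟨w, l', h4, h5, h6⟩ := (DL_ltr ..).1 h3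
      rw [h4]
      exact (kd_ltr ℓ sg hsg w l' (h5 ▸ a.2)).1
    · obtain ⟨l', h4, h6⟩ := (DL_bit ..).1 h3
      rw [h4]; exact (by decide : (2 : ℕ) ≠ 1)

theorem DL_surj (P : Wd r → Prop) (d : D Γ) (h : ∀ a, ltr a ∈ d → ∃ w, P w ∧ wp ℓ w = a.1) :
    ∃ l : CL r, l.length = d.length ∧ (∀ w, Sum.inr w ∈ l → P w) ∧ DL ℓ l d := by
  induction d with
  | nil => exact ⟨[], rfl, by simp, List.Forall₂.nil⟩
  | cons s d ih =>
    obtain ⟨l, h1, h2, h3⟩ := ih fun a ha => h a (List.mem_cons_of_mem _ ha)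
    rcases s with b | a
    · refine ⟨Sum.inl b :: l, by simp [h1], ?_, List.Forall₂.cons rfl h3⟩
      intro w hw
      rcases List.mem_cons.1 hw with hw | hw
      · cases hw
      · exact h2 w hw
    · obtain ⟨w, hw1, hw2⟩ := h a (List.mem_cons_self ..)
      refine ⟨Sum.inr w :: l, by simp [h1], ?_, List.Forall₂.cons hw2 h3⟩
      intro w' hw'
      rcases List.mem_cons.1 hw' with hw' | hw'
      · cases hw'; exact hw1
      · exact h2 w' hw'

theorem wp_surj (hℓ : Subgroup.closure (Set.range ℓ) = ⊤) (g : Γ) : ∃ w, wp ℓ w = g := by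
  have hg : g ∈ Subgroup.closure (Set.range ℓ) := by rw [hℓ]; trivial
  induction hg using Subgroup.closure_induction with
  | mem g hg => obtain ⟨j, rfl⟩ := hg; exact ⟨[(j, true)], by simp [wp]⟩
  | one => exact ⟨[], by simp [wp]⟩
  | mul a b _ _ ha hb =>
    obtain ⟨u, rfl⟩ := ha
    obtain ⟨v, rfl⟩ := hb
    exact ⟨u ++ v, wp_append _ _ _⟩
  | inv a _ ha =>
    obtain ⟨u, rfl⟩ := ha
    exact ⟨winv u, wp_winv _ _⟩

theorem dec_surj (hℓ : Subgroup.closure (Set.range ℓ) = ⊤) (p : Om Γ) : ∃ c, dec ℓ c = some p := by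
  obtain ⟨n, q, z⟩ := p
  obtain ⟨l, _, _, h⟩ := DL_surj ℓ (fun _ => True) (flat z) (fun a _ => by
    obtain ⟨w, hw⟩ := wp_surj ℓ hℓ a.1
    exact ⟨w, trivial, hw⟩)
  obtain ⟨k, hk⟩ := iv_surj n
  exact ⟨(k, q, l), (dec_iff ..).2 ⟨hk, rfl, h⟩⟩

end codes

end Step2
end FrattiniProof


/-! ## Part 17: computability of the operations on codes -/

set_option linter.all false

namespace FrattiniProof

namespace Step2

open Sym Cel

theorem ceq {α β : Type} [Primcodable α] [Primcodable β] [DecidableEq β] {f : α → β} (hf : Computable f) (k : β) :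
    Computable fun a => decide (f a = k) :=
  ((Primrec.eq.comp (Primrec.id (α := β)) (Primrec.const k)).decide.to_comp).comp hf

theorem pow_two_primrec : Primrec fun n : ℕ => 2 ^ n := by
  have h : Primrec fun n : ℕ => Nat.rec (motive := fun _ => ℕ) 1 (fun _ ih => 2 * ih) n :=
    Primrec.nat_rec₁ 1 (Primrec.nat_mul.comp (Primrec.const 2) Primrec.snd).to₂
  refine h.of_eq fun n => ?_
  induction n with
  | zero => rfl
  | succ n ih => rw [pow_succ, ← ih]; exact mul_comm _ _

theorem inN_primrec : PrimrecPred inN := by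
  have h : PrimrecRel fun j n : ℕ => j % 2 = 0 ∧ n % 2 ^ (j + 1) = 2 ^ j := by
    refine PrimrecPred.and (p := fun q : ℕ × ℕ => q.1 % 2 = 0) (q := fun q : ℕ × ℕ => q.2 % 2 ^ (q.1 + 1) = 2 ^ q.1) ?_ ?_
    · exact Primrec.eq.comp (Primrec.nat_mod.comp Primrec.fst (Primrec.const 2)) (Primrec.const 0)
    · exact Primrec.eq.comp (Primrec.nat_mod.comp Primrec.snd (pow_two_primrec.comp (Primrec.succ.comp Primrec.fst)))
        (pow_two_primrec.comp Primrec.fst)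
  exact (Primrec.eq.comp Primrec.id (Primrec.const 0)).or ((h.exists_lt).comp Primrec.id Primrec.id)

theorem bst_comp (b : Bool) : Computable (bst b) := by
  classical
  cases b
  · have h1 : PrimrecPred inA := inN_primrec.comp (Primrec.nat_add.comp (Primrec.nat_sub.comp Primrec.fst Primrec.snd)
      (Primrec.nat_sub.comp Primrec.snd Primrec.fst))
    have h2 : Primrec fun p => decide (inA p) := h1.decide
    exact h2.to_comp
  · exact Computable.const true

section codes
variable {r : ℕ} (sg : Wd r → ℤ) (hcs : Computable sg) (lw : Wd r → Bool) (hcl : Computable lw)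

include hcs in
theorem sgt_comp (u v : ℕ) : Computable fun w : Wd r => if sg w = -1 then u else v :=
  computable_ite (ceq hcs _) (Computable.const u) (Computable.const v)

theorem tail_comp : Computable fun l : CL r => l.tail := Primrec.list_tail.to_comp

include hcs in
theorem kd_comp : Computable (kd (r := r) sg) := by
  have h : Computable fun l : CL r => (Option.casesOn (l.head?) 0 fun s => Sum.casesOn s (fun b => cond b 2 1)
      (fun w => if sg w = -1 then 3 else 4) : ℕ) := by
    refine Computable.option_casesOn Primrec.list_head?.to_comp (Computable.const 0) ?_
    refine Computable.sumCasesOn (f := fun p : CL r × CS r => p.2) Computable.snd ?_ ?_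
    · exact Computable.cond Computable.snd (Computable.const 2) (Computable.const 1)
    · exact (sgt_comp sg hcs 3 4).comp Computable.snd
  refine h.of_eq fun l => ?_
  rcases l with _ | ⟨_ | _, l⟩ <;> rfl

theorem ow_comp : Computable (ow (r := r)) := by
  have h : Computable fun l : Option (CS r) => (Option.casesOn l [] fun s => Sum.casesOn s (fun b => [])
      (fun w => w) : Wd r) := by
    refine Computable.option_casesOn Computable.id (Computable.const []) ?_
    refine Computable.sumCasesOn (f := fun p : Option (CS r) × CS r => p.2) Computable.snd ?_ ?_
    · exact Computable.const []
    · exact Computable.snd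
  refine h.of_eq fun l => ?_
  rcases l with _ | (_ | _) <;> rfl

theorem hw_comp : Computable (hw (r := r)) :=
  (ow_comp.comp Primrec.list_head?.to_comp).of_eq fun l => by rcases l with _ | ⟨_ | _, l⟩ <;> rfl

theorem cons_comp {α : Type} [Primcodable α] {f : α → CS r} {g : α → CL r} (hf : Computable f) (hg : Computable g) :
    Computable fun a => f a :: g a := Computable.list_cons.comp hf hg

theorem inl_comp {α : Type} [Primcodable α] (b : Bool) {g : α → CL r} (hg : Computable g) :
    Computable fun a => Sum.inl b :: g a := cons_comp (Computable.const _) hg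

theorem inr_comp {α : Type} [Primcodable α] {f : α → Wd r} {g : α → CL r} (hf : Computable f) (hg : Computable g) :
    Computable fun a => Sum.inr (f a) :: g a := cons_comp (Computable.sumInr.comp hf) hg

include hcs in
theorem cinsD_comp : Computable fun p : Wd r × CL r => cinsD sg p.1 p.2 :=
  computable_ite (ceq (hcs.comp Computable.fst) _) (inl_comp _ (inl_comp _ Computable.snd))
    (computable_ite (ceq (hcs.comp Computable.fst) _) (inr_comp Computable.fst Computable.snd)
      (inl_comp _ (inr_comp Computable.fst Computable.snd)))

include hcs in
theorem cinsB_comp : Computable fun p : Wd r × CL r => cinsB sg p.1 p.2 :=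
  computable_ite (ceq (hcs.comp Computable.fst) _) (Computable.pair (Computable.const _) (inl_comp _ Computable.snd))
    (computable_ite (ceq (hcs.comp Computable.fst) _) (Computable.pair (Computable.const _) (inr_comp Computable.fst Computable.snd))
      (Computable.pair (Computable.const _) (inr_comp Computable.fst Computable.snd)))

theorem osome_comp {α : Type} [Primcodable α] {f : α → Wd r} {g : α → CL r} (hf : Computable f) (hg : Computable g) :
    Computable fun a => some (f a, g a) := Computable.option_some.comp (Computable.pair hf hg)

include hcs in
theorem cgetD_comp : Computable (cgetD (r := r) sg) := by
  have hk := kd_comp sg hcs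
  refine computable_ite (ceq hk _) (osome_comp hw_comp tail_comp) (computable_ite (ceq hk _) ?_ (Computable.const none))
  refine computable_ite (ceq (hk.comp tail_comp) _) (osome_comp (Computable.const []) (tail_comp.comp tail_comp)) ?_
  exact computable_ite (ceq (hk.comp tail_comp) _) (osome_comp (hw_comp.comp tail_comp) (tail_comp.comp tail_comp)) (Computable.const none)

include hcs in
theorem cgetB_comp : Computable (cgetB (r := r) sg) := by
  have hk := kd_comp sg hcs
  have h1 : Computable fun x : CBk r => x.1 := Computable.fst
  have h2 : Computable fun x : CBk r => x.2 := Computable.snd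
  have hs : Computable fun x : CBk r => some (hw x.2, x.2.tail) := osome_comp (hw_comp.comp h2) (tail_comp.comp h2)
  refine computable_ite (ceq h1 _) ?_ (computable_ite (ceq h1 _) ?_ (Computable.const none))
  · exact computable_ite (ceq (hk.comp h2) _) (osome_comp (Computable.const []) (tail_comp.comp h2))
      (computable_ite (ceq (hk.comp h2) _) hs (Computable.const none))
  · exact computable_ite (ceq (hk.comp h2) _) hs (Computable.const none)

include hcs in
theorem cMD_comp (x : Fin r × Bool) : Computable (cMD (r := r) sg x) := by
  have h : Computable fun l : CL r => (Option.casesOn (cgetD sg l) l fun y => cinsD sg (x :: y.1) y.2 : CL r) := by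
    refine Computable.option_casesOn (cgetD_comp sg hcs) Computable.id ?_
    have h1 : Computable fun p : CL r × (Wd r × CL r) => (x :: p.2.1, p.2.2) :=
      Computable.pair (Computable.list_cons.comp (Computable.const x) (Computable.fst.comp Computable.snd))
        (Computable.snd.comp Computable.snd)
    exact (cinsD_comp sg hcs).comp h1
  refine h.of_eq fun l => ?_
  unfold cMD; cases cgetD sg l <;> rfl

include hcs in
theorem cLB_comp (x : Fin r × Bool) : Computable (cLB (r := r) sg x) := by
  have h : Computable fun l : CBk r => (Option.casesOn (cgetB sg l) l fun y => cinsB sg (x :: y.1) y.2 : CBk r) := by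
    refine Computable.option_casesOn (cgetB_comp sg hcs) Computable.id ?_
    have h1 : Computable fun p : CBk r × (Wd r × CL r) => (x :: p.2.1, p.2.2) :=
      Computable.pair (Computable.list_cons.comp (Computable.const x) (Computable.fst.comp Computable.snd))
        (Computable.snd.comp Computable.snd)
    exact (cinsB_comp sg hcs).comp h1
  refine h.of_eq fun l => ?_
  unfold cLB; cases cgetB sg l <;> rfl

theorem isb_comp : Computable (isb (r := r)) := by
  have h : Computable fun s : CS r => (Sum.casesOn s (fun b => true) (fun w => false) : Bool) :=
    Computable.sumCasesOn Computable.id (Computable.const true) (Computable.const false)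
  refine h.of_eq fun s => by cases s <;> rfl

theorem sing_comp : Computable fun s : CS r => [s] := cons_comp Computable.id (Computable.const [])

include hcl in
theorem lws_comp : Computable (lws (r := r) lw) := hcl.comp (hw_comp.comp sing_comp)

include hcs hcl in
theorem ccFF_comp (x : Fin r × Bool) : Computable (ccFF (r := r) sg lw x) := by
  refine Computable.snd.comp (computable_list_foldr (h := fun (a : CL r) (q : (CL r × CL r) × CS r) => ccstep sg lw x q.1 q.2)
    Computable.id (Computable.const ([], [])) ?_)
  have hs : Computable fun p : CL r × ((CL r × CL r) × CS r) => p.2.2 := Computable.snd.comp Computable.snd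
  have h1 : Computable fun p : CL r × ((CL r × CL r) × CS r) => p.2.1.1 := Computable.fst.comp (Computable.fst.comp Computable.snd)
  have h2 : Computable fun p : CL r × ((CL r × CL r) × CS r) => p.2.1.2 := Computable.snd.comp (Computable.fst.comp Computable.snd)
  refine Computable.pair (cons_comp hs h1) (cons_comp hs ?_)
  exact computable_ite (ceq (isb_comp.comp hs) _) h2
    (computable_ite (ceq ((lws_comp lw hcl).comp hs) _) ((cMD_comp sg hcs x).comp h1) h1)

include hcs hcl in
theorem cCB_comp (x : Fin r × Bool) : Computable (cCB (r := r) sg lw x) :=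
  computable_ite (ceq Computable.fst _) (Computable.pair Computable.fst ((ccFF_comp sg hcs lw hcl x).comp Computable.snd)) Computable.id

theorem cpair {α : Type} [Primcodable α] (q : Fin 16) {g : α → CL r} (hg : Computable g) :
    Computable fun a => (q, g a) := Computable.pair (Computable.const q) hg

include hcs in
theorem cX_comp : Computable (cX (r := r) sg) := by
  have h1 : Computable fun x : CBk r => x.1 := Computable.fst
  have h2 : Computable fun x : CBk r => x.2 := Computable.snd
  have k0 := (kd_comp sg hcs).comp h2
  have t1 := tail_comp.comp h2
  have k1 := (kd_comp sg hcs).comp t1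
  have t2 := tail_comp.comp t1
  refine computable_ite (ceq h1 _) (computable_ite (ceq k0 _) (computable_ite (ceq k1 _) (cpair _ (inl_comp _ t2))
    (cpair _ t1)) Computable.id) ?_
  refine computable_ite (ceq h1 _) (cpair _ h2) ?_
  refine computable_ite (ceq h1 _) (computable_ite (ceq k0 _) (cpair _ (inl_comp _ (inl_comp _ t1))) (cpair _ h2)) ?_
  exact computable_ite (ceq h1 _) (cpair _ (inl_comp _ h2)) Computable.id

include hcs in
theorem cXI_comp : Computable (cXI (r := r) sg) := by
  have h1 : Computable fun x : CBk r => x.1 := Computable.fst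
  have h2 : Computable fun x : CBk r => x.2 := Computable.snd
  have k0 := (kd_comp sg hcs).comp h2
  have t1 := tail_comp.comp h2
  have k1 := (kd_comp sg hcs).comp t1
  have t2 := tail_comp.comp t1
  refine computable_ite (ceq h1 _) (computable_ite (ceq k0 _) (computable_ite (ceq k1 _) (cpair _ (inl_comp _ t2))
    (cpair _ t1)) (cpair _ h2)) ?_
  refine computable_ite (ceq h1 _) (cpair _ h2) ?_
  refine computable_ite (ceq h1 _) (computable_ite (ceq k0 _) (cpair _ (inl_comp _ (inl_comp _ t1))) (cpair _ h2)) ?_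
  exact computable_ite (ceq h1 _) (cpair _ (inl_comp _ h2)) Computable.id

theorem fin_comp (f : Fin 16 → Fin 16) : Computable f := (Primrec.dom_finite f).to_comp

include hcs in
theorem cXX_comp (b : Bool) : Computable (cXX (r := r) sg b) := by
  have h0 : Computable fun y : CBk r => (y.1 - 4, y.2) :=
    Computable.pair ((fin_comp (· - 4)).comp Computable.fst) Computable.snd
  have h1 : Computable fun y : CBk r => (cond b (cX sg (y.1 - 4, y.2)) (cXI sg (y.1 - 4, y.2))) := by
    cases b
    · exact (cXI_comp sg hcs).comp h0
    · exact (cX_comp sg hcs).comp h0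
  exact Computable.pair ((fin_comp (· + 4)).comp (Computable.fst.comp h1)) (Computable.snd.comp h1)

theorem cper_comp (b : Bool) (f : CBk r → CBk r) (hf : Computable f) : Computable (cper b f) :=
  Computable.cond ((bst_comp b).comp Computable.fst) (Computable.pair Computable.fst (hf.comp Computable.snd)) Computable.id

theorem cRR_comp (b : Bool) : Computable (cRR (r := r) b) := by
  have h1 : Computable fun c : CO r => c.2.1 := Computable.fst.comp Computable.snd
  have h2 : Computable fun c : CO r => c.2.2 := Computable.snd.comp Computable.snd
  cases b
  · exact Computable.pair (computable_ite (ceq h1 _) (ipred_primrec.to_comp.comp Computable.fst) Computable.fst)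
      (Computable.pair ((fin_comp (· - 1)).comp h1) h2)
  · exact Computable.pair (computable_ite (ceq h1 _) (isucc_primrec.to_comp.comp Computable.fst) Computable.fst)
      (Computable.pair ((fin_comp (· + 1)).comp h1) h2)

include hcs hcl in
theorem cgen_comp (i : Idx r) (b : Bool) : Computable (cgen sg lw i b) := by
  rcases i with _ | x | x | x
  · exact cRR_comp b
  · exact cper_comp _ _ (cXX_comp sg hcs b)
  · exact cper_comp _ _ (cLB_comp sg hcs _)
  · exact cper_comp _ _ (cCB_comp sg hcs lw hcl _)

/-! ### comparison and validity -/

include hcs in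
theorem valid_comp : Computable (valid (r := r) sg) := by
  have h1 : Computable fun c : CO r => c.2.2 := Computable.snd.comp Computable.snd
  have hb := Primrec.and.to_comp
  have hn := Primrec.not.to_comp
  have hok : Computable (okS (r := r) sg) := Primrec.or.to_comp.comp isb_comp (hn.comp (ceq (hcs.comp (hw_comp.comp sing_comp)) _))
  refine hb.comp ?_ (hn.comp (ceq ((kd_comp sg hcs).comp h1) _))
  refine computable_list_foldr (h := fun (a : CO r) (q : Bool × CS r) => okS sg q.2 && q.1) h1 (Computable.const true) ?_
  exact hb.comp (hok.comp (Computable.snd.comp Computable.snd)) (Computable.fst.comp Computable.snd)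

def Vv (i : Fin 5) : ℤ := (i.1 : ℤ) - 2

include hcs in
theorem on_comp : ∃ f : Option (CS r) → Fin 5, Computable f ∧ ∀ o, Vv (f o) = oc sg o := by
  refine ⟨fun o => Option.casesOn o 2 fun s => Sum.casesOn s (fun b => cond b 4 0) (fun w => if sg w = -1 then 3 else 1), ?_, ?_⟩
  · refine Computable.option_casesOn Computable.id (Computable.const 2) ?_
    refine Computable.sumCasesOn (f := fun p : Option (CS r) × CS r => p.2) Computable.snd ?_ ?_
    · exact Computable.cond Computable.snd (Computable.const _) (Computable.const _)
    · exact computable_ite (ceq (hcs.comp Computable.snd) _) (Computable.const _) (Computable.const _)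
  · rintro (_ | (b | w))
    · rfl
    · cases b <;> rfl
    · show Vv (if sg w = -1 then 3 else 1) = if sg w = -1 then 1 else -1
      split_ifs <;> rfl

theorem lexc {α : Type} [Primcodable α] {f g : α → ℤ} (hf : Computable f) (hg : Computable g) :
    Computable fun a => lexSgn (f a) (g a) := lexSgn_primrec.to_comp.comp hf hg

theorem sgnc {α ι κ : Type} [Primcodable α] [Finite ι] [Primcodable ι] [LinearOrder κ] (V : ι → κ) {f g : α → ι}
    (hf : Computable f) (hg : Computable g) : Computable fun a => sgnCmp (V (f a)) (V (g a)) :=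
  (Primrec.dom_finite (fun p : ι × ι => sgnCmp (V p.1) (V p.2))).to_comp.comp (Computable.pair hf hg)

include hcs in
theorem scmp_comp : Computable fun p : Option (CS r) × Option (CS r) => scmp sg p.1 p.2 := by
  obtain ⟨f, hf, hfo⟩ := on_comp sg hcs
  unfold scmp
  simp only [← hfo]
  refine lexc (sgnc Vv (hf.comp Computable.fst) (hf.comp Computable.snd)) (hcs.comp ?_)
  exact Computable.list_append.comp (winv_primrec.to_comp.comp (ow_comp.comp Computable.snd)) (ow_comp.comp Computable.fst)

theorem lcmp_aux (a3 : Computable fun a : (CL r × CL r) × (ℤ × ℕ) => scmp sg a.1.1[a.2.2]? a.1.2[a.2.2]?) :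
    Computable fun a : (CL r × CL r) × (ℤ × ℕ) => lexSgn (scmp sg a.1.1[a.2.2]? a.1.2[a.2.2]?) a.2.1 := by
  have a4 : Computable fun a : (CL r × CL r) × (ℤ × ℕ) => a.2.1 := Computable.fst.comp Computable.snd
  exact lexc a3 a4

theorem lcmp_aux2 (a3 : Computable fun a : (CL r × CL r) × (ℤ × ℕ) => lexSgn (scmp sg a.1.1[a.2.2]? a.1.2[a.2.2]?) a.2.1) :
    Computable fun p : CL r × CL r => lcmp sg p.1 p.2 := by
  have a4 : Computable fun a : (CL r × CL r) => List.range (a.1.length+1) :=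
    (Primrec.list_range.to_comp.comp (Computable.succ.comp (Computable.list_length.comp Computable.fst)))
  have := computable_list_foldr (h := fun (p : CL r × CL r) (q : ℤ × ℕ) => lexSgn (scmp sg p.1[q.2]? p.2[q.2]?) q.1)
    a4 (Computable.const 0) a3
  exact this

theorem get_comp : Computable fun a : (CL r × CL r) × (ℤ × ℕ) => (a.1.1[a.2.2]?, a.1.2[a.2.2]?) := by
  have a1 : Computable fun a : (CL r × CL r) × (ℤ × ℕ) => a.1.1[a.2.2]? :=
    Computable.list_getElem?.comp (Computable.fst.comp Computable.fst) (Computable.snd.comp Computable.snd)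
  have a2 : Computable fun a : (CL r × CL r) × (ℤ × ℕ) => a.1.2[a.2.2]? :=
    Computable.list_getElem?.comp (Computable.snd.comp Computable.fst) (Computable.snd.comp Computable.snd)
  exact Computable.pair a1 a2

include hcs in
theorem lcmp_comp : Computable fun p : CL r × CL r => lcmp sg p.1 p.2 :=
  lcmp_aux2 sg (lcmp_aux sg (Computable.comp (f := fun p : Option (CS r) × Option (CS r) => scmp sg p.1 p.2)
    (g := fun a : (CL r × CL r) × (ℤ × ℕ) => (a.1.1[a.2.2]?, a.1.2[a.2.2]?)) (scmp_comp sg hcs) get_comp))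

theorem ocmp_aux (a1 : Computable fun a : CO r × CO r => icmp a.1.1 a.2.1)
    (a2 : Computable fun a : CO r × CO r => sgnCmp a.1.2.1 a.2.2.1)
    (a3 : Computable fun a : CO r × CO r => lcmp sg a.1.2.2 a.2.2.2) : Computable₂ (ocmp (r := r) sg) := by
  exact lexc a1 (lexc a2 a3)

theorem ocmp_aux2 : Computable fun a : CO r × CO r => sgnCmp a.1.2.1 a.2.2.1 := by
  have b1 : Computable fun a : CO r × CO r => a.1.2.1 := Computable.fst.comp (Computable.snd.comp Computable.fst)
  have b2 : Computable fun a : CO r × CO r => a.2.2.1 := Computable.fst.comp (Computable.snd.comp Computable.snd)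
  exact sgnc (fun x : Fin 16 => x) b1 b2

theorem ocmp_aux3 : Computable fun a : CO r × CO r => icmp a.1.1 a.2.1 :=
    icmp_primrec.to_comp.comp (Computable.fst.comp Computable.fst) (Computable.fst.comp Computable.snd)

theorem ocmp_aux4 : Computable fun a : CO r × CO r => (a.1.2.2, a.2.2.2) :=
    Computable.pair (Computable.snd.comp (Computable.snd.comp Computable.fst)) (Computable.snd.comp (Computable.snd.comp Computable.snd))

include hcs in
theorem ocmp_comp : Computable₂ (ocmp (r := r) sg) :=
  ocmp_aux sg ocmp_aux3 ocmp_aux2 (Computable.comp (f := fun p : CL r × CL r => lcmp sg p.1 p.2)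
    (g := fun a : CO r × CO r => (a.1.2.2, a.2.2.2)) (lcmp_comp sg hcs) ocmp_aux4)

end codes

/-! ### tests -/

/-- all lists of length at most `n` with entries from `L` -/
def allL {α : Type} (L : List α) : ℕ → List (List α)
  | 0 => [[]]
  | n + 1 => [] :: L.flatMap fun a => (allL L n).map fun l => a :: l

theorem mem_allL {α : Type} (L : List α) (n : ℕ) (l : List α) (h1 : l.length ≤ n) (h2 : ∀ a ∈ l, a ∈ L) : l ∈ allL L n := by
  induction n generalizing l with
  | zero =>
    obtain rfl : l = [] := List.length_eq_zero_iff.1 (by omega)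
    simp [allL]
  | succ n ih =>
    rcases l with _ | ⟨a, l⟩
    · simp [allL]
    · simp only [allL, List.mem_cons, List.mem_flatMap, List.mem_map]
      refine Or.inr ⟨a, h2 a (by simp), l, ih l (by simpa using h1) (fun b hb => h2 b (by simp [hb])), rfl⟩

theorem allL_primrec {α : Type} [Primcodable α] : Primrec₂ (allL (α := α)) := by
  have h : Primrec fun p : List α × ℕ => Nat.rec (motive := fun _ => List (List α)) [[]]
      (fun _ ih => [] :: p.1.flatMap fun a => ih.map fun l => a :: l) p.2 := by
    refine Primrec.nat_rec' (f := fun p : List α × ℕ => p.2) (g := fun _ => [[]])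
      (h := fun p q => [] :: p.1.flatMap fun a => q.2.map fun l => a :: l) Primrec.snd (Primrec.const _) ?_
    refine Primrec.list_cons.comp (Primrec.const []) ?_
    refine Primrec.list_flatMap (Primrec.fst.comp Primrec.fst) ?_
    refine Primrec.list_map (Primrec.snd.comp (Primrec.snd.comp Primrec.fst)) ?_
    exact Primrec.list_cons.comp (Primrec.snd.comp Primrec.fst) Primrec.snd
  refine Primrec.of_eq h ?_
  rintro ⟨L, n⟩
  show _ = allL L n
  dsimp only
  induction n with
  | zero => rfl
  | succ n ih => simp only [allL]; rw [← ih]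

/-- all test codes: words up to length `B.1`, lists up to length `B.2.1`, integers up to `B.2.2` -/
def tst (r : ℕ) (B : ℕ × ℕ × ℕ) : List (CO r) :=
  (List.range (B.2.2 + 1)).flatMap fun i => (List.range (B.2.2 + 1)).flatMap fun j =>
    (List.finRange 16).flatMap fun q =>
      (allL ([Sum.inl true, Sum.inl false] ++ (allL (List.finRange r ×ˢ [true, false]) B.1).map fun w => Sum.inr w) B.2.1).map
        fun l => ((i, j), q, l)

theorem tst_primrec (r : ℕ) : Primrec (tst r) := by
  have hr : Primrec fun B : ℕ × ℕ × ℕ => List.range (B.2.2 + 1) :=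
    Primrec.list_range.comp (Primrec.succ.comp (Primrec.snd.comp Primrec.snd))
  unfold tst
  refine Primrec.list_flatMap hr ?_
  refine Primrec.list_flatMap (hr.comp Primrec.fst) ?_
  refine Primrec.list_flatMap (Primrec.const _) ?_
  refine Primrec.list_map ?_ ?_
  · have hb : Primrec fun B : ℕ × ℕ × ℕ => (allL ([Sum.inl true, Sum.inl false] ++ (allL (List.finRange r ×ˢ [true, false]) B.1).map fun w => Sum.inr w) B.2.1 : List (CL r)) := by
      refine allL_primrec.comp (Primrec.list_append.comp (Primrec.const _) ?_) (Primrec.fst.comp Primrec.snd)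
      refine Primrec.list_map (allL_primrec.comp (Primrec.const _) Primrec.fst) ?_
      exact Primrec.sumInr.comp Primrec.snd
    exact hb.comp (Primrec.fst.comp (Primrec.fst.comp Primrec.fst))
  · refine Primrec.pair (Primrec.pair ?_ ?_) (Primrec.pair ?_ Primrec.snd)
    · exact Primrec.snd.comp (Primrec.fst.comp (Primrec.fst.comp Primrec.fst))
    · exact Primrec.snd.comp (Primrec.fst.comp Primrec.fst)
    · exact Primrec.snd.comp Primrec.fst

theorem mem_tst {r : ℕ} (B : ℕ × ℕ × ℕ) (i j : ℕ) (q : Fin 16) (l : CL r) (hi : i ≤ B.2.2) (hj : j ≤ B.2.2)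
    (hl : l.length ≤ B.2.1) (hw : ∀ w, Sum.inr w ∈ l → w.length ≤ B.1) : ((i, j), q, l) ∈ tst r B := by
  simp only [tst, List.mem_flatMap, List.mem_map]
  refine ⟨i, List.mem_range.2 (by omega), j, List.mem_range.2 (by omega), q, List.mem_finRange q, l, ?_, rfl⟩
  apply mem_allL _ _ _ hl
  rintro (b | w) ha
  · cases b <;> simp
  · simp only [List.mem_append, List.mem_map]
    refine Or.inr ⟨w, ?_, rfl⟩
    apply mem_allL _ _ _ (hw w ha)
    rintro ⟨a, b⟩ _
    simp

end Step2
end FrattiniProof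


/-! ## Part 18: the computable left order on the simple group -/

set_option linter.all false

namespace FrattiniProof

namespace Step2

open Sym Cel

variable {Γ : Type} [Group Γ] [LinearOrder Γ] [Lab Γ]

def tstB (bnd : ℕ → ℕ) (L : ℕ) : ℕ × ℕ × ℕ :=
  (bnd (3 * L + 1), (3 * L + 2) + (3 * L + 1) * (3 * L + 3), 2 ^ (4 * L + 1) + 2 * L)

theorem tstB_primrec (bnd : ℕ → ℕ) (hb : Primrec bnd) : Primrec (tstB bnd) := by
  have h3 : Primrec fun L : ℕ => 3 * L := Primrec.nat_mul.comp (Primrec.const 3) Primrec.id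
  have h31 : Primrec fun L : ℕ => 3 * L + 1 := Primrec.succ.comp h3
  have h32 : Primrec fun L : ℕ => 3 * L + 2 := Primrec.succ.comp h31
  have h33 : Primrec fun L : ℕ => 3 * L + 3 := Primrec.succ.comp h32
  have h4 : Primrec fun L : ℕ => 4 * L + 1 := Primrec.succ.comp (Primrec.nat_mul.comp (Primrec.const 4) Primrec.id)
  have h2 : Primrec fun L : ℕ => 2 * L := Primrec.nat_mul.comp (Primrec.const 2) Primrec.id
  exact Primrec.pair (hb.comp h31) (Primrec.pair (Primrec.nat_add.comp h32 (Primrec.nat_mul.comp h31 h33))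
    (Primrec.nat_add.comp (pow_two_primrec.comp h4) h2))

theorem HH_order {r : ℕ} (ℓ : Fin r → Γ) (hℓ : Subgroup.closure (Set.range ℓ) = ⊤)
    (sg : Wd r → ℤ) (hsg : ∀ w, sg w = sgnCmp (wp ℓ w) 1) (hcs : Computable sg)
    (lw : Wd r → Bool) (hlw : ∀ w, lw w = Lab.lab (wp ℓ w)) (hcl : Computable lw)
    (bnd : ℕ → ℕ) (hb : Primrec bnd)
    (hrep : ∀ (m : ℕ) (a : Γ), a ≠ 1 → (¬ ∃ w, w.length ≤ bnd m ∧ wp ℓ w = a) → ∃ c1 c2 : Γ, c1 ≠ c2 ∧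
      (∃ w, w.length ≤ bnd m ∧ wp ℓ w = c1) ∧ (∃ w, w.length ≤ bnd m ∧ wp ℓ w = c2) ∧
      EE ℓ (a⁻¹ * c1) m a c1 ∧ EE ℓ (a⁻¹ * c2) m a c2) :
    ∃ (M : ℕ) (π : FreeGroup (Fin M) →* HH ℓ), Function.Surjective π ∧ ComputableLeftOrderVia π := by
  let s : Fin (Fintype.card (Idx r)) → Idx r := (Fintype.equivFin (Idx r)).symm
  have hs : Function.Surjective s := (Fintype.equivFin (Idx r)).symm.surjective
  have key := pipeline_tests (C := CO r) (ok (Γ := Γ)) ok_inj (fun i => gen ℓ (s i)) (fun i p q h => gen_mono ℓ (s i) p q h)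
    (dec ℓ) (dec_surj ℓ hℓ) (valid sg) (valid_comp sg hcs) (valid_iff ℓ sg hsg)
    (fun c a => cgen sg lw (s a.1) a.2 c) (fun a => cgen_comp sg hcs lw hcl (s a.1) a.2)
    (fun c a p hp => (dec_iff ..).2 (cgen_spec ℓ sg hsg lw hlw (s a.1) a.2 c p ((dec_iff ..).1 hp)))
    (ocmp sg) (ocmp_comp sg hcs)
    (fun c d p q hp hq => ocmp_spec ℓ sg hsg c d p q ((dec_iff ..).1 hp) ((dec_iff ..).1 hq))
    (fun L => tst r (tstB bnd L)) ((tst_primrec r).comp (tstB_primrec bnd hb)) ?_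
  · have e : Set.range (fun i => gen ℓ (s i)) = Set.range (gen ℓ) := hs.range_comp (gen ℓ)
    rw [e] at key
    exact ⟨_, key⟩
  · intro w h
    refine word_trivial ℓ s w (fun a => ∃ u, u.length ≤ bnd (3 * w.length + 1) ∧ wp ℓ u = a.1) (3 * w.length) (4 * w.length) rfl
      ⟨2 * w.length, by ring⟩ Nat.lt_two_pow_self ?_ ?_
    · intro a ha
      obtain ⟨c1, c2, h1, h2, h3, h4, h5⟩ := hrep _ a.1 a.2 ha
      have n1 : c1 ≠ 1 := by
        have := (h4.2 [] (by simp)).2.1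
        simpa [wp] using this
      have n2 : c2 ≠ 1 := by
        have := (h5.2 [] (by simp)).2.1
        simpa [wp] using this
      exact ⟨⟨c1, n1⟩, ⟨c2, n2⟩, h2, h3, fun h => h1 (congrArg Subtype.val h), h4, h5⟩
    · intro n q c hn hl ha
      obtain ⟨l, h1, h2, h3⟩ := DL_surj ℓ (fun u => u.length ≤ bnd (3 * w.length + 1)) (flat c) ha
      have hN : |n| ≤ ((2 ^ (4 * w.length + 1) + 2 * w.length : ℕ) : ℤ) := by push_cast; exact hn
      refine h ((n.toNat, (-n).toNat), q, l) ?_ (n, q, c) ((dec_iff ..).2 ⟨?_, rfl, h3⟩)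
      · apply mem_tst
        · show n.toNat ≤ 2 ^ (4 * w.length + 1) + 2 * w.length
          rw [abs_le] at hN
          omega
        · show (-n).toNat ≤ 2 ^ (4 * w.length + 1) + 2 * w.length
          rw [abs_le] at hN
          omega
        · exact h1.le.trans hl
        · exact h2
      · show iv (n.toNat, (-n).toNat) = n
        unfold iv; dsimp only; omega

end Step2
end FrattiniProof


/-! ## Part 19: the labelled group attached to an ordered group -/

set_option linter.all false

namespace FrattiniProof

namespace Step2

open Sym Cel

class LOG (G : Type) [Group G] [LinearOrder G] : Prop where
  mul_lt : ∀ a b c : G, b < c → a * b < a * c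

abbrev GZ (G : Type) := G ×ₗ Multiplicative ℤ

section wpg
variable {A : Type} [Group A] {m : ℕ} (x : Fin m → A)

theorem wpg_cons (a : Fin m × Bool) (w : Wd m) : wp x (a :: w) = cond a.2 (x a.1) (x a.1)⁻¹ * wp x w := by simp [wp]
theorem wpg_append (u v : Wd m) : wp x (u ++ v) = wp x u * wp x v := by simp [wp]
theorem wpg_winv (u : Wd m) : wp x (winv u) = (wp x u)⁻¹ := by
  unfold winv wp
  rw [List.prod_inv_reverse, ← List.map_reverse, List.map_map, List.map_map, ← List.map_reverse]
  congr 1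
  apply List.map_congr_left
  rintro ⟨a, b⟩ _
  cases b <;> simp

theorem winv_length (u : Wd m) : (winv u).length = u.length := by simp [winv]

end wpg

section gz
variable {G : Type} [Group G]

def mk (g : G) (k : ℤ) : GZ G := toLex (g, Multiplicative.ofAdd k)
def cg (a : GZ G) : G := (ofLex a).1
def cz (a : GZ G) : ℤ := Multiplicative.toAdd (ofLex a).2

theorem cg_mk (g : G) (k : ℤ) : cg (mk g k) = g := rfl
theorem cz_mk (g : G) (k : ℤ) : cz (mk g k) = k := rfl
theorem mk_eta (a : GZ G) : mk (cg a) (cz a) = a := rfl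
theorem mk_mul (g h : G) (k j : ℤ) : mk g k * mk h j = mk (g * h) (k + j) := rfl
theorem mk_inv (g : G) (k : ℤ) : (mk g k)⁻¹ = mk g⁻¹ (-k) := rfl
theorem mk_one : (1 : GZ G) = mk 1 0 := rfl
theorem mk_inj (g h : G) (k j : ℤ) : mk g k = mk h j ↔ g = h ∧ k = j := by
  constructor
  · intro e; exact ⟨congrArg cg e, congrArg cz e⟩
  · rintro ⟨rfl, rfl⟩; rfl
theorem mk_eq_one (g : G) (k : ℤ) : mk g k = 1 ↔ g = 1 ∧ k = 0 := mk_inj _ _ _ _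
theorem cg_mul (a b : GZ G) : cg (a * b) = cg a * cg b := rfl
theorem cz_mul (a b : GZ G) : cz (a * b) = cz a + cz b := rfl

variable [LinearOrder G]

theorem mk_lt (g h : G) (k j : ℤ) : mk g k < mk h j ↔ g < h ∨ g = h ∧ k < j := Prod.Lex.toLex_lt_toLex

theorem mk_lt_one (g : G) (k : ℤ) : mk g k < 1 ↔ g < 1 ∨ g = 1 ∧ k < 0 := mk_lt _ _ _ _

variable [LOG G]

instance : Lab (GZ G) where
  mul_lt := by
    intro a b c h
    obtain ⟨ga, ka, rfl⟩ : ∃ g k, a = mk g k := ⟨cg a, cz a, rfl⟩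
    obtain ⟨gb, kb, rfl⟩ : ∃ g k, b = mk g k := ⟨cg b, cz b, rfl⟩
    obtain ⟨gc, kc, rfl⟩ : ∃ g k, c = mk g k := ⟨cg c, cz c, rfl⟩
    rw [mk_mul, mk_mul, mk_lt]
    rw [mk_lt] at h
    rcases h with h | ⟨h1, h2⟩
    · exact Or.inl (LOG.mul_lt _ _ _ h)
    · exact Or.inr ⟨by rw [h1], by omega⟩
  lab a := decide (cg a = 1) && decide (0 < cz a)
  β := mk 1 1
  β_pos := by rw [mk_one, mk_lt]; simp
  lab_pos := by
    intro a h
    obtain ⟨g, k, rfl⟩ : ∃ g k, a = mk g k := ⟨cg a, cz a, rfl⟩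
    change (decide (g = 1) && decide (0 < k)) = true at h
    simp only [Bool.and_eq_true, decide_eq_true_eq] at h
    rw [mk_one, mk_lt]
    exact Or.inr ⟨h.1.symm, h.2⟩
  lab_β := by
    intro a
    obtain ⟨g, k, rfl⟩ : ∃ g k, a = mk g k := ⟨cg a, cz a, rfl⟩
    change (decide (1 * g = 1) && decide (0 < 1 + k)) = true ↔ mk g k = 1 ∨ (decide (g = 1) && decide (0 < k)) = true
    simp only [Bool.and_eq_true, decide_eq_true_eq, mk_eq_one, one_mul]
    constructor
    · rintro ⟨h1, h2⟩
      rcases eq_or_ne k 0 with h3 | h3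
      · exact Or.inl ⟨h1, h3⟩
      · exact Or.inr ⟨h1, by omega⟩
    · rintro (⟨h1, h2⟩ | ⟨h1, h2⟩)
      · exact ⟨h1, by omega⟩
      · exact ⟨h1, by omega⟩

theorem lab_mk (g : G) (k : ℤ) : Lab.lab (mk g k) = (decide (g = 1) && decide (0 < k)) := rfl

/-! ### generators -/

variable {m : ℕ} (x : Fin m → G)

def ell : Fin (m + 1) → GZ G := Fin.cases (mk 1 1) fun i => mk (x i) 0

def gw (w : Wd (m + 1)) : Wd m := w.flatMap fun a => Fin.cases (motive := fun _ => Wd m) [] (fun i => [(i, a.2)]) a.1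

def zst (s : ℕ × ℕ) (a : Fin (m + 1) × Bool) : ℕ × ℕ :=
  if a.1 = 0 then (if a.2 = true then isucc s else ipred s) else s

def zw (w : Wd (m + 1)) : ℕ × ℕ := w.foldr (fun a s => zst s a) (0, 0)

theorem wp_ell (w : Wd (m + 1)) : wp (ell x) w = mk (wp x (gw w)) (iv (zw w)) := by
  induction w with
  | nil => rfl
  | cons a w ih =>
    rw [wpg_cons, ih]
    obtain ⟨i, b⟩ := a
    refine Fin.cases ?_ (fun i => ?_) i
    · have h1 : gw ((0, b) :: w) = gw w := rfl
      have h2 : zw ((0, b) :: w) = if b = true then isucc (zw w) else ipred (zw w) := rfl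
      have h3 : ell x 0 = mk 1 1 := rfl
      rw [h1, h2, h3]
      cases b
      · show (mk 1 1)⁻¹ * _ = mk _ (iv (ipred (zw w)))
        rw [mk_inv, mk_mul, iv_ipred, inv_one, one_mul, neg_add_eq_sub]
      · show (mk 1 1) * _ = mk _ (iv (isucc (zw w)))
        rw [mk_mul, iv_isucc, one_mul, add_comm]
    · have h1 : gw ((i.succ, b) :: w) = (i, b) :: gw w := rfl
      have h2 : zw ((i.succ, b) :: w) = zw w := by
        show zst (zw w) (i.succ, b) = zw w
        exact if_neg (Fin.succ_ne_zero i)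
      have h3 : ell x i.succ = mk (x i) 0 := rfl
      rw [h1, h2, h3, wpg_cons]
      cases b
      · show (mk (x i) 0)⁻¹ * _ = mk ((x i)⁻¹ * _) _
        rw [mk_inv, mk_mul, neg_zero, zero_add]
      · show (mk (x i) 0) * _ = mk ((x i) * _) _
        rw [mk_mul, zero_add]

theorem gw_length (w : Wd (m + 1)) : (gw w).length ≤ w.length ∧ |iv (zw w)| ≤ w.length := by
  induction w with
  | nil => simp [gw, zw, iv]
  | cons a w ih =>
    obtain ⟨i, b⟩ := a
    obtain ⟨ih1, ih2⟩ := ih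
    rw [abs_le] at ih2
    refine Fin.cases ?_ (fun i => ?_) i
    · have h1 : gw ((0, b) :: w) = gw w := rfl
      have h2 : zw ((0, b) :: w) = if b = true then isucc (zw w) else ipred (zw w) := rfl
      rw [h1, h2, List.length_cons, abs_le]
      cases b
      · rw [if_neg (by simp), iv_ipred]; push_cast; omega
      · rw [if_pos rfl, iv_isucc]; push_cast; omega
    · have h1 : gw ((i.succ, b) :: w) = (i, b) :: gw w := rfl
      have h2 : zw ((i.succ, b) :: w) = zw w := by
        show zst (zw w) (i.succ, b) = zw w
        exact if_neg (Fin.succ_ne_zero i)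
      rw [h1, h2, List.length_cons, List.length_cons, abs_le]
      push_cast; omega

/-- every pair is a word of controlled length -/
theorem word_of (w : Wd m) (k : ℤ) : ∃ u : Wd (m + 1), u.length = w.length + k.natAbs ∧ wp (ell x) u = mk (wp x w) k := by
  have h1 : ∃ u : Wd (m + 1), u.length = w.length ∧ wp (ell x) u = mk (wp x w) 0 := by
    induction w with
    | nil => exact ⟨[], rfl, rfl⟩
    | cons a w ih =>
      obtain ⟨u, hu, hu2⟩ := ih
      refine ⟨(a.1.succ, a.2) :: u, by simp [hu], ?_⟩
      rw [wpg_cons, wpg_cons, hu2]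
      obtain ⟨i, b⟩ := a
      cases b <;> rfl
  have h2 : ∀ (n : ℕ) (b : Bool), wp (ell x) (List.replicate n ((0 : Fin (m + 1)), b)) = mk 1 (cond b (n : ℤ) (-n)) := by
    intro n b
    induction n with
    | zero => cases b <;> rfl
    | succ n ih =>
      rw [List.replicate_succ, wpg_cons, ih]
      have h3 : ell x 0 = mk 1 1 := rfl
      dsimp only
      rw [h3]
      cases b
      · show (mk 1 1)⁻¹ * mk 1 (-(n : ℤ)) = mk 1 (-((n + 1 : ℕ) : ℤ))
        rw [mk_inv, mk_mul, mk_inj]; exact ⟨by simp, by push_cast; ring⟩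
      · show (mk 1 1) * mk 1 (n : ℤ) = mk 1 ((n + 1 : ℕ) : ℤ)
        rw [mk_mul, mk_inj]; exact ⟨by simp, by push_cast; ring⟩
  obtain ⟨u, hu, hu2⟩ := h1
  refine ⟨u ++ List.replicate k.natAbs (0, decide (0 ≤ k)), by simp [hu], ?_⟩
  rw [wpg_append, h2, hu2, mk_mul, mul_one, mk_inj]
  refine ⟨rfl, ?_⟩
  by_cases hk : 0 ≤ k
  · rw [decide_eq_true hk]; show (0 : ℤ) + (k.natAbs : ℤ) = k; omega
  · rw [decide_eq_false hk]; show (0 : ℤ) + -(k.natAbs : ℤ) = k; omega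

/-! ### computability -/

theorem gw_primrec : Primrec (gw (m := m)) := by
  refine Primrec.list_flatMap Primrec.id ?_
  have : Primrec fun a : Fin (m + 1) × Bool => (Fin.cases (motive := fun _ => Wd m) [] (fun i => [(i, a.2)]) a.1) := Primrec.dom_finite _
  exact this.comp Primrec.snd

theorem zw_comp : Computable (zw (m := m)) := by
  refine computable_list_foldr (h := fun (w : Wd (m + 1)) (q : (ℕ × ℕ) × (Fin (m + 1) × Bool)) => zst q.1 q.2)
    Computable.id (Computable.const (0, 0)) ?_
  have h1 : Computable fun p : Wd (m + 1) × ((ℕ × ℕ) × (Fin (m + 1) × Bool)) => p.2.1 := Computable.fst.comp Computable.snd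
  have h2 : Computable fun p : Wd (m + 1) × ((ℕ × ℕ) × (Fin (m + 1) × Bool)) => p.2.2.1 :=
    Computable.fst.comp (Computable.snd.comp Computable.snd)
  have h3 : Computable fun p : Wd (m + 1) × ((ℕ × ℕ) × (Fin (m + 1) × Bool)) => p.2.2.2 :=
    Computable.snd.comp (Computable.snd.comp Computable.snd)
  exact computable_ite (ceq h2 _) (computable_ite (ceq h3 _) (isucc_primrec.to_comp.comp h1) (ipred_primrec.to_comp.comp h1)) h1

def sgz (sg0 : Wd m → ℤ) (w : Wd (m + 1)) : ℤ := lexSgn (sg0 (gw w)) (icmp (zw w) (0, 0))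
def lwz (sg0 : Wd m → ℤ) (w : Wd (m + 1)) : Bool := decide (sg0 (gw w) = 0) && decide (icmp (0, 0) (zw w) = -1)

theorem sgz_spec (sg0 : Wd m → ℤ) (h0 : ∀ w, sg0 w = sgnCmp (wp x w) 1) (w : Wd (m + 1)) :
    sgz sg0 w = sgnCmp (wp (ell x) w) 1 := by
  rw [wp_ell]
  have : sgnCmp (mk (wp x (gw w)) (iv (zw w))) 1 =
    lexSgn (sgnCmp (wp x (gw w)) 1) (sgnCmp (Multiplicative.ofAdd (iv (zw w))) 1) := sgnCmp_lex _ _ _ _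
  rw [this, ← h0]
  unfold sgz
  rw [icmp_spec]
  rfl

theorem lwz_spec (sg0 : Wd m → ℤ) (h0 : ∀ w, sg0 w = sgnCmp (wp x w) 1) (w : Wd (m + 1)) :
    lwz sg0 w = Lab.lab (wp (ell x) w) := by
  rw [wp_ell, lab_mk]
  unfold lwz
  rw [icmp_spec, h0]
  congr 1
  · exact decide_eq_decide.2 sgnCmp_eq_zero
  · exact decide_eq_decide.2 sgnCmp_eq_neg

theorem sgz_comp (sg0 : Wd m → ℤ) (hc : Computable sg0) : Computable (sgz sg0) := by
  have h1 : Computable fun w : Wd (m + 1) => sg0 (gw w) := hc.comp gw_primrec.to_comp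
  have h2 : Computable fun w : Wd (m + 1) => icmp (zw w) (0, 0) := icmp_primrec.to_comp.comp zw_comp (Computable.const (0, 0))
  exact lexc h1 h2

theorem lwz_comp (sg0 : Wd m → ℤ) (hc : Computable sg0) : Computable (lwz sg0) := by
  have h1 : Computable fun w : Wd (m + 1) => sg0 (gw w) := hc.comp gw_primrec.to_comp
  have h2 : Computable fun w : Wd (m + 1) => icmp (0, 0) (zw w) := icmp_primrec.to_comp.comp (Computable.const (0, 0)) zw_comp
  exact Primrec.and.to_comp.comp (ceq h1 _) (ceq h2 _)

theorem ell_top (hx : ∀ g, ∃ w, wp x w = g) : Subgroup.closure (Set.range (ell x)) = ⊤ := by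
  rw [eq_top_iff]
  rintro a -
  obtain ⟨w, hw⟩ := hx (cg a)
  obtain ⟨u, -, hu⟩ := word_of x w (cz a)
  rw [hw, mk_eta] at hu
  rw [← hu]
  unfold wp
  apply Subgroup.list_prod_mem
  intro y hy
  obtain ⟨⟨i, b⟩, -, rfl⟩ := List.mem_map.1 hy
  have : ell x i ∈ Subgroup.closure (Set.range (ell x)) := Subgroup.subset_closure ⟨i, rfl⟩
  cases b
  · exact inv_mem this
  · exact this

/-! ### letter representatives -/

theorem ball_finite (n : ℕ) : (Set.image (wp x) {w | w.length ≤ n}).Finite := (List.finite_length_le _ n).image _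

theorem lt_inv (b h : G) : b * h < 1 ↔ h < b⁻¹ := by
  constructor
  · intro e; have := LOG.mul_lt b⁻¹ _ _ e; simpa using this
  · intro e; have := LOG.mul_lt b _ _ e; simpa using this

theorem EE_of (n : ℕ) (a c : GZ G) (h : ∀ w : Wd m, w.length ≤ n → ∀ j : ℤ, |j| ≤ n →
    mk (wp x w) j * a ≠ 1 ∧ mk (wp x w) j * c ≠ 1 ∧ (mk (wp x w) j * a < 1 ↔ mk (wp x w) j * c < 1) ∧
      Lab.lab (mk (wp x w) j * a) = Lab.lab (mk (wp x w) j * c)) : EE (ell x) (a⁻¹ * c) n a c := by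
  refine ⟨by group, ?_⟩
  intro w hw
  rw [wp_ell]
  obtain ⟨h1, h2⟩ := gw_length w
  exact h _ (h1.trans hw) _ (h2.trans (by exact_mod_cast hw))

theorem reps (hx : ∀ g, ∃ w, wp x w = g) (n : ℕ) (a : GZ G)
    (ha : ¬ ∃ w, w.length ≤ 2 * n + 2 ∧ wp (ell x) w = a) : ∃ c1 c2 : GZ G, c1 ≠ c2 ∧
      (∃ w, w.length ≤ 2 * n + 2 ∧ wp (ell x) w = c1) ∧ (∃ w, w.length ≤ 2 * n + 2 ∧ wp (ell x) w = c2) ∧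
      EE (ell x) (a⁻¹ * c1) n a c1 ∧ EE (ell x) (a⁻¹ * c2) n a c2 := by
  obtain ⟨h, k, rfl⟩ : ∃ h k, a = mk h k := ⟨cg a, cz a, rfl⟩
  have fin : ∀ (h' : G) (k1 k2 : ℤ) (w : Wd m), k1 ≠ k2 → wp x w = h' → w.length + k1.natAbs ≤ 2 * n + 2 →
      w.length + k2.natAbs ≤ 2 * n + 2 →
      (∀ k', (k' = k1 ∨ k' = k2) → EE (ell x) ((mk h k)⁻¹ * mk h' k') n (mk h k) (mk h' k')) →
      ∃ c1 c2 : GZ G, c1 ≠ c2 ∧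
      (∃ w, w.length ≤ 2 * n + 2 ∧ wp (ell x) w = c1) ∧ (∃ w, w.length ≤ 2 * n + 2 ∧ wp (ell x) w = c2) ∧
      EE (ell x) ((mk h k)⁻¹ * c1) n (mk h k) c1 ∧ EE (ell x) ((mk h k)⁻¹ * c2) n (mk h k) c2 := by
    intro h' k1 k2 w hk hw h1 h2 h3
    refine ⟨mk h' k1, mk h' k2, fun e => hk ((mk_inj ..).1 e).2, ?_, ?_, h3 k1 (Or.inl rfl), h3 k2 (Or.inr rfl)⟩
    · obtain ⟨u, hu, hu2⟩ := word_of x w k1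
      exact ⟨u, by omega, by rw [hu2, hw]⟩
    · obtain ⟨u, hu, hu2⟩ := word_of x w k2
      exact ⟨u, by omega, by rw [hu2, hw]⟩
  by_cases hb : ∃ w : Wd m, w.length ≤ n ∧ wp x w = h
  · obtain ⟨w, hw, hwh⟩ := hb
    have hk : (n : ℤ) + 2 < |k| := by
      by_contra hk
      apply ha
      obtain ⟨u, hu, hu2⟩ := word_of x w k
      refine ⟨u, ?_, by rw [hu2, hwh]⟩
      rw [not_lt, abs_le] at hk
      omega
    rcases lt_or_ge k 0 with hk0 | hk0
    · rw [abs_of_neg hk0] at hk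
      refine fin h (-(n + 1)) (-(n + 2)) w (by omega) hwh (by omega) (by omega) ?_
      intro k' hk'
      apply EE_of
      intro v hv j hj
      rw [abs_le] at hj
      have e1 : j + k < 0 := by omega
      have e2 : j + k' < 0 := by omega
      simp only [mk_mul, mk_lt_one, lab_mk, ne_eq, mk_eq_one, e1.ne, e2.ne, and_false, not_false_eq_true, e1, e2, e1.not_gt, e2.not_gt,
        true_and, decide_false, Bool.and_false]
    · rw [abs_of_nonneg hk0] at hk
      refine fin h (n + 1) (n + 2) w (by omega) hwh (by omega) (by omega) ?_
      intro k' hk'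
      apply EE_of
      intro v hv j hj
      rw [abs_le] at hj
      have e1 : 0 < j + k := by omega
      have e2 : 0 < j + k' := by omega
      simp only [mk_mul, mk_lt_one, lab_mk, ne_eq, mk_eq_one, e1.ne', e2.ne', and_false, not_false_eq_true, e1, e2, e1.not_gt, e2.not_gt,
        true_and, decide_true, Bool.and_true]
  · have hb' : ∀ w : Wd m, w.length ≤ n → wp x w * h ≠ 1 := by
      intro w hw e
      refine hb ⟨winv w, by rw [winv_length]; exact hw, ?_⟩
      rw [wpg_winv]; exact inv_eq_of_mul_eq_one_right e
    have hinv : ∀ w : Wd m, w.length ≤ n → (wp x w)⁻¹ ∈ Set.image (wp x) {w | w.length ≤ n} := by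
      intro w hw
      exact ⟨winv w, by show (winv w).length ≤ n; rw [winv_length]; exact hw, wpg_winv x w⟩
    by_cases hc : ∃ b ∈ Set.image (wp x) {w | w.length ≤ n}, h < b
    · obtain ⟨b0, ⟨hb0, hb1⟩, hmin⟩ := Set.exists_min_image {b | b ∈ Set.image (wp x) {w | w.length ≤ n} ∧ h < b} id
        ((ball_finite x n).subset fun b hb => hb.1) hc
      obtain ⟨w, hw, rfl⟩ := hb0
      have hw' : w.length ≤ n := hw
      refine fin (wp x w) (-(n + 1)) (-(n + 2)) w (by omega) rfl (by omega) (by omega) ?_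
      intro k' hk'
      apply EE_of
      intro v hv j hj
      rw [abs_le] at hj
      have e2 : j + k' < 0 := by omega
      have e3 := hb' v hv
      simp only [mk_mul, mk_lt_one, lab_mk, ne_eq, mk_eq_one, e2.ne, and_false, not_false_eq_true, e2, e2.not_gt,
        true_and, decide_false, Bool.and_false, e3, false_and, Bool.false_and, or_false, and_true]
      rw [← le_iff_lt_or_eq, lt_inv]
      constructor
      · intro e4
        have e5 : wp x w ≤ (wp x v)⁻¹ := hmin _ ⟨hinv v hv, e4⟩
        rcases e5.lt_or_eq with e6 | e6
        · exact ((lt_inv _ _).2 e6).le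
        · rw [e6, mul_inv_cancel]
      · intro e4
        rcases e4.lt_or_eq with e6 | e6
        · exact hb1.trans ((lt_inv _ _).1 e6)
        · rw [← inv_eq_of_mul_eq_one_right e6] at hb1; exact hb1
    · push Not at hc
      obtain ⟨b1, hb1, hmax⟩ := Set.exists_max_image (Set.image (wp x) {w | w.length ≤ n}) id (ball_finite x n) ⟨_, ⟨[], by simp, rfl⟩⟩
      obtain ⟨w, hw, rfl⟩ := hb1
      have hw' : w.length ≤ n := hw
      have hs : ∃ s : Fin m × Bool, 1 < wp x [s] := by
        by_contra hs
        push Not at hs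
        have hall : ∀ i, x i = 1 := by
          intro i
          have h1 := hs (i, true)
          have h2 := hs (i, false)
          simp only [wp, List.map_cons, List.map_nil, List.prod_cons, List.prod_nil, mul_one, cond_true, cond_false] at h1 h2
          refine le_antisymm h1 ?_
          rcases h2.lt_or_eq with h3 | h3
          · have := LOG.mul_lt (x i) _ _ h3
            rw [mul_inv_cancel, mul_one] at this
            exact this.le
          · exact (inv_eq_one.1 h3).ge
        have htriv : ∀ u : Wd m, wp x u = 1 := by
          intro u
          induction u with
          | nil => rfl
          | cons s u ih =>
            rw [wpg_cons, ih, hall]; cases s.2 <;> simp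
        obtain ⟨u, hu⟩ := hx h
        exact hb ⟨[], by simp, by rw [htriv, ← hu, htriv]⟩
      obtain ⟨s, hs⟩ := hs
      refine fin (wp x (w ++ [s])) 0 1 (w ++ [s]) (by omega) rfl (by simp; omega) (by simp; omega) ?_
      intro k' hk'
      apply EE_of
      intro v hv j hj
      have e3 := hb' v hv
      have e4 : ¬ wp x v * h < 1 := by
        rw [lt_inv]; exact (hc _ (hinv v hv)).not_gt
      have e5 : (wp x v)⁻¹ < wp x (w ++ [s]) := by
        rw [wpg_append]
        refine lt_of_le_of_lt (hmax _ (hinv v hv)) ?_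
        have := LOG.mul_lt (wp x w) _ _ hs
        rw [mul_one] at this; exact this
      have e6 : ¬ wp x v * wp x (w ++ [s]) < 1 := by
        rw [lt_inv]; exact e5.not_gt
      have e7 : wp x v * wp x (w ++ [s]) ≠ 1 := by
        intro e; exact e5.ne (inv_eq_of_mul_eq_one_right e)
      simp only [mk_mul, mk_lt_one, lab_mk, ne_eq, mk_eq_one, e3, e4, e6, e7, false_and, not_false_eq_true, or_false, true_and, decide_false,
        Bool.false_and]

end gz

end Step2
end FrattiniProof


/-! ## Part 20: the embedding is Frattini -/

set_option linter.all false

namespace FrattiniProof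

namespace Step2

open Sym Cel

section fr
variable {Γ : Type} [Group Γ] [LinearOrder Γ] [Lab Γ] {r : ℕ} (ℓ : Fin r → Γ)

theorem phi_mem (hℓ : Subgroup.closure (Set.range ℓ) = ⊤) (γ : Γ) : perB Set.univ (LB γ) ∈ HH ℓ := by
  have h : γ ∈ Subgroup.closure (Set.range ℓ) := by rw [hℓ]; trivial
  have h2 : Subgroup.closure (Set.range ℓ) ≤ (HH ℓ).comap ((perB Set.univ).comp LB) := by
    rw [Subgroup.closure_le]
    rintro _ ⟨i, rfl⟩
    exact HH_gen ℓ (Sum.inr (Sum.inr (Sum.inl (true, i))))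
  exact h2 h

theorem word_rep {M : ℕ} (s : Fin M → Idx r) (hs : Function.Surjective s) (h : Equiv.Perm (Om Γ)) (hh : h ∈ HH ℓ) :
    ∃ w : List (Fin M × Bool), wordAct (fun i => gen ℓ (s i)) w = h := by
  have app : ∀ u v : Wd M, wordAct (fun i => gen ℓ (s i)) (u ++ v) =
      wordAct (fun i => gen ℓ (s i)) u * wordAct (fun i => gen ℓ (s i)) v := fun u v => by simp [wordAct]
  have inv : ∀ u : Wd M, wordAct (fun i => gen ℓ (s i)) (winv u) = (wordAct (fun i => gen ℓ (s i)) u)⁻¹ := by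
    intro u
    exact wpg_winv (A := Equiv.Perm (Om Γ)) (fun i => gen ℓ (s i)) u
  unfold HH at hh
  induction hh using Subgroup.closure_induction with
  | mem y hy =>
    obtain ⟨i, rfl⟩ := hy
    obtain ⟨j, rfl⟩ := hs i
    exact ⟨[(j, true)], by simp [wordAct]⟩
  | one => exact ⟨[], rfl⟩
  | mul a b _ _ iha ihb =>
    obtain ⟨u, rfl⟩ := iha
    obtain ⟨v, rfl⟩ := ihb
    exact ⟨u ++ v, app u v⟩
  | inv a _ iha =>
    obtain ⟨u, rfl⟩ := iha
    exact ⟨winv u, inv u⟩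

theorem flat_ins (μ : Γ) (d : D Γ) : (μ = 1 ∧ flat (insB μ d).2 = bit true :: d) ∨ ∃ a : Ltr Γ, a.1 = μ ∧ flat (insB μ d).2 = ltr a :: d := by
  rcases three μ with h | ⟨a, rfl, h⟩ | ⟨a, rfl, h⟩
  · left; subst h; exact ⟨rfl, by rw [insB_one]; rfl⟩
  · right; exact ⟨a, rfl, by rw [insB_lt a h]; rfl⟩
  · right; exact ⟨a, rfl, by rw [insB_gt a h]; rfl⟩

theorem RL_ne (δ : Γ) (n : ℕ) (l l' : D Γ) (hne : l ≠ l') (hR : RL ℓ δ n l l') (s s' : Sym Γ) (d : D Γ)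
    (h : l = s :: d) (h' : l' = s' :: d) : ∃ a a' : Ltr Γ, s = ltr a ∧ s' = ltr a' ∧ a'.1 = a.1 * δ := by
  obtain ⟨u, a, a', t, e1, e2, e3⟩ := hR
  cases u with
  | nil =>
    rw [h] at e1; rw [h'] at e2
    exact ⟨a, a', (List.cons.inj e1).1, (List.cons.inj e2).1, e3.1⟩
  | cons z u =>
    exfalso
    apply hne
    rw [h] at e1; rw [h'] at e2
    have f1 := (List.cons.inj e1)
    have f2 := (List.cons.inj e2)
    rw [h, h', f1.1, f2.1]

/-- conjugacy extraction from a single pair of related points -/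
theorem conj_extract (w : List (Fin (Fintype.card (Idx r)) × Bool)) (γ γ' a : Γ) (hγ : γ ≠ 1)
    (hE : EE ℓ (a⁻¹ * (γ * a)) (3 * w.length) a (γ * a)) (ha : 1 < a) (hb : 1 < γ * a)
    (hc : wordAct (fun i => gen ℓ ((Fintype.equivFin (Idx r)).symm i)) w * perB Set.univ (LB γ) =
      perB Set.univ (LB γ') * wordAct (fun i => gen ℓ ((Fintype.equivFin (Idx r)).symm i)) w) :
    IsConj γ γ' := by
  set h := wordAct (fun i => gen ℓ ((Fintype.equivFin (Idx r)).symm i)) w with hh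
  have hR : RO (RL ℓ (a⁻¹ * (γ * a))) (3 * w.length) ((0, insB a []) : Om Γ) ((0, insB (γ * a) []) : Om Γ) := by
    have q1 := insB_gt (⟨a, ha.ne'⟩ : Ltr Γ) ha []
    have q2 := insB_gt (⟨γ * a, hb.ne'⟩ : Ltr Γ) hb []
    dsimp only at q1 q2
    rw [q1, q2]
    exact ⟨rfl, rfl, [], ⟨a, ha.ne'⟩, ⟨γ * a, hb.ne'⟩, [], rfl, rfl, hE⟩
  have hW := Sim.word (RL_sim ℓ (a⁻¹ * (γ * a))) ℓ (fun i => ⟨(i, true), rfl⟩) (fun i => ⟨(i, false), rfl⟩)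
    (fun i => (Fintype.equivFin (Idx r)).symm i) w _ _ hR
  rw [← hh] at hW
  have hP' : h ((0, insB (γ * a) []) : Om Γ) = perB Set.univ (LB γ') (h ((0, insB a []) : Om Γ)) := by
    have := congrArg (fun f : Equiv.Perm (Om Γ) => f (0, insB a [])) hc
    simp only [Equiv.Perm.mul_apply] at this
    rw [perB_univ, LB_ins] at this
    exact this
  have hne : h ((0, insB (γ * a) []) : Om Γ) ≠ h ((0, insB a []) : Om Γ) := by
    intro e
    have e2 := h.injective e
    have e3 : insB (γ * a) ([] : D Γ) = insB a [] := congrArg Prod.snd e2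
    have q1 := (hgetB (insB (γ * a) ([] : D Γ)) (γ * a, [])).2 rfl
    have q2 := (hgetB (insB (γ * a) ([] : D Γ)) (a, [])).2 e3.symm
    rw [q1] at q2
    have q3 : γ * a = a := congrArg Prod.fst (Option.some.inj q2)
    exact hγ (mul_eq_right.1 q3)
  generalize h ((0, insB (γ * a) []) : Om Γ) = P' at *
  generalize h ((0, insB a []) : Om Γ) = P at *
  obtain ⟨n, b⟩ := P
  rw [perB_univ] at hP'
  rcases hg : getB b with _ | ⟨μ, d⟩
  · rw [LB_none _ _ hg] at hP'; exact absurd hP' hne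
  · rw [hgetB] at hg
    dsimp only at hg
    subst hg
    rw [LB_ins] at hP'
    subst hP'
    obtain ⟨-, hW1, hW2⟩ := hW
    dsimp only at hW1 hW2
    have hfl : flat (insB μ d).2 ≠ flat (insB (γ' * μ) d).2 := by
      intro e
      exact hne (Prod.ext rfl (Prod.ext hW1.symm (flat_inj e).symm))
    have fin : ∀ s s' : Sym Γ, flat (insB μ d).2 = s :: d → flat (insB (γ' * μ) d).2 = s' :: d →
      (∀ c : Ltr Γ, s = ltr c → c.1 = μ) → (∀ c : Ltr Γ, s' = ltr c → c.1 = γ' * μ) → IsConj γ γ' := by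
      intro s s' h1 h2 h3 h4
      obtain ⟨c, c', g1, g2, g3⟩ := RL_ne ℓ _ _ _ _ hfl hW2 s s' d h1 h2
      rw [h3 c g1, h4 c' g2] at g3
      rw [isConj_iff]
      refine ⟨μ * a⁻¹, ?_⟩
      have : γ' = μ * (a⁻¹ * (γ * a)) * μ⁻¹ := by rw [← g3]; group
      rw [this]; group
    have look : ∀ ν : Γ, ∃ s : Sym Γ, flat (insB ν d).2 = s :: d ∧ ∀ c : Ltr Γ, s = ltr c → c.1 = ν := by
      intro ν
      rcases flat_ins ν d with ⟨-, e⟩ | ⟨c, e1, e2⟩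
      · exact ⟨_, e, fun c hc => by cases hc⟩
      · exact ⟨_, e2, fun c' hc => by cases hc; exact e1⟩
    obtain ⟨s, h1, h3⟩ := look μ
    obtain ⟨s', h2, h4⟩ := look (γ' * μ)
    exact fin s s' h1 h2 h3 h4

theorem phi_inj (γ : Γ) (h : perB Set.univ (LB γ) = 1) : γ = 1 := by
  have := congrArg (fun f : Equiv.Perm (Om Γ) => f (0, insB 1 [])) h
  simp only [Equiv.Perm.one_apply] at this
  rw [perB_univ, LB_ins] at this
  have e3 : insB (γ * 1) ([] : D Γ) = insB 1 [] := congrArg Prod.snd this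
  have q1 := (hgetB (insB (γ * 1) ([] : D Γ)) (γ * 1, [])).2 rfl
  have q2 := (hgetB (insB (γ * 1) ([] : D Γ)) (1, [])).2 e3.symm
  rw [q1] at q2
  have q3 : γ * 1 = 1 := congrArg Prod.fst (Option.some.inj q2)
  rwa [mul_one] at q3

end fr

section fr2
variable {G : Type} [Group G] [LinearOrder G] [LOG G] {m : ℕ} (x : Fin m → G)

theorem far (n : ℕ) (g : G) (hg : g ≠ 1) : ∃ k : G, ∀ w : Wd m, w.length ≤ n → 1 < wp x w * k ∧ 1 < wp x w * (g * k) := by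
  have ht : ∃ t : G, 1 < t := by
    rcases lt_or_gt_of_ne hg with h | h
    · have := LOG.mul_lt g⁻¹ _ _ h
      rw [inv_mul_cancel, mul_one] at this
      exact ⟨_, this⟩
    · exact ⟨g, h⟩
  obtain ⟨t, ht⟩ := ht
  let B := Set.image (wp x) {w | w.length ≤ n}
  have hB : B.Finite := ball_finite x n
  have hS : (Set.image (fun b => b⁻¹) B ∪ Set.image (fun b => (b * g)⁻¹) B).Finite := (hB.image _).union (hB.image _)
  obtain ⟨k, -, hk⟩ := Set.exists_max_image _ id hS ⟨_, Or.inl ⟨_, ⟨[], by simp, rfl⟩, rfl⟩⟩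
  have hkt : k < k * t := by
    have := LOG.mul_lt k _ _ ht
    rwa [mul_one] at this
  refine ⟨k * t, fun w hw => ?_⟩
  have hw' : wp x w ∈ B := ⟨w, hw, rfl⟩
  constructor
  · have h1 := lt_of_le_of_lt (hk _ (Or.inl ⟨_, hw', rfl⟩)) hkt
    have := LOG.mul_lt (wp x w) _ _ h1
    simpa using this
  · have h1 := lt_of_le_of_lt (hk _ (Or.inr ⟨_, hw', rfl⟩)) hkt
    have := LOG.mul_lt (wp x w * g) _ _ h1
    simp only [id] at this
    rw [mul_inv_cancel, mul_assoc (wp x w) g] at this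
    exact this

def iota : G →* GZ G where
  toFun g := mk g 0
  map_one' := rfl
  map_mul' g h := by rw [mk_mul, add_zero]

noncomputable def phi (hx : ∀ g, ∃ w, wp x w = g) : G →* HH (ell x) :=
  (((perB Set.univ).comp LB).codRestrict (HH (ell x)) (phi_mem (ell x) (ell_top x hx))).comp iota

theorem phi_val (hx : ∀ g, ∃ w, wp x w = g) (g : G) : (phi x hx g).1 = perB Set.univ (LB (mk g 0)) := rfl

theorem phi_frattini (hx : ∀ g, ∃ w, wp x w = g) : IsFrattini (phi x hx) := by
  have hinj : ∀ g, phi x hx g = 1 → g = 1 := by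
    intro g h
    have h1 := phi_inj (mk g 0) (congrArg Subtype.val h)
    exact ((mk_eq_one _ _).1 h1).1
  refine ⟨(injective_iff_map_eq_one _).2 hinj, fun g g' => ⟨fun h => (phi x hx).map_isConj h, fun h => ?_⟩⟩
  by_cases hg : g = 1
  · subst hg
    rw [map_one, isConj_one_right] at h
    rw [hinj g' h]
  · rw [isConj_iff] at h
    obtain ⟨c, hc⟩ := h
    obtain ⟨w, hw⟩ := word_rep (ell x) (Fintype.equivFin (Idx (m + 1))).symm (Fintype.equivFin (Idx (m + 1))).symm.surjective c.1 c.2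
    obtain ⟨k, hk⟩ := far x (3 * w.length) g hg
    have hc2 : c * phi x hx g = phi x hx g' * c := by rw [← hc]; group
    have hc3 := congrArg Subtype.val hc2
    rw [Subgroup.coe_mul, Subgroup.coe_mul, phi_val, phi_val, ← hw] at hc3
    have h0 := hk [] (by simp)
    have e0 : wp x [] = 1 := rfl
    rw [e0, one_mul, one_mul] at h0
    have key := conj_extract (ell x) w (mk g 0) (mk g' 0) (mk k 0) (fun e => hg ((mk_eq_one _ _).1 e).1) ?_ ?_ ?_ hc3
    · rw [isConj_iff] at key ⊢
      obtain ⟨d, hd⟩ := key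
      exact ⟨cg d, congrArg cg hd⟩
    · apply EE_of
      intro v hv j hj
      obtain ⟨e1, e2⟩ := hk v hv
      simp only [mk_mul, mk_lt_one, lab_mk, ne_eq, mk_eq_one, e1.ne', e2.ne', e1.not_gt, e2.not_gt, false_and, not_false_eq_true, or_false,
        true_and, decide_false, Bool.false_and]
    · rw [mk_one, mk_lt]; exact Or.inl h0.1
    · rw [mk_mul, mk_one, mk_lt]; exact Or.inl h0.2

end fr2

end Step2
end FrattiniProof

set_option linter.all false

namespace FrattiniProof

namespace Step2

theorem IsFrattini_comp {A B C : Type} [Group A] [Group B] [Group C] (f : A →* B) (g : B →* C) (hf : IsFrattini f)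
    (hg : IsFrattini g) : IsFrattini (g.comp f) :=
  ⟨hg.1.comp hf.1, fun a b => (hf.2 a b).trans (hg.2 _ _)⟩

theorem wp_lift {H : Type} [Group H] {m : ℕ} (π : FreeGroup (Fin m) →* H) (w : Wd m) :
    wp (fun i => π (FreeGroup.of i)) w = π (FreeGroup.mk w) := by
  induction w with
  | nil => exact (map_one π).symm
  | cons a w ih =>
    rw [wpg_cons, ih]
    have : (FreeGroup.mk (a :: w) : FreeGroup (Fin m)) = FreeGroup.mk [a] * FreeGroup.mk w := rfl
    rw [this, map_mul]
    congr 1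
    obtain ⟨i, b⟩ := a
    cases b
    · show (π (FreeGroup.of i))⁻¹ = π (FreeGroup.mk [(i, false)])
      rw [← map_inv]; rfl
    · rfl

theorem final (H1 : Type) [Group H1] (m : ℕ) (π : FreeGroup (Fin m) →* H1) (hπ : Function.Surjective π)
    (l : LinearOrder H1) (hl : ∀ a b c : H1, l.le b c → l.le (a * b) (a * c))
    (hc : Computable (fun w : List (Fin m × Bool) => orderSign l (π (FreeGroup.mk w)))) :
    ∃ (H : Type) (_ : Group H), Group.FG H ∧ IsSimpleGroup H ∧ IsLeftOrderable H ∧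
      (∃ (m : ℕ) (π : FreeGroup (Fin m) →* H),
        Function.Surjective π ∧ ComputableLeftOrderVia π) ∧
      ∃ φ : H1 →* H, IsFrattini φ := by
  letI := l
  haveI : LOG H1 := ⟨fun a b c h => lt_of_le_of_ne (hl a b c h.le) fun e => h.ne (mul_left_cancel e)⟩
  let x : Fin m → H1 := fun i => π (FreeGroup.of i)
  have hx : ∀ g, ∃ w, wp x w = g := by
    intro g
    obtain ⟨f, rfl⟩ := hπ g
    refine ⟨f.toWord, ?_⟩
    rw [wp_lift, FreeGroup.mk_toWord]
  let sg0 : Wd m → ℤ := fun w => orderSign l (π (FreeGroup.mk w))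
  have h0 : ∀ w, sg0 w = sgnCmp (wp x w) 1 := by
    intro w
    have := orderSign_cmp l hl (wp x w) 1
    rw [inv_one, one_mul] at this
    rw [← this, wp_lift]
  obtain ⟨M, π2, hs, ho⟩ := HH_order (ell x) (ell_top x hx) (sgz sg0) (sgz_spec x sg0 h0) (sgz_comp sg0 hc)
    (lwz sg0) (lwz_spec x sg0 h0) (lwz_comp sg0 hc) (fun n => 2 * n + 2)
    (Primrec.nat_add.comp (Primrec.nat_mul.comp (Primrec.const 2) Primrec.id) (Primrec.const 2))
    (fun n a _ ha => reps x hx n a ha)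
  refine ⟨HH (ell x), inferInstance, Group.fg_of_surjective hs, HH_simple (ell x) (ell_top x hx), ?_, ⟨M, π2, hs, ho⟩,
    phi x hx, phi_frattini x hx⟩
  obtain ⟨l2, hl2, -⟩ := ho
  exact ⟨l2, hl2⟩

end Step2
end FrattiniProof

theorem frattini_embedding_into_fg_simple_with_computable_left_order
    (G : Type) [Group G] [Countable G] (x : ℕ → G)
    (hx : Subgroup.closure (Set.range x) = ⊤)
    (hord : ComputableLeftOrderWrt x) :
    ∃ (H : Type) (_ : Group H), Group.FG H ∧ IsSimpleGroup H ∧ IsLeftOrderable H ∧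
      (∃ (m : ℕ) (π : FreeGroup (Fin m) →* H),
        Function.Surjective π ∧ ComputableLeftOrderVia π) ∧
      ∃ φ : G →* H, IsFrattini φ := by
  obtain ⟨H1, i1, m, π, φ, hπ, ⟨l, hl, hc⟩, hφ⟩ := FrattiniProof.Step1.step1 x hx hord
  obtain ⟨H, i2, h1, h2, h3, h4, ψ, hψ⟩ := FrattiniProof.Step2.final H1 m π hπ l hl hc
  exact ⟨H, i2, h1, h2, h3, h4, ψ.comp φ, FrattiniProof.Step2.IsFrattini_comp φ ψ hφ hψ⟩
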